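/- Let ℝ_+=(0,∞) and let a=(a_ij) be a continuous map from [0,T]×ℝ_+^d into the symmetric positive definite d×d matrices with each a_ij bounded and locally Hölder continuous on [0,T)×ℝ_+^d. Let 0=t_0<t_1<⋯<t_N=T and let h:(ℝ_+^d)^{N+1}→ℝ be locally Lipschitz with polynomially growing Lipschitz constant: there exist p≥0 and L≥0 such that |h(x_0,…,x_N)−h(y_0,…,y_N)| ≤ (1+m^p) L Σ_{i=0}^N |x_i−y_i| whenever |x_i|,|y_i| ≤ m for all i. Set v_N(t,x_0,…,x_N,x) := h(x_0,…,x_N). Then the following recursive scheme is well-defined: for k=N−1,…,0, the function f_{k+1}(x) := v_{k+1}(t_{k+1},x_0,…,x_k,x,x) is continuous and of at most polynomial growth in x, and there exists a unique (within the class of functions of at most polynomial growth uniformly in t) function v_k:[t_k,t_{k+1}]×(ℝ_+^d)^{k+1}×ℝ_+^d→ℝ such that for each fixed (x_0,…,x_k), (t,x)↦v_k(t,x_0,…,x_k,x) belongs to C^{1,2}([t_k,t_{k+1})×ℝ_+^d)∩C([t_k,t_{k+1}]×ℝ_+^d), satisfies ∂v_k/∂t + ℒ^+v_k = 0 on [t_k,t_{k+1})×ℝ_+^d,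 and v_k(t_{k+1},x_0,…,x_k,x) = f_{k+1}(x). -/

import Mathlib

open Finset Filter Topology Set

noncomputable section

/-- The successor `s'` of `s` in the partition `P` of `[0,T]` (equal to `T` if there is none). -/
def succOf (T : ℝ) (P : Finset ℝ) (s : ℝ) : ℝ :=
  if h : (P.filter (fun u => s < u)).Nonempty then (P.filter (fun u => s < u)).min' h else T

/-- A refining sequence of partitions of `[0,T]` whose meshes tend to zero. -/
structure PartitionSeq (T : ℝ) where
  part : ℕ → Finset ℝ
  subset_Icc : ∀ n, ↑(part n) ⊆ Set.Icc (0 : ℝ) T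
  zero_mem : ∀ n, (0 : ℝ) ∈ part n
  top_mem : ∀ n, T ∈ part n
  refining : ∀ n, part n ⊆ part (n + 1)
  mesh_to_zero : ∀ ε > 0, ∃ N, ∀ n ≥ N, ∀ s ∈ part n, succOf T (part n) s - s < ε
/-- Approximating sums for the covariation `⟨S_i,S_j⟩(t)` along the `n`-th partition. -/
def covSum (T : ℝ) (𝕋 : PartitionSeq T) {d : ℕ} (S : ℝ → Fin d → ℝ) (i j : Fin d)
    (t : ℝ) (n : ℕ) : ℝ :=
  ∑ s ∈ (𝕋.part n).filter (fun s => s ≤ t),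
    (S (succOf T (𝕋.part n) s) i - S s i) * (S (succOf T (𝕋.part n) s) j - S s j)

/-- The Föllmer integral `∫_r^t ξ(s)·dS(s)` exists along `(𝕋_n)` with value `I`. -/
def HasFollmerIntegral (T : ℝ) (𝕋 : PartitionSeq T) {d : ℕ} (ξ S : ℝ → Fin d → ℝ)
    (r t I : ℝ) : Prop :=
  Tendsto (fun n => ∑ s ∈ (𝕋.part n).filter (fun s => r ≤ s ∧ s ≤ t),
    ∑ k, ξ s k * (S (succOf T (𝕋.part n) s) k - S s k)) atTop (𝓝 I)

/-- The open positive orthant `ℝ_+^d`. -/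
def posOrth (d : ℕ) : Set (Fin d → ℝ) := {x | ∀ i, 0 < x i}

/-- The class `𝒮_a`: continuous trajectories whose covariations are `∫_0^t a_ij(s,S(s)) ds`. -/
def SclassA (T : ℝ) (𝕋 : PartitionSeq T) {d : ℕ}
    (a : ℝ → (Fin d → ℝ) → Fin d → Fin d → ℝ) : Set (ℝ → Fin d → ℝ) :=
  {S | ContinuousOn S (Set.Icc 0 T) ∧
    ∀ i j : Fin d, ∀ t ∈ Set.Icc (0 : ℝ) T,
      Tendsto (fun n => covSum T 𝕋 S i j t n) atTop (𝓝 (∫ s in (0 : ℝ)..t, a s (S s) i j))}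

/-- The class `𝒮_a^+`: positive continuous trajectories whose covariations are
`∫_0^t a_ij(s,S(s)) S_i(s) S_j(s) ds`. -/
def SclassAPos (T : ℝ) (𝕋 : PartitionSeq T) {d : ℕ}
    (a : ℝ → (Fin d → ℝ) → Fin d → Fin d → ℝ) : Set (ℝ → Fin d → ℝ) :=
  {S | ContinuousOn S (Set.Icc 0 T) ∧ (∀ t ∈ Set.Icc (0 : ℝ) T, ∀ i, 0 < S t i) ∧
    ∀ i j : Fin d, ∀ t ∈ Set.Icc (0 : ℝ) T,
      Tendsto (fun n => covSum T 𝕋 S i j t n) atTop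
        (𝓝 (∫ s in (0 : ℝ)..t, a s (S s) i j * S s i * S s j))}

/-- First partial derivative in the `i`-th space direction. -/
def pd1 {d : ℕ} (f : (Fin d → ℝ) → ℝ) (i : Fin d) (x : Fin d → ℝ) : ℝ :=
  fderiv ℝ f x (Pi.single i 1)

/-- Second partial derivative in the space directions `i, j`. -/
def pd2 {d : ℕ} (f : (Fin d → ℝ) → ℝ) (i j : Fin d) (x : Fin d → ℝ) : ℝ :=
  fderiv ℝ (fun y => pd1 f j y) x (Pi.single i 1)

/-- Time derivative (within the time interval `I`). -/
def tderiv {d : ℕ} (I : Set ℝ) (v : ℝ → (Fin d → ℝ) → ℝ) (t : ℝ) (x : Fin d → ℝ) : ℝ :=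
  derivWithin (fun τ => v τ x) I t

/-- `v` is of class `C^{1,2}(I × D)`: continuous on `I × D`, continuously differentiable in
`(t,x)` and twice continuously differentiable in `x` on `(int I) × D`, with all derivatives
admitting continuous extensions to `I × D`. -/
structure IsC12 {d : ℕ} (I : Set ℝ) (D : Set (Fin d → ℝ)) (v : ℝ → (Fin d → ℝ) → ℝ) : Prop where
  cont : ContinuousOn (fun p : ℝ × (Fin d → ℝ) => v p.1 p.2) (I ×ˢ D)
  diff : ∀ t ∈ interior I, ∀ x ∈ D,
    DifferentiableAt ℝ (fun p : ℝ × (Fin d → ℝ) => v p.1 p.2) (t, x)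
  diff2 : ∀ t ∈ interior I, ∀ x ∈ D, ∀ j : Fin d, DifferentiableAt ℝ (pd1 (v t) j) x
  derivs_extend : ∃ (gt : ℝ × (Fin d → ℝ) → ℝ) (gx : Fin d → ℝ × (Fin d → ℝ) → ℝ)
      (gxx : Fin d → Fin d → ℝ × (Fin d → ℝ) → ℝ),
    ContinuousOn gt (I ×ˢ D) ∧ (∀ i, ContinuousOn (gx i) (I ×ˢ D)) ∧
    (∀ i j, ContinuousOn (gxx i j) (I ×ˢ D)) ∧
    ∀ t ∈ interior I, ∀ x ∈ D,
      gt (t, x) = deriv (fun τ => v τ x) t ∧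
      (∀ i, gx i (t, x) = pd1 (v t) i x) ∧
      ∀ i j, gxx i j (t, x) = pd2 (v t) i j x

/-- Local Hölder continuity on a set. -/
def LocallyHolderOn {E : Type*} [PseudoMetricSpace E] (f : E → ℝ) (s : Set E) : Prop :=
  ∀ p ∈ s, ∃ U ∈ 𝓝[s] p, ∃ α C : ℝ, 0 < α ∧ α ≤ 1 ∧ 0 ≤ C ∧
    ∀ q ∈ U, ∀ q' ∈ U, |f q - f q'| ≤ C * dist q q' ^ α

namespace TVP

/-! ### Functions that are Hölder continuous in the space variable -/

/-- `g` is jointly continuous, bounded by `M`, and `α`-Hölder in space with constant `M`. -/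
structure Hol {d : ℕ} (α M : ℝ) (g : ℝ → (Fin d → ℝ) → ℝ) : Prop where
  cont : Continuous (fun p : ℝ × (Fin d → ℝ) => g p.1 p.2)
  bdd : ∀ t x, |g t x| ≤ M
  hol : ∀ t x y, |g t x - g t y| ≤ M * ‖x - y‖ ^ α

namespace Hol

variable {d : ℕ} {α M N : ℝ} {f g : ℝ → (Fin d → ℝ) → ℝ}

lemma nonneg (h : Hol α M g) : 0 ≤ M := (abs_nonneg _).trans (h.bdd 0 0)

lemma mono (h : Hol α M g) (hMN : M ≤ N) : Hol α N g :=
  ⟨h.cont, fun t x => (h.bdd t x).trans hMN, fun t x y => (h.hol t x y).trans (by gcongr)⟩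

lemma congr (h : Hol α M g) (hfg : ∀ t x, f t x = g t x) : Hol α M f := by
  have : f = g := by funext t x; exact hfg t x
  rwa [this]

lemma zero : Hol α 0 (fun (_ : ℝ) (_ : Fin d → ℝ) => (0 : ℝ)) :=
  ⟨continuous_const, by simp, by simp⟩

lemma const (c : ℝ) : Hol α |c| (fun (_ : ℝ) (_ : Fin d → ℝ) => c) :=
  ⟨continuous_const, by simp, fun t x y => by simp; positivity⟩

lemma add (hf : Hol α M f) (hg : Hol α N g) : Hol α (M + N) (fun t x => f t x + g t x) := by
  refine ⟨hf.cont.add hg.cont, fun t x => (abs_add_le _ _).trans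
    (add_le_add (hf.bdd t x) (hg.bdd t x)), fun t x y => ?_⟩
  calc _ = |(f t x - f t y) + (g t x - g t y)| := by congr 1; ring
    _ ≤ _ := abs_add_le _ _
    _ ≤ _ := by rw [add_mul]; exact add_le_add (hf.hol t x y) (hg.hol t x y)

lemma const_mul (c : ℝ) (hf : Hol α M f) : Hol α (|c| * M) (fun t x => c * f t x) := by
  refine ⟨continuous_const.mul hf.cont, fun t x => ?_, fun t x y => ?_⟩
  · rw [abs_mul]; exact mul_le_mul_of_nonneg_left (hf.bdd t x) (abs_nonneg c)
  · rw [← mul_sub, abs_mul, mul_assoc]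
    exact mul_le_mul_of_nonneg_left (hf.hol t x y) (abs_nonneg c)

lemma neg (hf : Hol α M f) : Hol α M (fun t x => - f t x) := by
  simpa using hf.const_mul (-1)

lemma sub (hf : Hol α M f) (hg : Hol α N g) : Hol α (M + N) (fun t x => f t x - g t x) := by
  simpa [sub_eq_add_neg] using hf.add hg.neg

/-- Product estimate with separate control of sup norms and Hölder seminorms. -/
lemma mul_of {a b : ℝ} (hf : Hol α M f) (hg : Hol α N g) (ha : ∀ t x, |f t x| ≤ a)
    (hb : ∀ t x, |g t x| ≤ b) {R : ℝ} (hR : a * b ≤ R) (hR' : a * N + M * b ≤ R) :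
    Hol α R (fun t x => f t x * g t x) := by
  have ha0 : 0 ≤ a := (abs_nonneg _).trans (ha 0 0)
  refine ⟨hf.cont.mul hg.cont, fun t x => ?_, fun t x y => ?_⟩
  · rw [abs_mul]
    exact (mul_le_mul (ha t x) (hb t x) (abs_nonneg _) ha0).trans hR
  · calc |f t x * g t x - f t y * g t y|
        = |f t x * (g t x - g t y) + (f t x - f t y) * g t y| := by congr 1; ring
      _ ≤ |f t x * (g t x - g t y)| + |(f t x - f t y) * g t y| := abs_add_le _ _
      _ ≤ a * (N * ‖x - y‖ ^ α) + (M * ‖x - y‖ ^ α) * b := by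
          rw [abs_mul, abs_mul]
          have h0 : 0 ≤ ‖x - y‖ ^ α := by positivity
          exact add_le_add (mul_le_mul (ha t x) (hg.hol t x y) (abs_nonneg _) ha0)
            (mul_le_mul (hf.hol t x y) (hb t y) (abs_nonneg _) (mul_nonneg hf.nonneg h0))
      _ = (a * N + M * b) * ‖x - y‖ ^ α := by ring
      _ ≤ R * ‖x - y‖ ^ α := by gcongr

lemma mul (hf : Hol α M f) (hg : Hol α N g) :
    Hol α (2 * (M * N)) (fun t x => f t x * g t x) := by
  have := mul_nonneg hf.nonneg hg.nonneg
  exact hf.mul_of hg hf.bdd hg.bdd (by linarith) (by linarith)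

lemma sum {ι : Type*} (s : Finset ι) {F : ι → ℝ → (Fin d → ℝ) → ℝ} {K : ι → ℝ}
    (h : ∀ i ∈ s, Hol α (K i) (F i)) : Hol α (∑ i ∈ s, K i) (fun t x => ∑ i ∈ s, F i t x) := by
  classical
  induction s using Finset.induction_on with
  | empty => simpa using zero
  | insert a s ha ih =>
    simp only [Finset.sum_insert ha]
    exact (h a (by simp)).add (ih fun i hi => h i (by simp [hi]))

lemma sum_const {ι : Type*} [Fintype ι] {F : ι → ℝ → (Fin d → ℝ) → ℝ} {K : ℝ}
    (h : ∀ i, Hol α K (F i)) : Hol α (Fintype.card ι * K) (fun t x => ∑ i, F i t x) := by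
  have := sum (K := fun _ => K) Finset.univ (fun i _ => h i)
  simpa using this

/-- Uniformly convergent series of Hölder functions. -/
lemma tsum {F : ℕ → ℝ → (Fin d → ℝ) → ℝ} {K : ℕ → ℝ} (hK : Summable K)
    (h : ∀ n, Hol α (K n) (F n)) : Hol α (∑' n, K n) (fun t x => ∑' n, F n t x) := by
  have hs : ∀ t x, Summable (fun n => F n t x) := fun t x =>
    Summable.of_norm_bounded hK (fun n => (h n).bdd t x)
  refine ⟨continuous_tsum (fun n => (h n).cont) hK (fun n p => (h n).bdd p.1 p.2),
    fun t x => ?_, fun t x y => ?_⟩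
  · rw [← Real.norm_eq_abs]
    exact tsum_of_norm_bounded hK.hasSum (fun n => (h n).bdd t x)
  · rw [← (hs t x).tsum_sub (hs t y), ← tsum_mul_right, ← Real.norm_eq_abs]
    exact tsum_of_norm_bounded (hK.mul_right _).hasSum (fun n => (h n).hol t x y)

/-- A bounded function that is Lipschitz in space is Hölder in space. -/
lemma of_lip (hα : 0 < α) (hα1 : α ≤ 1) (hc : Continuous (fun p : ℝ × (Fin d → ℝ) => g p.1 p.2))
    (hb : ∀ t x, |g t x| ≤ M) (hl : ∀ t x y, |g t x - g t y| ≤ N * ‖x - y‖) :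
    Hol α (2 * M + |N|) g := by
  have hM : 0 ≤ M := (abs_nonneg _).trans (hb 0 0)
  refine ⟨hc, fun t x => (hb t x).trans (by have := abs_nonneg N; linarith), fun t x y => ?_⟩
  rcases le_total ‖x - y‖ 1 with h1 | h1
  · have h2 : ‖x - y‖ ≤ ‖x - y‖ ^ α := by
      rcases eq_or_lt_of_le (norm_nonneg (x - y)) with h0 | h0
      · rw [← h0]; positivity
      · calc ‖x - y‖ = ‖x - y‖ ^ (1 : ℝ) := (Real.rpow_one _).symm
          _ ≤ _ := Real.rpow_le_rpow_of_exponent_ge h0 h1 hα1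
    calc _ ≤ N * ‖x - y‖ := hl t x y
      _ ≤ |N| * ‖x - y‖ := by gcongr; exact le_abs_self N
      _ ≤ |N| * ‖x - y‖ ^ α := by gcongr
      _ ≤ _ := by gcongr; linarith
  · have h2 : 1 ≤ ‖x - y‖ ^ α := Real.one_le_rpow h1 hα.le
    have h3 : |g t x - g t y| ≤ 2 * M := by
      have := abs_sub (g t x) (g t y); have := hb t x; have := hb t y; linarith
    have := abs_nonneg N
    nlinarith

/-- Interpolation between the sup norm and the Lipschitz seminorm. -/
lemma of_interp {m n κ : ℝ} (hα : 0 < α) (hα1 : α ≤ 1) (hκ : 0 < κ) (hn : 0 ≤ n)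
    (hc : Continuous (fun p : ℝ × (Fin d → ℝ) => g p.1 p.2))
    (hb : ∀ t x, |g t x| ≤ m) (hl : ∀ t x y, |g t x - g t y| ≤ n * ‖x - y‖) :
    Hol α (m + n * κ ^ (1 - α) + 2 * m * (κ ^ α)⁻¹) g := by
  have hm : 0 ≤ m := (abs_nonneg _).trans (hb 0 0)
  have e1 : 0 ≤ n * κ ^ (1 - α) := by positivity
  have e2 : 0 ≤ 2 * m * (κ ^ α)⁻¹ := by positivity
  refine ⟨hc, fun t x => (hb t x).trans (by linarith), fun t x y => ?_⟩
  have h0 : 0 ≤ ‖x - y‖ ^ α := by positivity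
  rcases le_total ‖x - y‖ κ with h1 | h1
  · have h2 : ‖x - y‖ ≤ κ ^ (1 - α) * ‖x - y‖ ^ α := by
      rcases eq_or_lt_of_le (norm_nonneg (x - y)) with h0 | h0
      · rw [← h0]; positivity
      · calc ‖x - y‖ = ‖x - y‖ ^ (1 - α) * ‖x - y‖ ^ α := by
              rw [← Real.rpow_add h0]; simp
          _ ≤ _ := by gcongr
    calc _ ≤ n * ‖x - y‖ := hl t x y
      _ ≤ n * (κ ^ (1 - α) * ‖x - y‖ ^ α) := by gcongr
      _ = (n * κ ^ (1 - α)) * ‖x - y‖ ^ α := by ring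
      _ ≤ _ := by gcongr; linarith
  · have h3 : |g t x - g t y| ≤ 2 * m := by
      have := abs_sub (g t x) (g t y); have := hb t x; have := hb t y; linarith
    have h4 : κ ^ α ≤ ‖x - y‖ ^ α := by gcongr
    have hk : 0 < κ ^ α := by positivity
    calc _ ≤ 2 * m := h3
      _ = (2 * m * (κ ^ α)⁻¹) * κ ^ α := by field_simp
      _ ≤ (2 * m * (κ ^ α)⁻¹) * ‖x - y‖ ^ α := by gcongr
      _ ≤ _ := by gcongr; linarith

end Hol

/-! ### Jets -/

/-- The linear functional with coordinates `c`. -/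
def grad {d : ℕ} (c : Fin d → ℝ) : (Fin d → ℝ) →L[ℝ] ℝ :=
  ∑ i, c i • ContinuousLinearMap.proj (R := ℝ) (φ := fun _ : Fin d => ℝ) i

@[simp] lemma grad_apply {d : ℕ} (c v : Fin d → ℝ) : grad c v = ∑ i, c i * v i := by
  simp [grad]

lemma grad_add {d : ℕ} (c e : Fin d → ℝ) : grad (fun i => c i + e i) = grad c + grad e := by
  ext v; simp [grad, add_mul, Finset.sum_add_distrib]

lemma grad_smul {d : ℕ} (r : ℝ) (c : Fin d → ℝ) : grad (fun i => r * c i) = r • grad c := by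
  ext v; simp [grad, Finset.mul_sum, mul_assoc]

lemma grad_single {d : ℕ} (c : Fin d → ℝ) (i : Fin d) : grad c (Pi.single i 1) = c i := by
  simp [Pi.single_apply]

lemma grad_injective {d : ℕ} : Function.Injective (grad (d := d)) := fun c e h => by
  funext i; rw [← grad_single c i, h, grad_single]

lemma norm_grad_le {d : ℕ} (c : Fin d → ℝ) {K : ℝ} (hc : ∀ i, |c i| ≤ K) :
    ‖grad c‖ ≤ d * K := by
  have hK : 0 ≤ d * K := by
    rcases Nat.eq_zero_or_pos d with h | h
    · subst h; simp
    · exact mul_nonneg (by positivity) ((abs_nonneg _).trans (hc ⟨0, h⟩))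
  refine ContinuousLinearMap.opNorm_le_bound _ hK fun v => ?_
  rw [grad_apply]
  calc ‖∑ i, c i * v i‖ ≤ ∑ i, ‖c i * v i‖ := norm_sum_le _ _
    _ ≤ ∑ _i : Fin d, K * ‖v‖ := by
        refine Finset.sum_le_sum fun i _ => ?_
        rw [norm_mul]
        exact mul_le_mul (hc i) (norm_le_pi_norm v i) (norm_nonneg _)
          ((abs_nonneg _).trans (hc i))
    _ = d * K * ‖v‖ := by simp; ring

/-- The map `grad` as a continuous linear map. -/
def gradL (d : ℕ) : (Fin d → ℝ) →L[ℝ] ((Fin d → ℝ) →L[ℝ] ℝ) :=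
  LinearMap.toContinuousLinearMap
    { toFun := grad
      map_add' := fun c e => grad_add c e
      map_smul' := fun r c => grad_smul r c }

@[simp] lemma gradL_apply {d : ℕ} (c : Fin d → ℝ) : gradL d c = grad c := rfl

/-- A function of time and space with candidates for its derivatives. -/
structure Jet (d : ℕ) where
  u : ℝ → (Fin d → ℝ) → ℝ
  ut : ℝ → (Fin d → ℝ) → ℝ
  ux : Fin d → ℝ → (Fin d → ℝ) → ℝ
  uxx : Fin d → Fin d → ℝ → (Fin d → ℝ) → ℝ

/-- The components of the jet are the derivatives of `u`; they are Hölder with the constants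
indicated. -/
structure JB {d : ℕ} (α N₁ N₂ : ℝ) (J : Jet d) : Prop where
  dt : ∀ t x, HasDerivAt (fun s => J.u s x) (J.ut t x) t
  dx : ∀ t x, HasFDerivAt (J.u t) (grad fun i => J.ux i t x) x
  dxx : ∀ i t x, HasFDerivAt (J.ux i t) (grad fun j => J.uxx i j t x) x
  hu : Hol α N₁ J.u
  hux : ∀ i, Hol α N₁ (J.ux i)
  huxx : ∀ i j, Hol α N₂ (J.uxx i j)
  hut : Hol α N₂ J.ut

/-- The parabolic residual `∂ₜu + λu - ½ ∑ Aᵢⱼ ∂ᵢⱼu`. -/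
def Jet.res {d : ℕ} (A : Fin d → Fin d → ℝ → (Fin d → ℝ) → ℝ) (l : ℝ) (J : Jet d)
    (t : ℝ) (x : Fin d → ℝ) : ℝ :=
  J.ut t x + l * J.u t x - (1 / 2) * ∑ i, ∑ j, A i j t x * J.uxx i j t x

namespace JB

variable {d : ℕ} {α M₁ M₂ N₁ N₂ : ℝ} {J K : Jet d}

lemma mono (h : JB α M₁ M₂ J) (h1 : M₁ ≤ N₁) (h2 : M₂ ≤ N₂) : JB α N₁ N₂ J :=
  ⟨h.dt, h.dx, h.dxx, h.hu.mono h1, fun i => (h.hux i).mono h1,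
    fun i j => (h.huxx i j).mono h2, h.hut.mono h2⟩

end JB

/-- The product jet. -/
def Jet.mul {d : ℕ} (J K : Jet d) : Jet d where
  u t x := J.u t x * K.u t x
  ut t x := J.ut t x * K.u t x + J.u t x * K.ut t x
  ux i t x := J.ux i t x * K.u t x + J.u t x * K.ux i t x
  uxx i j t x := J.uxx i j t x * K.u t x + J.ux i t x * K.ux j t x
    + (J.ux j t x * K.ux i t x + J.u t x * K.uxx i j t x)

/-- The sum jet. -/
def Jet.add {d : ℕ} (J K : Jet d) : Jet d where
  u t x := J.u t x + K.u t x
  ut t x := J.ut t x + K.ut t x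
  ux i t x := J.ux i t x + K.ux i t x
  uxx i j t x := J.uxx i j t x + K.uxx i j t x

/-- The scaled jet. -/
def Jet.smul {d : ℕ} (c : ℝ) (J : Jet d) : Jet d where
  u t x := c * J.u t x
  ut t x := c * J.ut t x
  ux i t x := c * J.ux i t x
  uxx i j t x := c * J.uxx i j t x

lemma JB.mul {d : ℕ} {α Z N₁ N₂ : ℝ} {J K : Jet d} (hJ : JB α Z Z J) (hK : JB α N₁ N₂ K) :
    JB α (4 * (Z * N₁)) (6 * (Z * N₁) + 2 * (Z * N₂)) (J.mul K) := by
  have h0 : 0 ≤ Z * N₁ := mul_nonneg hJ.hu.nonneg hK.hu.nonneg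
  refine ⟨fun t x => (hJ.dt t x).mul (hK.dt t x), fun t x => ?_, fun i t x => ?_, ?_, ?_, ?_, ?_⟩
  · refine ((hJ.dx t x).mul (hK.dx t x)).congr_fderiv ?_
    rw [← grad_smul, ← grad_smul, ← grad_add]
    congr 1; funext i; simp only [Jet.mul]; ring
  · refine (((hJ.dxx i t x).mul (hK.dx t x)).add
      ((hJ.dx t x).mul (hK.dxx i t x))).congr_fderiv ?_
    rw [← grad_smul, ← grad_smul, ← grad_add, ← grad_smul, ← grad_smul, ← grad_add, ← grad_add]
    congr 1; funext j; simp only [Jet.mul]; ring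
  · exact (hJ.hu.mul hK.hu).mono (by linarith)
  · exact fun i => (((hJ.hux i).mul hK.hu).add (hJ.hu.mul (hK.hux i))).mono (by linarith)
  · exact fun i j => ((((hJ.huxx i j).mul hK.hu).add ((hJ.hux i).mul (hK.hux j))).add
      (((hJ.hux j).mul (hK.hux i)).add (hJ.hu.mul (hK.huxx i j)))).mono (by linarith)
  · exact ((hJ.hut.mul hK.hu).add (hJ.hu.mul hK.hut)).mono (by linarith)

lemma JB.add {d : ℕ} {α M₁ M₂ N₁ N₂ : ℝ} {J K : Jet d} (hJ : JB α M₁ M₂ J)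
    (hK : JB α N₁ N₂ K) : JB α (M₁ + N₁) (M₂ + N₂) (J.add K) := by
  refine ⟨fun t x => (hJ.dt t x).add (hK.dt t x), fun t x => ?_, fun i t x => ?_,
    hJ.hu.add hK.hu, fun i => (hJ.hux i).add (hK.hux i), fun i j => (hJ.huxx i j).add (hK.huxx i j),
    hJ.hut.add hK.hut⟩
  · exact ((hJ.dx t x).add (hK.dx t x)).congr_fderiv (grad_add _ _).symm
  · exact ((hJ.dxx i t x).add (hK.dxx i t x)).congr_fderiv (grad_add _ _).symm

lemma JB.smul {d : ℕ} {α N₁ N₂ : ℝ} {J : Jet d} (c : ℝ) (hJ : JB α N₁ N₂ J) :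
    JB α (|c| * N₁) (|c| * N₂) (J.smul c) := by
  refine ⟨fun t x => (hJ.dt t x).const_mul c, fun t x => ?_, fun i t x => ?_,
    hJ.hu.const_mul c, fun i => (hJ.hux i).const_mul c, fun i j => (hJ.huxx i j).const_mul c,
    hJ.hut.const_mul c⟩
  · exact ((hJ.dx t x).const_mul c).congr_fderiv (grad_smul _ _).symm
  · exact ((hJ.dxx i t x).const_mul c).congr_fderiv (grad_smul _ _).symm

/-- The zeroth and first order terms produced by multiplying with the jet `Z`. -/
def comm {d : ℕ} (A : Fin d → Fin d → ℝ → (Fin d → ℝ) → ℝ) (Z J : Jet d)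
    (t : ℝ) (x : Fin d → ℝ) : ℝ :=
  Z.ut t x * J.u t x - (1 / 2) * ∑ i, ∑ j, A i j t x * (Z.uxx i j t x * J.u t x
    + Z.ux i t x * J.ux j t x + Z.ux j t x * J.ux i t x)

lemma res_mul {d : ℕ} (A : Fin d → Fin d → ℝ → (Fin d → ℝ) → ℝ) (l : ℝ) (Z J : Jet d)
    (t : ℝ) (x : Fin d → ℝ) :
    (Z.mul J).res A l t x = Z.u t x * J.res A l t x + comm A Z J t x := by
  have : ∑ i, ∑ j, A i j t x * (Z.mul J).uxx i j t x
      = ∑ i, ∑ j, A i j t x * (Z.uxx i j t x * J.u t x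
        + Z.ux i t x * J.ux j t x + Z.ux j t x * J.ux i t x)
        + Z.u t x * ∑ i, ∑ j, A i j t x * J.uxx i j t x := by
    simp only [Finset.mul_sum, ← Finset.sum_add_distrib]
    refine Finset.sum_congr rfl fun i _ => Finset.sum_congr rfl fun j _ => ?_
    simp only [Jet.mul]; ring
  simp only [Jet.res, comm, this]
  simp only [Jet.mul]; ring

lemma res_add {d : ℕ} (A : Fin d → Fin d → ℝ → (Fin d → ℝ) → ℝ) (l : ℝ) (J K : Jet d)
    (t : ℝ) (x : Fin d → ℝ) :
    (J.add K).res A l t x = J.res A l t x + K.res A l t x := by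
  simp only [Jet.res, Jet.add, mul_add, Finset.sum_add_distrib]; ring

lemma res_smul {d : ℕ} (A : Fin d → Fin d → ℝ → (Fin d → ℝ) → ℝ) (l c : ℝ) (J : Jet d)
    (t : ℝ) (x : Fin d → ℝ) :
    (J.smul c).res A l t x = c * J.res A l t x := by
  have : ∀ i j, A i j t x * (c * J.uxx i j t x) = c * (A i j t x * J.uxx i j t x) :=
    fun i j => by ring
  simp only [Jet.res, Jet.smul, this, ← Finset.mul_sum]; ring

lemma Hol.comm {d : ℕ} {α H Z N : ℝ} {A : Fin d → Fin d → ℝ → (Fin d → ℝ) → ℝ} {ζ J : Jet d}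
    (hA : ∀ i j, Hol α H (A i j)) (hZ : JB α Z Z ζ) (hu : Hol α N J.u)
    (hux : ∀ i, Hol α N (J.ux i)) :
    Hol α ((2 + 6 * d * d * H) * (Z * N)) (comm A ζ J) := by
  have h1 : ∀ i j, Hol α (2 * (H * (6 * (Z * N)))) (fun t x => A i j t x *
      (ζ.uxx i j t x * J.u t x + ζ.ux i t x * J.ux j t x + ζ.ux j t x * J.ux i t x)) :=
    fun i j => (hA i j).mul (((((hZ.huxx i j).mul hu).add ((hZ.hux i).mul (hux j))).add
      ((hZ.hux j).mul (hux i))).mono (by linarith))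
  have h2 := (Hol.sum_const fun i => Hol.sum_const fun j => h1 i j).const_mul (1 / 2)
  refine ((hZ.hut.mul hu).sub h2).mono (le_of_eq ?_)
  simp only [Fintype.card_fin]
  rw [abs_of_pos (by norm_num : (0 : ℝ) < 1 / 2)]
  ring

end TVP

namespace TVP

/-! ### The standard Gaussian measure on `Fin d → ℝ` -/

open MeasureTheory ProbabilityTheory

/-- The standard Gaussian measure. -/
def gam (d : ℕ) : Measure (Fin d → ℝ) := Measure.pi fun _ => gaussianReal 0 1

instance (d : ℕ) : IsProbabilityMeasure (gam d) := by unfold gam; infer_instance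

/-- The Cameron–Martin density. -/
def cmd {d : ℕ} (h z : Fin d → ℝ) : ℝ := Real.exp (∑ i, (h i * z i - h i ^ 2 / 2))

lemma continuous_cmd {d : ℕ} (h : Fin d → ℝ) : Continuous (cmd h) := by
  unfold cmd; fun_prop

lemma gaussianReal_shift (c : ℝ) : gaussianReal c 1 =
    (gaussianReal 0 1).withDensity (fun z => ENNReal.ofReal (Real.exp (c * z - c ^ 2 / 2))) := by
  have h1 : (1 : NNReal) ≠ 0 := one_ne_zero
  rw [gaussianReal_of_var_ne_zero _ h1, gaussianReal_of_var_ne_zero _ h1, ← withDensity_mul]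
  · congr 1; funext z
    simp only [Pi.mul_apply, gaussianPDF]
    rw [← ENNReal.ofReal_mul (gaussianPDFReal_nonneg _ _ _)]
    congr 1
    simp only [gaussianPDFReal]
    conv_rhs => rw [mul_assoc, ← Real.exp_add]
    congr 2
    simp; ring
  · exact measurable_gaussianPDF _ _
  · fun_prop

lemma gam_map_add {d : ℕ} (h : Fin d → ℝ) : (gam d).map (fun z => z + h) =
    (gam d).withDensity (fun z => ENNReal.ofReal (cmd h z)) := by
  have e1 : (gam d).map (fun z => z + h) = Measure.pi (fun i => gaussianReal (h i) 1) := by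
    have := Measure.pi_map_pi (μ := fun _ : Fin d => gaussianReal 0 1)
      (f := fun i x => x + h i) (fun i => by fun_prop)
    have h2 : (fun z : Fin d → ℝ => z + h) = fun x i => x i + h i := rfl
    rw [h2]; unfold gam; rw [this]; congr 1; funext i
    rw [gaussianReal_map_add_const]; simp
  rw [e1]
  refine Measure.pi_eq fun s hs => ?_
  rw [withDensity_apply _ (MeasurableSet.univ_pi hs), ← lintegral_indicator (MeasurableSet.univ_pi hs)]
  have h3 : ∀ z : Fin d → ℝ, (Set.univ.pi s).indicator (fun z => ENNReal.ofReal (cmd h z)) z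
      = ∏ i, (s i).indicator (fun y => ENNReal.ofReal (Real.exp (h i * y - h i ^ 2 / 2))) (z i) := by
    intro z
    by_cases hz : z ∈ Set.univ.pi s
    · rw [Set.indicator_of_mem hz, cmd, Real.exp_sum, ENNReal.ofReal_prod_of_nonneg]
      · refine Finset.prod_congr rfl fun i _ => ?_
        rw [Set.indicator_of_mem (hz i trivial)]
      · intros; positivity
    · rw [Set.indicator_of_notMem hz]
      simp only [Set.mem_pi, Set.mem_univ, true_implies, not_forall] at hz
      obtain ⟨i, hi⟩ := hz
      exact (Finset.prod_eq_zero (Finset.mem_univ i) (Set.indicator_of_notMem hi _)).symm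
  simp_rw [h3]
  have hm : ∀ i, Measurable ((s i).indicator
      (fun y => ENNReal.ofReal (Real.exp (h i * y - h i ^ 2 / 2)))) := fun i =>
    Measurable.indicator (by fun_prop) (hs i)
  have hind := iIndepFun_pi (μ := fun _ : Fin d => gaussianReal 0 1) (X := fun i => (s i).indicator
      (fun y => ENNReal.ofReal (Real.exp (h i * y - h i ^ 2 / 2)))) (fun i => (hm i).aemeasurable)
  unfold gam
  rw [lintegral_prod_eq_prod_lintegral_of_indepFun _ _ hind
    (fun i => (hm i).comp (measurable_pi_apply i))]
  refine Finset.prod_congr rfl fun i _ => ?_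
  have := (measurePreserving_eval (fun _ : Fin d => gaussianReal 0 1) i).lintegral_comp (hm i)
  simp only [Function.eval] at this
  rw [this, lintegral_indicator (hs i), gaussianReal_shift (h i), withDensity_apply _ (hs i)]

lemma integral_gam_shift {d : ℕ} (h : Fin d → ℝ) {F : (Fin d → ℝ) → ℝ} (hF : Continuous F) :
    ∫ z, F (z + h) ∂gam d = ∫ z, F z * cmd h z ∂gam d := by
  rw [← integral_map (φ := fun z => z + h) (by fun_prop) hF.aestronglyMeasurable, gam_map_add,
    integral_withDensity_eq_integral_toReal_smul]
  · refine integral_congr_ae (Eventually.of_forall fun z => ?_)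
    simp only [smul_eq_mul, ENNReal.toReal_ofReal (show 0 ≤ cmd h z from (Real.exp_pos _).le)]
    ring
  · exact (continuous_cmd h).measurable.ennreal_ofReal
  · exact Eventually.of_forall fun _ => ENNReal.ofReal_lt_top

/-- Continuous functions of at most exponential growth. -/
def EG {d : ℕ} (f : (Fin d → ℝ) → ℝ) : Prop :=
  Continuous f ∧ ∃ C c : ℝ, 0 ≤ C ∧ 0 ≤ c ∧ ∀ z, |f z| ≤ C * Real.exp (c * ∑ i, |z i|)

lemma integrable_exp_abs (c : ℝ) : Integrable (fun x : ℝ => Real.exp (c * |x|))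
    (gaussianReal 0 1) := by
  have := (integrable_exp_mul_gaussianReal (μ := 0) (v := 1) c).add
    (integrable_exp_mul_gaussianReal (μ := 0) (v := 1) (-c))
  refine this.mono' (by fun_prop) (Eventually.of_forall fun x => ?_)
  rw [Real.norm_eq_abs, Real.abs_exp]
  simp only [Pi.add_apply]
  rcases abs_cases x with ⟨h, _⟩ | ⟨h, _⟩ <;> rw [h]
  · have := Real.exp_pos (-c * x); linarith
  · have := Real.exp_pos (c * x)
    rw [show c * -x = -c * x by ring]; linarith

lemma integrable_exp_sum {d : ℕ} (c : ℝ) :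
    Integrable (fun z : Fin d → ℝ => Real.exp (c * ∑ i, |z i|)) (gam d) := by
  have := Integrable.fintype_prod (μ := fun _ : Fin d => gaussianReal 0 1)
    (f := fun _ x => Real.exp (c * |x|)) (fun _ => integrable_exp_abs c)
  refine this.congr (Eventually.of_forall fun z => ?_)
  simp only [Finset.mul_sum, Real.exp_sum]

namespace EG

variable {d : ℕ} {f g : (Fin d → ℝ) → ℝ}

lemma integrable (hf : EG f) : Integrable f (gam d) := by
  obtain ⟨hc, C, c, -, -, h⟩ := hf
  exact ((integrable_exp_sum c).const_mul C).mono' hc.aestronglyMeasurable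
    (Eventually.of_forall h)

lemma const (c : ℝ) : EG (fun _ : Fin d → ℝ => c) :=
  ⟨continuous_const, |c|, 0, abs_nonneg _, le_rfl, by simp⟩

lemma add (hf : EG f) (hg : EG g) : EG (fun z => f z + g z) := by
  obtain ⟨hc, C, c, h1, h2, h⟩ := hf
  obtain ⟨hc', C', c', h1', h2', h'⟩ := hg
  refine ⟨hc.add hc', C + C', c + c', by positivity, by positivity, fun z => ?_⟩
  have hs : 0 ≤ ∑ i, |z i| := Finset.sum_nonneg fun i _ => abs_nonneg _
  have e1 : Real.exp (c * ∑ i, |z i|) ≤ Real.exp ((c + c') * ∑ i, |z i|) := by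
    gcongr; linarith
  have e2 : Real.exp (c' * ∑ i, |z i|) ≤ Real.exp ((c + c') * ∑ i, |z i|) := by
    gcongr; linarith
  calc _ ≤ |f z| + |g z| := abs_add_le _ _
    _ ≤ C * Real.exp (c * ∑ i, |z i|) + C' * Real.exp (c' * ∑ i, |z i|) := add_le_add (h z) (h' z)
    _ ≤ C * Real.exp ((c + c') * ∑ i, |z i|) + C' * Real.exp ((c + c') * ∑ i, |z i|) := by gcongr
    _ = _ := by ring

lemma mul (hf : EG f) (hg : EG g) : EG (fun z => f z * g z) := by
  obtain ⟨hc, C, c, h1, h2, h⟩ := hf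
  obtain ⟨hc', C', c', h1', h2', h'⟩ := hg
  refine ⟨hc.mul hc', C * C', c + c', by positivity, by positivity, fun z => ?_⟩
  rw [abs_mul, add_mul, Real.exp_add]
  calc _ ≤ (C * Real.exp (c * ∑ i, |z i|)) * (C' * Real.exp (c' * ∑ i, |z i|)) :=
        mul_le_mul (h z) (h' z) (abs_nonneg _) (by positivity)
    _ = _ := by ring

lemma const_mul (c : ℝ) (hf : EG f) : EG (fun z => c * f z) := (EG.const c).mul hf

lemma sub (hf : EG f) (hg : EG g) : EG (fun z => f z - g z) := by
  simpa [sub_eq_add_neg] using hf.add (hg.const_mul (-1))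

lemma coord (k : Fin d) : EG (fun z => z k) := by
  refine ⟨continuous_apply k, 1, 1, zero_le_one, zero_le_one, fun z => ?_⟩
  have : |z k| ≤ ∑ i, |z i| :=
    Finset.single_le_sum (f := fun i => |z i|) (fun i _ => abs_nonneg _) (Finset.mem_univ k)
  have h2 := Real.add_one_le_exp (∑ i, |z i|)
  simp only [one_mul]; linarith

lemma abs (hf : EG f) : EG (fun z => |f z|) := by
  obtain ⟨hc, C, c, h1, h2, h⟩ := hf
  exact ⟨hc.abs, C, c, h1, h2, fun z => by simpa using h z⟩

lemma norm_coord : EG (fun z : Fin d → ℝ => ‖z‖) := by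
  refine ⟨continuous_norm, 1, 1, zero_le_one, zero_le_one, fun z => ?_⟩
  have h2 := Real.add_one_le_exp (∑ i, |z i|)
  have h3 : 0 ≤ ∑ i, |z i| := Finset.sum_nonneg fun i _ => abs_nonneg _
  have : ‖z‖ ≤ ∑ i, |z i| := (pi_norm_le_iff_of_nonneg h3).2 fun k =>
    Finset.single_le_sum (f := fun i => |z i|) (fun i _ => abs_nonneg _) (Finset.mem_univ k)
  simp only [one_mul, abs_norm]; linarith

lemma of_bdd {M : ℝ} (hf : Continuous f) (hb : ∀ z, |f z| ≤ M) : EG f :=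
  ⟨hf, M, 0, (abs_nonneg _).trans (hb 0), le_rfl, by simpa using hb⟩

lemma sum {ι : Type*} (s : Finset ι) {F : ι → (Fin d → ℝ) → ℝ} (h : ∀ i ∈ s, EG (F i)) :
    EG (fun z => ∑ i ∈ s, F i z) := by
  classical
  induction s using Finset.induction_on with
  | empty => simpa using const 0
  | insert a s ha ih =>
    simp only [Finset.sum_insert ha]
    exact (h a (by simp)).add (ih fun i hi => h i (by simp [hi]))

end EG

lemma hasFDerivAt_cmd {d : ℕ} (z k : Fin d → ℝ) :
    HasFDerivAt (fun k => cmd k z) (grad fun i => (z i - k i) * cmd k z) k := by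
  have h1 : HasFDerivAt (fun k : Fin d → ℝ => ∑ i, (k i * z i - k i ^ 2 / 2))
      (grad fun i => z i - k i) k := by
    have : ∀ i ∈ (Finset.univ : Finset (Fin d)),
        HasFDerivAt (fun k : Fin d → ℝ => k i * z i - k i ^ 2 / 2)
        ((z i - k i) • ContinuousLinearMap.proj (R := ℝ) (φ := fun _ : Fin d => ℝ) i) k := by
      intro i _
      have h0 : HasFDerivAt (fun k : Fin d → ℝ => k i)
        (ContinuousLinearMap.proj (R := ℝ) (φ := fun _ : Fin d => ℝ) i) k := hasFDerivAt_apply i k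
      have hd : HasDerivAt (fun y : ℝ => y * z i - y ^ 2 / 2) (z i - k i) (k i) := by
        have := ((hasDerivAt_id (k i)).mul_const (z i)).sub (((hasDerivAt_id (k i)).pow 2).div_const 2)
        refine this.congr_deriv ?_
        simp
      exact hd.comp_hasFDerivAt k h0
    exact HasFDerivAt.fun_sum this
  refine h1.exp.congr_fderiv ?_
  rw [← grad_smul]; congr 1; funext i; rw [cmd]; ring

lemma cmd_le {d : ℕ} {k : Fin d → ℝ} (hk : ‖k‖ ≤ 1) (z : Fin d → ℝ) :
    cmd k z ≤ Real.exp (∑ i, |z i|) := by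
  refine Real.exp_le_exp.2 (Finset.sum_le_sum fun i _ => ?_)
  have h1 : |k i| ≤ 1 := (norm_le_pi_norm k i).trans hk
  have h2 : k i * z i ≤ |k i| * |z i| := by rw [← abs_mul]; exact le_abs_self _
  nlinarith [abs_nonneg (z i), sq_nonneg (k i)]

lemma EG.shift_bound {d : ℕ} {f : (Fin d → ℝ) → ℝ} (hf : EG f) :
    ∃ C c : ℝ, 0 ≤ C ∧ 0 ≤ c ∧ ∀ k : Fin d → ℝ, ‖k‖ ≤ 1 → ∀ z,
      |f (z - k)| ≤ C * Real.exp (c * ∑ i, |z i|) := by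
  obtain ⟨hc, C, c, h1, h2, h⟩ := hf
  refine ⟨C * Real.exp (c * d), c, by positivity, h2, fun k hk z => (h _).trans ?_⟩
  rw [mul_assoc, ← Real.exp_add, ← mul_add]
  gcongr
  calc ∑ i, |(z - k) i| ≤ ∑ i, (1 + |z i|) := by
        refine Finset.sum_le_sum fun i _ => ?_
        have h1 : |k i| ≤ 1 := (norm_le_pi_norm k i).trans hk
        have := abs_sub (z i) (k i)
        simp only [Pi.sub_apply]; linarith
    _ = d + ∑ i, |z i| := by simp [Finset.sum_add_distrib]

/-- Differentiation of Gaussian averages by shifting the Gaussian measure. -/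
lemma hasFDerivAt_gauss {d : ℕ} {g : (Fin d → ℝ) → ℝ} {M s : ℝ} (hg : Continuous g)
    (hb : ∀ x, |g x| ≤ M) (hs : 0 < s) {H : (Fin d → ℝ) → ℝ} {H' : Fin d → (Fin d → ℝ) → ℝ}
    (hH : EG H) (hH' : ∀ k, EG (H' k)) (hd : ∀ z, HasFDerivAt H (grad fun k => H' k z) z)
    (x : Fin d → ℝ) :
    HasFDerivAt (fun x => ∫ z, g (x + s • z) * H z ∂gam d)
      (grad fun k => s⁻¹ * ∫ z, g (x + s • z) * (z k * H z - H' k z) ∂gam d) x := by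
  have hgc : Continuous fun z => g (x + s • z) := by fun_prop
  have hM : 0 ≤ M := (abs_nonneg _).trans (hb 0)
  set W : Fin d → (Fin d → ℝ) → ℝ := fun i z => z i * H z - H' i z with hWdef
  have hW : ∀ i, EG (W i) := fun i => ((EG.coord i).mul hH).sub (hH' i)
  let Φ : (Fin d → ℝ) → (Fin d → ℝ) → ℝ := fun k z => g (x + s • z) * (H (z - k) * cmd k z)
  let Φ' : (Fin d → ℝ) → (Fin d → ℝ) → ((Fin d → ℝ) →L[ℝ] ℝ) := fun k z =>
    grad fun i => g (x + s • z) * (W i (z - k) * cmd k z)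
  have e1 : ∀ y, ∫ z, g (y + s • z) * H z ∂gam d = ∫ z, Φ (s⁻¹ • (y - x)) z ∂gam d := by
    intro y
    have := integral_gam_shift (s⁻¹ • (y - x))
      (F := fun z => g (x + s • z) * H (z - s⁻¹ • (y - x))) (hgc.mul (hH.1.comp (by fun_prop)))
    simp only [mul_assoc, add_sub_cancel_right] at this
    rw [← this]
    refine integral_congr_ae (Eventually.of_forall fun z => ?_)
    simp only [smul_add, smul_smul, mul_inv_cancel₀ hs.ne', one_smul]
    congr 2; abel
  have hΦ' : ∀ k z, HasFDerivAt (fun k => Φ k z) (Φ' k z) k := by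
    intro k z
    have h1 : HasFDerivAt (fun k => H (z - k)) (grad fun i => - H' i (z - k)) k := by
      have h2 : HasFDerivAt (fun k => z - k) (-ContinuousLinearMap.id ℝ (Fin d → ℝ)) k :=
        (hasFDerivAt_id k).const_sub z
      refine ((hd (z - k)).comp k h2).congr_fderiv ?_
      ext v; simp
    refine ((h1.mul (hasFDerivAt_cmd z k)).const_mul (g (x + s • z))).congr_fderiv ?_
    rw [← grad_smul, ← grad_smul, ← grad_add, ← grad_smul]
    congr 1; funext i; simp only [hWdef, Pi.sub_apply]; ring
  have hcont : ∀ i, Continuous (fun z => g (x + s • z) * (W i z * cmd 0 z)) := fun i =>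
    hgc.mul ((hW i).1.mul (continuous_cmd 0))
  choose C c hC hc hCc using fun i => (hW i).shift_bound
  have key : HasFDerivAt (fun k => ∫ z, Φ k z ∂gam d) (∫ z, Φ' 0 z ∂gam d) 0 := by
    refine hasFDerivAt_integral_of_dominated_of_fderiv_le (F' := Φ')
      (bound := fun z => d * (∑ i, M * (C i * Real.exp ((c i + 1) * ∑ i, |z i|))))
      (Metric.ball_mem_nhds 0 one_pos) ?_ ?_ ?_ ?_ ?_ ?_
    · exact Eventually.of_forall fun k => (hgc.mul
        ((hH.1.comp (by fun_prop)).mul (continuous_cmd k))).aestronglyMeasurable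
    · have hcm : EG (cmd (0 : Fin d → ℝ)) := EG.of_bdd (continuous_cmd 0) (M := 1)
        fun z => by simp [cmd]
      simpa [Φ] using ((EG.of_bdd hgc fun z => hb _).mul (hH.mul hcm)).integrable
    · have : Continuous (Φ' 0) := by
        have h3 : Φ' 0 = fun z => gradL d (fun i => g (x + s • z) * (W i z * cmd 0 z)) := by
          funext z; simp [Φ']
        rw [h3]
        exact (gradL d).continuous.comp (continuous_pi hcont)
      exact this.aestronglyMeasurable
    · refine Eventually.of_forall fun z k hk => ?_
      have hk1 : ‖k‖ ≤ 1 := by simpa using (Metric.mem_ball.1 hk).le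
      refine norm_grad_le _ fun i => ?_
      have hcm : 0 ≤ cmd k z := (Real.exp_pos _).le
      calc |g (x + s • z) * (W i (z - k) * cmd k z)|
          ≤ M * (C i * Real.exp ((c i + 1) * ∑ i, |z i|)) := by
            rw [abs_mul, abs_mul, abs_of_nonneg hcm, add_mul, Real.exp_add, one_mul, ← mul_assoc (C i)]
            exact mul_le_mul (hb _) (mul_le_mul (hCc i k hk1 z) (cmd_le hk1 z) hcm
              (mul_nonneg (hC i) (Real.exp_pos _).le)) (by positivity) hM
        _ ≤ _ := Finset.single_le_sum
            (f := fun i => M * (C i * Real.exp ((c i + 1) * ∑ i, |z i|)))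
            (fun i _ => mul_nonneg hM (mul_nonneg (hC i) (Real.exp_pos _).le)) (Finset.mem_univ i)
    · exact (integrable_finsetSum _ fun i _ =>
        ((integrable_exp_sum _).const_mul _).const_mul _).const_mul _
    · exact Eventually.of_forall fun z k _ => hΦ' k z
  have e2 : ∫ z, Φ' 0 z ∂gam d = grad fun i => ∫ z, g (x + s • z) * W i z ∂gam d := by
    have h3 : Φ' 0 = fun z => gradL d (fun i => g (x + s • z) * W i z) := by
      funext z; simp [Φ', cmd]
    have hintg : ∀ i, Integrable (fun z => g (x + s • z) * W i z) (gam d) := fun i =>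
      ((EG.of_bdd hgc fun z => hb _).mul (hW i)).integrable
    rw [h3, ContinuousLinearMap.integral_comp_comm _ (Integrable.of_eval hintg), gradL_apply]
    congr 1; funext i
    rw [eval_integral hintg]
  rw [e2] at key
  have hlin : HasFDerivAt (fun y => s⁻¹ • (y - x)) (s⁻¹ • ContinuousLinearMap.id ℝ (Fin d → ℝ)) x :=
    ((hasFDerivAt_id x).sub_const x).const_smul s⁻¹
  have key2 : HasFDerivAt (fun k => ∫ z, Φ k z ∂gam d)
      (grad fun i => ∫ z, g (x + s • z) * W i z ∂gam d) (s⁻¹ • (x - x)) := by simpa using key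
  have := key2.comp x hlin
  refine (this.congr_of_eventuallyEq (Eventually.of_forall fun y => e1 y)).congr_fderiv ?_
  rw [grad_smul]; ext v; simp [hWdef]

end TVP

namespace TVP

open MeasureTheory ProbabilityTheory

lemma gaussianReal_prod_map (a b c : ℝ) (hc : c ^ 2 = a ^ 2 + b ^ 2) :
    ((gaussianReal 0 1).prod (gaussianReal 0 1)).map (fun p => a * p.1 + b * p.2) =
      (gaussianReal 0 1).map (c * ·) := by
  have h1 := gaussianReal_conv_gaussianReal (m₁ := a * 0) (m₂ := b * 0)
    (v₁ := .mk (a ^ 2) (sq_nonneg _) * 1) (v₂ := .mk (b ^ 2) (sq_nonneg _) * 1)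
  rw [← gaussianReal_map_const_mul, ← gaussianReal_map_const_mul, Measure.conv,
    Measure.map_prod_map _ _ (by fun_prop) (by fun_prop), Measure.map_map (by fun_prop)
    (by fun_prop)] at h1
  rw [gaussianReal_map_const_mul]
  refine Eq.trans h1 ?_
  congr 1
  · ring
  · ext; simp [hc]

lemma gam_semigroup_map {d : ℕ} (a b c : ℝ) (hc : c ^ 2 = a ^ 2 + b ^ 2) :
    ((gam d).prod (gam d)).map (fun p => a • p.1 + b • p.2) = (gam d).map (fun z => c • z) := by
  have h1 := measurePreserving_arrowProdEquivProdArrow ℝ ℝ (Fin d)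
    (fun _ => gaussianReal 0 1) (fun _ => gaussianReal 0 1)
  have h2 := Measure.pi_map_pi
    (μ := fun _ : Fin d => (gaussianReal 0 1).prod (gaussianReal 0 1))
    (f := fun _ p => a * p.1 + b * p.2) (fun i => by fun_prop)
  have h3 := Measure.pi_map_pi (μ := fun _ : Fin d => gaussianReal 0 1)
    (f := fun _ x => c * x) (fun i => by fun_prop)
  have h4 : ((gam d).prod (gam d)).map (fun p => a • p.1 + b • p.2) =
      Measure.pi (fun _ : Fin d =>
        ((gaussianReal 0 1).prod (gaussianReal 0 1)).map (fun p => a * p.1 + b * p.2)) := by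
    rw [← h2]; unfold gam; rw [← h1.map_eq, Measure.map_map (by fun_prop) h1.measurable]
    rfl
  rw [h4]
  simp_rw [gaussianReal_prod_map a b c hc]
  rw [← h3]; rfl

lemma gam_semigroup {d : ℕ} {F : (Fin d → ℝ) → ℝ} {M : ℝ} (hF : Continuous F)
    (hb : ∀ x, |F x| ≤ M) (a b c : ℝ) (hc : c ^ 2 = a ^ 2 + b ^ 2) :
    ∫ z, ∫ w, F (a • z + b • w) ∂gam d ∂gam d = ∫ z, F (c • z) ∂gam d := by
  have h := gam_semigroup_map (d := d) a b c hc
  have h1 : Integrable (fun p : (Fin d → ℝ) × (Fin d → ℝ) => F (a • p.1 + b • p.2))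
      ((gam d).prod (gam d)) :=
    (integrable_const M).mono' (by fun_prop) (Eventually.of_forall fun p => hb _)
  rw [← integral_prod _ h1, ← integral_map (φ := fun p : (Fin d → ℝ) × (Fin d → ℝ) =>
    a • p.1 + b • p.2) (by fun_prop) hF.aestronglyMeasurable, h,
    integral_map (by fun_prop) hF.aestronglyMeasurable]

/-- Gaussian divergence weights have mean zero. -/
lemma mean_zero {d : ℕ} {H : (Fin d → ℝ) → ℝ} {H' : Fin d → (Fin d → ℝ) → ℝ}
    (hH : EG H) (hH' : ∀ k, EG (H' k)) (hd : ∀ z, HasFDerivAt H (grad fun k => H' k z) z)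
    (k : Fin d) : ∫ z, (z k * H z - H' k z) ∂gam d = 0 := by
  have h := hasFDerivAt_gauss (g := fun _ => 1) (M := 1) continuous_const (by simp) one_pos
    hH hH' hd 0
  have h2 : HasFDerivAt (fun _ : Fin d → ℝ => ∫ z, 1 * H z ∂gam d)
      (0 : (Fin d → ℝ) →L[ℝ] ℝ) 0 := hasFDerivAt_const _ _
  have h3 := congrArg (fun L => L (Pi.single k 1)) (h.unique h2)
  simp only [grad_single] at h3
  simpa using h3

/-- First, second and third order weights. -/
def w1 {d : ℕ} (k : Fin d) (z : Fin d → ℝ) : ℝ := z k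

/-- Kronecker symbol. -/
def kr {d : ℕ} (i j : Fin d) : ℝ := if i = j then 1 else 0

/-- Second order weights. -/
def w2 {d : ℕ} (i k : Fin d) (z : Fin d → ℝ) : ℝ := z k * z i - kr i k

/-- Third order weights. -/
def w3 {d : ℕ} (i j k : Fin d) (z : Fin d → ℝ) : ℝ :=
  z k * w2 i j z - (kr j k * z i + z j * kr i k)

variable {d : ℕ}

lemma EG_w2 (i k : Fin d) : EG (w2 i k) := ((EG.coord k).mul (EG.coord i)).sub (EG.const _)

lemma EG_dw2 (i j k : Fin d) : EG (fun z : Fin d → ℝ => kr j k * z i + z j * kr i k) :=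
  ((EG.const _).mul (EG.coord i)).add ((EG.coord j).mul (EG.const _))

lemma EG_w3 (i j k : Fin d) : EG (w3 i j k) :=
  ((EG.coord k).mul (EG_w2 i j)).sub (EG_dw2 i j k)

lemma hasFDerivAt_coord (i : Fin d) (z : Fin d → ℝ) :
    HasFDerivAt (fun z : Fin d → ℝ => z i) (grad fun k => kr i k) z := by
  refine (hasFDerivAt_apply i z).congr_fderiv ?_
  ext v; simp [kr]

lemma hasFDerivAt_w2 (i j : Fin d) (z : Fin d → ℝ) :
    HasFDerivAt (w2 i j) (grad fun k => kr j k * z i + z j * kr i k) z := by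
  refine (((hasFDerivAt_coord j z).mul (hasFDerivAt_coord i z)).sub_const
    (kr i j)).congr_fderiv ?_
  rw [← grad_smul, ← grad_smul, ← grad_add]; congr 1; funext k; ring

lemma integral_w1 (k : Fin d) : ∫ z, z k ∂gam d = 0 := by
  have := mean_zero (H := fun _ => 1) (H' := fun _ _ => 0) (EG.const 1) (fun _ => EG.const 0)
    (fun z => (hasFDerivAt_const (1 : ℝ) z).congr_fderiv (by ext v; simp)) k
  simpa using this

lemma integral_w2 (i k : Fin d) : ∫ z, w2 i k z ∂gam d = 0 :=
  mean_zero (H := fun z => z i) (H' := fun k _ => kr i k) (EG.coord i) (fun _ => EG.const _)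
    (hasFDerivAt_coord i) k

lemma integral_w3 (i j k : Fin d) : ∫ z, w3 i j k z ∂gam d = 0 :=
  mean_zero (EG_w2 i j) (EG_dw2 i j) (hasFDerivAt_w2 i j) k

lemma integral_coord_mul (i k : Fin d) : ∫ z, z k * z i ∂gam d = kr i k := by
  have h := integral_w2 i k
  unfold w2 at h
  rw [integral_sub ((EG.coord k).mul (EG.coord i)).integrable (integrable_const _)] at h
  simp only [integral_const, probReal_univ, smul_eq_mul, one_mul] at h
  linarith

/-- Gaussian average at scale `s` with weight `K`. -/
def gav (K g : (Fin d → ℝ) → ℝ) (s : ℝ) (x : Fin d → ℝ) : ℝ := ∫ z, g (x + s • z) * K z ∂gam d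

/-- The constant in estimates of `gav K`. -/
def gcst (K : (Fin d → ℝ) → ℝ) : ℝ := ∫ z, (1 + ‖z‖) * |K z| ∂gam d

lemma gcst_nonneg (K : (Fin d → ℝ) → ℝ) : 0 ≤ gcst K := integral_nonneg fun z => by positivity

section gav

variable {K : (Fin d → ℝ) → ℝ} {g : (Fin d → ℝ) → ℝ} {M : ℝ}

lemma EG_gcst (hK : EG K) : EG (fun z => (1 + ‖z‖) * |K z|) :=
  ((EG.const 1).add EG.norm_coord).mul hK.abs

lemma integrable_gav (hK : EG K) (hg : Continuous g) (hb : ∀ x, |g x| ≤ M) (s : ℝ) (x : Fin d → ℝ) :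
    Integrable (fun z => g (x + s • z) * K z) (gam d) :=
  ((EG.of_bdd (by fun_prop) fun z => hb _).mul hK).integrable

lemma abs_integral_le_gcst (hK : EG K) {F : (Fin d → ℝ) → ℝ} {B : ℝ}
    (h : ∀ z, |F z| ≤ B * ((1 + ‖z‖) * |K z|)) : |∫ z, F z ∂gam d| ≤ B * gcst K := by
  rw [← Real.norm_eq_abs, gcst, ← integral_const_mul]
  exact norm_integral_le_of_norm_le ((EG_gcst hK).integrable.const_mul B)
    (Eventually.of_forall h)

lemma abs_gav_le (hK : EG K) (hb : ∀ x, |g x| ≤ M) (s : ℝ) (x : Fin d → ℝ) :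
    |gav K g s x| ≤ M * gcst K := by
  have hM : 0 ≤ M := (abs_nonneg _).trans (hb 0)
  refine abs_integral_le_gcst hK fun z => ?_
  rw [abs_mul]
  have h1 : 0 ≤ ‖z‖ * |K z| := by positivity
  exact mul_le_mul (hb _) (by linarith) (abs_nonneg _) hM

lemma abs_gav_sub_le (hK : EG K) (hg : Continuous g) (hb : ∀ x, |g x| ≤ M) {α : ℝ}
    (hh : ∀ x y, |g x - g y| ≤ M * ‖x - y‖ ^ α) (s : ℝ) (x y : Fin d → ℝ) :
    |gav K g s x - gav K g s y| ≤ M * ‖x - y‖ ^ α * gcst K := by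
  have hM : 0 ≤ M := (abs_nonneg _).trans (hb 0)
  unfold gav
  rw [← integral_sub (integrable_gav hK hg hb s x) (integrable_gav hK hg hb s y)]
  refine abs_integral_le_gcst hK fun z => ?_
  rw [← sub_mul, abs_mul]
  have h1 : 0 ≤ ‖z‖ * |K z| := by positivity
  have h2 := hh (x + s • z) (y + s • z)
  rw [add_sub_add_right_eq_sub] at h2
  exact mul_le_mul h2 (by linarith) (abs_nonneg _) (by positivity)

lemma rpow_le_one_add {α r : ℝ} (hα : 0 ≤ α) (hα1 : α ≤ 1) (hr : 0 ≤ r) : r ^ α ≤ 1 + r := by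
  rcases le_total r 1 with h | h
  · exact (Real.rpow_le_one hr h hα).trans (by linarith)
  · calc r ^ α ≤ r ^ (1 : ℝ) := Real.rpow_le_rpow_of_exponent_le h hα1
      _ ≤ _ := by rw [Real.rpow_one]; linarith

lemma abs_gav_sub_self_le (hK : EG K) (hg : Continuous g) (hb : ∀ x, |g x| ≤ M) {α : ℝ}
    (hα : 0 ≤ α) (hα1 : α ≤ 1)
    (hh : ∀ x y, |g x - g y| ≤ M * ‖x - y‖ ^ α) {s : ℝ} (hs : 0 ≤ s) (x : Fin d → ℝ) :
    |gav K g s x - g x * ∫ z, K z ∂gam d| ≤ M * s ^ α * gcst K := by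
  have hM : 0 ≤ M := (abs_nonneg _).trans (hb 0)
  unfold gav
  rw [← integral_const_mul, ← integral_sub (integrable_gav hK hg hb s x) (hK.integrable.const_mul _)]
  refine abs_integral_le_gcst hK fun z => ?_
  rw [← sub_mul, abs_mul]
  have h2 := hh (x + s • z) x
  rw [add_sub_cancel_left, norm_smul, Real.norm_of_nonneg hs, Real.mul_rpow hs (norm_nonneg _)] at h2
  have h3 := rpow_le_one_add hα hα1 (norm_nonneg z)
  calc |g (x + s • z) - g x| * |K z| ≤ (M * (s ^ α * (1 + ‖z‖))) * |K z| := by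
        gcongr; exact h2.trans (by gcongr)
    _ = _ := by ring

lemma abs_gav_le_of_mean_zero (hK : EG K) (h0 : ∫ z, K z ∂gam d = 0) (hg : Continuous g)
    (hb : ∀ x, |g x| ≤ M) {α : ℝ} (hα : 0 ≤ α) (hα1 : α ≤ 1)
    (hh : ∀ x y, |g x - g y| ≤ M * ‖x - y‖ ^ α) {s : ℝ} (hs : 0 ≤ s) (x : Fin d → ℝ) :
    |gav K g s x| ≤ M * s ^ α * gcst K := by
  simpa [h0] using abs_gav_sub_self_le hK hg hb hα hα1 hh hs x

end gav

lemma continuous_gav {X : Type*} [TopologicalSpace X] [FirstCountableTopology X]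
    {K : (Fin d → ℝ) → ℝ} (hK : EG K) {g : X → (Fin d → ℝ) → ℝ} {M : ℝ}
    (hg : Continuous fun p : X × (Fin d → ℝ) => g p.1 p.2) (hb : ∀ t x, |g t x| ≤ M)
    {s : X → ℝ} {x : X → Fin d → ℝ} (hs : Continuous s) (hx : Continuous x) :
    Continuous fun p => gav K (g p) (s p) (x p) := by
  refine continuous_of_dominated (bound := fun z => M * |K z|) (fun p => ?_) (fun p => ?_)
    (hK.abs.integrable.const_mul M) ?_
  · have : Continuous (g p) := hg.comp (Continuous.prodMk_right p)
    exact ((this.comp (by fun_prop)).mul hK.1).aestronglyMeasurable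
  · refine Eventually.of_forall fun z => ?_
    rw [norm_mul]
    exact mul_le_mul_of_nonneg_right (hb _ _) (abs_nonneg _)
  · refine Eventually.of_forall fun z => ?_
    exact (hg.comp (continuous_id.prodMk (hx.add (hs.smul continuous_const)))).mul
      continuous_const

lemma hasFDerivAt_gav {g : (Fin d → ℝ) → ℝ} {M s : ℝ} (hg : Continuous g)
    (hb : ∀ x, |g x| ≤ M) (hs : 0 < s) (x : Fin d → ℝ) :
    HasFDerivAt (gav (fun _ => 1) g s) (grad fun k => s⁻¹ * gav (w1 k) g s x) x := by
  have := hasFDerivAt_gauss hg hb hs (H := fun _ => 1) (H' := fun _ _ => 0) (EG.const 1)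
    (fun _ => EG.const 0)
    (fun z => (hasFDerivAt_const (1 : ℝ) z).congr_fderiv (by ext v; simp)) x
  have h2 : gav (fun _ => 1) g s = fun x => ∫ z, g (x + s • z) ∂gam d := by
    funext y; simp [gav]
  rw [h2]; simpa [gav, w1] using this

lemma hasFDerivAt_gav_w1 {g : (Fin d → ℝ) → ℝ} {M s : ℝ} (hg : Continuous g)
    (hb : ∀ x, |g x| ≤ M) (hs : 0 < s) (i : Fin d) (x : Fin d → ℝ) :
    HasFDerivAt (gav (w1 i) g s) (grad fun k => s⁻¹ * gav (w2 i k) g s x) x :=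
  hasFDerivAt_gauss hg hb hs (EG.coord i) (fun _ => EG.const _) (hasFDerivAt_coord i) x

lemma hasFDerivAt_gav_w2 {g : (Fin d → ℝ) → ℝ} {M s : ℝ} (hg : Continuous g)
    (hb : ∀ x, |g x| ≤ M) (hs : 0 < s) (i j : Fin d) (x : Fin d → ℝ) :
    HasFDerivAt (gav (w2 i j) g s) (grad fun k => s⁻¹ * gav (w3 i j k) g s x) x :=
  hasFDerivAt_gauss hg hb hs (EG_w2 i j) (EG_dw2 i j) (hasFDerivAt_w2 i j) x

end TVP

namespace TVP

open MeasureTheory ProbabilityTheory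

/-! ### Integrals with singular kernels in time -/

/-- The reference kernel `r ^ (θ - 1) e ^ {-l r}`. -/
def kern (l θ r : ℝ) : ℝ := r ^ (θ - 1) * Real.exp (-(l * r))

/-- The integral of `kern l θ` over `(0, ∞)`. -/
def kint (l θ : ℝ) : ℝ := (1 / l) ^ θ * Real.Gamma θ

section kern

variable {l θ B : ℝ}

lemma kint_pos (hl : 0 < l) (hθ : 0 < θ) : 0 < kint l θ :=
  mul_pos (Real.rpow_pos_of_pos (by positivity) _) (Real.Gamma_pos_of_pos hθ)

lemma integral_kern (hl : 0 < l) (hθ : 0 < θ) : ∫ r in Ioi 0, kern l θ r = kint l θ :=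
  Real.integral_rpow_mul_exp_neg_mul_Ioi hθ hl

lemma integrableOn_kern (hl : 0 < l) (hθ : 0 < θ) : IntegrableOn (kern l θ) (Ioi 0) := by
  by_contra h
  have := integral_kern hl hθ
  rw [integral_undef h] at this
  exact (kint_pos hl hθ).ne this

lemma kern_nonneg {r : ℝ} (hr : 0 < r) : 0 ≤ kern l θ r :=
  mul_nonneg (Real.rpow_nonneg hr.le _) (Real.exp_pos _).le

lemma abs_integral_le_kint (hl : 0 < l) (hθ : 0 < θ) {q : ℝ → ℝ}
    (h : ∀ r, 0 < r → |q r| ≤ B * kern l θ r) : |∫ r in Ioi 0, q r| ≤ B * kint l θ := by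
  rw [← integral_kern hl hθ, ← integral_const_mul, ← Real.norm_eq_abs]
  exact norm_integral_le_of_norm_le ((integrableOn_kern hl hθ).const_mul B)
    ((ae_restrict_iff' measurableSet_Ioi).2 (Eventually.of_forall h))

lemma integrableOn_of_kern (hl : 0 < l) (hθ : 0 < θ) {q : ℝ → ℝ}
    (h : ∀ r, 0 < r → |q r| ≤ B * kern l θ r) (hc : ContinuousOn q (Ioi 0)) :
    IntegrableOn q (Ioi 0) :=
  ((integrableOn_kern hl hθ).const_mul B).mono' (hc.aestronglyMeasurable measurableSet_Ioi)
    ((ae_restrict_iff' measurableSet_Ioi).2 (Eventually.of_forall h))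

lemma continuous_integral_kern {X : Type*} [TopologicalSpace X] [FirstCountableTopology X]
    (hl : 0 < l) (hθ : 0 < θ) {q : ℝ → X → ℝ}
    (h : ∀ r, 0 < r → ∀ x, |q r x| ≤ B * kern l θ r)
    (hc : ∀ x, ContinuousOn (fun r => q r x) (Ioi 0)) (hx : ∀ r, 0 < r → Continuous (q r)) :
    Continuous fun x => ∫ r in Ioi 0, q r x := by
  refine continuous_of_dominated (bound := fun r => B * kern l θ r)
    (fun x => (hc x).aestronglyMeasurable measurableSet_Ioi)
    (fun x => (ae_restrict_iff' measurableSet_Ioi).2 (Eventually.of_forall fun r hr => h r hr x))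
    ((integrableOn_kern hl hθ).const_mul B) ?_
  exact (ae_restrict_iff' measurableSet_Ioi).2 (Eventually.of_forall hx)

lemma hasFDerivAt_integral_kern {d : ℕ} (hl : 0 < l) (hθ : 0 < θ) {q : ℝ → (Fin d → ℝ) → ℝ}
    {q' : Fin d → ℝ → (Fin d → ℝ) → ℝ}
    (hq : ∀ x, ContinuousOn (fun r => q r x) (Ioi 0))
    (hqi : ∀ x, IntegrableOn (fun r => q r x) (Ioi 0))
    (h' : ∀ i r, 0 < r → ∀ x, |q' i r x| ≤ B * kern l θ r)
    (hq' : ∀ i x, ContinuousOn (fun r => q' i r x) (Ioi 0))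
    (hd : ∀ r, 0 < r → ∀ x, HasFDerivAt (q r) (grad fun i => q' i r x) x) (x : Fin d → ℝ) :
    HasFDerivAt (fun x => ∫ r in Ioi 0, q r x) (grad fun i => ∫ r in Ioi 0, q' i r x) x := by
  have key : HasFDerivAt (fun x => ∫ r in Ioi 0, q r x)
      (∫ r in Ioi 0, gradL d (fun i => q' i r x)) x := by
    refine hasFDerivAt_integral_of_dominated_of_fderiv_le
      (F' := fun x r => gradL d (fun i => q' i r x)) (bound := fun r => d * (B * kern l θ r))
      Filter.univ_mem ?_ (hqi x) ?_ ?_ ?_ ?_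
    · exact Eventually.of_forall fun y => (hq y).aestronglyMeasurable measurableSet_Ioi
    · exact ((gradL d).continuous.comp_continuousOn
        (continuousOn_pi.2 fun i => hq' i x)).aestronglyMeasurable measurableSet_Ioi
    · exact (ae_restrict_iff' measurableSet_Ioi).2 (Eventually.of_forall fun r hr y _ =>
        norm_grad_le _ fun i => h' i r hr y)
    · exact ((integrableOn_kern hl hθ).const_mul B).const_mul _
    · exact (ae_restrict_iff' measurableSet_Ioi).2 (Eventually.of_forall fun r hr y _ => hd r hr y)
  have hintg : ∀ i, Integrable (fun r => q' i r x) (volume.restrict (Ioi 0)) := fun i =>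
    integrableOn_of_kern hl hθ (fun r hr => h' i r hr x) (hq' i x)
  rw [ContinuousLinearMap.integral_comp_comm _ (Integrable.of_eval hintg), gradL_apply] at key
  refine key.congr_fderiv ?_
  congr 1; funext i
  rw [eval_integral hintg]

end kern

/-! ### The heat potential -/

variable {d : ℕ}

/-- Integrands of the heat potential and its derivatives. -/
def hq (l : ℝ) (n : ℕ) (K : (Fin d → ℝ) → ℝ) (g : ℝ → (Fin d → ℝ) → ℝ) (r t : ℝ)
    (x : Fin d → ℝ) : ℝ :=
  Real.exp (-(l * r)) * (((√r)⁻¹) ^ n * gav K (g (t - r)) (√r) x)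

section hq

variable {l α M : ℝ} {g : ℝ → (Fin d → ℝ) → ℝ} {K : (Fin d → ℝ) → ℝ} {n : ℕ}

lemma sqrt_inv_pow {r : ℝ} (hr : 0 < r) (n : ℕ) : ((√r)⁻¹) ^ n = r ^ (-(n / 2 : ℝ)) := by
  rw [Real.sqrt_eq_rpow, ← Real.rpow_neg hr.le, ← Real.rpow_natCast, ← Real.rpow_mul hr.le]
  congr 1; ring

lemma abs_hq_le (hg : Hol α M g) (hK : EG K) {r : ℝ} (hr : 0 < r) (t : ℝ) (x : Fin d → ℝ) :
    |hq l n K g r t x| ≤ M * gcst K * kern l (1 - n / 2) r := by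
  rw [hq, abs_mul, abs_mul, Real.abs_exp, abs_of_nonneg (by positivity), sqrt_inv_pow hr, kern,
    show (1 - n / 2 - 1 : ℝ) = -(n / 2) by ring]
  have := abs_gav_le hK (hg.bdd (t - r)) (√r) x
  have h1 : 0 ≤ r ^ (-(n / 2 : ℝ)) := Real.rpow_nonneg hr.le _
  calc _ ≤ Real.exp (-(l * r)) * (r ^ (-(n / 2 : ℝ)) * (M * gcst K)) := by gcongr
    _ = _ := by ring

lemma abs_hq_sub_le (hg : Hol α M g) (hK : EG K) {r : ℝ} (hr : 0 < r) (t : ℝ) (x y : Fin d → ℝ) :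
    |hq l n K g r t x - hq l n K g r t y| ≤
      M * ‖x - y‖ ^ α * gcst K * kern l (1 - n / 2) r := by
  rw [hq, hq, ← mul_sub, ← mul_sub, abs_mul, abs_mul, Real.abs_exp, abs_of_nonneg (by positivity),
    sqrt_inv_pow hr, kern, show (1 - n / 2 - 1 : ℝ) = -(n / 2) by ring]
  have hgc : Continuous (g (t - r)) := hg.cont.comp (Continuous.prodMk_right _)
  have := abs_gav_sub_le hK hgc (hg.bdd (t - r)) (hg.hol (t - r)) (√r) x y
  have h1 : 0 ≤ r ^ (-(n / 2 : ℝ)) := Real.rpow_nonneg hr.le _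
  calc _ ≤ Real.exp (-(l * r)) * (r ^ (-(n / 2 : ℝ)) * (M * ‖x - y‖ ^ α * gcst K)) := by gcongr
    _ = _ := by ring

lemma abs_hq_le_of_mean_zero (hα : 0 ≤ α) (hα1 : α ≤ 1) (hg : Hol α M g) (hK : EG K)
    (h0 : ∫ z, K z ∂gam d = 0) {r : ℝ} (hr : 0 < r) (t : ℝ) (x : Fin d → ℝ) :
    |hq l n K g r t x| ≤ M * gcst K * kern l (1 + α / 2 - n / 2) r := by
  rw [hq, abs_mul, abs_mul, Real.abs_exp, abs_of_nonneg (by positivity), sqrt_inv_pow hr, kern,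
    show (1 + α / 2 - n / 2 - 1 : ℝ) = -(n / 2) + α / 2 by ring, Real.rpow_add hr]
  have hgc : Continuous (g (t - r)) := hg.cont.comp (Continuous.prodMk_right _)
  have := abs_gav_le_of_mean_zero hK h0 hgc (hg.bdd (t - r)) hα hα1 (hg.hol (t - r))
    (Real.sqrt_nonneg r) x
  rw [Real.sqrt_eq_rpow, ← Real.rpow_mul hr.le, show 1 / 2 * α = α / 2 by ring,
    ← Real.sqrt_eq_rpow] at this
  have h1 : 0 ≤ r ^ (-(n / 2 : ℝ)) := Real.rpow_nonneg hr.le _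
  calc _ ≤ Real.exp (-(l * r)) * (r ^ (-(n / 2 : ℝ)) * (M * r ^ (α / 2) * gcst K)) := by gcongr
    _ = _ := by ring

lemma continuousOn_hq (hg : Hol α M g) (hK : EG K) (t : ℝ) (x : Fin d → ℝ) :
    ContinuousOn (fun r => hq l n K g r t x) (Ioi 0) := by
  unfold hq
  have h1 : Continuous fun r => gav K (g (t - r)) (√r) x :=
    continuous_gav (g := fun r => g (t - r)) hK
      (hg.cont.comp (by fun_prop : Continuous fun p : ℝ × (Fin d → ℝ) => (t - p.1, p.2)))
      (fun r => hg.bdd _) (by fun_prop) continuous_const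
  refine ContinuousOn.mul (by fun_prop) (ContinuousOn.mul (ContinuousOn.pow ?_ n) h1.continuousOn)
  exact ContinuousOn.inv₀ (by fun_prop) fun r hr => (Real.sqrt_pos.2 hr).ne'

lemma continuous_hq (hg : Hol α M g) (hK : EG K) (r : ℝ) :
    Continuous (fun p : ℝ × (Fin d → ℝ) => hq l n K g r p.1 p.2) := by
  unfold hq
  have h1 : Continuous fun p : ℝ × (Fin d → ℝ) => gav K (g (p.1 - r)) (√r) p.2 :=
    continuous_gav (g := fun p : ℝ × (Fin d → ℝ) => g (p.1 - r)) hK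
      (hg.cont.comp (by fun_prop :
        Continuous fun p : (ℝ × (Fin d → ℝ)) × (Fin d → ℝ) => (p.1.1 - r, p.2)))
      (fun r => hg.bdd _) continuous_const continuous_snd
  exact continuous_const.mul (continuous_const.mul h1)

lemma continuous_slice {g : ℝ → (Fin d → ℝ) → ℝ}
    (hg : Continuous fun p : ℝ × (Fin d → ℝ) => g p.1 p.2) (t : ℝ) : Continuous (g t) :=
  hg.comp (Continuous.prodMk_right t)

lemma hasFDerivAt_hq {K : (Fin d → ℝ) → ℝ} {K' : Fin d → (Fin d → ℝ) → ℝ} {r t : ℝ}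
    (h : ∀ x, HasFDerivAt (gav K (g (t - r)) (√r))
      (grad fun k => (√r)⁻¹ * gav (K' k) (g (t - r)) (√r) x) x) (x : Fin d → ℝ) :
    HasFDerivAt (hq l n K g r t) (grad fun k => hq l (n + 1) (K' k) g r t x) x := by
  refine (((h x).const_mul _).const_mul _).congr_fderiv ?_
  rw [← grad_smul, ← grad_smul]; congr 1; funext k; rw [hq, pow_succ]; ring

/-- The heat potential with its derivatives. -/
def heatJet (l : ℝ) (g : ℝ → (Fin d → ℝ) → ℝ) : Jet d where
  u t x := ∫ r in Ioi 0, hq l 0 (fun _ => 1) g r t x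
  ux i t x := ∫ r in Ioi 0, hq l 1 (w1 i) g r t x
  uxx i j t x := ∫ r in Ioi 0, hq l 2 (w2 i j) g r t x
  ut t x := (1 / 2) * ∑ i, (∫ r in Ioi 0, hq l 2 (w2 i i) g r t x)
    - l * (∫ r in Ioi 0, hq l 0 (fun _ => 1) g r t x) + g t x

lemma heatJet_res (l : ℝ) (g : ℝ → (Fin d → ℝ) → ℝ) (t : ℝ) (x : Fin d → ℝ) :
    (heatJet l g).res (fun i j _ _ => kr i j) l t x = g t x := by
  simp [Jet.res, heatJet, kr]
  ring

lemma EG_w1 (i : Fin d) : EG (w1 i) := EG.coord i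

variable (hα : 0 < α) (hα1 : α ≤ 1 / 2) (hl : 0 < l) (hg : Hol α M g)
include hα hα1 hl hg

lemma abs_hq2_le (i j : Fin d) (r : ℝ) (hr : 0 < r) (t : ℝ) (x : Fin d → ℝ) :
    |hq l 2 (w2 i j) g r t x| ≤ M * gcst (w2 i j) * kern l (α / 2) r := by
  have := abs_hq_le_of_mean_zero (l := l) (n := 2) hα.le (by linarith) hg (EG_w2 i j)
    (integral_w2 i j) hr t x
  convert this using 2
  push_cast; congr 1; ring

lemma hasFDerivAt_heat_u (t : ℝ) (x : Fin d → ℝ) : HasFDerivAt ((heatJet l g).u t)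
    (grad fun i => (heatJet l g).ux i t x) x := by
  have hintg : ∀ x, IntegrableOn (fun r => hq l 0 (fun _ => 1) g r t x) (Ioi 0) := fun x =>
    integrableOn_of_kern hl (θ := 1 - (0 : ℕ) / 2) (by simp)
      (fun r hr => abs_hq_le hg (EG.const 1) hr t x) (continuousOn_hq hg (EG.const 1) t x)
  refine hasFDerivAt_integral_kern (B := M * ∑ i : Fin d, gcst (w1 i)) (θ := 1 - (1 : ℕ) / 2)
    (q := fun r => hq l 0 (fun _ => 1) g r t)
    (q' := fun i r x => hq l 1 (w1 i) g r t x) hl (by norm_num)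
    (fun x => continuousOn_hq hg (EG.const 1) t x) hintg (fun i r hr x => ?_)
    (fun i x => continuousOn_hq hg (EG_w1 i) t x) (fun r hr y => ?_) x
  · refine (abs_hq_le hg (EG_w1 i) hr t x).trans ?_
    have := hg.nonneg
    have h2 := Finset.single_le_sum (f := fun i : Fin d => gcst (w1 i))
      (fun i _ => gcst_nonneg _) (Finset.mem_univ i)
    have h3 := kern_nonneg (l := l) (θ := 1 - (1 : ℕ) / 2) hr
    gcongr
  · exact hasFDerivAt_hq (fun x => hasFDerivAt_gav (continuous_slice hg.cont _) (hg.bdd _)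
      (Real.sqrt_pos.2 hr) x) y

lemma hasFDerivAt_heat_ux (i : Fin d) (t : ℝ) (x : Fin d → ℝ) :
    HasFDerivAt ((heatJet l g).ux i t) (grad fun j => (heatJet l g).uxx i j t x) x := by
  have hintg : ∀ x, IntegrableOn (fun r => hq l 1 (w1 i) g r t x) (Ioi 0) := fun x =>
    integrableOn_of_kern hl (θ := 1 - (1 : ℕ) / 2) (by norm_num)
      (fun r hr => abs_hq_le hg (EG_w1 i) hr t x) (continuousOn_hq hg (EG_w1 i) t x)
  refine hasFDerivAt_integral_kern (B := M * ∑ j : Fin d, gcst (w2 i j)) (θ := α / 2)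
    (q := fun r => hq l 1 (w1 i) g r t)
    (q' := fun j r x => hq l 2 (w2 i j) g r t x) hl (by positivity)
    (fun x => continuousOn_hq hg (EG_w1 i) t x) hintg (fun j r hr x => ?_)
    (fun j x => continuousOn_hq hg (EG_w2 i j) t x) (fun r hr y => ?_) x
  · refine (abs_hq2_le hα hα1 hl hg i j r hr t x).trans ?_
    have := hg.nonneg
    have h2 := Finset.single_le_sum (f := fun j : Fin d => gcst (w2 i j))
      (fun i _ => gcst_nonneg _) (Finset.mem_univ j)
    have h3 := kern_nonneg (l := l) (θ := α / 2) hr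
    gcongr
  · exact hasFDerivAt_hq (fun x => hasFDerivAt_gav_w1 (continuous_slice hg.cont _) (hg.bdd _)
      (Real.sqrt_pos.2 hr) i x) y

lemma Hol_heat_u : Hol α (M * gcst (fun _ : Fin d → ℝ => 1) * kint l 1) (heatJet l g).u := by
  have e : (1 - (0 : ℕ) / 2 : ℝ) = 1 := by norm_num
  have hi : ∀ t x, IntegrableOn (fun r => hq l 0 (fun _ => 1) g r t x) (Ioi 0) := fun t x =>
    integrableOn_of_kern hl (θ := 1 - (0 : ℕ) / 2) (by simp)
      (fun r hr => abs_hq_le hg (EG.const 1) hr t x) (continuousOn_hq hg (EG.const 1) t x)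
  refine ⟨?_, fun t x => ?_, fun t x y => ?_⟩
  · exact continuous_integral_kern hl (θ := 1 - (0 : ℕ) / 2) (by simp)
      (q := fun r (p : ℝ × (Fin d → ℝ)) => hq l 0 (fun _ => 1) g r p.1 p.2)
      (fun r hr p => abs_hq_le hg (EG.const 1) hr p.1 p.2)
      (fun p => continuousOn_hq hg (EG.const 1) p.1 p.2)
      (fun r _ => continuous_hq hg (EG.const 1) r)
  · have := abs_integral_le_kint hl (θ := 1 - (0 : ℕ) / 2) (by simp)
      (fun r hr => abs_hq_le hg (EG.const 1) hr t x)
    rwa [e] at this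
  · have := abs_integral_le_kint hl (θ := 1 - (0 : ℕ) / 2) (by simp)
      (fun r hr => abs_hq_sub_le hg (EG.const 1) hr t x y)
    rw [e, integral_sub (hi t x) (hi t y)] at this
    exact this.trans (le_of_eq (by ring))

lemma Hol_heat_ux (i : Fin d) : Hol α (M * gcst (w1 i) * kint l (1 / 2)) ((heatJet l g).ux i) := by
  have e : (1 - (1 : ℕ) / 2 : ℝ) = 1 / 2 := by norm_num
  have hi : ∀ t x, IntegrableOn (fun r => hq l 1 (w1 i) g r t x) (Ioi 0) := fun t x =>
    integrableOn_of_kern hl (θ := 1 - (1 : ℕ) / 2) (by norm_num)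
      (fun r hr => abs_hq_le hg (EG_w1 i) hr t x) (continuousOn_hq hg (EG_w1 i) t x)
  refine ⟨?_, fun t x => ?_, fun t x y => ?_⟩
  · exact continuous_integral_kern hl (θ := 1 - (1 : ℕ) / 2) (by norm_num)
      (q := fun r (p : ℝ × (Fin d → ℝ)) => hq l 1 (w1 i) g r p.1 p.2)
      (fun r hr p => abs_hq_le hg (EG_w1 i) hr p.1 p.2)
      (fun p => continuousOn_hq hg (EG_w1 i) p.1 p.2)
      (fun r _ => continuous_hq hg (EG_w1 i) r)
  · have := abs_integral_le_kint hl (θ := 1 - (1 : ℕ) / 2) (by norm_num)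
      (fun r hr => abs_hq_le hg (EG_w1 i) hr t x)
    rwa [e] at this
  · have := abs_integral_le_kint hl (θ := 1 - (1 : ℕ) / 2) (by norm_num)
      (fun r hr => abs_hq_sub_le hg (EG_w1 i) hr t x y)
    rw [e, integral_sub (hi t x) (hi t y)] at this
    exact this.trans (le_of_eq (by ring))

lemma abs_heat_uxx_le (i j : Fin d) (t : ℝ) (x : Fin d → ℝ) :
    |(heatJet l g).uxx i j t x| ≤ M * gcst (w2 i j) * kint l (α / 2) :=
  abs_integral_le_kint hl (by positivity) (fun r hr => abs_hq2_le hα hα1 hl hg i j r hr t x)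

lemma continuous_heat_uxx (i j : Fin d) :
    Continuous fun p : ℝ × (Fin d → ℝ) => (heatJet l g).uxx i j p.1 p.2 :=
  continuous_integral_kern hl (θ := α / 2) (by positivity)
    (q := fun r (p : ℝ × (Fin d → ℝ)) => hq l 2 (w2 i j) g r p.1 p.2)
    (fun r hr p => abs_hq2_le hα hα1 hl hg i j r hr p.1 p.2)
    (fun p => continuousOn_hq hg (EG_w2 i j) p.1 p.2)
    (fun r _ => continuous_hq hg (EG_w2 i j) r)

/-- Lipschitz bound for the second derivatives of the heat semigroup. -/
lemma abs_hq2_sub_le (i j : Fin d) {r : ℝ} (hr : 0 < r) (t : ℝ) (x y : Fin d → ℝ) :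
    |hq l 2 (w2 i j) g r t x - hq l 2 (w2 i j) g r t y| ≤
      d * (M * ∑ k, gcst (w3 i j k)) * ‖x - y‖ * r ^ ((α - 1) / 2 - 1) := by
  have hd : ∀ z ∈ (Set.univ : Set (Fin d → ℝ)), HasFDerivWithinAt (hq l 2 (w2 i j) g r t)
      (grad fun k => hq l 3 (w3 i j k) g r t z) Set.univ z := fun z _ =>
    (hasFDerivAt_hq (fun x => hasFDerivAt_gav_w2 (continuous_slice hg.cont _) (hg.bdd _)
      (Real.sqrt_pos.2 hr) i j x) z).hasFDerivWithinAt
  have hb : ∀ z ∈ (Set.univ : Set (Fin d → ℝ)), ‖grad fun k => hq l 3 (w3 i j k) g r t z‖ ≤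
      d * (M * (∑ k, gcst (w3 i j k)) * r ^ ((α - 1) / 2 - 1)) := by
    intro z _
    refine norm_grad_le _ fun k => ?_
    have h1 := abs_hq_le_of_mean_zero (l := l) (n := 3) hα.le (by linarith) hg (EG_w3 i j k)
      (integral_w3 i j k) hr t z
    refine h1.trans ?_
    have h2 := Finset.single_le_sum (f := fun k : Fin d => gcst (w3 i j k))
      (fun i _ => gcst_nonneg _) (Finset.mem_univ k)
    have h0 := hg.nonneg
    have h4 : kern l (1 + α / 2 - (3 : ℕ) / 2) r ≤ r ^ ((α - 1) / 2 - 1) := by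
      rw [kern, show (1 + α / 2 - (3 : ℕ) / 2 - 1 : ℝ) = (α - 1) / 2 - 1 by push_cast; ring]
      refine mul_le_of_le_one_right (Real.rpow_nonneg hr.le _) (Real.exp_le_one_iff.2 ?_)
      have := mul_pos hl hr; linarith
    have h5 := gcst_nonneg (w3 i j k)
    have h6 := kern_nonneg (l := l) (θ := 1 + α / 2 - (3 : ℕ) / 2) hr
    have h7 : 0 ≤ M * ∑ k, gcst (w3 i j k) :=
      mul_nonneg h0 (Finset.sum_nonneg fun k _ => gcst_nonneg _)
    gcongr
  have := convex_univ.norm_image_sub_le_of_norm_hasFDerivWithin_le hd hb (mem_univ y) (mem_univ x)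
  rw [Real.norm_eq_abs] at this
  exact this.trans (le_of_eq (by ring))

lemma heat_uxx_hol (i j : Fin d) (t : ℝ) (x y : Fin d → ℝ) :
    |(heatJet l g).uxx i j t x - (heatJet l g).uxx i j t y| ≤
      (4 / α * gcst (w2 i j) + 4 * (d * ∑ k, gcst (w3 i j k))) * M * ‖x - y‖ ^ α := by
  have hM := hg.nonneg
  rcases eq_or_ne x y with rfl | hxy
  · simp [Real.zero_rpow hα.ne']
  set h := ‖x - y‖ with hh
  have h0 : 0 < h := norm_pos_iff.2 (sub_ne_zero.2 hxy)
  have hi : ∀ x, IntegrableOn (fun r => hq l 2 (w2 i j) g r t x) (Ioi 0) := fun x =>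
    integrableOn_of_kern hl (θ := α / 2) (by positivity)
      (fun r hr => abs_hq2_le hα hα1 hl hg i j r hr t x) (continuousOn_hq hg (EG_w2 i j) t x)
  have hi2 : IntegrableOn (fun r => hq l 2 (w2 i j) g r t x - hq l 2 (w2 i j) g r t y) (Ioi 0) :=
    (hi x).sub (hi y)
  have e1 : (heatJet l g).uxx i j t x - (heatJet l g).uxx i j t y
      = (∫ r in Ioc 0 (h ^ 2), (hq l 2 (w2 i j) g r t x - hq l 2 (w2 i j) g r t y))
      + ∫ r in Ioi (h ^ 2), (hq l 2 (w2 i j) g r t x - hq l 2 (w2 i j) g r t y) := by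
    simp only [heatJet]
    rw [← integral_sub (hi x) (hi y), ← setIntegral_union (Ioc_disjoint_Ioi le_rfl)
      measurableSet_Ioi (hi2.mono_set Ioc_subset_Ioi_self)
      (hi2.mono_set (Ioi_subset_Ioi (by positivity))), Ioc_union_Ioi_eq_Ioi (by positivity)]
  have b1 : |∫ r in Ioc 0 (h ^ 2), (hq l 2 (w2 i j) g r t x - hq l 2 (w2 i j) g r t y)|
      ≤ 4 / α * gcst (w2 i j) * M * h ^ α := by
    have hintg : IntervalIntegrable (fun r : ℝ => r ^ (α / 2 - 1)) volume 0 (h ^ 2) :=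
      intervalIntegral.intervalIntegrable_rpow' (by linarith)
    have hint2 := (intervalIntegrable_iff_integrableOn_Ioc_of_le (by positivity)).1 hintg
    have h2 : ∫ r in Ioc 0 (h ^ 2), (2 * (M * gcst (w2 i j))) * r ^ (α / 2 - 1)
        = 4 / α * gcst (w2 i j) * M * h ^ α := by
      rw [integral_const_mul, ← intervalIntegral.integral_of_le (by positivity),
        integral_rpow (Or.inl (by linarith)), sub_add_cancel, Real.zero_rpow (by positivity),
        ← Real.rpow_natCast, ← Real.rpow_mul h0.le]
      rw [show ((2 : ℕ) : ℝ) * (α / 2) = α by push_cast; ring]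
      field_simp; ring
    rw [← h2, ← Real.norm_eq_abs]
    refine norm_integral_le_of_norm_le (hint2.const_mul _)
      ((ae_restrict_iff' measurableSet_Ioc).2 (Eventually.of_forall fun r hr => ?_))
    have hk : kern l (α / 2) r ≤ r ^ (α / 2 - 1) := by
      refine mul_le_of_le_one_right (Real.rpow_nonneg hr.1.le _) (Real.exp_le_one_iff.2 ?_)
      have := mul_pos hl hr.1; linarith
    have hB : 0 ≤ M * gcst (w2 i j) := mul_nonneg hM (gcst_nonneg _)
    have a1 := abs_hq2_le hα hα1 hl hg i j r hr.1 t x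
    have a2 := abs_hq2_le hα hα1 hl hg i j r hr.1 t y
    have a3 := abs_sub (hq l 2 (w2 i j) g r t x) (hq l 2 (w2 i j) g r t y)
    have a4 := mul_le_mul_of_nonneg_left hk hB
    rw [Real.norm_eq_abs]; linarith
  have b2 : |∫ r in Ioi (h ^ 2), (hq l 2 (w2 i j) g r t x - hq l 2 (w2 i j) g r t y)|
      ≤ 4 * (d * ∑ k, gcst (w3 i j k)) * M * h ^ α := by
    have hlt : (α - 1) / 2 - 1 < -1 := by linarith
    have hS : 0 ≤ ∑ k, gcst (w3 i j k) := Finset.sum_nonneg fun k _ => gcst_nonneg _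
    have h2 : ∫ r in Ioi (h ^ 2), (d * (M * ∑ k, gcst (w3 i j k)) * h) * r ^ ((α - 1) / 2 - 1)
        ≤ 4 * (d * ∑ k, gcst (w3 i j k)) * M * h ^ α := by
      rw [integral_const_mul, integral_Ioi_rpow_of_lt hlt (by positivity), sub_add_cancel,
        ← Real.rpow_natCast, ← Real.rpow_mul h0.le,
        show ((2 : ℕ) : ℝ) * ((α - 1) / 2) = α - 1 by push_cast; ring, Real.rpow_sub_one h0.ne']
      have h3 : (d * (M * ∑ k, gcst (w3 i j k)) * h) * (-(h ^ α / h) / ((α - 1) / 2))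
          = (d * (M * ∑ k, gcst (w3 i j k)) * h ^ α) * (2 / (1 - α)) := by
        have : 1 - α ≠ 0 := by linarith
        have : α - 1 ≠ 0 := by linarith
        field_simp; ring
      rw [h3]
      have h4 : 2 / (1 - α) ≤ 4 := by rw [div_le_iff₀ (by linarith)]; linarith
      calc _ ≤ (d * (M * ∑ k, gcst (w3 i j k)) * h ^ α) * 4 := by gcongr
        _ = _ := by ring
    refine le_trans ?_ h2
    rw [← Real.norm_eq_abs]
    refine norm_integral_le_of_norm_le ((integrableOn_Ioi_rpow_of_lt hlt (by positivity)).const_mul _)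
      ((ae_restrict_iff' measurableSet_Ioi).2 (Eventually.of_forall fun r hr => ?_))
    exact abs_hq2_sub_le hα hα1 hl hg i j (lt_trans (by positivity) hr) t x y
  rw [e1]
  refine (abs_add_le _ _).trans ((add_le_add b1 b2).trans (le_of_eq (by ring)))

end hq

end TVP

namespace TVP

open MeasureTheory ProbabilityTheory

/-! ### The time derivative of the heat potential -/

/-- A function with a continuous right derivative is differentiable. -/
lemma hasDerivAt_of_right {f f' : ℝ → ℝ} (hc : Continuous f) (hc' : Continuous f')
    (h : ∀ t, HasDerivWithinAt f (f' t) (Ici t) t) (t : ℝ) : HasDerivAt f (f' t) t := by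
  have hP : ∀ s, HasDerivAt (fun s => ∫ r in (t - 1)..s, f' r) (f' s) s := fun s =>
    intervalIntegral.integral_hasDerivAt_right (hc'.intervalIntegrable _ _)
      (hc'.stronglyMeasurableAtFilter _ _) hc'.continuousAt
  have hPc : Continuous fun s => ∫ r in (t - 1)..s, f' r :=
    continuous_iff_continuousAt.2 fun s => (hP s).continuousAt
  have key : ∀ s ∈ Icc (t - 1) (t + 1), f s - (∫ r in (t - 1)..s, f' r)
      = f (t - 1) - ∫ r in (t - 1)..(t - 1), f' r := by
    refine constant_of_has_deriv_right_zero (f := fun s => f s - ∫ r in (t - 1)..s, f' r)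
      (hc.sub hPc).continuousOn fun s _ => ?_
    have := (h s).sub (hP s).hasDerivWithinAt
    rwa [sub_self] at this
  have h2 : HasDerivAt (fun s => f (t - 1) + ∫ r in (t - 1)..s, f' r) (f' t) t :=
    (hP t).const_add _
  refine h2.congr_of_eventuallyEq ?_
  filter_upwards [Icc_mem_nhds (show t - 1 < t by linarith) (show t < t + 1 by linarith)] with s hs
  have := key s hs
  simp only [intervalIntegral.integral_same] at this
  linarith

variable {d : ℕ}

/-- Second order Taylor expansion with Hölder continuous second derivatives. -/
lemma taylor_two {α H : ℝ} (hα : 0 ≤ α) {f : (Fin d → ℝ) → ℝ} {fx : Fin d → (Fin d → ℝ) → ℝ}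
    {fxx : Fin d → Fin d → (Fin d → ℝ) → ℝ} (h1 : ∀ x, HasFDerivAt f (grad fun i => fx i x) x)
    (h2 : ∀ i x, HasFDerivAt (fx i) (grad fun j => fxx i j x) x)
    (hh : ∀ i j x y, |fxx i j x - fxx i j y| ≤ H * ‖x - y‖ ^ α) (hH : 0 ≤ H) (x v : Fin d → ℝ) :
    |f (x + v) - (f x + ∑ i, fx i x * v i + (1 / 2) * ∑ i, ∑ j, fxx i j x * v j * v i)| ≤
      d * d * H * (‖v‖ ^ α * ‖v‖ ^ 2) := by
  have hline : ∀ s : ℝ, HasDerivAt (fun s : ℝ => x + s • v) v s := fun s => by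
    simpa using ((hasDerivAt_id s).smul_const v).const_add x
  set D : ℝ := d * d * H * (‖v‖ ^ α * ‖v‖ ^ 2) with hD
  have hD0 : 0 ≤ D := by positivity
  set ψ : ℝ → ℝ := fun s => ∑ i, (fx i (x + s • v) - (fx i x + s * ∑ j, fxx i j x * v j)) * v i
    with hψ
  have hψd : ∀ s, HasDerivAt ψ (∑ i, (∑ j, (fxx i j (x + s • v) - fxx i j x) * v j) * v i) s := by
    intro s
    refine HasDerivAt.fun_sum fun i _ => ?_
    have e1 := (h2 i (x + s • v)).comp_hasDerivAt s (hline s)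
    have e2 := ((hasDerivAt_id s).mul_const (∑ j, fxx i j x * v j)).const_add (fx i x)
    refine ((e1.sub e2).mul_const (v i)).congr_deriv ?_
    simp only [grad_apply, sub_mul, Finset.sum_sub_distrib]; simp
  have hψb : ∀ s ∈ Icc (0 : ℝ) 1, |ψ s| ≤ D := by
    intro s hs
    have := norm_image_sub_le_of_norm_deriv_le_segment' (f := ψ) (a := 0) (b := 1) (C := D)
      (fun s _ => (hψd s).hasDerivWithinAt) (fun s hs => ?_) s hs
    · have h0 : ψ 0 = 0 := by simp [hψ]
      rw [h0, sub_zero, Real.norm_eq_abs] at this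
      refine this.trans ?_
      have : s - 0 ≤ 1 := by linarith [hs.2]
      nlinarith
    · refine (norm_sum_le _ _).trans ?_
      have hb : ∀ i, ‖(∑ j, (fxx i j (x + s • v) - fxx i j x) * v j) * v i‖
          ≤ d * (H * (‖v‖ ^ α * ‖v‖ ^ 2)) := by
        intro i
        rw [norm_mul]
        have e1 : ‖∑ j, (fxx i j (x + s • v) - fxx i j x) * v j‖ ≤ d * (H * ‖v‖ ^ α * ‖v‖) := by
          refine (norm_sum_le _ _).trans ?_
          have : ∀ j ∈ Finset.univ, ‖(fxx i j (x + s • v) - fxx i j x) * v j‖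
              ≤ H * ‖v‖ ^ α * ‖v‖ := fun j _ => by
            rw [norm_mul]
            have e2 := hh i j (x + s • v) x
            have e3 : ‖x + s • v - x‖ ≤ ‖v‖ := by
              rw [add_sub_cancel_left, norm_smul, Real.norm_eq_abs, abs_of_nonneg hs.1]
              have := hs.2; have := norm_nonneg v; nlinarith
            have e4 : ‖x + s • v - x‖ ^ α ≤ ‖v‖ ^ α := by gcongr
            refine mul_le_mul (e2.trans ?_) (norm_le_pi_norm v j) (norm_nonneg _) (by positivity)
            gcongr
          refine (Finset.sum_le_sum this).trans (le_of_eq ?_)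
          simp
        calc _ ≤ d * (H * ‖v‖ ^ α * ‖v‖) * ‖v‖ :=
              mul_le_mul e1 (norm_le_pi_norm v i) (norm_nonneg _) (by positivity)
          _ = _ := by ring
      refine (Finset.sum_le_sum fun i _ => hb i).trans (le_of_eq ?_)
      simp [hD]; ring
  have hφd : ∀ s, HasDerivAt (fun s : ℝ => f (x + s • v) - (f x + s * (∑ i, fx i x * v i)
      + (s ^ 2 / 2) * ∑ i, ∑ j, fxx i j x * v j * v i)) (ψ s) s := by
    intro s
    have e1 := (h1 (x + s • v)).comp_hasDerivAt s (hline s)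
    have e2 := (((hasDerivAt_id s).mul_const (∑ i, fx i x * v i)).const_add (f x)).add
      (((hasDerivAt_pow 2 s).div_const 2).mul_const (∑ i, ∑ j, fxx i j x * v j * v i))
    refine (e1.sub e2).congr_deriv ?_
    simp only [grad_apply, hψ, sub_mul, add_mul, Finset.sum_sub_distrib, Finset.sum_add_distrib,
      mul_assoc s, ← Finset.mul_sum, Finset.sum_mul]
    simp
  have := norm_image_sub_le_of_norm_deriv_le_segment' (a := 0) (b := 1) (C := D)
      (fun s _ => (hφd s).hasDerivWithinAt) (fun s hs => hψb s ⟨hs.1, hs.2.le⟩) 1 (by simp)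
  simp only [one_smul, zero_smul, add_zero, Real.norm_eq_abs] at this
  convert this using 1 <;> simp [hD]

lemma gav_taylor {α H B : ℝ} (hα : 0 ≤ α) (hα1 : α ≤ 1) {f : (Fin d → ℝ) → ℝ}
    {fx : Fin d → (Fin d → ℝ) → ℝ} {fxx : Fin d → Fin d → (Fin d → ℝ) → ℝ}
    (h1 : ∀ x, HasFDerivAt f (grad fun i => fx i x) x)
    (h2 : ∀ i x, HasFDerivAt (fx i) (grad fun j => fxx i j x) x) (hB : ∀ x, |f x| ≤ B)
    (hh : ∀ i j x y, |fxx i j x - fxx i j y| ≤ H * ‖x - y‖ ^ α) (hH : 0 ≤ H) (x : Fin d → ℝ)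
    {s : ℝ} (hs : 0 ≤ s) :
    |gav (fun _ => 1) f s x - f x - s ^ 2 * ((1 / 2) * ∑ i, fxx i i x)| ≤
      d * d * H * (s ^ α * s ^ 2) * gcst (fun z : Fin d → ℝ => (1 + ‖z‖) * (1 + ‖z‖)) := by
  have hc : Continuous f := continuous_iff_continuousAt.2 fun x => (h1 x).continuousAt
  have i0 : Integrable (fun z => f (x + s • z) * 1) (gam d) := integrable_gav (EG.const 1) hc hB s x
  have i1 : ∀ i, Integrable (fun z : Fin d → ℝ => fx i x * (s * z i)) (gam d) := fun i =>
    (((EG.coord i).const_mul s).const_mul (fx i x)).integrable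
  have i2 : ∀ i j, Integrable (fun z : Fin d → ℝ => (fxx i j x * s ^ 2) * (z j * z i)) (gam d) :=
    fun i j => (((EG.coord j).mul (EG.coord i)).const_mul _).integrable
  have e : gav (fun _ => 1) f s x - f x - s ^ 2 * ((1 / 2) * ∑ i, fxx i i x)
      = ∫ z, (f (x + s • z) * 1 - (f x + ∑ i, fx i x * (s * z i)
        + (1 / 2) * ∑ i, ∑ j, (fxx i j x * s ^ 2) * (z j * z i))) ∂gam d := by
    have j1 := integrable_finsetSum Finset.univ fun i _ => i1 i
    have j2 := integrable_finsetSum Finset.univ fun i _ =>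
      integrable_finsetSum Finset.univ fun j _ => i2 i j
    have j3 : Integrable (fun z : Fin d → ℝ => f x + ∑ i, fx i x * (s * z i)) (gam d) :=
      (integrable_const _).add j1
    have j4 : Integrable (fun z : Fin d → ℝ => f x + ∑ i, fx i x * (s * z i)
        + (1 / 2) * ∑ i, ∑ j, (fxx i j x * s ^ 2) * (z j * z i)) (gam d) := j3.add (j2.const_mul _)
    rw [integral_sub i0 j4, integral_add j3 (j2.const_mul _),
      integral_add (integrable_const _) j1, integral_finsetSum _ fun i _ => i1 i,
      integral_const_mul, integral_finsetSum _ fun i _ =>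
      integrable_finsetSum Finset.univ fun j _ => i2 i j]
    have k1 : ∀ i : Fin d, ∫ z, fx i x * (s * z i) ∂gam d = 0 := fun i => by
      rw [integral_const_mul, integral_const_mul, integral_w1]; simp
    have k2 : ∀ i : Fin d, ∫ z, ∑ j, (fxx i j x * s ^ 2) * (z j * z i) ∂gam d = fxx i i x * s ^ 2 := by
      intro i
      rw [integral_finsetSum _ fun j _ => i2 i j]
      simp_rw [integral_const_mul, integral_coord_mul]
      simp [kr]
    simp only [k1, k2, gav, integral_const, probReal_univ, smul_eq_mul, one_mul,
      Finset.sum_const_zero, ← Finset.sum_mul]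
    ring
  rw [e]
  refine abs_integral_le_gcst ((EG.const 1 |>.add EG.norm_coord).mul
    (EG.const 1 |>.add EG.norm_coord)) fun z => ?_
  have := taylor_two hα h1 h2 hh hH x (s • z)
  simp only [Pi.smul_apply, smul_eq_mul, norm_smul, Real.norm_eq_abs, abs_of_nonneg hs] at this
  have e3 : ∑ i, ∑ j, fxx i j x * s ^ 2 * (z j * z i) = ∑ i, ∑ j, fxx i j x * (s * z j) * (s * z i) :=
    Finset.sum_congr rfl fun i _ => Finset.sum_congr rfl fun j _ => by ring
  rw [mul_one, e3]
  refine this.trans ?_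
  rw [Real.mul_rpow hs (norm_nonneg z), mul_pow, abs_of_nonneg (by positivity)]
  have h3 := rpow_le_one_add hα hα1 (norm_nonneg z)
  have h4 : ‖z‖ ^ α * ‖z‖ ^ 2 ≤ (1 + ‖z‖) * ((1 + ‖z‖) * (1 + ‖z‖)) := by
    rw [pow_two]
    have := norm_nonneg z
    gcongr <;> linarith
  calc _ = d * d * H * (s ^ α * s ^ 2) * (‖z‖ ^ α * ‖z‖ ^ 2) := by ring
    _ ≤ _ := by gcongr

variable {l α M : ℝ} {g : ℝ → (Fin d → ℝ) → ℝ}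

lemma continuous_hq_zero (hg : Hol α M g) :
    Continuous fun p : ℝ × ℝ × (Fin d → ℝ) => hq l 0 (fun _ => 1) g p.1 p.2.1 p.2.2 := by
  unfold hq
  have h1 : Continuous fun p : ℝ × ℝ × (Fin d → ℝ) =>
      gav (fun _ => 1) (g (p.2.1 - p.1)) (√p.1) p.2.2 :=
    continuous_gav (g := fun p : ℝ × ℝ × (Fin d → ℝ) => g (p.2.1 - p.1)) (EG.const 1)
      (hg.cont.comp (by fun_prop :
        Continuous fun p : (ℝ × ℝ × (Fin d → ℝ)) × (Fin d → ℝ) => (p.1.2.1 - p.1.1, p.2)))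
      (fun r => hg.bdd _) (by fun_prop) (by fun_prop)
  simp only [pow_zero, one_mul]
  exact Continuous.mul (by fun_prop) h1

lemma integrableOn_hq_zero (hl : 0 < l) (hg : Hol α M g) (t : ℝ) (x : Fin d → ℝ) :
    IntegrableOn (fun r => hq l 0 (fun _ => 1) g r t x) (Ioi 0) :=
  integrableOn_of_kern hl (θ := 1 - (0 : ℕ) / 2) (by simp)
    (fun r hr => abs_hq_le hg (EG.const 1) hr t x) (continuousOn_hq hg (EG.const 1) t x)

lemma heat_semigroup (hl : 0 < l) (hg : Hol α M g) (t : ℝ) (x : Fin d → ℝ) {ε : ℝ} (hε : 0 ≤ ε) :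
    Real.exp (-(l * ε)) * gav (fun _ => 1) ((heatJet l g).u t) (√ε) x =
      ∫ r in Ioi ε, hq l 0 (fun _ => 1) g r (t + ε) x := by
  have hF : Continuous fun p : (Fin d → ℝ) × ℝ => hq l 0 (fun _ => 1) g p.2 t (x + √ε • p.1) :=
    (continuous_hq_zero hg).comp (by fun_prop :
      Continuous fun p : (Fin d → ℝ) × ℝ => (p.2, t, x + √ε • p.1))
  have hintg : Integrable (fun p : (Fin d → ℝ) × ℝ => hq l 0 (fun _ => 1) g p.2 t (x + √ε • p.1))
      ((gam d).prod (volume.restrict (Ioi 0))) := by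
    have hk := ((integrableOn_kern (l := l) (θ := 1 - (0 : ℕ) / 2) hl (by simp)).const_mul
      (M * gcst (fun _ : Fin d → ℝ => 1)))
    have hk2 := hk.comp_snd (gam d)
    refine hk2.mono' hF.aestronglyMeasurable ?_
    have : ∀ᵐ p : (Fin d → ℝ) × ℝ ∂((gam d).prod (volume.restrict (Ioi 0))), p.2 ∈ Ioi (0 : ℝ) :=
      Measure.quasiMeasurePreserving_snd.ae (ae_restrict_mem measurableSet_Ioi)
    filter_upwards [this] with p hp
    exact abs_hq_le hg (EG.const 1) hp t _
  have e1 : gav (fun _ => 1) ((heatJet l g).u t) (√ε) x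
      = ∫ r in Ioi 0, ∫ z, hq l 0 (fun _ => 1) g r t (x + √ε • z) ∂gam d := by
    simp only [gav, heatJet, mul_one]
    exact integral_integral_swap hintg
  rw [e1, ← integral_const_mul]
  have e2 : ∫ r in Ioi ε, hq l 0 (fun _ => 1) g r (t + ε) x
      = ∫ r in Ioi 0, hq l 0 (fun _ => 1) g (r + ε) (t + ε) x := by
    have := (measurePreserving_add_right (volume : Measure ℝ) ε).setIntegral_preimage_emb
      (MeasurableEquiv.addRight ε).measurableEmbedding
      (fun r => hq l 0 (fun _ => 1) g r (t + ε) x) (Ioi ε)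
    rw [← this]; simp
  rw [e2]
  refine setIntegral_congr_fun measurableSet_Ioi fun r hr => ?_
  have hgc := continuous_slice hg.cont (t - r)
  have := gam_semigroup (F := fun y => g (t - r) (x + y)) (by fun_prop) (fun y => hg.bdd _ _)
    (√ε) (√r) (√(r + ε)) (by
      have hr : 0 < r := hr
      rw [Real.sq_sqrt, Real.sq_sqrt, Real.sq_sqrt] <;> linarith)
  simp only [hq, pow_zero, one_mul, gav, mul_one, add_sub_add_right_eq_sub, integral_const_mul]
  rw [← this, ← mul_assoc, ← Real.exp_add]
  simp only [add_assoc]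
  congr 2; ring

lemma hasDerivWithinAt_of_le {G : ℝ → ℝ} {c K θ : ℝ} (hθ : 0 < θ)
    (h : ∀ ε, 0 ≤ ε → |G ε - G 0 - ε * c| ≤ K * (ε ^ θ * ε)) : HasDerivWithinAt G c (Ici 0) 0 := by
  rw [hasDerivWithinAt_iff_isLittleO]
  have h1 : (fun ε : ℝ => G ε - G 0 - (ε - 0) • c) =O[𝓝[≥] 0] fun ε => ε ^ θ * ε := by
    refine Asymptotics.IsBigO.of_bound K ?_
    filter_upwards [self_mem_nhdsWithin] with ε hε
    have hε : 0 ≤ ε := hε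
    rw [sub_zero, smul_eq_mul, Real.norm_eq_abs, Real.norm_of_nonneg (by positivity)]
    exact h ε hε
  refine h1.trans_isLittleO ?_
  have h2 : (fun ε : ℝ => ε ^ θ) =o[𝓝[≥] 0] fun _ => (1 : ℝ) := by
    rw [Asymptotics.isLittleO_one_iff]
    have := (Real.continuous_rpow_const hθ.le).tendsto 0
    rw [Real.zero_rpow hθ.ne'] at this
    exact this.mono_left nhdsWithin_le_nhds
  simpa using h2.mul_isBigO (Asymptotics.isBigO_refl (fun ε : ℝ => ε) _)

lemma hasDerivWithinAt_short_integral {F : ℝ → ℝ → ℝ} (hF : Continuous fun p : ℝ × ℝ => F p.1 p.2) :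
    HasDerivWithinAt (fun ε => ∫ r in Ioc 0 ε, F r ε) (F 0 0) (Ici 0) 0 := by
  rw [hasDerivWithinAt_iff_isLittleO, Asymptotics.isLittleO_iff]
  intro η hη
  obtain ⟨δ, hδ, h⟩ := Metric.continuousAt_iff.1 (hF.continuousAt (x := (0, 0))) η hη
  filter_upwards [self_mem_nhdsWithin, mem_nhdsWithin_of_mem_nhds (Metric.ball_mem_nhds 0 hδ)]
    with ε hε hε2
  have hε : 0 ≤ ε := hε
  rw [Metric.mem_ball, dist_zero_right, Real.norm_of_nonneg hε] at hε2
  have hi : IntegrableOn (fun r => F r ε) (Ioc 0 ε) :=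
    (Continuous.integrableOn_Icc (by fun_prop)).mono_set Ioc_subset_Icc_self
  have e : (∫ r in Ioc 0 ε, F r ε) - (∫ r in Ioc 0 0, F r 0) - (ε - 0) • F 0 0
      = ∫ r in Ioc 0 ε, (F r ε - F 0 0) := by
    rw [integral_sub hi (by simp), setIntegral_const]
    simp [hε]
  rw [e]
  have := norm_setIntegral_le_of_norm_le_const (μ := volume) (s := Ioc 0 ε) (C := η)
    (f := fun r => F r ε - F 0 0) (by simp) (fun r hr => ?_)
  · simpa [hε, abs_of_nonneg hε] using this
  · have := h (x := (r, ε)) (by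
      rw [Prod.dist_eq]; simp only [dist_zero_right, Real.norm_eq_abs]
      rw [abs_of_pos hr.1, abs_of_nonneg hε]
      exact max_lt (hr.2.trans_lt hε2) hε2)
    exact this.le

variable (hα : 0 < α) (hα1 : α ≤ 1 / 2) (hl : 0 < l) (hg : Hol α M g)
include hα hα1 hl hg

lemma heat_right_deriv (t : ℝ) (x : Fin d → ℝ) :
    HasDerivWithinAt (fun s => (heatJet l g).u s x) ((heatJet l g).ut t x) (Ici t) t := by
  set J := heatJet l g with hJ
  have split : ∀ ε, 0 ≤ ε → J.u (t + ε) x = Real.exp (-(l * ε)) * gav (fun _ => 1) (J.u t) (√ε) x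
      + ∫ r in Ioc 0 ε, hq l 0 (fun _ => 1) g r (t + ε) x := by
    intro ε hε
    have hi := integrableOn_hq_zero hl hg (t + ε) x
    rw [hJ, heat_semigroup hl hg t x hε, add_comm (∫ r in Ioi ε, _), ← setIntegral_union (Ioc_disjoint_Ioi le_rfl)
      measurableSet_Ioi (hi.mono_set Ioc_subset_Ioi_self)
      (hi.mono_set (Ioi_subset_Ioi hε)), Ioc_union_Ioi_eq_Ioi hε]
    rfl
  have hU := Hol_heat_u hα hα1 hl hg
  have d1 : HasDerivWithinAt (fun ε => gav (fun _ => 1) (J.u t) (√ε) x)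
      ((1 / 2) * ∑ i, J.uxx i i t x) (Ici 0) 0 := by
    set H : ℝ := ∑ i, ∑ j, (4 / α * gcst (w2 i j) + 4 * (d * ∑ k, gcst (w3 i j k))) * M with hH
    have hH1 : ∀ i j, 0 ≤ (4 / α * gcst (w2 (d := d) i j) + 4 * (d * ∑ k, gcst (w3 i j k))) * M :=
      fun i j => mul_nonneg (add_nonneg (mul_nonneg (by positivity) (gcst_nonneg _))
        (mul_nonneg (by norm_num) (mul_nonneg (by positivity)
          (Finset.sum_nonneg fun k _ => gcst_nonneg _)))) hg.nonneg
    refine hasDerivWithinAt_of_le (θ := α / 2) (by positivity) (K := d * d * H *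
      gcst (fun z : Fin d → ℝ => (1 + ‖z‖) * (1 + ‖z‖))) fun ε hε => ?_
    have := gav_taylor hα.le (by linarith) (hasFDerivAt_heat_u hα hα1 hl hg t)
      (fun i => hasFDerivAt_heat_ux hα hα1 hl hg i t) (hU.bdd t) (H := H) (fun i j x y => ?_)
      (Finset.sum_nonneg fun i _ => Finset.sum_nonneg fun j _ => hH1 i j) x (Real.sqrt_nonneg ε)
    · have e0 : gav (fun _ => 1) (J.u t) (√0) x = J.u t x := by simp [gav]
      rw [e0]
      rw [Real.sq_sqrt hε, Real.sqrt_eq_rpow, ← Real.rpow_mul hε,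
        show (1 / 2 * α : ℝ) = α / 2 by ring] at this
      rw [Real.sqrt_eq_rpow]
      refine this.trans (le_of_eq (by ring))
    · refine (heat_uxx_hol hα hα1 hl hg i j t x y).trans ?_
      refine mul_le_mul_of_nonneg_right ?_ (by positivity)
      exact (Finset.single_le_sum (f := fun j => _) (fun j _ => hH1 i j) (Finset.mem_univ j)).trans
        (Finset.single_le_sum (f := fun i => ∑ j,
          (4 / α * gcst (w2 (d := d) i j) + 4 * (d * ∑ k, gcst (w3 i j k))) * M)
          (fun i _ => Finset.sum_nonneg fun j _ => hH1 i j) (Finset.mem_univ i))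
  have d2 : HasDerivWithinAt (fun ε => ∫ r in Ioc 0 ε, hq l 0 (fun _ => 1) g r (t + ε) x)
      (g t x) (Ici 0) 0 := by
    have := hasDerivWithinAt_short_integral (F := fun r ε => hq l 0 (fun _ => 1) g r (t + ε) x)
      ((continuous_hq_zero hg).comp (by fun_prop : Continuous fun p : ℝ × ℝ => (p.1, t + p.2, x)))
    simpa [hq, gav] using this
  have d0 : HasDerivWithinAt (fun ε : ℝ => Real.exp (-(l * ε))) (-l) (Ici 0) 0 := by
    have : HasDerivAt (fun ε : ℝ => Real.exp (-(l * ε))) (Real.exp (-(l * 0)) * (-(l * 1))) 0 :=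
      (((hasDerivAt_id (0 : ℝ)).const_mul l).neg).exp
    simpa using this.hasDerivWithinAt
  have d3 : HasDerivWithinAt (fun ε => J.u (t + ε) x) (J.ut t x) (Ici 0) 0 := by
    refine (((d0.mul d1).add d2).congr (fun ε hε => split ε hε) (split 0 le_rfl)).congr_deriv ?_
    have e0 : gav (fun _ => 1) (J.u t) (√0) x = J.u t x := by simp [gav]
    rw [e0]
    simp [hJ, heatJet]; ring
  have d4 : HasDerivWithinAt (fun s => s - t) 1 (Ici t) t :=
    ((hasDerivAt_id t).sub_const t).hasDerivWithinAt
  have d5 := HasDerivWithinAt.comp (h₂ := fun ε => J.u (t + ε) x) (h := fun s => s - t)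
    (s' := Ici 0) t (by simpa using d3) d4 (fun s hs => by simpa using hs)
  simpa [Function.comp_def] using d5

lemma Hol_heat_uxx (i j : Fin d) :
    Hol α ((gcst (w2 i j) * kint l (α / 2) + (4 / α * gcst (w2 i j) +
      4 * (d * ∑ k, gcst (w3 i j k)))) * M) ((heatJet l g).uxx i j) := by
  have h0 := mul_nonneg (gcst_nonneg (w2 i j)) (kint_pos hl (half_pos hα)).le
  have h1 : 0 ≤ 4 / α * gcst (w2 i j) + 4 * (d * ∑ k, gcst (w3 i j k)) :=
    add_nonneg (mul_nonneg (by positivity) (gcst_nonneg _))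
        (mul_nonneg (by norm_num) (mul_nonneg (by positivity)
          (Finset.sum_nonneg fun k _ => gcst_nonneg _)))
  have hM := hg.nonneg
  refine ⟨continuous_heat_uxx hα hα1 hl hg i j, fun t x =>
    (abs_heat_uxx_le hα hα1 hl hg i j t x).trans ?_,
    fun t x y => (heat_uxx_hol hα hα1 hl hg i j t x y).trans ?_⟩
  · nlinarith [mul_nonneg h1 hM]
  · refine mul_le_mul_of_nonneg_right ?_ (by positivity)
    nlinarith [mul_nonneg h0 hM]

omit hα hα1 hl hg in
set_option maxHeartbeats 1000000 in
/-- Schauder estimate for the heat potential. -/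
lemma exists_heat_bound (d : ℕ) {α : ℝ} (hα : 0 < α) (hα1 : α ≤ 1 / 2) :
    ∃ C : ℝ, 0 < C ∧ ∀ l : ℝ, 1 ≤ l → ∀ (M : ℝ) (g : ℝ → (Fin d → ℝ) → ℝ), Hol α M g →
      JB α (C * (√l)⁻¹ * M) (C * M) (heatJet l g) ∧
      ∀ i j t x, |(heatJet l g).uxx i j t x| ≤ C * (1 / l) ^ (α / 2) * M := by
  set C₁ : ℝ := ∑ i : Fin d, ∑ j, (gcst (w2 i j) * Real.Gamma (α / 2) + (4 / α * gcst (w2 i j) +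
      4 * (d * ∑ k, gcst (w3 i j k)))) with hC₁
  have hG := (Real.Gamma_pos_of_pos (half_pos hα))
  have hterm : ∀ i j : Fin d, 0 ≤ gcst (w2 i j) * Real.Gamma (α / 2) + (4 / α * gcst (w2 i j) +
      4 * (d * ∑ k, gcst (w3 i j k))) := fun i j =>
    add_nonneg (mul_nonneg (gcst_nonneg _) hG.le) (add_nonneg (mul_nonneg (by positivity)
      (gcst_nonneg _)) (mul_nonneg (by norm_num) (mul_nonneg (by positivity)
      (Finset.sum_nonneg fun k _ => gcst_nonneg _))))
  have hle : ∀ i j : Fin d, gcst (w2 i j) * Real.Gamma (α / 2) + (4 / α * gcst (w2 i j) +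
      4 * (d * ∑ k, gcst (w3 i j k))) ≤ C₁ := fun i j =>
    (Finset.single_le_sum (f := fun j => gcst (w2 i j) * Real.Gamma (α / 2) +
      (4 / α * gcst (w2 i j) + 4 * (d * ∑ k, gcst (w3 i j k)))) (fun j _ => hterm i j)
      (Finset.mem_univ j)).trans
      (Finset.single_le_sum (f := fun i => ∑ j, (gcst (w2 i j) * Real.Gamma (α / 2) +
        (4 / α * gcst (w2 i j) + 4 * (d * ∑ k, gcst (w3 i j k)))))
        (fun i _ => Finset.sum_nonneg fun j _ => hterm i j) (Finset.mem_univ i))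
  have hC₁0 : 0 ≤ C₁ := Finset.sum_nonneg fun i _ => Finset.sum_nonneg fun j _ => hterm i j
  set C₂ : ℝ := gcst (fun _ : Fin d → ℝ => 1) with hC₂
  have hC₂0 : 0 ≤ C₂ := gcst_nonneg _
  set C₃ : ℝ := ∑ i : Fin d, gcst (w1 i) * Real.Gamma (1 / 2) with hC₃
  have hC₃0 : 0 ≤ C₃ := Finset.sum_nonneg fun i _ =>
    mul_nonneg (gcst_nonneg _) (Real.Gamma_pos_of_pos (by norm_num)).le
  refine ⟨C₁ * (1 + d) + 1 + C₂ + C₃, by positivity, fun l hl M g hg => ?_⟩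
  have hl0 : 0 < l := by linarith
  have hM := hg.nonneg
  have hll : (1 / l) ^ (α / 2) ≤ 1 :=
    Real.rpow_le_one (by positivity) (by rw [div_le_one hl0]; exact hl) (by positivity)
  have hx : ∀ i j, Hol α (C₁ * M) ((heatJet l g).uxx i j) := fun i j => by
    refine (Hol_heat_uxx hα hα1 hl0 hg i j).mono (mul_le_mul_of_nonneg_right ?_ hM)
    refine le_trans ?_ (hle i j)
    gcongr
    · exact gcst_nonneg _
    · exact mul_le_of_le_one_left hG.le hll
  have hsq : 1 / l ≤ (√l)⁻¹ := by
    rw [one_div]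
    exact inv_anti₀ (Real.sqrt_pos.2 hl0) (Real.sqrt_le_left (by linarith) |>.2 (by nlinarith))
  have hs0 : 0 < (√l)⁻¹ := inv_pos.2 (Real.sqrt_pos.2 hl0)
  have hk1 : kint l 1 = 1 / l := by simp [kint]
  have hu := Hol_heat_u hα hα1 hl0 hg
  have hut : Hol α ((d * C₁ + C₂ + 1) * M) (heatJet l g).ut := by
    have e1 := (((Hol.sum_const fun i => hx i i).const_mul (1 / 2)).sub (hu.const_mul l)).add hg
    refine (e1.congr fun t x => rfl).mono ?_
    rw [hk1, abs_of_pos hl0, abs_of_pos (by norm_num : (0 : ℝ) < 1 / 2), Fintype.card_fin]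
    have e2 : l * (M * C₂ * (1 / l)) = C₂ * M := by field_simp
    rw [e2]
    have : 0 ≤ d * (C₁ * M) := by positivity
    nlinarith
  have hutd : ∀ x, Continuous fun t => (heatJet l g).ut t x := fun x =>
    hut.cont.comp (by fun_prop : Continuous fun t : ℝ => (t, x))
  have hud : ∀ x, Continuous fun t => (heatJet l g).u t x := fun x =>
    hu.cont.comp (by fun_prop : Continuous fun t : ℝ => (t, x))
  have hm1 : ∀ {a : ℝ}, a ≤ C₁ * (1 + d) + 1 + C₂ + C₃ → a * M ≤ (C₁ * (1 + d) + 1 + C₂ + C₃) * M :=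
    fun h => mul_le_mul_of_nonneg_right h hM
  have hdC : 0 ≤ C₁ * d := by positivity
  refine ⟨⟨fun t x => hasDerivAt_of_right (hud x) (hutd x)
    (fun t => heat_right_deriv hα hα1 hl0 hg t x) t, hasFDerivAt_heat_u hα hα1 hl0 hg,
    hasFDerivAt_heat_ux hα hα1 hl0 hg, hu.mono ?_, fun i => (Hol_heat_ux hα hα1 hl0 hg i).mono ?_,
    fun i j => (hx i j).mono (hm1 (by linarith)), hut.mono (hm1 (by linarith))⟩,
    fun i j t x => (abs_heat_uxx_le hα hα1 hl0 hg i j t x).trans ?_⟩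
  · rw [hk1]
    calc M * C₂ * (1 / l) ≤ M * C₂ * (√l)⁻¹ := by gcongr
      _ = C₂ * (√l)⁻¹ * M := by ring
      _ ≤ _ := by gcongr; linarith
  · have e : kint l (1 / 2) = (√l)⁻¹ * Real.Gamma (1 / 2) := by
      rw [kint, ← Real.sqrt_eq_rpow, one_div, Real.sqrt_inv]
    have h3 : gcst (w1 i) * Real.Gamma (1 / 2) ≤ C₃ :=
      Finset.single_le_sum (f := fun i : Fin d => gcst (w1 i) * Real.Gamma (1 / 2)) (fun i _ =>
        mul_nonneg (gcst_nonneg _) (Real.Gamma_pos_of_pos (by norm_num)).le) (Finset.mem_univ i)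
    rw [e]
    calc M * gcst (w1 i) * ((√l)⁻¹ * Real.Gamma (1 / 2))
        = (gcst (w1 i) * Real.Gamma (1 / 2)) * (√l)⁻¹ * M := by ring
      _ ≤ _ := by gcongr; linarith
  · have h4 : gcst (w2 i j) * Real.Gamma (α / 2) ≤ C₁ := by
      refine le_trans ?_ (hle i j)
      have := add_nonneg (mul_nonneg (by positivity : (0 : ℝ) ≤ 4 / α) (gcst_nonneg (w2 i j)))
        (mul_nonneg (by norm_num : (0 : ℝ) ≤ 4) (mul_nonneg (by positivity : (0 : ℝ) ≤ d)
        (Finset.sum_nonneg fun k (_ : k ∈ Finset.univ) => gcst_nonneg (w3 i j k))))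
      linarith
    rw [kint]
    have h5 : 0 ≤ (1 / l) ^ (α / 2) := by positivity
    calc M * gcst (w2 i j) * ((1 / l) ^ (α / 2) * Real.Gamma (α / 2))
        = (gcst (w2 i j) * Real.Gamma (α / 2)) * (1 / l) ^ (α / 2) * M := by ring
      _ ≤ _ := by gcongr; linarith

end TVP

namespace TVP

/-! ### Series of jets and the Neumann iteration -/

variable {d : ℕ}

/-- The sum of a sequence of jets. -/
def Jet.tsum (J : ℕ → Jet d) : Jet d where
  u t x := ∑' n, (J n).u t x
  ut t x := ∑' n, (J n).ut t x
  ux i t x := ∑' n, (J n).ux i t x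
  uxx i j t x := ∑' n, (J n).uxx i j t x

lemma hasFDerivAt_tsum_grad {f : ℕ → (Fin d → ℝ) → ℝ} {fx : ℕ → Fin d → (Fin d → ℝ) → ℝ}
    {K₁ K₂ : ℕ → ℝ} (h1 : Summable K₁) (h2 : Summable K₂)
    (hd : ∀ n x, HasFDerivAt (f n) (grad fun i => fx n i x) x) (hf : ∀ n x, |f n x| ≤ K₁ n)
    (hfx : ∀ n i x, |fx n i x| ≤ K₂ n) (x : Fin d → ℝ) :
    HasFDerivAt (fun x => ∑' n, f n x) (grad fun i => ∑' n, fx n i x) x := by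
  have := hasFDerivAt_tsum (x₀ := x) (h2.mul_left (d : ℝ)) hd
    (fun n x => norm_grad_le _ fun i => hfx n i x)
    (Summable.of_norm_bounded h1 fun n => hf n x) x
  refine this.congr_fderiv ?_
  have hs : ∀ i, Summable fun n => fx n i x := fun i =>
    Summable.of_norm_bounded h2 fun n => hfx n i x
  have hs' : Summable fun n => (fun i => fx n i x) := Pi.summable.2 hs
  have e := (gradL d).map_tsum hs'
  simp only [gradL_apply] at e
  rw [← e]; congr 1; funext i; exact tsum_apply hs'

lemma JB.tsum {α : ℝ} {J : ℕ → Jet d} {K₁ K₂ : ℕ → ℝ} (h1 : Summable K₁) (h2 : Summable K₂)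
    (h : ∀ n, JB α (K₁ n) (K₂ n) (J n)) : JB α (∑' n, K₁ n) (∑' n, K₂ n) (Jet.tsum J) := by
  refine ⟨fun t x => ?_, fun t x => ?_, fun i t x => ?_, Hol.tsum h1 fun n => (h n).hu,
    fun i => Hol.tsum h1 fun n => (h n).hux i, fun i j => Hol.tsum h2 fun n => (h n).huxx i j,
    Hol.tsum h2 fun n => (h n).hut⟩
  · exact hasDerivAt_tsum (y₀ := t) h2 (fun n s => (h n).dt s x) (fun n s => (h n).hut.bdd s x)
      (Summable.of_norm_bounded h1 fun n => (h n).hu.bdd t x) t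
  · exact hasFDerivAt_tsum_grad h1 h1 (fun n => (h n).dx t) (fun n => (h n).hu.bdd t)
      (fun n i => ((h n).hux i).bdd t) x
  · exact hasFDerivAt_tsum_grad h1 h2 (fun n => (h n).dxx i t)
      (fun n => ((h n).hux i).bdd t) (fun n j => ((h n).huxx i j).bdd t) x

lemma hasSum_res {α : ℝ} {J : ℕ → Jet d} {K₁ K₂ : ℕ → ℝ} (h1 : Summable K₁) (h2 : Summable K₂)
    (h : ∀ n, JB α (K₁ n) (K₂ n) (J n)) (A : Fin d → Fin d → ℝ → (Fin d → ℝ) → ℝ) (l t : ℝ)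
    (x : Fin d → ℝ) : HasSum (fun n => (J n).res A l t x) ((Jet.tsum J).res A l t x) := by
  have e1 : HasSum (fun n => (J n).ut t x) ((Jet.tsum J).ut t x) :=
    (Summable.of_norm_bounded h2 fun n => (h n).hut.bdd t x).hasSum
  have e2 : HasSum (fun n => (J n).u t x) ((Jet.tsum J).u t x) :=
    (Summable.of_norm_bounded h1 fun n => (h n).hu.bdd t x).hasSum
  have e3 : ∀ i j, HasSum (fun n => (J n).uxx i j t x) ((Jet.tsum J).uxx i j t x) := fun i j =>
    (Summable.of_norm_bounded h2 fun n => ((h n).huxx i j).bdd t x).hasSum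
  exact (e1.add (e2.mul_left l)).sub ((hasSum_sum fun i _ => hasSum_sum fun j _ =>
    (e3 i j).mul_left (A i j t x)).mul_left (1 / 2))

instance : Inhabited (Jet d) :=
  ⟨⟨fun _ _ => 0, fun _ _ => 0, fun _ _ _ => 0, fun _ _ _ _ => 0⟩⟩

/-- An approximate right inverse can be improved to an exact one. -/
lemma neumann {α N₁ N₂ l : ℝ} {A : Fin d → Fin d → ℝ → (Fin d → ℝ) → ℝ}
    (P : ∀ (M : ℝ) (g : ℝ → (Fin d → ℝ) → ℝ), Hol α M g → ∃ J, JB α (N₁ * M) (N₂ * M) J ∧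
      Hol α (M / 2) (fun t x => g t x - J.res A l t x))
    (M : ℝ) (g : ℝ → (Fin d → ℝ) → ℝ) (hg : Hol α M g) :
    ∃ J, JB α (2 * N₁ * M) (2 * N₂ * M) J ∧ ∀ t x, J.res A l t x = g t x := by
  choose! S hS hR using P
  let G : ℕ → ℝ → (Fin d → ℝ) → ℝ := fun n =>
    Nat.rec g (fun n f t x => f t x - (S (M * (1 / 2) ^ n) f).res A l t x) n
  have hG0 : G 0 = g := rfl
  have hGs : ∀ n, G (n + 1) = fun t x => G n t x - (S (M * (1 / 2) ^ n) (G n)).res A l t x :=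
    fun n => rfl
  have hG : ∀ n, Hol α (M * (1 / 2) ^ n) (G n) := by
    intro n
    induction n with
    | zero => simpa [hG0] using hg
    | succ n ih =>
      rw [hGs]
      refine (hR _ _ ih).mono (le_of_eq ?_)
      rw [pow_succ]; ring
  have hJ := fun n => hS _ _ (hG n)
  have hsum : HasSum (fun n : ℕ => ((1 : ℝ) / 2) ^ n) 2 := hasSum_geometric_two
  have hK : ∀ N : ℝ, HasSum (fun n : ℕ => N * (M * (1 / 2) ^ n)) (2 * N * M) := fun N => by
    have e := hsum.mul_left (N * M)
    rw [show 2 * N * M = N * M * 2 by ring]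
    exact e.congr_fun fun n => by ring
  refine ⟨Jet.tsum fun n => S (M * (1 / 2) ^ n) (G n), ?_, fun t x => ?_⟩
  · have := JB.tsum (hK N₁).summable (hK N₂).summable hJ
    rwa [(hK N₁).tsum_eq, (hK N₂).tsum_eq] at this
  · have h1 := hasSum_res (hK N₁).summable (hK N₂).summable hJ A l t x
    refine tendsto_nhds_unique h1.tendsto_sum_nat ?_
    have e : ∀ n, ∑ k ∈ Finset.range n, (S (M * (1 / 2) ^ k) (G k)).res A l t x
        = g t x - G n t x := by
      intro n
      induction n with
      | zero => simp [hG0]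
      | succ n ih => rw [Finset.sum_range_succ, ih, hGs]; ring
    simp only [e]
    have h2 : Tendsto (fun n => G n t x) atTop (𝓝 0) := by
      refine squeeze_zero_norm (fun n => (hG n).bdd t x) ?_
      simpa using (tendsto_pow_atTop_nhds_zero_of_lt_one (by norm_num : (0 : ℝ) ≤ 1 / 2)
        (by norm_num)).const_mul M
    simpa using h2.const_sub (g t x)

/-! ### Solvability for coefficients close to a constant matrix -/

/-- Solvability of the resolvent equation on the whole space with a priori bounds. -/
def LocSolv (α : ℝ) (A : Fin d → Fin d → ℝ → (Fin d → ℝ) → ℝ) : Prop :=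
  ∃ C l₀ : ℝ, 0 < C ∧ 1 ≤ l₀ ∧ ∀ l, l₀ ≤ l → ∀ (M : ℝ) (g : ℝ → (Fin d → ℝ) → ℝ), Hol α M g →
    ∃ J, JB α (C * (√l)⁻¹ * M) (C * M) J ∧ ∀ t x, J.res A l t x = g t x

lemma exists_rpow_small {β c : ℝ} (hβ : 0 < β) (hc : 0 < c) :
    ∃ l₀ : ℝ, 1 ≤ l₀ ∧ ∀ l, l₀ ≤ l → (1 / l) ^ β ≤ c := by
  have h1 : Tendsto (fun l : ℝ => (1 / l) ^ β) atTop (𝓝 0) := by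
    have := tendsto_rpow_neg_atTop hβ
    refine this.congr' ?_
    filter_upwards [eventually_ge_atTop 0] with l hl
    rw [one_div, Real.inv_rpow hl, Real.rpow_neg hl]
  obtain ⟨l₀, h⟩ := eventually_atTop.1 (h1.eventually (eventually_le_nhds hc))
  exact ⟨max l₀ 1, le_max_right _ _, fun l hl => h l ((le_max_left _ _).trans hl)⟩

lemma locSolv_near_one (d : ℕ) {α : ℝ} (hα : 0 < α) (hα1 : α ≤ 1 / 2) :
    ∃ δ : ℝ, 0 < δ ∧ ∀ (A : Fin d → Fin d → ℝ → (Fin d → ℝ) → ℝ) (H : ℝ),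
      (∀ i j, Hol α H (A i j)) → (∀ i j t x, |A i j t x - kr i j| ≤ δ) → LocSolv α A := by
  obtain ⟨C, hC, hheat⟩ := exists_heat_bound d hα hα1
  refine ⟨1 / (2 * C * (d * d + 1)), by positivity, fun A H hA hδ => ?_⟩
  rcases lt_or_ge H 0 with hH | hH
  · refine ⟨C, 1, hC, le_rfl, fun l hl M g hg => ⟨heatJet l g, (hheat l hl M g hg).1, fun t x => ?_⟩⟩
    rw [← heatJet_res l g t x]
    have : ∀ i j : Fin d, False := fun i j => by
      have := (hA i j).nonneg; linarith
    simp only [Jet.res]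
    rw [Finset.sum_congr rfl fun i _ => (this i i).elim]
  have hH' : 0 < H + 1 := by linarith
  obtain ⟨l₀, hl₀, hsm⟩ := exists_rpow_small (β := α / 2) (half_pos hα)
    (c := 1 / (2 * (H + 1) * C * (d * d + 1))) (by positivity)
  refine ⟨2 * C, l₀, by positivity, hl₀, fun l hl M g hg => ?_⟩
  have hl1 := hl₀.trans hl
  have := neumann (α := α) (N₁ := C * (√l)⁻¹) (N₂ := C) (l := l) (A := A) (fun M g hg => ?_) M g hg
  · simpa only [mul_assoc] using this
  · obtain ⟨hJ, hxx⟩ := hheat l hl1 M g hg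
    refine ⟨heatJet l g, hJ, ?_⟩
    have hM := hg.nonneg
    have hkr : ∀ i j, Hol α (H + 1) (fun t x => A i j t x - kr i j) := fun i j =>
      ((hA i j).sub (Hol.const (kr i j))).mono (by unfold kr; split_ifs <;> simp)
    have hterm : ∀ i j, Hol α (M / (d * d + 1))
        (fun t x => (A i j t x - kr i j) * (heatJet l g).uxx i j t x) := by
      intro i j
      have h1 := hsm l hl
      have e1 : 1 / (2 * C * (d * d + 1)) * (C * M) = M / (2 * (d * d + 1)) := by field_simp
      have e2 : (H + 1) * (C * (1 / l) ^ (α / 2) * M) ≤ M / (2 * (d * d + 1)) := by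
        calc _ ≤ (H + 1) * (C * (1 / (2 * (H + 1) * C * (d * d + 1))) * M) := by gcongr
          _ = _ := by field_simp
      have e3 : M / (d * d + 1) = M / (2 * (d * d + 1)) + M / (2 * (d * d + 1)) := by
        field_simp; ring
      have e4 : (1 / l) ^ (α / 2) ≤ 1 := Real.rpow_le_one (by positivity)
        (by rw [div_le_one (by linarith)]; exact hl1) (by positivity)
      refine (hkr i j).mul_of (hJ.huxx i j) (hδ i j) (hxx i j) ?_ ?_
      · rw [e3, ← e1]
        have : C * (1 / l) ^ (α / 2) * M ≤ C * M := by
          calc _ ≤ C * 1 * M := by gcongr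
            _ = _ := by ring
        have h5 : (1 / (2 * C * (d * d + 1))) * (C * (1 / l) ^ (α / 2) * M)
            ≤ 1 / (2 * C * (d * d + 1)) * (C * M) := by gcongr
        have h6 : 0 ≤ 1 / (2 * C * (d * d + 1)) * (C * M) := by positivity
        linarith
      · rw [e3, e1]; linarith
    have h2 := (Hol.sum_const fun i => Hol.sum_const fun j => hterm i j).const_mul (1 / 2)
    refine (h2.mono ?_).congr fun t x => ?_
    · simp only [Fintype.card_fin]
      rw [abs_of_pos (by norm_num : (0 : ℝ) < 1 / 2)]
      have : (d : ℝ) * (d * (M / (d * d + 1))) ≤ M := by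
        rw [← mul_assoc, mul_div_assoc', div_le_iff₀ (by positivity)]
        nlinarith
      linarith
    · conv_lhs => rw [← heatJet_res l g t x]
      simp only [Jet.res, sub_mul, Finset.sum_sub_distrib]
      ring

/-! ### Linear changes of variables -/

open Matrix

/-- Pulling back a jet along a linear map. -/
def Jet.lin (τ : Matrix (Fin d) (Fin d) ℝ) (J : Jet d) : Jet d where
  u t x := J.u t (τ *ᵥ x)
  ut t x := J.ut t (τ *ᵥ x)
  ux i t x := ∑ k, τ k i * J.ux k t (τ *ᵥ x)
  uxx i j t x := ∑ k, τ k i * ∑ l, τ l j * J.uxx k l t (τ *ᵥ x)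

lemma exists_mulVec_bound (τ : Matrix (Fin d) (Fin d) ℝ) :
    ∃ s : ℝ, 0 ≤ s ∧ ∀ v, ‖τ *ᵥ v‖ ≤ s * ‖v‖ :=
  ⟨‖(Matrix.toLin' τ).toContinuousLinearMap‖, norm_nonneg _, fun v =>
    (Matrix.toLin' τ).toContinuousLinearMap.le_opNorm v⟩

lemma continuous_mulVec (τ : Matrix (Fin d) (Fin d) ℝ) : Continuous fun x => τ *ᵥ x :=
  (Matrix.toLin' τ).toContinuousLinearMap.continuous

lemma Hol.mulVec {α M s : ℝ} {g : ℝ → (Fin d → ℝ) → ℝ} (hα : 0 ≤ α) (hα1 : α ≤ 1)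
    (hg : Hol α M g) {τ : Matrix (Fin d) (Fin d) ℝ} (hs : 0 ≤ s) (hτ : ∀ v, ‖τ *ᵥ v‖ ≤ s * ‖v‖) :
    Hol α ((1 + s) * M) (fun t x => g t (τ *ᵥ x)) := by
  have hM := hg.nonneg
  refine ⟨hg.cont.comp (continuous_fst.prodMk ((continuous_mulVec τ).comp continuous_snd)),
    fun t x => (hg.bdd _ _).trans (by nlinarith), fun t x y => (hg.hol _ _ _).trans ?_⟩
  rw [← mulVec_sub]
  calc M * ‖τ *ᵥ (x - y)‖ ^ α ≤ M * (s * ‖x - y‖) ^ α := by gcongr; exact hτ _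
    _ = s ^ α * M * ‖x - y‖ ^ α := by rw [Real.mul_rpow hs (norm_nonneg _)]; ring
    _ ≤ _ := by gcongr; exact rpow_le_one_add hα hα1 hs

lemma hasFDerivAt_comp_mulVec {f : (Fin d → ℝ) → ℝ} {c : Fin d → ℝ}
    {τ : Matrix (Fin d) (Fin d) ℝ} {x : Fin d → ℝ} (h : HasFDerivAt f (grad c) (τ *ᵥ x)) :
    HasFDerivAt (fun x => f (τ *ᵥ x)) (grad fun i => ∑ k, τ k i * c k) x := by
  have h1 : HasFDerivAt (fun x => τ *ᵥ x) (Matrix.toLin' τ).toContinuousLinearMap x :=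
    (Matrix.toLin' τ).toContinuousLinearMap.hasFDerivAt
  refine (HasFDerivAt.comp x h h1).congr_fderiv ?_
  ext v
  simp only [ContinuousLinearMap.comp_apply, grad_apply, LinearMap.coe_toContinuousLinearMap',
    Matrix.toLin'_apply, mulVec, dotProduct, Finset.mul_sum, Finset.sum_mul]
  rw [Finset.sum_comm]
  exact Finset.sum_congr rfl fun i _ => Finset.sum_congr rfl fun j _ => by ring

lemma JB.lin {α N₁ N₂ s b : ℝ} {J : Jet d} (hα : 0 ≤ α) (hα1 : α ≤ 1) (hJ : JB α N₁ N₂ J)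
    {τ : Matrix (Fin d) (Fin d) ℝ} (hs : 0 ≤ s) (hτ : ∀ v, ‖τ *ᵥ v‖ ≤ s * ‖v‖)
    (hb : 0 ≤ b) (hτb : ∀ i j, |τ i j| ≤ b) :
    JB α ((1 + d * b) * ((1 + s) * N₁)) ((1 + (d * b) * (d * b)) * ((1 + s) * N₂)) (J.lin τ) := by
  have hN₁ := hJ.hu.nonneg
  have hN₂ := hJ.hut.nonneg
  have hm : ∀ (i j : Fin d) {f : ℝ → (Fin d → ℝ) → ℝ} {N : ℝ}, Hol α N f →
      Hol α (b * N) (fun t x => τ i j * f t x) := fun i j f N h =>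
    (h.const_mul (τ i j)).mono (mul_le_mul_of_nonneg_right (hτb i j) h.nonneg)
  have p1 : 0 ≤ (d * b) * ((1 + s) * N₁) := by positivity
  have p2 : 0 ≤ (d * b) * (d * b) * ((1 + s) * N₂) := by positivity
  have p3 : 0 ≤ (1 + s) * N₁ := by positivity
  have p4 : 0 ≤ (1 + s) * N₂ := by positivity
  refine ⟨fun t x => hJ.dt t _, fun t x => hasFDerivAt_comp_mulVec (hJ.dx t _), fun i t x => ?_,
    (hJ.hu.mulVec hα hα1 hs hτ).mono (by linarith), fun i => ?_, fun i j => ?_,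
    (hJ.hut.mulVec hα hα1 hs hτ).mono (by linarith)⟩
  · have := HasFDerivAt.fun_sum (u := Finset.univ) fun k (_ : k ∈ Finset.univ) =>
      (hasFDerivAt_comp_mulVec (hJ.dxx k t (τ *ᵥ x))).const_mul (τ k i)
    refine this.congr_fderiv ?_
    ext v
    simp only [_root_.sum_apply, _root_.smul_apply, grad_apply, Jet.lin,
      smul_eq_mul, Finset.mul_sum, Finset.sum_mul]
    rw [Finset.sum_comm]
    exact Finset.sum_congr rfl fun i _ => Finset.sum_congr rfl fun j _ =>
      Finset.sum_congr rfl fun k _ => by ring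
  · refine (Hol.sum_const fun k => hm k i ((hJ.hux k).mulVec hα hα1 hs hτ)).mono ?_
    rw [Fintype.card_fin]; linarith
  · refine (Hol.sum_const fun k => hm k i (Hol.sum_const fun l =>
      hm l j ((hJ.huxx k l).mulVec hα hα1 hs hτ))).mono ?_
    rw [Fintype.card_fin]; linarith

lemma res_lin (A : Fin d → Fin d → ℝ → (Fin d → ℝ) → ℝ) (l : ℝ) (J : Jet d)
    {σ τ : Matrix (Fin d) (Fin d) ℝ} (h : σ * τ = 1) (t : ℝ) (x : Fin d → ℝ) :
    (J.lin τ).res A l t x =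
      J.res (fun k m t y => ∑ i, ∑ j, τ k i * A i j t (σ *ᵥ y) * τ m j) l t (τ *ᵥ x) := by
  have hx : σ *ᵥ (τ *ᵥ x) = x := by rw [mulVec_mulVec, h, one_mulVec]
  simp only [Jet.res, Jet.lin, hx, Finset.mul_sum, Finset.sum_mul]
  congr 1
  rw [Finset.sum_congr rfl fun i _ => Finset.sum_comm, Finset.sum_comm]
  refine Finset.sum_congr rfl fun k _ => ?_
  rw [Finset.sum_congr rfl fun i _ => Finset.sum_comm, Finset.sum_comm]
  refine Finset.sum_congr rfl fun k _ => Finset.sum_congr rfl fun i _ =>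
    Finset.sum_congr rfl fun j _ => by ring

lemma LocSolv.lin {α : ℝ} (hα : 0 ≤ α) (hα1 : α ≤ 1) {A : Fin d → Fin d → ℝ → (Fin d → ℝ) → ℝ}
    {σ τ : Matrix (Fin d) (Fin d) ℝ} (h : σ * τ = 1)
    (hs : LocSolv α (fun k m t y => ∑ i, ∑ j, τ k i * A i j t (σ *ᵥ y) * τ m j)) :
    LocSolv α A := by
  obtain ⟨C, l₀, hC, hl₀, H⟩ := hs
  obtain ⟨s, hs, hσ⟩ := exists_mulVec_bound σ
  obtain ⟨s', hs', hτ⟩ := exists_mulVec_bound τ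
  set b : ℝ := ∑ i, ∑ j, |τ i j| with hb
  have hb0 : 0 ≤ b := Finset.sum_nonneg fun i _ => Finset.sum_nonneg fun j _ => abs_nonneg _
  have hbt : ∀ i j, |τ i j| ≤ b := fun i j =>
    (Finset.single_le_sum (f := fun j => |τ i j|) (fun j _ => abs_nonneg _)
      (Finset.mem_univ j)).trans (Finset.single_le_sum (f := fun i => ∑ j, |τ i j|)
      (fun i _ => Finset.sum_nonneg fun j _ => abs_nonneg _) (Finset.mem_univ i))
  set D₁ := (1 + d * b) * (1 + s') * (1 + s) with hD₁
  set D₂ := (1 + (d * b) * (d * b)) * (1 + s') * (1 + s) with hD₂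
  have h1 : 0 < D₁ := by positivity
  have h2 : 0 < D₂ := by positivity
  refine ⟨C * (D₁ + D₂), l₀, by positivity, hl₀, fun l hl M g hg => ?_⟩
  obtain ⟨J, hJ, hr⟩ := H l hl _ _ (hg.mulVec hα hα1 hs hσ)
  refine ⟨J.lin τ, (hJ.lin hα hα1 hs' hτ hb0 hbt).mono ?_ ?_, fun t x => ?_⟩
  · have hM := hg.nonneg
    calc _ = C * D₁ * (√l)⁻¹ * M := by rw [hD₁]; ring
      _ ≤ _ := by gcongr; linarith
  · have hM := hg.nonneg
    calc _ = C * D₂ * M := by rw [hD₂]; ring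
      _ ≤ _ := by gcongr; linarith
  · rw [res_lin A l J h, hr, mulVec_mulVec, h, one_mulVec]

open scoped MatrixOrder in
lemma exists_factor {A₀ : Matrix (Fin d) (Fin d) ℝ} (h : A₀.PosDef) :
    ∃ σ τ : Matrix (Fin d) (Fin d) ℝ, σ * τ = 1 ∧ τ * A₀ * τᵀ = 1 := by
  obtain ⟨y, hy⟩ := CStarAlgebra.nonneg_iff_eq_star_mul_self.mp h.posSemidef.nonneg
  have hy' : A₀ = yᵀ * y := by rw [hy, star_eq_conjTranspose, conjTranspose_eq_transpose_of_trivial]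
  have hu : IsUnit y.det := by
    have := (Matrix.isUnit_iff_isUnit_det _).1 h.isUnit
    rw [hy', det_mul] at this
    exact isUnit_of_mul_isUnit_right this
  have hu' : IsUnit yᵀ.det := by rwa [det_transpose]
  refine ⟨yᵀ, (yᵀ)⁻¹, mul_nonsing_inv _ hu', ?_⟩
  rw [hy', ← Matrix.mul_assoc, nonsing_inv_mul _ hu', Matrix.one_mul, transpose_nonsing_inv,
    transpose_transpose, mul_nonsing_inv _ hu]

lemma locSolv_near {α : ℝ} (hα : 0 < α) (hα1 : α ≤ 1 / 2) {A₀ : Matrix (Fin d) (Fin d) ℝ}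
    (h : A₀.PosDef) :
    ∃ δ : ℝ, 0 < δ ∧ ∀ (A : Fin d → Fin d → ℝ → (Fin d → ℝ) → ℝ) (H : ℝ),
      (∀ i j, Hol α H (A i j)) → (∀ i j t x, |A i j t x - A₀ i j| ≤ δ) → LocSolv α A := by
  obtain ⟨δ, hδ, H⟩ := locSolv_near_one d hα hα1
  obtain ⟨σ, τ, hστ, hτ⟩ := exists_factor h
  set b : ℝ := ∑ i, ∑ j, |τ i j| with hb
  have hb0 : 0 ≤ b := Finset.sum_nonneg fun i _ => Finset.sum_nonneg fun j _ => abs_nonneg _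
  have hbt : ∀ i j, |τ i j| ≤ b := fun i j =>
    (Finset.single_le_sum (f := fun j => |τ i j|) (fun j _ => abs_nonneg _)
      (Finset.mem_univ j)).trans (Finset.single_le_sum (f := fun i => ∑ j, |τ i j|)
      (fun i _ => Finset.sum_nonneg fun j _ => abs_nonneg _) (Finset.mem_univ i))
  obtain ⟨s, hs, hσ⟩ := exists_mulVec_bound σ
  refine ⟨δ / (d * (d * (b * b)) + 1), by positivity, fun A K hA hd => ?_⟩
  have hterm : ∀ k m i j, Hol α (b * b * ((1 + s) * K))
      (fun t y => τ k i * A i j t (σ *ᵥ y) * τ m j) := fun k m i j => by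
    have h1 := (hA i j).mulVec hα.le (by linarith) hs hσ
    refine ((h1.const_mul (τ k i * τ m j)).mono ?_).congr fun t x => by ring
    refine mul_le_mul_of_nonneg_right ?_ h1.nonneg
    rw [abs_mul]; exact mul_le_mul (hbt k i) (hbt m j) (abs_nonneg _) hb0
  refine LocSolv.lin hα.le (by linarith) hστ (H _ _ (fun k m => Hol.sum_const fun i =>
    Hol.sum_const fun j => hterm k m i j) fun k m t y => ?_)
  have e : kr k m = ∑ i, ∑ j, τ k i * A₀ i j * τ m j := by
    have := congrFun (congrFun hτ k) m
    rw [Matrix.one_apply] at this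
    rw [kr, ← this, Matrix.mul_apply]
    simp only [Matrix.mul_apply, transpose_apply, Finset.sum_mul]
    rw [Finset.sum_comm]
  rw [e, ← Finset.sum_sub_distrib, ← Real.norm_eq_abs]
  have hb2 : ∀ i j, ‖τ k i * A i j t (σ *ᵥ y) * τ m j - τ k i * A₀ i j * τ m j‖
      ≤ b * b * (δ / (d * (d * (b * b)) + 1)) := fun i j => by
    rw [← sub_mul, ← mul_sub, norm_mul, norm_mul]
    have h1 := hd i j t (σ *ᵥ y)
    have h2 := hbt k i
    have h3 := hbt m j
    simp only [Real.norm_eq_abs]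
    calc _ ≤ b * (δ / (d * (d * (b * b)) + 1)) * b := by gcongr
      _ = _ := by ring
  have hb3 : ∀ i, ‖∑ j, τ k i * A i j t (σ *ᵥ y) * τ m j - ∑ j, τ k i * A₀ i j * τ m j‖
      ≤ d * (b * b * (δ / (d * (d * (b * b)) + 1))) := fun i => by
    rw [← Finset.sum_sub_distrib]
    refine (norm_sum_le _ _).trans ((Finset.sum_le_sum fun j _ => hb2 i j).trans (le_of_eq ?_))
    simp
  refine (norm_sum_le _ _).trans ((Finset.sum_le_sum fun i _ => hb3 i).trans ?_)
  simp only [Finset.sum_const, Finset.card_univ, Fintype.card_fin, nsmul_eq_mul]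
  have : d * (d * (b * b * (δ / (d * (d * (b * b)) + 1))))
      = δ * (d * (d * (b * b))) / (d * (d * (b * b)) + 1) := by ring
  rw [this, div_le_iff₀ (by positivity)]
  nlinarith

end TVP

namespace TVP

variable {d : ℕ} {α : ℝ}

/-! ### Smooth functions as jets -/

lemma Hol.of_contDiff (hα : 0 < α) (hα1 : α ≤ 1) {f : ℝ × (Fin d → ℝ) → ℝ}
    (hf : ContDiff ℝ 1 f) (hc : HasCompactSupport f) :
    ∃ M, Hol α M (fun t x => f (t, x)) := by
  obtain ⟨C, hC⟩ := hf.lipschitzWith_of_hasCompactSupport hc one_ne_zero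
  obtain ⟨M, hM⟩ := hc.exists_bound_of_continuous hf.continuous
  refine ⟨_, Hol.of_lip (M := M) (N := C) hα hα1 hf.continuous (fun t x => hM _)
    fun t x y => ?_⟩
  have := hC.dist_le_mul (t, x) (t, y)
  simpa [Prod.dist_eq, dist_eq_norm] using this

/-- The jet of a smooth function of time and space. -/
def smoothJet (f : ℝ × (Fin d → ℝ) → ℝ) : Jet d where
  u t x := f (t, x)
  ut t x := fderiv ℝ f (t, x) (1, 0)
  ux i t x := fderiv ℝ f (t, x) (0, Pi.single i 1)
  uxx i j t x := fderiv ℝ (fun p => fderiv ℝ f p (0, Pi.single i 1)) (t, x) (0, Pi.single j 1)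

lemma grad_eq (L : (Fin d → ℝ) →L[ℝ] ℝ) : grad (fun i => L (Pi.single i 1)) = L := by
  ext v
  rw [grad_apply]
  conv_rhs => rw [← Finset.univ_sum_single v, map_sum]
  refine Finset.sum_congr rfl fun i _ => ?_
  rw [show Pi.single i (v i) = v i • (Pi.single i 1 : Fin d → ℝ) by
    rw [← Pi.single_smul, smul_eq_mul, mul_one], map_smul, smul_eq_mul, mul_comm]

lemma hasFDerivAt_slice {f : ℝ × (Fin d → ℝ) → ℝ} (hf : Differentiable ℝ f) (t : ℝ)
    (x : Fin d → ℝ) :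
    HasFDerivAt (fun y => f (t, y)) (grad fun i => fderiv ℝ f (t, x) (0, Pi.single i 1)) x := by
  have h := (hf (t, x)).hasFDerivAt.comp x (hasFDerivAt_prodMk_right t x)
  refine h.congr_fderiv ?_
  rw [← grad_eq (ContinuousLinearMap.comp _ _)]
  rfl

lemma hasDerivAt_slice {f : ℝ × (Fin d → ℝ) → ℝ} (hf : Differentiable ℝ f) (t : ℝ)
    (x : Fin d → ℝ) : HasDerivAt (fun s => f (s, x)) (fderiv ℝ f (t, x) (1, 0)) t := by
  have h : HasDerivAt (fun s : ℝ => (s, x)) (1, 0) t :=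
    (hasDerivAt_id t).prodMk (hasDerivAt_const t x)
  exact (hf (t, x)).hasFDerivAt.comp_hasDerivAt t h

lemma exists_JB_smoothJet (hα : 0 < α) (hα1 : α ≤ 1) {f : ℝ × (Fin d → ℝ) → ℝ}
    (hf : ContDiff ℝ 3 f) (hc : HasCompactSupport f) : ∃ Z, JB α Z Z (smoothJet f) := by
  have hD : ∀ v, ContDiff ℝ 2 (fun p => fderiv ℝ f p v) := fun v =>
    (hf.fderiv_right (by norm_num)).clm_apply contDiff_const
  have hDc : ∀ v, HasCompactSupport (fun p => fderiv ℝ f p v) := fun v => hc.fderiv_apply ℝ v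
  have hDD : ∀ v w, ContDiff ℝ 1 (fun p => fderiv ℝ (fun q => fderiv ℝ f q v) p w) := fun v w =>
    ((hD v).fderiv_right (by norm_num)).clm_apply contDiff_const
  have h2 : (2 : WithTop ℕ∞) ≠ 0 := by norm_num
  have h3 : (3 : WithTop ℕ∞) ≠ 0 := by norm_num
  obtain ⟨M0, hM0⟩ := Hol.of_contDiff hα hα1 (hf.of_le (by norm_num)) hc
  obtain ⟨M1, hM1⟩ := Hol.of_contDiff hα hα1 ((hD (1, 0)).of_le (by norm_num)) (hDc (1, 0))
  choose M2 hM2 using fun i : Fin d => Hol.of_contDiff hα hα1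
    ((hD (0, Pi.single i 1)).of_le (by norm_num)) (hDc (0, Pi.single i 1))
  choose M3 hM3 using fun i j : Fin d => Hol.of_contDiff hα hα1
    (hDD (0, Pi.single i 1) (0, Pi.single j 1))
    ((hDc (0, Pi.single i 1)).fderiv_apply ℝ (0, Pi.single j 1))
  have n2 : ∀ i, 0 ≤ M2 i := fun i => (hM2 i).nonneg
  have n3 : ∀ i j, 0 ≤ M3 i j := fun i j => (hM3 i j).nonneg
  have s2 : 0 ≤ ∑ i, M2 i := Finset.sum_nonneg fun i _ => n2 i
  have s3' : ∀ i, 0 ≤ ∑ j, M3 i j := fun i => Finset.sum_nonneg fun j _ => n3 i j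
  have s3 : 0 ≤ ∑ i, ∑ j, M3 i j := Finset.sum_nonneg fun i _ => s3' i
  have n0 := hM0.nonneg
  have n1 := hM1.nonneg
  refine ⟨M0 + M1 + ∑ i, M2 i + ∑ i, ∑ j, M3 i j, fun t x => ?_, fun t x => ?_, fun i t x => ?_,
    hM0.mono (by linarith), fun i => (hM2 i).mono ?_, fun i j => (hM3 i j).mono ?_,
    hM1.mono (by linarith)⟩
  · exact hasDerivAt_slice (hf.differentiable h3) t x
  · exact hasFDerivAt_slice (hf.differentiable h3) t x
  · exact hasFDerivAt_slice ((hD _).differentiable h2) t x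
  · have := Finset.single_le_sum (f := M2) (fun i _ => n2 i) (Finset.mem_univ i)
    linarith
  · have := Finset.single_le_sum (f := M3 i) (fun j _ => n3 i j) (Finset.mem_univ j)
    have := Finset.single_le_sum (f := fun i => ∑ j, M3 i j) (fun i _ => s3' i) (Finset.mem_univ i)
    linarith

/-- The constant jet. -/
def Jet.const (c : ℝ) : Jet d := ⟨fun _ _ => c, fun _ _ => 0, fun _ _ _ => 0, fun _ _ _ _ => 0⟩

lemma grad_zero : grad (fun _ : Fin d => (0 : ℝ)) = 0 := by ext v; simp

lemma JB.const (c : ℝ) : JB α |c| |c| (Jet.const c : Jet d) :=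
  ⟨fun t x => hasDerivAt_const t c, fun t x => by
    simpa only [Jet.const, grad_zero] using hasFDerivAt_const c x, fun i t x => by
    simpa only [Jet.const, grad_zero] using hasFDerivAt_const (0 : ℝ) x, Hol.const c,
    fun i => Hol.zero.mono (abs_nonneg c), fun i j => Hol.zero.mono (abs_nonneg c),
    Hol.zero.mono (abs_nonneg c)⟩

lemma JB.mul_self_bound {Z W : ℝ} {ζ ξ : Jet d} (h1 : JB α Z Z ζ) (h2 : JB α W W ξ) :
    JB α (8 * (Z * W)) (8 * (Z * W)) (ζ.mul ξ) := by
  have := mul_nonneg h1.hu.nonneg h2.hu.nonneg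
  exact (h1.mul h2).mono (by linarith) (by linarith)

/-- The jet of `∏ (1 - ζₖ)`. -/
def prodJet {ι : Type*} (s : List ι) (ζ : ι → Jet d) : Jet d :=
  s.foldr (fun k J => ((Jet.const 1).add ((ζ k).smul (-1))).mul J) (Jet.const 1)

/-! ### Gluing local solution operators -/

/-- Approximate solvability of the resolvent equation with right hand side `φ g`. -/
def ApproxSolv (α : ℝ) (A : Fin d → Fin d → ℝ → (Fin d → ℝ) → ℝ) (φ : ℝ → (Fin d → ℝ) → ℝ) :
    Prop :=
  ∃ C l₀ : ℝ, 0 < C ∧ 1 ≤ l₀ ∧ ∀ l, l₀ ≤ l → ∀ (M : ℝ) (g : ℝ → (Fin d → ℝ) → ℝ), Hol α M g →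
    ∃ J, JB α (C * (√l)⁻¹ * M) (C * M) J ∧
      Hol α (C * (√l)⁻¹ * M) (fun t x => φ t x * g t x - J.res A l t x)

variable {A A' : Fin d → Fin d → ℝ → (Fin d → ℝ) → ℝ} {φ ψ : ℝ → (Fin d → ℝ) → ℝ}

lemma LocSolv.approxSolv {H Z : ℝ} {ζ : Jet d} (hA : ∀ i j, Hol α H (A i j))
    (h : LocSolv α A') (hζ : JB α Z Z ζ) (hAA : ∀ t x, ζ.u t x ≠ 0 → ∀ i j, A' i j t x = A i j t x) :
    ApproxSolv α A ζ.u := by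
  obtain ⟨C, l₀, hC, hl₀, h⟩ := h
  have hZ := hζ.hu.nonneg
  refine ⟨(10 * Z + (2 + 6 * d * d * |H|) * Z + 1) * C, l₀, by positivity, hl₀,
    fun l hl M g hg => ?_⟩
  obtain ⟨J, hJ, hr⟩ := h l hl M g hg
  have hM := hg.nonneg
  have hl1 : (√l)⁻¹ ≤ 1 := inv_le_one_of_one_le₀ (Real.one_le_sqrt.2 (hl₀.trans hl))
  have hN₁ : 0 ≤ C * (√l)⁻¹ * M := by positivity
  have hN₂ : C * (√l)⁻¹ * M ≤ C * M := by
    calc _ ≤ C * 1 * M := by gcongr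
      _ = _ := by ring
  have hp : 0 ≤ (2 + 6 * d * d * |H|) * Z := by positivity
  refine ⟨ζ.mul J, (hζ.mul hJ).mono ?_ ?_, ?_⟩
  · calc 4 * (Z * (C * (√l)⁻¹ * M)) = (4 * Z) * (C * (√l)⁻¹ * M) := by ring
      _ ≤ (10 * Z + (2 + 6 * d * d * |H|) * Z + 1) * (C * (√l)⁻¹ * M) := by gcongr; linarith
      _ = _ := by ring
  · calc 6 * (Z * (C * (√l)⁻¹ * M)) + 2 * (Z * (C * M))
        ≤ 6 * (Z * (C * M)) + 2 * (Z * (C * M)) := by gcongr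
      _ = (8 * Z) * (C * M) := by ring
      _ ≤ (10 * Z + (2 + 6 * d * d * |H|) * Z + 1) * (C * M) := by gcongr; linarith
      _ = _ := by ring
  · refine ((Hol.comm (fun i j => (hA i j).mono (le_abs_self H)) hζ hJ.hu hJ.hux).neg.congr
      fun t x => ?_).mono ?_
    · rw [res_mul]
      have : ζ.u t x * J.res A l t x = ζ.u t x * g t x := by
        by_cases h0 : ζ.u t x = 0
        · simp [h0]
        · rw [← hr t x]
          simp only [Jet.res, hAA t x h0]
      rw [this]; ring
    · calc (2 + 6 * d * d * |H|) * (Z * (C * (√l)⁻¹ * M))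
          = (2 + 6 * d * d * |H|) * Z * (C * (√l)⁻¹ * M) := by ring
        _ ≤ (10 * Z + (2 + 6 * d * d * |H|) * Z + 1) * (C * (√l)⁻¹ * M) := by gcongr; linarith
        _ = _ := by ring

lemma ApproxSolv.congr (h : ApproxSolv α A φ) (hφ : ∀ t x, φ t x = ψ t x) : ApproxSolv α A ψ := by
  have : φ = ψ := by funext t x; exact hφ t x
  rwa [← this]

lemma ApproxSolv.zero : ApproxSolv α A (fun _ _ => 0) := by
  refine ⟨1, 1, one_pos, le_rfl, fun l hl M g hg => ⟨Jet.const 0, ?_, ?_⟩⟩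
  · have := hg.nonneg
    exact (JB.const 0).mono (by simp; positivity) (by simpa using this)
  · have := hg.nonneg
    refine (Hol.zero.mono (by positivity)).congr fun t x => ?_
    simp [Jet.res, Jet.const]

lemma ApproxSolv.add (h1 : ApproxSolv α A φ) (h2 : ApproxSolv α A ψ) :
    ApproxSolv α A (fun t x => φ t x + ψ t x) := by
  obtain ⟨C₁, l₁, hC₁, hl₁, h1⟩ := h1
  obtain ⟨C₂, l₂, hC₂, hl₂, h2⟩ := h2
  refine ⟨C₁ + C₂, max l₁ l₂, by positivity, hl₁.trans (le_max_left _ _), fun l hl M g hg => ?_⟩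
  obtain ⟨J, hJ, hr⟩ := h1 l ((le_max_left _ _).trans hl) M g hg
  obtain ⟨K, hK, hs⟩ := h2 l ((le_max_right _ _).trans hl) M g hg
  refine ⟨J.add K, (hJ.add hK).mono (le_of_eq (by ring)) (le_of_eq (by ring)),
    ((hr.add hs).congr fun t x => ?_).mono (le_of_eq (by ring))⟩
  rw [res_add]; ring

lemma ApproxSolv.mul {Z : ℝ} (h : ApproxSolv α A φ) (hψ : Hol α Z ψ) :
    ApproxSolv α A (fun t x => φ t x * ψ t x) := by
  obtain ⟨C, l₀, hC, hl₀, h⟩ := h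
  have hZ := hψ.nonneg
  refine ⟨C * (2 * Z + 1), l₀, by positivity, hl₀, fun l hl M g hg => ?_⟩
  obtain ⟨J, hJ, hr⟩ := h l hl _ _ ((hψ.mul hg).mono (N := (2 * Z + 1) * M) (by
    have := hg.nonneg; linarith))
  exact ⟨J, hJ.mono (le_of_eq (by ring)) (le_of_eq (by ring)),
    (hr.congr fun t x => by ring).mono (le_of_eq (by ring))⟩

lemma ApproxSolv.locSolv (h : ApproxSolv α A (fun _ _ => 1)) : LocSolv α A := by
  obtain ⟨C, l₀, hC, hl₀, h⟩ := h
  refine ⟨2 * C, max l₀ ((2 * C) ^ 2), by positivity, hl₀.trans (le_max_left _ _),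
    fun l hl M g hg => ?_⟩
  have hs : 2 * C ≤ √l := Real.le_sqrt_of_sq_le ((le_max_right _ _).trans hl)
  have hs0 : 0 < √l := by linarith [mul_pos two_pos hC]
  have := neumann (α := α) (N₁ := C * (√l)⁻¹) (N₂ := C) (l := l) (A := A) (fun M g hg => ?_) M g hg
  · simpa only [mul_assoc] using this
  · obtain ⟨J, hJ, hr⟩ := h l ((le_max_left _ _).trans hl) M g hg
    refine ⟨J, hJ, (hr.congr fun t x => by ring).mono ?_⟩
    have hM := hg.nonneg
    have : C * (√l)⁻¹ ≤ 1 / 2 := by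
      rw [← div_eq_mul_inv, div_le_iff₀ hs0]; linarith
    calc _ ≤ 1 / 2 * M := by gcongr
      _ = _ := by ring

lemma approxSolv_prodJet {ι : Type*} (s : List ι) (ζ : ι → Jet d) (hζ : ∀ k ∈ s, ∃ Z, JB α Z Z (ζ k))
    (h : ∀ k ∈ s, ApproxSolv α A (ζ k).u) :
    (∃ Z, JB α Z Z (prodJet s ζ)) ∧ ApproxSolv α A (fun t x => 1 - (prodJet s ζ).u t x) ∧
      ∀ t x, (∃ k ∈ s, (ζ k).u t x = 1) → (prodJet s ζ).u t x = 0 := by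
  induction s with
  | nil =>
    refine ⟨⟨_, JB.const 1⟩, ApproxSolv.zero.congr fun t x => ?_, fun t x ⟨k, hk, _⟩ => by simp at hk⟩
    simp [prodJet, Jet.const]
  | cons k s ih =>
    obtain ⟨⟨W, hW⟩, h1, h2⟩ := ih (fun k hk => hζ k (List.mem_cons_of_mem _ hk))
      (fun k hk => h k (List.mem_cons_of_mem _ hk))
    obtain ⟨Z, hZ⟩ := hζ k List.mem_cons_self
    have hu : ∀ t x, (prodJet (k :: s) ζ).u t x = (1 + -1 * (ζ k).u t x) * (prodJet s ζ).u t x :=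
      fun t x => rfl
    refine ⟨⟨_, ((JB.const 1).add (hZ.smul (-1))).mul_self_bound hW⟩,
      (h1.add ((h k List.mem_cons_self).mul hW.hu)).congr fun t x => ?_, fun t x ⟨m, hm, hm1⟩ => ?_⟩
    · rw [hu]; ring
    · rw [hu]
      rcases List.mem_cons.1 hm with rfl | hm
      · rw [hm1]; ring
      · rw [h2 t x ⟨m, hm, hm1⟩, mul_zero]

lemma Hol.clamp {M δ : ℝ} {g : ℝ → (Fin d → ℝ) → ℝ} (hδ : 0 ≤ δ) (hg : Hol α M g) :
    Hol α (M + δ) (fun t x => max (-δ) (min δ (g t x))) := by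
  refine ⟨continuous_const.max (continuous_const.min hg.cont), fun t x => ?_, fun t x y => ?_⟩
  · have := hg.nonneg
    rw [abs_le]
    exact ⟨by have := le_max_left (-δ) (min δ (g t x)); linarith,
      max_le (by linarith) ((min_le_left _ _).trans (by linarith))⟩
  · have h1 : |max (-δ) (min δ (g t x)) - max (-δ) (min δ (g t y))| ≤ |g t x - g t y| := by
      rw [max_comm (-δ), max_comm (-δ), min_comm δ, min_comm δ]
      exact (abs_max_sub_max_le_abs _ _ _).trans (by
        simpa using abs_min_sub_min_le_max (g t x) δ (g t y) δ)
    have h2 : 0 ≤ ‖x - y‖ ^ α := by positivity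
    exact (h1.trans (hg.hol t x y)).trans (by gcongr; linarith)

/-- Solvability for Hölder coefficients that are the identity off a compact set. -/
theorem locSolv_of_compact (hα : 0 < α) (hα1 : α ≤ 1 / 2) {H : ℝ}
    (hA : ∀ i j, Hol α H (A i j)) (hpd : ∀ t x, (Matrix.of fun i j => A i j t x).PosDef)
    {K : Set (ℝ × (Fin d → ℝ))} (hK : IsCompact K)
    (hAK : ∀ t x, (t, x) ∉ K → ∀ i j, A i j t x = kr i j) : LocSolv α A := by
  have hα2 : α ≤ 1 := by linarith
  have hloc : ∀ p : ℝ × (Fin d → ℝ), ∃ ζ : Jet d, (∃ Z, JB α Z Z ζ) ∧ ApproxSolv α A ζ.u ∧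
      ∀ᶠ q in 𝓝 p, ζ.u q.1 q.2 = 1 := by
    intro p
    obtain ⟨δ, hδ, hs⟩ := locSolv_near hα hα1 (hpd p.1 p.2)
    have hnear : ∀ᶠ q in 𝓝 p, ∀ i j, |A i j q.1 q.2 - A i j p.1 p.2| ≤ δ := by
      refine eventually_all.2 fun i => eventually_all.2 fun j => ?_
      have := Metric.tendsto_nhds.1 ((hA i j).cont.tendsto p) δ hδ
      filter_upwards [this] with q hq using by rw [← Real.dist_eq]; exact hq.le
    obtain ⟨r, hr, hr'⟩ := Metric.eventually_nhds_iff_ball.1 hnear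
    let b : ContDiffBump p := ⟨r / 2, r, by positivity, by linarith⟩
    obtain ⟨Z, hZ⟩ := exists_JB_smoothJet (f := b) hα hα2 b.contDiff b.hasCompactSupport
    refine ⟨smoothJet b, ⟨Z, hZ⟩, ?_, b.eventuallyEq_one⟩
    refine LocSolv.approxSolv (A' := fun i j t x => A i j p.1 p.2 +
      max (-δ) (min δ (A i j t x - A i j p.1 p.2))) hA (hs _ (H + (H + H + δ)) (fun i j => ?_)
        fun i j t x => ?_) hZ fun t x hne i j => ?_
    · have h1 : Hol α H (fun (_ : ℝ) (_ : Fin d → ℝ) => A i j p.1 p.2) :=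
        (Hol.const _).mono ((hA i j).bdd _ _)
      exact h1.add (((hA i j).sub h1).clamp hδ.le)
    · simp only [Matrix.of_apply, add_sub_cancel_left]
      rw [abs_le]
      exact ⟨le_max_left _ _, max_le (by linarith) (min_le_left _ _)⟩
    · have hm : (t, x) ∈ Metric.ball p r := by
        have : (t, x) ∈ Function.support b := hne
        rwa [b.support_eq] at this
      have := abs_le.1 (hr' _ hm i j)
      dsimp only at this ⊢
      rw [min_eq_right this.2, max_eq_right this.1]; ring
  choose ζ hζ hζs hζ1 using hloc
  obtain ⟨s, -, hs⟩ := hK.elim_nhds_subcover (fun p => {q | (ζ p).u q.1 q.2 = 1})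
    fun p _ => hζ1 p
  obtain ⟨⟨Z, hZ⟩, h1, h2⟩ := approxSolv_prodJet s.toList ζ (fun k _ => hζ k) fun k _ => hζs k
  obtain ⟨δ, hδ, hI⟩ := locSolv_near_one d hα hα1
  have h3 : LocSolv α (fun (i j : Fin d) (_ : ℝ) (_ : Fin d → ℝ) => kr i j) :=
    hI _ 1 (fun i j => (Hol.const _).mono (by unfold kr; split_ifs <;> simp))
      fun i j t x => by simpa using hδ.le
  have h4 := h3.approxSolv hA hZ fun t x hne i j => by
    refine (hAK t x (fun hm => hne ?_) i j).symm
    obtain ⟨k, hk, hk1⟩ := Set.mem_iUnion₂.1 (hs hm)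
    exact h2 t x ⟨k, by simpa using hk, hk1⟩
  exact ((h1.add h4).congr fun t x => by ring).locSolv

end TVP

namespace TVP

variable {d : ℕ}

/-! ### Maximum principles -/

/-- The components of the jet are the derivatives of `u` at the point `(t, x)`. -/
structure Jet.At (J : Jet d) (t : ℝ) (x : Fin d → ℝ) : Prop where
  dt : HasDerivAt (fun s => J.u s x) (J.ut t x) t
  dx : ∀ᶠ y in 𝓝 x, HasFDerivAt (J.u t) (grad fun i => J.ux i t y) y
  dxx : ∀ i, HasFDerivAt (J.ux i t) (grad fun j => J.uxx i j t x) x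

lemma JB.at {α N₁ N₂ : ℝ} {J : Jet d} (h : JB α N₁ N₂ J) (t : ℝ) (x : Fin d → ℝ) : J.At t x :=
  ⟨h.dt t x, Eventually.of_forall (h.dx t), fun i => h.dxx i t x⟩

lemma Jet.At.add {J K : Jet d} {t : ℝ} {x : Fin d → ℝ} (hJ : J.At t x) (hK : K.At t x) :
    (J.add K).At t x := by
  refine ⟨hJ.dt.add hK.dt, ?_, fun i => ?_⟩
  · filter_upwards [hJ.dx, hK.dx] with y h1 h2
    exact (h1.add h2).congr_fderiv (grad_add _ _).symm
  · exact ((hJ.dxx i).add (hK.dxx i)).congr_fderiv (grad_add _ _).symm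

lemma Jet.At.smul (c : ℝ) {J : Jet d} {t : ℝ} {x : Fin d → ℝ} (hJ : J.At t x) :
    (J.smul c).At t x := by
  refine ⟨hJ.dt.const_mul c, ?_, fun i => ?_⟩
  · filter_upwards [hJ.dx] with y h1
    exact (h1.const_mul c).congr_fderiv (grad_smul _ _).symm
  · exact ((hJ.dxx i).const_mul c).congr_fderiv (grad_smul _ _).symm

lemma Jet.At.const (c t : ℝ) (x : Fin d → ℝ) : (Jet.const c).At t x :=
  (JB.const (α := 1) c).at t x

lemma second_deriv_nonpos {f f' : ℝ → ℝ} {c : ℝ} (h1 : ∀ᶠ s in 𝓝 0, HasDerivAt f (f' s) s)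
    (h2 : HasDerivAt f' c 0) (hm : IsLocalMax f 0) : c ≤ 0 := by
  by_contra! hc
  have e1 : deriv f =ᶠ[𝓝 0] f' := by filter_upwards [h1] with s hs using hs.deriv
  have e2 : deriv (deriv f) 0 = c := by rw [e1.deriv_eq, h2.deriv]
  have hmin := isLocalMin_of_deriv_deriv_pos (f := f) (x₀ := 0) (by rwa [e2]) hm.deriv_eq_zero
    h1.self_of_nhds.continuousAt
  have e3 : f =ᶠ[𝓝 0] fun _ => f 0 := by
    filter_upwards [hm, hmin] with s h h' using le_antisymm h h'
  have e4 : deriv f =ᶠ[𝓝 0] fun _ => 0 := by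
    refine e3.deriv.trans (Eventually.of_forall fun s => by simp)
  rw [e4.deriv_eq] at e2
  simp at e2
  exact hc.ne e2

lemma hess_nonpos {J : Jet d} {t : ℝ} {x : Fin d → ℝ} (h : J.At t x) (hm : IsLocalMax (J.u t) x)
    {A : Matrix (Fin d) (Fin d) ℝ} (hA : A.PosSemidef) :
    ∑ i, ∑ j, A i j * J.uxx i j t x ≤ 0 := by
  have key : ∀ v : Fin d → ℝ, ∑ i, ∑ j, J.uxx i j t x * v i * v j ≤ 0 := by
    intro v
    have hl : ∀ s : ℝ, HasDerivAt (fun s : ℝ => x + s • v) v s := fun s => by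
      simpa using ((hasDerivAt_id s).smul_const v).const_add x
    have hl0 : Tendsto (fun s : ℝ => x + s • v) (𝓝 0) (𝓝 x) := by
      have := (hl 0).continuousAt.tendsto
      simpa using this
    refine second_deriv_nonpos (f := fun s => J.u t (x + s • v))
      (f' := fun s => ∑ i, J.ux i t (x + s • v) * v i) ?_ ?_ ?_
    · filter_upwards [hl0.eventually h.dx] with s hs
      exact (hs.comp_hasDerivAt s (hl s)).congr_deriv (by rw [grad_apply])
    · have e : ∀ i, HasDerivAt (fun s : ℝ => J.ux i t (x + s • v) * v i)
          (∑ j, J.uxx i j t x * v i * v j) 0 := fun i => by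
        have h0 : x + (0 : ℝ) • v = x := by simp
        have := HasFDerivAt.comp_hasDerivAt (f := fun s : ℝ => x + s • v) (0 : ℝ)
          (by rw [h0]; exact h.dxx i) (hl 0)
        refine (this.mul_const (v i)).congr_deriv ?_
        rw [grad_apply, Finset.sum_mul]
        exact Finset.sum_congr rfl fun j _ => by ring
      exact HasDerivAt.fun_sum fun i _ => e i
    · have : ∀ᶠ s in 𝓝 (0 : ℝ), J.u t (x + s • v) ≤ J.u t x := hl0.eventually hm
      simpa [IsLocalMax, IsMaxFilter] using this
  obtain ⟨y, hy⟩ : ∃ y : Matrix (Fin d) (Fin d) ℝ, A = y.transpose * y := by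
    open scoped MatrixOrder in
    obtain ⟨y, hy⟩ := CStarAlgebra.nonneg_iff_eq_star_mul_self.mp hA.nonneg
    exact ⟨y, by rw [hy, Matrix.star_eq_conjTranspose, Matrix.conjTranspose_eq_transpose_of_trivial]⟩
  have e : ∑ i, ∑ j, A i j * J.uxx i j t x = ∑ k, ∑ i, ∑ j, J.uxx i j t x * y k i * y k j := by
    rw [hy]
    simp only [Matrix.mul_apply, Matrix.transpose_apply, Finset.sum_mul]
    rw [Finset.sum_congr rfl fun i _ => Finset.sum_comm, Finset.sum_comm]
    exact Finset.sum_congr rfl fun k _ => Finset.sum_congr rfl fun i _ =>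
      Finset.sum_congr rfl fun j _ => by ring
  rw [e]
  exact Finset.sum_nonpos fun k _ => key _

lemma deriv_nonneg_of_left_max {f : ℝ → ℝ} {c s r : ℝ} (h : HasDerivAt f c s) (hr : r < s)
    (hm : ∀ u ∈ Icc r s, f u ≤ f s) : 0 ≤ c := by
  have h1 := (hasDerivWithinAt_iff_tendsto_slope' (s := Iio s) (by simp)).1 h.hasDerivWithinAt
  refine ge_of_tendsto h1 ?_
  filter_upwards [Ioo_mem_nhdsLT hr] with u hu
  rw [slope_def_field]
  exact div_nonneg_of_nonpos (sub_nonpos.2 (hm u ⟨hu.1.le, hu.2.le⟩)) (sub_nonpos.2 hu.2.le)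

theorem max_principle {K : Set (Fin d → ℝ)} (hK : IsCompact K) {t₁ t₂ l : ℝ} (hl : 0 ≤ l)
    {A : Fin d → Fin d → ℝ → (Fin d → ℝ) → ℝ} {J : Jet d}
    (hc : ContinuousOn (fun p : ℝ × (Fin d → ℝ) => J.u p.1 p.2) (Icc t₁ t₂ ×ˢ K))
    (hJ : ∀ t ∈ Ioo t₁ t₂, ∀ x ∈ interior K, J.At t x)
    (hA : ∀ t ∈ Ioo t₁ t₂, ∀ x ∈ interior K, (Matrix.of fun i j => A i j t x).PosSemidef)
    (hres : ∀ t ∈ Ioo t₁ t₂, ∀ x ∈ interior K, J.res A l t x ≤ 0)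
    (h0 : ∀ x ∈ K, J.u t₁ x ≤ 0)
    (hb : ∀ t ∈ Icc t₁ t₂, ∀ x ∈ K, x ∉ interior K → J.u t x ≤ 0) :
    ∀ t ∈ Icc t₁ t₂, ∀ x ∈ K, J.u t x ≤ 0 := by
  have main : ∀ t ∈ Ico t₁ t₂, ∀ x ∈ K, J.u t x ≤ 0 := by
    intro t ht x hx
    by_contra! hpos
    set η := J.u t x with hη
    have htt : 0 ≤ t - t₁ := by linarith [ht.1]
    set ε := η / (2 * (t - t₁) + 1) with hε
    have hε0 : 0 < ε := by positivity
    have hεt : ε * (t - t₁) ≤ η / 2 := by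
      rw [hε, div_mul_eq_mul_div, div_le_div_iff₀ (by positivity) (by norm_num)]
      nlinarith
    have hsub : Icc t₁ t ×ˢ K ⊆ Icc t₁ t₂ ×ˢ K :=
      Set.prod_mono (Icc_subset_Icc_right ht.2.le) Subset.rfl
    obtain ⟨⟨s, y⟩, ⟨hs, hy⟩, hmax⟩ := (isCompact_Icc.prod hK).exists_isMaxOn
      (f := fun p : ℝ × (Fin d → ℝ) => J.u p.1 p.2 - ε * (p.1 - t₁)) ⟨(t, x), ⟨ht.1, le_rfl⟩, hx⟩
      ((hc.mono hsub).sub (by fun_prop))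
    simp only [isMaxOn_iff, Set.mem_prod, and_imp, Prod.forall] at hmax hs hy
    have hst : 0 ≤ ε * (s - t₁) := mul_nonneg hε0.le (by linarith [hs.1])
    have hu : 0 < J.u s y := by
      have := hmax t x ⟨ht.1, le_rfl⟩ hx
      rw [← hη] at this
      linarith
    have hs1 : t₁ < s := by
      rcases eq_or_lt_of_le hs.1 with e | e
      · rw [← e] at hu; linarith [h0 y hy]
      · exact e
    have hs2 : s < t₂ := hs.2.trans_lt ht.2
    have hyi : y ∈ interior K := by
      by_contra hyn
      linarith [hb s ⟨hs.1, hs2.le⟩ y hy hyn]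
    have hat := hJ s ⟨hs1, hs2⟩ y hyi
    have hloc : IsLocalMax (J.u s) y := by
      filter_upwards [mem_interior_iff_mem_nhds.1 hyi] with z hz
      have := hmax s z hs hz
      linarith
    have hH := hess_nonpos hat hloc (hA s ⟨hs1, hs2⟩ y hyi)
    have hd : HasDerivAt (fun r => J.u r y - ε * (r - t₁)) (J.ut s y - ε * 1) s :=
      hat.dt.sub (((hasDerivAt_id s).sub_const t₁).const_mul ε)
    have ht' := deriv_nonneg_of_left_max hd hs1 fun r hr => hmax r y ⟨hr.1, hr.2.trans hs.2⟩ hy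
    have hr := hres s ⟨hs1, hs2⟩ y hyi
    simp only [Jet.res] at hr
    simp only [Matrix.of_apply] at hH
    have := mul_nonneg hl hu.le
    linarith
  intro t ht x hx
  rcases eq_or_lt_of_le ht.2 with rfl | h
  · rcases eq_or_lt_of_le ht.1 with rfl | h'
    · exact h0 x hx
    · have hcx : ContinuousOn (fun s => J.u s x) (Icc t₁ t) :=
        hc.comp (f := fun s : ℝ => (s, x)) (by fun_prop) fun s hs => ⟨hs, hx⟩
      have h1 : Tendsto (fun s => J.u s x) (𝓝[Ico t₁ t] t) (𝓝 (J.u t x)) :=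
        ((hcx t ht).mono Ico_subset_Icc_self)
      have : (𝓝[Ico t₁ t] t).NeBot := by
        rw [← mem_closure_iff_nhdsWithin_neBot, closure_Ico h'.ne]
        exact ht
      exact le_of_tendsto h1 (eventually_mem_nhdsWithin.mono fun s hs => main s hs x hx)
  · exact main t ⟨ht.1, h⟩ x hx

/-- Comparison of a subsolution with a supersolution. -/
theorem comparison {K : Set (Fin d → ℝ)} (hK : IsCompact K) {t₁ t₂ l : ℝ} (hl : 0 ≤ l)
    {A : Fin d → Fin d → ℝ → (Fin d → ℝ) → ℝ} {J B : Jet d}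
    (hc : ContinuousOn (fun p : ℝ × (Fin d → ℝ) => J.u p.1 p.2) (Icc t₁ t₂ ×ˢ K))
    (hcB : ContinuousOn (fun p : ℝ × (Fin d → ℝ) => B.u p.1 p.2) (Icc t₁ t₂ ×ˢ K))
    (hJ : ∀ t ∈ Ioo t₁ t₂, ∀ x ∈ interior K, J.At t x)
    (hB : ∀ t ∈ Ioo t₁ t₂, ∀ x ∈ interior K, B.At t x)
    (hA : ∀ t ∈ Ioo t₁ t₂, ∀ x ∈ interior K, (Matrix.of fun i j => A i j t x).PosSemidef)
    (hres : ∀ t ∈ Ioo t₁ t₂, ∀ x ∈ interior K, J.res A l t x ≤ B.res A l t x)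
    (h0 : ∀ x ∈ K, J.u t₁ x ≤ B.u t₁ x)
    (hb : ∀ t ∈ Icc t₁ t₂, ∀ x ∈ K, x ∉ interior K → J.u t x ≤ B.u t x) :
    ∀ t ∈ Icc t₁ t₂, ∀ x ∈ K, J.u t x ≤ B.u t x := by
  have e : ∀ t x, (J.add (B.smul (-1))).u t x = J.u t x - B.u t x := fun t x => by
    simp only [Jet.add, Jet.smul]; ring
  have := max_principle hK hl (A := A) (J := J.add (B.smul (-1))) (t₁ := t₁) (t₂ := t₂)
    ((hc.sub hcB).congr fun p _ => e _ _)
    (fun t ht x hx => (hJ t ht x hx).add ((hB t ht x hx).smul (-1))) hA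
    (fun t ht x hx => by rw [res_add, res_smul]; linarith [hres t ht x hx])
    (fun x hx => by rw [e]; linarith [h0 x hx])
    (fun t ht x hx hn => by rw [e]; linarith [hb t ht x hx hn])
  intro t ht x hx
  linarith [this t ht x hx, e t x]

/-! ### Barriers -/

/-- The jet of `exp (μ t) (1 + ∑ p (xᵢ))`. -/
def sepJet (μ : ℝ) (p p₁ p₂ : ℝ → ℝ) : Jet d where
  u t x := Real.exp (μ * t) * (1 + ∑ i, p (x i))
  ut t x := μ * (Real.exp (μ * t) * (1 + ∑ i, p (x i)))
  ux i t x := Real.exp (μ * t) * p₁ (x i)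
  uxx i j t x := Real.exp (μ * t) * (kr i j * p₂ (x i))

lemma sepJet_at {μ : ℝ} {p p₁ p₂ : ℝ → ℝ} {t : ℝ} {x : Fin d → ℝ}
    (h1 : ∀ i, ∀ᶠ s in 𝓝 (x i), HasDerivAt p (p₁ s) s) (h2 : ∀ i, HasDerivAt p₁ (p₂ (x i)) (x i)) :
    (sepJet (d := d) μ p p₁ p₂).At t x := by
  have hi : ∀ (i : Fin d) (y : Fin d → ℝ),
      HasFDerivAt (fun y : Fin d → ℝ => y i) (grad fun j => kr i j) y := fun i y => by
    refine (hasFDerivAt_apply (𝕜 := ℝ) i y).congr_fderiv ?_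
    ext v; simp [kr]
  refine ⟨?_, ?_, fun i => ?_⟩
  · have := (((hasDerivAt_id t).const_mul μ).exp).mul_const (1 + ∑ i, p (x i))
    refine this.congr_deriv ?_
    simp only [id, sepJet]; ring
  · have : ∀ᶠ y in 𝓝 x, ∀ i, HasDerivAt p (p₁ (y i)) (y i) :=
      eventually_all.2 fun i => (continuous_apply i).continuousAt.eventually (h1 i)
    filter_upwards [this] with y hy
    have := ((HasFDerivAt.fun_sum (u := Finset.univ) fun i _ =>
      (hy i).comp_hasFDerivAt y (hi i y)).const_add 1).const_mul (Real.exp (μ * t))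
    refine this.congr_fderiv ?_
    ext v
    simp [sepJet, kr, Finset.mul_sum, mul_assoc]
  · have := ((h2 i).comp_hasFDerivAt x (hi i x)).const_mul (Real.exp (μ * t))
    refine this.congr_fderiv ?_
    ext v
    simp [sepJet, kr, mul_assoc]

lemma sepJet_res (μ : ℝ) (p p₁ p₂ : ℝ → ℝ) (A : Fin d → Fin d → ℝ → (Fin d → ℝ) → ℝ) (l t : ℝ)
    (x : Fin d → ℝ) : (sepJet μ p p₁ p₂).res A l t x =
      Real.exp (μ * t) * ((μ + l) * (1 + ∑ i, p (x i)) - 1 / 2 * ∑ i, A i i t x * p₂ (x i)) := by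
  have : ∀ i : Fin d, ∑ j, A i j t x * (Real.exp (μ * t) * (kr i j * p₂ (x i)))
      = Real.exp (μ * t) * (A i i t x * p₂ (x i)) := fun i => by
    rw [Finset.sum_eq_single i]
    · simp [kr]; ring
    · intro j _ hj; simp [kr, hj.symm]
    · simp
  simp only [Jet.res, sepJet, this, ← Finset.mul_sum]
  ring

/-- The maximum principle for bounded functions on the whole space. -/
theorem bounded_max_principle {t₁ t₂ l H B : ℝ} (hl : 0 ≤ l)
    {A : Fin d → Fin d → ℝ → (Fin d → ℝ) → ℝ} {J : Jet d}
    (hc : ContinuousOn (fun p : ℝ × (Fin d → ℝ) => J.u p.1 p.2) (Icc t₁ t₂ ×ˢ univ))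
    (hJ : ∀ t ∈ Ioo t₁ t₂, ∀ x, J.At t x)
    (hA : ∀ t ∈ Ioo t₁ t₂, ∀ x, (Matrix.of fun i j => A i j t x).PosSemidef)
    (hH : ∀ t ∈ Ioo t₁ t₂, ∀ x i, A i i t x ≤ H)
    (hB : ∀ t ∈ Icc t₁ t₂, ∀ x, J.u t x ≤ B)
    (hres : ∀ t ∈ Ioo t₁ t₂, ∀ x, J.res A l t x ≤ 0)
    (h0 : ∀ x, J.u t₁ x ≤ 0) :
    ∀ t ∈ Icc t₁ t₂, ∀ x, J.u t x ≤ 0 := by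
  intro t ht x
  set μ : ℝ := d * |H| with hμ
  have hμ0 : 0 ≤ μ := by positivity
  set W : Jet d := sepJet μ (fun s => s ^ 2) (fun s => 2 * s) (fun _ => 2) with hW
  have hWat : ∀ t x, W.At t x := fun t x => sepJet_at
    (fun i => Eventually.of_forall fun s => by simpa using hasDerivAt_pow 2 s)
    (fun i => by simpa using (hasDerivAt_id (x i)).const_mul 2)
  have hWu : ∀ t x, W.u t x = Real.exp (μ * t) * (1 + ∑ i, x i ^ 2) := fun t x => rfl
  have hWpos : ∀ t x, 0 < W.u t x := fun t x => by
    rw [hWu]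
    have := Finset.sum_nonneg fun i (_ : i ∈ Finset.univ) => sq_nonneg (x i)
    positivity
  have hWres : ∀ t ∈ Ioo t₁ t₂, ∀ x, 0 ≤ W.res A l t x := fun t ht x => by
    rw [hW, sepJet_res]
    have h2 : ∑ i, A i i t x * 2 ≤ ∑ _i : Fin d, |H| * 2 := Finset.sum_le_sum fun i _ =>
      mul_le_mul_of_nonneg_right ((hH t ht x i).trans (le_abs_self H)) (by norm_num)
    rw [Finset.sum_const, Finset.card_univ, Fintype.card_fin, nsmul_eq_mul] at h2
    have h3 := Finset.sum_nonneg fun i (_ : i ∈ Finset.univ) => sq_nonneg (x i)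
    have h4 : μ ≤ (μ + l) * (1 + ∑ i, x i ^ 2) := by nlinarith [mul_nonneg hl h3, mul_nonneg hμ0 h3]
    refine mul_nonneg (Real.exp_pos _).le ?_
    linarith
  have key : ∀ ε : ℝ, 0 < ε → J.u t x ≤ ε * W.u t x := by
    intro ε hε
    obtain ⟨R, hR, hxR, hBR⟩ : ∃ R : ℝ, 0 < R ∧ ‖x‖ ≤ R ∧
        B ≤ ε * (Real.exp (μ * t₁) * (1 + R ^ 2)) := by
      set c := ε * Real.exp (μ * t₁) with hcdef
      have hc0 : 0 < c := by positivity
      refine ⟨1 + ‖x‖ + |B| / c, by positivity, by linarith [div_nonneg (abs_nonneg B) hc0.le], ?_⟩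
      have h1 : |B| / c ≤ 1 + (1 + ‖x‖ + |B| / c) ^ 2 := by
        have := div_nonneg (abs_nonneg B) hc0.le
        nlinarith [norm_nonneg x]
      rw [div_le_iff₀ hc0] at h1
      rw [← mul_assoc, ← hcdef]
      linarith [le_abs_self B]
    have := comparison (isCompact_closedBall (0 : Fin d → ℝ) R) hl (A := A) (J := J)
      (B := W.smul ε) (t₁ := t₁) (t₂ := t₂) (hc.mono (Set.prod_mono Subset.rfl (subset_univ _)))
      (by simp only [Jet.smul, hWu]; fun_prop) (fun t ht x _ => hJ t ht x)
      (fun t ht x _ => (hWat t x).smul ε) (fun t ht x _ => hA t ht x)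
      (fun t ht x _ => by
        rw [res_smul]
        exact (hres t ht x).trans (mul_nonneg hε.le (hWres t ht x)))
      (fun x _ => (h0 x).trans (mul_nonneg hε.le (hWpos _ _).le))
      (fun s hs y hy hyi => ?_) t ht x (by simpa using hxR)
    · exact this
    · refine (hB s hs y).trans (hBR.trans ?_)
      rw [interior_closedBall _ hR.ne', Metric.mem_ball, dist_zero_right, not_lt] at hyi
      have hy2 : R ^ 2 ≤ ∑ i, y i ^ 2 := by
        have h1 : ‖y‖ ≤ √(∑ i, y i ^ 2) := (pi_norm_le_iff_of_nonneg (Real.sqrt_nonneg _)).2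
          fun i => Real.abs_le_sqrt (Finset.single_le_sum (f := fun i => y i ^ 2)
            (fun i _ => sq_nonneg _) (Finset.mem_univ i))
        exact (Real.le_sqrt' hR).1 (hyi.trans h1)
      simp only [Jet.smul, hWu]
      have : μ * t₁ ≤ μ * s := mul_le_mul_of_nonneg_left hs.1 hμ0
      gcongr
  have h1 : Tendsto (fun ε : ℝ => ε * W.u t x) (𝓝[>] 0) (𝓝 0) := by
    have : Tendsto (fun ε : ℝ => ε * W.u t x) (𝓝 0) (𝓝 (0 * W.u t x)) :=
      (continuous_id.mul continuous_const).tendsto 0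
    rw [zero_mul] at this
    exact this.mono_left nhdsWithin_le_nhds
  exact ge_of_tendsto h1 (eventually_mem_nhdsWithin.mono fun ε hε => key ε hε)

/-- A bounded ancient solution of the resolvent equation vanishes. -/
lemma ancient_nonpos {N₁ t₂ l H : ℝ} (hl : 0 < l)
    {A : Fin d → Fin d → ℝ → (Fin d → ℝ) → ℝ} {J : Jet d}
    (hJc : Continuous fun p : ℝ × (Fin d → ℝ) => J.u p.1 p.2) (hJb : ∀ t x, |J.u t x| ≤ N₁)
    (hJ : ∀ t x, J.At t x)
    (hA : ∀ t x, (Matrix.of fun i j => A i j t x).PosSemidef) (hH : ∀ i j t x, |A i j t x| ≤ H)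
    (hres : ∀ t < t₂, ∀ x, J.res A l t x = 0) : ∀ t ≤ t₂, ∀ x, J.u t x ≤ 0 := by
  intro t ht x
  have key : ∀ t₁ ≤ t, J.u t x ≤ N₁ * Real.exp (-l * (t - t₁)) := by
    intro t₁ ht₁
    set W : Jet d := (sepJet (-l) (fun _ => 0) (fun _ => 0) (fun _ => 0)) with hW
    have hWat : ∀ t x, W.At t x := fun t x => sepJet_at
      (fun i => Eventually.of_forall fun s => hasDerivAt_const s 0) (fun i => hasDerivAt_const _ 0)
    have hWu : ∀ t x, W.u t x = Real.exp (-l * t) := fun t x => by simp [hW, sepJet]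
    set c := -(N₁ * Real.exp (l * t₁)) with hcd
    have hu : ∀ s x, (J.add (W.smul c)).u s x = J.u s x - N₁ * Real.exp (-l * (s - t₁)) := by
      intro s x
      simp only [Jet.add, Jet.smul, hWu, hcd]
      rw [show -l * (s - t₁) = l * t₁ + -l * s by ring, Real.exp_add]; ring
    have hN : 0 ≤ N₁ := (abs_nonneg _).trans (hJb t x)
    have := bounded_max_principle (t₁ := t₁) (t₂ := t₂) hl.le (A := A) (J := J.add (W.smul c))
      (H := H) (B := N₁) ?_ (fun t _ x => (hJ t x).add ((hWat t x).smul c)) (fun t _ x => hA t x)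
      (fun t _ x i => (le_abs_self _).trans (hH i i t x)) (fun s hs x => ?_) (fun s hs x => ?_)
      (fun x => ?_) t ⟨ht₁, ht⟩ x
    · rw [hu] at this; linarith
    · simp only [hu]
      exact (hJc.sub (by fun_prop)).continuousOn
    · rw [hu]
      have := (abs_le.1 (hJb s x)).2
      have := mul_nonneg hN (Real.exp_pos (-l * (s - t₁))).le
      linarith
    · rw [res_add, res_smul, hres s hs.2, hW, sepJet_res]; simp
    · rw [hu]
      have := (abs_le.1 (hJb t₁ x)).2
      simpa using this
  have h1 : Tendsto (fun t₁ : ℝ => N₁ * Real.exp (-l * (t - t₁))) atBot (𝓝 0) := by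
    have h2 : Tendsto (fun t₁ : ℝ => -l * (t - t₁)) atBot atBot := by
      have : Tendsto (fun t₁ : ℝ => l * t₁ + -(l * t)) atBot atBot :=
        tendsto_atBot_add_const_right _ _ (tendsto_id.const_mul_atBot hl)
      refine this.congr fun s => by ring
    simpa using (Real.tendsto_exp_atBot.comp h2).const_mul N₁
  exact ge_of_tendsto h1 ((eventually_le_atBot t).mono fun s hs => key s hs)

/-- The jet `J` has continuous and bounded components, without any Hölder condition. -/
structure JC (N : ℝ) (J : Jet d) : Prop where
  hat : ∀ t x, J.At t x
  cu : Continuous fun p : ℝ × (Fin d → ℝ) => J.u p.1 p.2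
  cux : ∀ i, Continuous fun p : ℝ × (Fin d → ℝ) => J.ux i p.1 p.2
  bu : ∀ t x, |J.u t x| ≤ N
  bux : ∀ i t x, |J.ux i t x| ≤ N
  buxx : ∀ i j t x, |J.uxx i j t x| ≤ N

lemma JC.mono {N M : ℝ} {J : Jet d} (h : JC N J) (hNM : N ≤ M) : JC M J :=
  ⟨h.hat, h.cu, h.cux, fun t x => (h.bu t x).trans hNM, fun i t x => (h.bux i t x).trans hNM,
    fun i j t x => (h.buxx i j t x).trans hNM⟩

lemma JB.jc {α N₁ N₂ N : ℝ} {J : Jet d} (h : JB α N₁ N₂ J) (h1 : N₁ ≤ N) (h2 : N₂ ≤ N) : JC N J :=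
  ⟨h.at, h.hu.cont, fun i => (h.hux i).cont, fun t x => (h.hu.bdd t x).trans h1,
    fun i t x => ((h.hux i).bdd t x).trans h1, fun i j t x => ((h.huxx i j).bdd t x).trans h2⟩

lemma JC.add {N M : ℝ} {J K : Jet d} (hJ : JC N J) (hK : JC M K) : JC (N + M) (J.add K) :=
  ⟨fun t x => (hJ.hat t x).add (hK.hat t x), hJ.cu.add hK.cu, fun i => (hJ.cux i).add (hK.cux i),
    fun t x => (abs_add_le _ _).trans (add_le_add (hJ.bu t x) (hK.bu t x)),
    fun i t x => (abs_add_le _ _).trans (add_le_add (hJ.bux i t x) (hK.bux i t x)),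
    fun i j t x => (abs_add_le _ _).trans (add_le_add (hJ.buxx i j t x) (hK.buxx i j t x))⟩

lemma JC.smul {N : ℝ} {J : Jet d} (c : ℝ) (hJ : JC N J) : JC (|c| * N) (J.smul c) := by
  have key : ∀ y : ℝ, |y| ≤ N → |c * y| ≤ |c| * N := fun y hy => by
    rw [abs_mul]; exact mul_le_mul_of_nonneg_left hy (abs_nonneg c)
  exact ⟨fun t x => (hJ.hat t x).smul c, continuous_const.mul hJ.cu,
    fun i => continuous_const.mul (hJ.cux i), fun t x => key _ (hJ.bu t x),
    fun i t x => key _ (hJ.bux i t x), fun i j t x => key _ (hJ.buxx i j t x)⟩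

lemma ancient_unique {N M t₂ l H : ℝ} (hl : 0 < l)
    {A : Fin d → Fin d → ℝ → (Fin d → ℝ) → ℝ} {J K : Jet d} (hJ : JC N J) (hK : JC M K)
    (hA : ∀ t x, (Matrix.of fun i j => A i j t x).PosSemidef) (hH : ∀ i j t x, |A i j t x| ≤ H)
    (hres : ∀ t < t₂, ∀ x, J.res A l t x = K.res A l t x) : ∀ t ≤ t₂, ∀ x, J.u t x = K.u t x := by
  have key : ∀ {N M : ℝ} {J K : Jet d}, JC N J → JC M K →
      (∀ t < t₂, ∀ x, J.res A l t x = K.res A l t x) → ∀ t ≤ t₂, ∀ x, J.u t x ≤ K.u t x := by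
    intro N M J K hJ hK hres t ht x
    have e : ∀ t x, (J.add (K.smul (-1))).u t x = J.u t x - K.u t x := fun t x => by
      simp only [Jet.add, Jet.smul]; ring
    have h := hJ.add (hK.smul (-1))
    have := ancient_nonpos hl (A := A) (t₂ := t₂) h.cu h.bu h.hat hA hH
      (fun t ht x => by rw [res_add, res_smul, hres t ht x]; ring) t ht x
    rw [e] at this
    linarith
  exact fun t ht x => le_antisymm (key hJ hK hres t ht x)
    (key hK hJ (fun t ht x => (hres t ht x).symm) t ht x)

end TVP

namespace TVP

variable {d : ℕ}

/-! ### Interior estimates -/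

lemma lip_of_grad {f : (Fin d → ℝ) → ℝ} {f' : (Fin d → ℝ) → Fin d → ℝ} {b : ℝ}
    (h : ∀ x, HasFDerivAt f (grad (f' x)) x) (hb : ∀ x i, |f' x i| ≤ b) (x y : Fin d → ℝ) :
    |f x - f y| ≤ d * b * ‖x - y‖ := by
  have := convex_univ.norm_image_sub_le_of_norm_hasFDerivWithin_le (f := f)
    (f' := fun x => grad (f' x)) (C := d * b) (fun x _ => (h x).hasFDerivWithinAt)
    (fun x _ => norm_grad_le _ (hb x)) (Set.mem_univ y) (Set.mem_univ x)
  simpa using this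

lemma grad_interp {f : (Fin d → ℝ) → ℝ} {f' : (Fin d → ℝ) → Fin d → ℝ} {m n s : ℝ} (hs : 0 < s)
    (h : ∀ x, HasFDerivAt f (grad (f' x)) x) (hm : ∀ x, |f x| ≤ m)
    (hn : ∀ i x y, |f' x i - f' y i| ≤ n * ‖x - y‖) (x : Fin d → ℝ) (i : Fin d) :
    |f' x i| ≤ 2 * m / s + s * n := by
  have hd : ∀ r : ℝ, HasDerivAt (fun r : ℝ => f (x + r • Pi.single i (1 : ℝ)))
      (f' (x + r • Pi.single i (1 : ℝ)) i) r := fun r => by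
    have hl : HasDerivAt (fun r : ℝ => x + r • Pi.single i (1 : ℝ)) (Pi.single i (1 : ℝ)) r := by
      simpa using ((hasDerivAt_id r).smul_const (Pi.single i (1 : ℝ))).const_add x
    exact ((h _).comp_hasDerivAt r hl).congr_deriv (grad_single _ _)
  obtain ⟨r, hr, hr'⟩ := exists_hasDerivAt_eq_slope _ _ hs
    (fun r _ => (hd r).continuousAt.continuousWithinAt) fun r _ => hd r
  have h1 := hn i x (x + r • Pi.single i (1 : ℝ))
  have h2 : ‖x - (x + r • Pi.single i (1 : ℝ))‖ = r := by
    rw [sub_add_cancel_left, norm_neg, norm_smul, Pi.norm_single]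
    simp [abs_of_pos hr.1]
  have h3 : |f' (x + r • Pi.single i (1 : ℝ)) i| ≤ 2 * m / s := by
    rw [hr', sub_zero, abs_div, abs_of_pos hs]
    gcongr
    have := hm (x + s • Pi.single i (1 : ℝ)); have := hm (x + (0 : ℝ) • Pi.single i (1 : ℝ))
    exact (abs_sub _ _).trans (by linarith)
  have hn0 : 0 ≤ n := by
    have h4 := (abs_nonneg _).trans h1
    rw [h2] at h4
    exact nonneg_of_mul_nonneg_left h4 hr.1
  rw [h2] at h1
  have h5 : n * r ≤ s * n := by nlinarith [hr.2]
  have h6 := abs_sub_abs_le_abs_sub (f' x i) (f' (x + r • Pi.single i (1 : ℝ)) i)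
  linarith

/-- Composition of a jet with a rescaled function of one variable. -/
def Jet.comp (F F' F'' : ℝ → ℝ) (b c : ℝ) (J : Jet d) : Jet d where
  u t x := F (b * (J.u t x - c))
  ut t x := b * (F' (b * (J.u t x - c)) * J.ut t x)
  ux i t x := b * (F' (b * (J.u t x - c)) * J.ux i t x)
  uxx i j t x := b * (b * (F'' (b * (J.u t x - c)) * (J.ux i t x * J.ux j t x))
    + F' (b * (J.u t x - c)) * J.uxx i j t x)

lemma Hol.lip_comp {α Z M b c : ℝ} {F : ℝ → ℝ} {g : ℝ → (Fin d → ℝ) → ℝ} (hM : 0 ≤ M) (hb : 0 ≤ b)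
    (hg : Hol α Z g) (hF : ∀ y, |F y| ≤ M) (hF' : ∀ y z, |F y - F z| ≤ M * |y - z|) :
    Hol α (M * (1 + b * Z)) (fun t x => F (b * (g t x - c))) := by
  have hZ := hg.nonneg
  have hc : Continuous F := LipschitzWith.continuous (K := ⟨M, hM⟩)
    (LipschitzWith.of_dist_le_mul fun y z => by rw [Real.dist_eq, Real.dist_eq]; exact hF' y z)
  refine ⟨hc.comp (continuous_const.mul (hg.cont.sub continuous_const)), fun t x => (hF _).trans ?_,
    fun t x y => (hF' _ _).trans ?_⟩
  · have := mul_nonneg hM (mul_nonneg hb hZ)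
    linarith
  · rw [show b * (g t x - c) - b * (g t y - c) = b * (g t x - g t y) by ring, abs_mul,
      abs_of_nonneg hb, mul_assoc]
    refine mul_le_mul_of_nonneg_left ?_ hM
    have h1 : 0 ≤ ‖x - y‖ ^ α := by positivity
    have := mul_le_mul_of_nonneg_left (hg.hol t x y) hb
    linarith

lemma JB.comp {α Z M b c : ℝ} {F F' F'' : ℝ → ℝ} {J : Jet d} (hJ : JB α Z Z J) (hM : 1 ≤ M)
    (hZ : 1 ≤ Z) (hb : 1 ≤ b)
    (h1 : ∀ y, HasDerivAt F (F' y) y) (h2 : ∀ y, HasDerivAt F' (F'' y) y)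
    (hF : ∀ y, |F y| ≤ M) (hF' : ∀ y, |F' y| ≤ M) (hF'' : ∀ y, |F'' y| ≤ M)
    (lF : ∀ y z, |F y - F z| ≤ M * |y - z|) (lF' : ∀ y z, |F' y - F' z| ≤ M * |y - z|)
    (lF'' : ∀ y z, |F'' y - F'' z| ≤ M * |y - z|) :
    JB α (12 * M * Z ^ 3 * b ^ 3) (12 * M * Z ^ 3 * b ^ 3) (Jet.comp F F' F'' b c J) := by
  have hM0 : 0 ≤ M := by linarith
  have hb0 : 0 ≤ b := by linarith
  have e0 := hJ.hu.lip_comp (c := c) hM0 hb0 hF lF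
  have e1 := hJ.hu.lip_comp (c := c) hM0 hb0 hF' lF'
  have e2 := hJ.hu.lip_comp (c := c) hM0 hb0 hF'' lF''
  set W := M * (1 + b * Z) with hW
  have hW0 : 0 ≤ W := e0.nonneg
  have hW1 : W ≤ 2 * M * Z * b := by
    have : 1 ≤ b * Z := one_le_mul_of_one_le_of_one_le hb hZ
    nlinarith
  have hMZ : 1 ≤ M * Z := one_le_mul_of_one_le_of_one_le hM hZ
  have k1 : 2 * M * Z * b ≤ 12 * M * Z ^ 3 * b ^ 3 := by
    have h1 : Z * b ≤ Z ^ 3 * b ^ 3 := by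
      gcongr <;> exact le_self_pow₀ (by assumption) (by norm_num)
    have : 0 ≤ Z * b := by positivity
    nlinarith
  have k2 : b * (2 * (2 * M * Z * b * Z)) ≤ 12 * M * Z ^ 3 * b ^ 3 := by
    have h1 : Z ^ 2 * b ^ 2 ≤ Z ^ 3 * b ^ 3 := by
      gcongr <;> first | assumption | norm_num
    have : 0 ≤ Z ^ 2 * b ^ 2 := by positivity
    nlinarith
  have k3 : b * (b * (2 * (2 * M * Z * b * (2 * (Z * Z)))) + 2 * (2 * M * Z * b * Z))
      ≤ 12 * M * Z ^ 3 * b ^ 3 := by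
    have h1 : Z ^ 2 * b ^ 2 ≤ Z ^ 3 * b ^ 3 := by
      gcongr <;> first | assumption | norm_num
    have : 0 ≤ Z ^ 2 * b ^ 2 := by positivity
    nlinarith
  have hin : ∀ t x, HasFDerivAt (fun y => b * (J.u t y - c)) (grad fun i => b * J.ux i t x) x :=
    fun t x => (((hJ.dx t x).sub_const c).const_mul b).congr_fderiv (grad_smul _ _).symm
  refine ⟨fun t x => ?_, fun t x => ?_, fun i t x => ?_, e0.mono (hW1.trans k1), fun i => ?_,
    fun i j => ?_, ?_⟩
  · refine ((h1 _).comp t (((hJ.dt t x).sub_const c).const_mul b)).congr_deriv ?_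
    simp only [Jet.comp]; ring
  · refine ((h1 _).comp_hasFDerivAt x (hin t x)).congr_fderiv ?_
    rw [← grad_smul]; congr 1; funext i; simp only [Jet.comp]; ring
  · refine ((((h2 _).comp_hasFDerivAt x (hin t x)).mul (hJ.dxx i t x)).const_mul b).congr_fderiv ?_
    rw [← grad_smul, ← grad_smul, ← grad_smul, ← grad_add, ← grad_smul]
    congr 1; funext j; simp only [Jet.comp, Function.comp]; ring
  · refine ((e1.mul (hJ.hux i)).const_mul b).mono ?_
    rw [abs_of_nonneg hb0]; refine le_trans ?_ k2; gcongr
  · refine ((((e2.mul ((hJ.hux i).mul (hJ.hux j))).const_mul b).add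
      (e1.mul (hJ.huxx i j))).const_mul b).mono ?_
    rw [abs_of_nonneg hb0]; refine le_trans ?_ k3; gcongr
  · refine ((e1.mul hJ.hut).const_mul b).mono ?_
    rw [abs_of_nonneg hb0]; refine le_trans ?_ k2; gcongr

lemma JC.jetMul {α Z N : ℝ} {ζ J : Jet d} (hζ : JB α Z Z ζ) (hJ : JC N J) :
    JC (4 * (Z * N)) (ζ.mul J) := by
  have hZ := hζ.hu.nonneg
  have hN : 0 ≤ N := (abs_nonneg _).trans (hJ.bu 0 0)
  have hZN : 0 ≤ Z * N := mul_nonneg hZ hN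
  have key : ∀ {a b : ℝ}, |a| ≤ Z → |b| ≤ N → |a * b| ≤ Z * N := fun ha hb => by
    rw [abs_mul]; exact mul_le_mul ha hb (abs_nonneg _) hZ
  have huc : ∀ p : ℝ × (Fin d → ℝ), |ζ.u p.1 p.2| ≤ Z := fun p => hζ.hu.bdd _ _
  refine ⟨fun t x => ⟨(hζ.dt t x).mul (hJ.hat t x).dt, ?_, fun i => ?_⟩, hζ.hu.cont.mul hJ.cu,
    fun i => ((hζ.hux i).cont.mul hJ.cu).add (hζ.hu.cont.mul (hJ.cux i)), fun t x => ?_,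
    fun i t x => ?_, fun i j t x => ?_⟩
  · filter_upwards [(hJ.hat t x).dx] with y hy
    refine ((hζ.dx t y).mul hy).congr_fderiv ?_
    rw [← grad_smul, ← grad_smul, ← grad_add]
    congr 1; funext i; simp only [Jet.mul]; ring
  · refine (((hζ.dxx i t x).mul (hJ.hat t x).dx.self_of_nhds).add
      ((hζ.dx t x).mul ((hJ.hat t x).dxx i))).congr_fderiv ?_
    rw [← grad_smul, ← grad_smul, ← grad_add, ← grad_smul, ← grad_smul, ← grad_add, ← grad_add]
    congr 1; funext j; simp only [Jet.mul]; ring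
  · have := key (hζ.hu.bdd t x) (hJ.bu t x)
    simp only [Jet.mul]; linarith
  · have h1 := key ((hζ.hux i).bdd t x) (hJ.bu t x)
    have h2 := key (hζ.hu.bdd t x) (hJ.bux i t x)
    exact (abs_add_le _ _).trans (by linarith)
  · have h1 := key ((hζ.huxx i j).bdd t x) (hJ.bu t x)
    have h2 := key ((hζ.hux i).bdd t x) (hJ.bux j t x)
    have h3 := key ((hζ.hux j).bdd t x) (hJ.bux i t x)
    have h4 := key (hζ.hu.bdd t x) (hJ.buxx i j t x)
    simp only [Jet.mul]
    rw [abs_le] at *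
    constructor <;> linarith

/-- A smooth step with all the bounds used below. -/
lemma exists_step : ∃ (F F' F'' : ℝ → ℝ) (M : ℝ), 1 ≤ M ∧ (∀ y, HasDerivAt F (F' y) y) ∧
    (∀ y, HasDerivAt F' (F'' y) y) ∧ (∀ y, |F y| ≤ 1) ∧ (∀ y, |F' y| ≤ M) ∧ (∀ y, |F'' y| ≤ M) ∧
    (∀ y z, |F y - F z| ≤ M * |y - z|) ∧ (∀ y z, |F' y - F' z| ≤ M * |y - z|) ∧
    (∀ y z, |F'' y - F'' z| ≤ M * |y - z|) ∧ (∀ y, 1 ≤ y → F y = 1 ∧ F' y = 0) ∧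
    (∀ y, 1 < y → F'' y = 0) ∧ ∀ y < 0, F y = 0 ∧ F' y = 0 ∧ F'' y = 0 := by
  set S := Real.smoothTransition with hS
  have hc : ContDiff ℝ 4 S := Real.smoothTransition.contDiff
  have hc1 : ContDiff ℝ 3 (deriv S) := hc.deriv' 
  have hc2 : ContDiff ℝ 2 (deriv (deriv S)) := hc1.deriv'
  have hc3 : ContDiff ℝ 1 (deriv (deriv (deriv S))) := hc2.deriv'
  have z0 : ∀ y < 0, S =ᶠ[𝓝 y] fun _ => 0 := fun y hy => by
    filter_upwards [Iio_mem_nhds hy] with z hz using Real.smoothTransition.zero_of_nonpos hz.le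
  have z1 : ∀ y, 1 < y → S =ᶠ[𝓝 y] fun _ => 1 := fun y hy => by
    filter_upwards [Ioi_mem_nhds hy] with z hz using Real.smoothTransition.one_of_one_le hz.le
  have D : ∀ {f : ℝ → ℝ} {y c : ℝ}, f =ᶠ[𝓝 y] (fun _ => c) → deriv f =ᶠ[𝓝 y] fun _ => 0 :=
    fun h => h.deriv.trans (Eventually.of_forall fun s => by simp)
  have bd : ∀ {f : ℝ → ℝ}, Continuous f → (∀ y < 0, f y = 0) → (∀ y, 1 < y → f y = 0) →
      ∃ M, ∀ y, |f y| ≤ M := fun {f} hf h0 h1 => by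
    obtain ⟨M, hM⟩ := isCompact_Icc.exists_bound_of_continuousOn (s := Icc (0 : ℝ) 1) hf.continuousOn
    have hM0 := (norm_nonneg _).trans (hM 0 (by simp))
    refine ⟨M, fun y => ?_⟩
    by_cases h : y ∈ Icc (0 : ℝ) 1
    · exact hM y h
    · rw [Set.mem_Icc, not_and_or, not_le, not_le] at h
      rcases h with h | h
      · rw [h0 y h]; simpa
      · rw [h1 y h]; simpa
  obtain ⟨M1, hM1⟩ := bd hc1.continuous (fun y hy => (D (z0 y hy)).self_of_nhds)
    fun y hy => (D (z1 y hy)).self_of_nhds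
  obtain ⟨M2, hM2⟩ := bd hc2.continuous (fun y hy => (D (D (z0 y hy))).self_of_nhds)
    fun y hy => (D (D (z1 y hy))).self_of_nhds
  obtain ⟨M3, hM3⟩ := bd hc3.continuous (fun y hy => (D (D (D (z0 y hy)))).self_of_nhds)
    fun y hy => (D (D (D (z1 y hy)))).self_of_nhds
  have lip : ∀ {f : ℝ → ℝ} {M : ℝ}, Differentiable ℝ f → (∀ y, |deriv f y| ≤ M) →
      ∀ y z, |f y - f z| ≤ M * |y - z| := fun {f M} hf hM y z => by
    simpa using convex_univ.norm_image_sub_le_of_norm_deriv_le (fun x _ => hf x)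
      (fun x _ => hM x) (Set.mem_univ z) (Set.mem_univ y)
  set M := max 1 (max M1 (max M2 M3)) with hM
  have m1 : M1 ≤ M := (le_max_left _ _).trans (le_max_right _ _)
  have m2 : M2 ≤ M := (le_max_left _ _).trans ((le_max_right _ _).trans (le_max_right _ _))
  have m3 : M3 ≤ M := (le_max_right _ _).trans ((le_max_right _ _).trans (le_max_right _ _))
  have d0 := hc.differentiable (by norm_num)
  have d1 := hc1.differentiable (by norm_num)
  have d2 := hc2.differentiable (by norm_num)
  refine ⟨S, deriv S, deriv (deriv S), M, le_max_left _ _, fun y => (d0 y).hasDerivAt,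
    fun y => (d1 y).hasDerivAt, fun y => ?_, fun y => (hM1 y).trans m1, fun y => (hM2 y).trans m2,
    lip d0 fun y => (hM1 y).trans m1, lip d1 fun y => (hM2 y).trans m2,
    lip d2 fun y => (hM3 y).trans m3, fun y hy => ?_,
    fun y hy => (D (D (z1 y hy))).self_of_nhds, fun y hy => ?_⟩
  · rw [abs_of_nonneg (Real.smoothTransition.nonneg y)]
    exact Real.smoothTransition.le_one y
  · have h1 := Real.smoothTransition.one_of_one_le hy
    refine ⟨h1, IsLocalMax.deriv_eq_zero (Eventually.of_forall fun z => ?_)⟩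
    rw [hS, h1]; exact Real.smoothTransition.le_one z
  · exact ⟨(z0 y hy).self_of_nhds, (D (z0 y hy)).self_of_nhds, (D (D (z0 y hy))).self_of_nhds⟩

lemma iterate_bound {P : ℕ → ℝ → Prop} {Γ ε c D : ℝ} (hΓ : 0 ≤ Γ) (hε : ε * Γ = 1 / 2) (hc : 0 ≤ c)
    (hD : 0 ≤ D) (hstep : ∀ j b, 0 ≤ b → P (j + 1) b → P j (ε * b + c * Γ ^ j))
    (h0 : ∀ j, P j (D * Γ ^ j)) (n j : ℕ) :
    P j (Γ ^ j * ((1 / 2) ^ n * D + 2 * c * (1 - (1 / 2) ^ n))) := by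
  induction n generalizing j with
  | zero => simpa [mul_comm] using h0 j
  | succ n ih =>
    have h1 : (0 : ℝ) ≤ 1 - (1 / 2) ^ n := by
      have : ((1 : ℝ) / 2) ^ n ≤ 1 := pow_le_one₀ (by norm_num) (by norm_num)
      linarith
    have := hstep j _ (by positivity) (ih (j + 1))
    convert this using 1
    calc _ = 1 / 2 * (Γ ^ j * ((1 / 2) ^ n * D + 2 * c * (1 - (1 / 2) ^ n))) + c * Γ ^ j := by ring
      _ = _ := by rw [← hε]; ring

lemma JC.eq_of_u_eq {N M : ℝ} {J K : Jet d} (hJ : JC N J) (hK : JC M K)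
    (h : ∀ t x, J.u t x = K.u t x) :
    (∀ i t x, J.ux i t x = K.ux i t x) ∧ ∀ i j t x, J.uxx i j t x = K.uxx i j t x := by
  have h1 : ∀ t x, (fun i => J.ux i t x) = fun i => K.ux i t x := fun t x => by
    have e : J.u t = K.u t := funext (h t)
    have := (hJ.hat t x).dx.self_of_nhds
    rw [e] at this
    exact grad_injective (this.unique (hK.hat t x).dx.self_of_nhds)
  refine ⟨fun i t x => congrFun (h1 t x) i, fun i j t x => ?_⟩
  have e : J.ux i t = K.ux i t := funext fun x => congrFun (h1 t x) i
  have := (hJ.hat t x).dxx i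
  rw [e] at this
  exact congrFun (grad_injective (this.unique ((hK.hat t x).dxx i))) j

lemma interior_step {α H C l Z N N' m b τ : ℝ} (hα : 0 < α) (hα1 : α ≤ 1 / 2) (hl : 0 < l)
    {A : Fin d → Fin d → ℝ → (Fin d → ℝ) → ℝ} (hA : ∀ i j, Hol α H (A i j))
    (hpsd : ∀ t x, (Matrix.of fun i j => A i j t x).PosSemidef)
    (hs : ∀ M g, Hol α M g → ∃ J, JB α (C * M) (C * M) J ∧ ∀ t x, J.res A l t x = g t x)
    {ζ V v : Jet d} (hζ : JB α Z Z ζ) (hV : JC N V) (hv : JC N' v) (hb : 0 ≤ b)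
    (hVm : ∀ t x, |V.u t x| ≤ m) (hVxx : ∀ i j t x, |V.uxx i j t x| ≤ b)
    (hres : ∀ t x, v.res A l t x = l * (ζ.u t x * V.u t x) + comm A ζ V t x)
    (hτ : 0 < τ) (hτ1 : τ ≤ 1) :
    ∀ i j t x, |v.ux i t x| ≤ C * (2 * l + 2 + 6 * d * d * H) * (d ^ 2 + 6 * d + 9) * Z *
      (m * (τ⁻¹) ^ 6 + τ ^ 2 * b) ∧ |v.uxx i j t x| ≤
        C * (2 * l + 2 + 6 * d * d * H) * (d ^ 2 + 6 * d + 9) * Z * (m * (τ⁻¹) ^ 6 + τ ^ 2 * b) := by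
  have hα2 : α ≤ 1 := by linarith
  have hm : 0 ≤ m := (abs_nonneg _).trans (hVm 0 0)
  have hZ := hζ.hu.nonneg
  set σ := τ⁻¹ with hσ
  have hσ0 : 0 < σ := inv_pos.2 hτ
  have hσ1 : 1 ≤ σ := (one_le_inv₀ hτ).2 hτ1
  have hστ : σ * τ = 1 := inv_mul_cancel₀ hτ.ne'
  set Q := m * σ ^ 6 + τ ^ 2 * b with hQ
  have hQ0 : 0 ≤ Q := by positivity
  set n := 2 * m * σ ^ 4 + τ ^ 4 * (d * b) with hn
  have hn0 : 0 ≤ n := by positivity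
  have lux : ∀ i t x y, |V.ux i t x - V.ux i t y| ≤ d * b * ‖x - y‖ := fun i t x y =>
    lip_of_grad (fun x => (hV.hat t x).dxx i) (fun x j => hVxx i j t x) x y
  have bux : ∀ i t x, |V.ux i t x| ≤ n := fun i t x => by
    have := grad_interp (s := τ ^ 4) (m := m) (n := d * b) (by positivity)
      (fun x => (hV.hat t x).dx.self_of_nhds) (hVm t) (fun i x y => lux i t x y) x i
    rwa [div_eq_mul_inv, ← inv_pow] at this
  have lu : ∀ t x y, |V.u t x - V.u t y| ≤ d * n * ‖x - y‖ := fun t x y =>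
    lip_of_grad (fun x => (hV.hat t x).dx.self_of_nhds) (fun x i => bux i t x) x y
  have p1 : (τ ^ 4) ^ (1 / 2 : ℝ) = τ ^ 2 := by
    rw [← Real.sqrt_eq_rpow, show τ ^ 4 = (τ ^ 2) ^ 2 by ring, Real.sqrt_sq (by positivity)]
  have hτ4 : τ ^ 4 ≤ 1 := pow_le_one₀ hτ.le hτ1
  have p2 : (τ ^ 4) ^ (1 - α) ≤ τ ^ 2 := by
    rw [← p1]
    exact Real.rpow_le_rpow_of_exponent_ge (by positivity) hτ4 (by linarith)
  have p3 : ((τ ^ 4) ^ α)⁻¹ ≤ σ ^ 2 := by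
    rw [hσ, inv_pow, ← p1]
    exact inv_anti₀ (by positivity) (Real.rpow_le_rpow_of_exponent_ge (by positivity) hτ4 hα1)
  have q1 : m ≤ Q := by
    have : m * 1 ≤ m * σ ^ 6 := by gcongr; exact one_le_pow₀ hσ1
    have : 0 ≤ τ ^ 2 * b := by positivity
    linarith
  have q2 : n * σ ^ 2 ≤ (d + 2) * Q := by
    have e : n * σ ^ 2 = 2 * (m * σ ^ 6) + (σ * τ) ^ 2 * (d * (τ ^ 2 * b)) := by rw [hn]; ring
    rw [e, hστ, hQ]
    have h1 : 0 ≤ m * σ ^ 6 := by positivity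
    have h2 : 0 ≤ τ ^ 2 * b := by positivity
    have h3 : 0 ≤ (d : ℝ) * (m * σ ^ 6) := by positivity
    nlinarith
  have q3 : n ≤ (d + 2) * Q := by
    refine le_trans ?_ q2
    have : n * 1 ≤ n * σ ^ 2 := by gcongr; exact one_le_pow₀ hσ1
    linarith
  have q4 : d * b * τ ^ 2 ≤ d * Q := by
    have h1 : 0 ≤ m * σ ^ 6 := by positivity
    rw [mul_assoc]; gcongr; rw [hQ]; linarith
  have q5 : (d : ℝ) * n ≤ d * ((d + 2) * Q) := by gcongr
  have h1 : Hol α ((d ^ 2 + 6 * d + 9) * Q) V.u := by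
    refine (Hol.of_interp hα hα2 one_pos (by positivity) hV.cu hVm lu).mono ?_
    have : 0 ≤ (d : ℝ) * Q := by positivity
    rw [Real.one_rpow, Real.one_rpow]
    nlinarith
  have h2 : ∀ i, Hol α ((d ^ 2 + 6 * d + 9) * Q) (V.ux i) := fun i => by
    refine (Hol.of_interp (κ := τ ^ 4) hα hα2 (by positivity) (by positivity) (hV.cux i) (bux i)
      (lux i)).mono ?_
    have e1 : d * b * (τ ^ 4) ^ (1 - α) ≤ d * b * τ ^ 2 := by gcongr
    have e2 : 2 * n * ((τ ^ 4) ^ α)⁻¹ ≤ 2 * n * σ ^ 2 := by gcongr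
    have : 0 ≤ (d : ℝ) * Q := by positivity
    have : 0 ≤ (d : ℝ) * (d * Q) := by positivity
    nlinarith
  set D := ((d : ℝ) ^ 2 + 6 * d + 9) * Q with hD
  have hg : Hol α ((2 * l + 2 + 6 * d * d * H) * (Z * D))
      (fun t x => l * (ζ.u t x * V.u t x) + comm A ζ V t x) := by
    refine (((hζ.hu.mul h1).const_mul l).add (Hol.comm hA hζ h1 h2)).mono (le_of_eq ?_)
    rw [abs_of_pos hl]; ring
  obtain ⟨J, hJ, hJr⟩ := hs _ _ hg
  have hJc := hJ.jc le_rfl le_rfl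
  have hu : ∀ t x, v.u t x = J.u t x := fun t x =>
    ancient_unique hl hv hJc hpsd (fun i j t x => (hA i j).bdd t x) (t₂ := t)
      (fun s _ y => by rw [hres, hJr]) t le_rfl x
  obtain ⟨k1, k2⟩ := hv.eq_of_u_eq hJc hu
  intro i j t x
  rw [k1, k2]
  refine ⟨(hJc.bux i t x).trans (le_of_eq ?_), (hJc.buxx i j t x).trans (le_of_eq ?_)⟩ <;>
  · rw [hD]; ring

/-- Interior estimate for solutions of the homogeneous equation. -/
theorem interior_estimate {α H : ℝ} (hα : 0 < α) (hα1 : α ≤ 1 / 2)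
    {A : Fin d → Fin d → ℝ → (Fin d → ℝ) → ℝ} (hA : ∀ i j, Hol α H (A i j))
    (hpsd : ∀ t x, (Matrix.of fun i j => A i j t x).PosSemidef) (hs : LocSolv α A)
    (p : ℝ × (Fin d → ℝ)) {r : ℝ} (hr : 0 < r) : ∃ C : ℝ, ∀ (J : Jet d) (N m : ℝ), JC N J → 0 ≤ m →
      (∀ q ∈ Metric.ball p r, J.res A 0 q.1 q.2 = 0) → (∀ q ∈ Metric.ball p r, |J.u q.1 q.2| ≤ m) →
      ∀ q ∈ Metric.closedBall p (r / 2), ∀ i j,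
        |J.ux i q.1 q.2| ≤ C * m ∧ |J.uxx i j q.1 q.2| ≤ C * m := by
  obtain ⟨C, l, hC, hl1, hsol⟩ := hs
  have hl : 0 < l := by linarith
  have hA' : ∀ i j, Hol α |H| (A i j) := fun i j => (hA i j).mono (le_abs_self H)
  have hsol' : ∀ M g, Hol α M g → ∃ J, JB α (C * M) (C * M) J ∧ ∀ t x, J.res A l t x = g t x := by
    intro M g hg
    obtain ⟨J, hJ, hJr⟩ := hsol l le_rfl M g hg
    refine ⟨J, hJ.mono ?_ le_rfl, hJr⟩
    have h1 : (√l)⁻¹ ≤ 1 := inv_le_one_of_one_le₀ (Real.one_le_sqrt.2 hl1)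
    have h2 := hg.nonneg
    gcongr
    nlinarith
  let B : ContDiffBump p := ⟨r / 2, r, by positivity, by linarith⟩
  obtain ⟨Z₀, hZ₀⟩ := exists_JB_smoothJet (f := B) hα (by linarith) B.contDiff B.hasCompactSupport
  set Z := max 1 Z₀ with hZd
  have hZ : JB α Z Z (smoothJet B) := hZ₀.mono (le_max_right _ _) (le_max_right _ _)
  have hZ1 : 1 ≤ Z := le_max_left _ _
  obtain ⟨F, F', F'', M, hM, dF, dF', bF, bF', bF'', lF, lF', lF'', F1, F2, F0⟩ := exists_step
  set θ : ℕ → ℝ := fun j => (1 + (1 / 2) ^ j) / 4 with hθ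
  set ζ : ℕ → Jet d := fun j => Jet.comp F F' F'' (8 * 2 ^ j) (θ (j + 1)) (smoothJet B) with hζ
  set K := 12 * M * Z ^ 3 * 8 ^ 3 with hK
  have hM0 : 0 < M := by linarith
  have hK0 : 0 < K := by positivity
  have hζB : ∀ j, JB α (K * 8 ^ j) (K * 8 ^ j) (ζ j) := fun j => by
    have := hZ.comp (c := θ (j + 1)) hM hZ1 (b := 8 * 2 ^ j)
      (by have : (1 : ℝ) ≤ 2 ^ j := one_le_pow₀ (by norm_num)
          linarith)
      dF dF' (fun y => (bF y).trans hM) bF' bF'' lF lF' lF''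
    have e : 12 * M * Z ^ 3 * (8 * 2 ^ j) ^ 3 = K * 8 ^ j := by
      rw [hK, mul_pow, ← pow_mul, mul_comm j 3, pow_mul]; norm_num; ring
    rwa [e] at this
  have hθpos : ∀ j, 0 < θ j := fun j => by positivity
  have ζlow : ∀ j t x, B (t, x) < θ (j + 1) → (ζ j).u t x = 0 ∧ (ζ j).ut t x = 0 ∧
      (∀ i, (ζ j).ux i t x = 0) ∧ ∀ i k, (ζ j).uxx i k t x = 0 := by
    intro j t x h
    have h1 : 8 * 2 ^ j * ((smoothJet B).u t x - θ (j + 1)) < 0 :=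
      mul_neg_of_pos_of_neg (by positivity) (sub_neg.2 h)
    obtain ⟨e0, e1, e2⟩ := F0 _ h1
    refine ⟨e0, ?_, fun i => ?_, fun i k => ?_⟩ <;> simp only [hζ, Jet.comp, e1, e2] <;> ring
  have ζhigh : ∀ j t x, θ j ≤ B (t, x) → (ζ j).u t x = 1 ∧ ∀ i, (ζ j).ux i t x = 0 := by
    intro j t x h
    have h1 : 1 ≤ 8 * 2 ^ j * ((smoothJet B).u t x - θ (j + 1)) := by
      have e : 8 * 2 ^ j * (θ j - θ (j + 1)) = 1 := by
        simp only [hθ, pow_succ, one_div, inv_pow]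
        field_simp
        ring
      rw [← e]
      have : (smoothJet B).u t x = B (t, x) := rfl
      rw [this]; gcongr
    obtain ⟨e0, e1⟩ := F1 _ h1
    refine ⟨e0, fun i => ?_⟩
    simp only [hζ, Jet.comp, e1]; ring
  have ζle : ∀ j t x, |(ζ j).u t x| ≤ 1 := fun j t x => bF _
  set E := C * (2 * l + 2 + 6 * d * d * |H|) * (d ^ 2 + 6 * d + 9) with hE
  have hE0 : 0 < E := by positivity
  set ε : ℝ := 1 / (2 * 8 ^ 7) with hε
  set τ₀ := min 1 (ε / (E * K)) with hτ₀
  have hτ0 : 0 < τ₀ := lt_min one_pos (by positivity)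
  have hτ1 : τ₀ ≤ 1 := min_le_left _ _
  have hτε : E * K * τ₀ ≤ ε := by
    have := min_le_right 1 (ε / (E * K))
    rwa [← hτ₀, le_div_iff₀ (by positivity), mul_comm] at this
  set c := E * K * (τ₀⁻¹) ^ 6 with hc
  refine ⟨2 * c, fun J N m hJ hm hres hJm => ?_⟩
  have hN : 0 ≤ N := (abs_nonneg _).trans (hJ.bu 0 0)
  set v : ℕ → Jet d := fun j => (ζ j).mul J with hv
  have hvC : ∀ j, JC (4 * (K * 8 ^ j * N)) (v j) := fun j => hJ.jetMul (hζB j)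
  have hball : ∀ t x, 0 < B (t, x) → (t, x) ∈ Metric.ball p r := fun t x h => by
    have : (t, x) ∈ Function.support B := h.ne'
    rwa [B.support_eq] at this
  have hvm : ∀ j t x, |(v j).u t x| ≤ m := fun j t x => by
    by_cases h : B (t, x) < θ (j + 1)
    · simp only [hv, Jet.mul, (ζlow j t x h).1, zero_mul, abs_zero, hm]
    · have h1 := hJm _ (hball t x ((hθpos _).trans_le (not_lt.1 h)))
      simp only [hv, Jet.mul, abs_mul]
      calc _ ≤ 1 * m := mul_le_mul (ζle j t x) h1 (abs_nonneg _) zero_le_one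
        _ = m := one_mul m
  have hvr : ∀ j t x, (v j).res A l t x =
      l * ((ζ j).u t x * (v (j + 1)).u t x) + comm A (ζ j) (v (j + 1)) t x := by
    intro j t x
    simp only [hv]
    rw [res_mul]
    by_cases h : B (t, x) < θ (j + 1)
    · obtain ⟨e0, e1, e2, e3⟩ := ζlow j t x h
      simp only [comm, e0, e1, e2, e3]; simp
    · have h0 := hres _ (hball t x ((hθpos _).trans_le (not_lt.1 h)))
      have h1 : J.res A l t x = l * J.u t x := by
        simp only [Jet.res] at h0 ⊢
        linarith
      obtain ⟨e0, e1⟩ := ζhigh (j + 1) t x (not_lt.1 h)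
      have e2 : ((ζ (j + 1)).mul J).u t x = J.u t x := by simp only [Jet.mul, e0, one_mul]
      have e3 : ∀ i, ((ζ (j + 1)).mul J).ux i t x = J.ux i t x := fun i => by
        simp only [Jet.mul, e0, e1]; ring
      simp only [comm, e2, e3, h1]; ring
  set P : ℕ → ℝ → Prop := fun j b => ∀ i k t x, |(v j).ux i t x| ≤ b ∧ |(v j).uxx i k t x| ≤ b
    with hP
  have hstep : ∀ j b, 0 ≤ b → P (j + 1) b → P j (ε * b + c * m * (8 ^ 7) ^ j) := by
    intro j b hb hPb i k t x
    have h8 : (1 : ℝ) ≤ 8 ^ j := one_le_pow₀ (by norm_num)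
    have h8' : ((8 : ℝ) ^ j)⁻¹ ≤ 1 := inv_le_one_of_one_le₀ h8
    have hτj1 : τ₀ * (8 ^ j)⁻¹ ≤ 1 := mul_le_one₀ hτ1 (by positivity) h8'
    have := interior_step (τ := τ₀ * (8 ^ j)⁻¹) hα hα1 hl hA' hpsd hsol'
      (hζB j) (hvC (j + 1)) (hvC j) hb (hvm (j + 1)) (fun i k t x => (hPb i k t x).2) (hvr j)
      (by positivity) hτj1 i k t x
    have key : E * (K * 8 ^ j) * (m * (τ₀ * (8 ^ j)⁻¹)⁻¹ ^ 6 + (τ₀ * (8 ^ j)⁻¹) ^ 2 * b)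
        ≤ ε * b + c * m * (8 ^ 7) ^ j := by
      have e1 : E * (K * 8 ^ j) * (m * (τ₀ * (8 ^ j)⁻¹)⁻¹ ^ 6) = c * m * (8 ^ 7) ^ j := by
        rw [mul_inv, inv_inv, hc, ← pow_mul, mul_comm 7 j, pow_mul]; ring
      have e2 : E * (K * 8 ^ j) * ((τ₀ * (8 ^ j)⁻¹) ^ 2 * b)
          = (E * K * τ₀) * (τ₀ * (8 ^ j)⁻¹) * (8 ^ j * (8 ^ j)⁻¹) * b := by ring
      rw [mul_inv_cancel₀ (by positivity), mul_one] at e2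
      have e3 : (E * K * τ₀) * (τ₀ * (8 ^ j)⁻¹) ≤ ε * 1 := by gcongr
      have e4 := mul_le_mul_of_nonneg_right e3 hb
      rw [mul_add, e1, e2]
      linarith
    exact ⟨this.1.trans key, this.2.trans key⟩
  have h0 : ∀ j, P j (4 * (K * N) * (8 ^ 7) ^ j) := by
    intro j i k t x
    have e : 4 * (K * 8 ^ j * N) ≤ 4 * (K * N) * (8 ^ 7) ^ j := by
      have : (8 : ℝ) ^ j ≤ (8 ^ 7) ^ j := by gcongr; norm_num
      calc _ = 4 * (K * N) * 8 ^ j := by ring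
        _ ≤ _ := by gcongr
    exact ⟨((hvC j).bux i t x).trans e, ((hvC j).buxx i k t x).trans e⟩
  have hit := fun n => iterate_bound (P := P) (Γ := 8 ^ 7) (ε := ε) (by positivity)
    (by rw [hε]; norm_num) (by positivity : 0 ≤ c * m) (by positivity) hstep h0 n 0
  have hlim : Tendsto (fun n : ℕ => (8 ^ 7 : ℝ) ^ 0 * ((1 / 2) ^ n * (4 * (K * N))
      + 2 * (c * m) * (1 - (1 / 2) ^ n))) atTop (𝓝 (2 * c * m)) := by
    have h1 : Tendsto (fun n : ℕ => (1 / 2 : ℝ) ^ n) atTop (𝓝 0) :=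
      tendsto_pow_atTop_nhds_zero_of_lt_one (by norm_num) (by norm_num)
    have := ((h1.mul_const (4 * (K * N))).add ((h1.const_sub 1).const_mul (2 * (c * m)))).const_mul
      ((8 ^ 7 : ℝ) ^ 0)
    convert this using 2
    ring
  have hv1 : ∀ i k t x, |(v 0).ux i t x| ≤ 2 * c * m ∧ |(v 0).uxx i k t x| ≤ 2 * c * m :=
    fun i k t x => ⟨ge_of_tendsto' hlim fun n => (hit n i k t x).1,
      ge_of_tendsto' hlim fun n => (hit n i k t x).2⟩
  intro q hq i k
  obtain ⟨t, x⟩ := q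
  have hB1 : B (t, x) = 1 := B.one_of_mem_closedBall hq
  have hy : 1 < 8 * 2 ^ 0 * ((smoothJet B).u t x - θ (0 + 1)) := by
    have : (smoothJet B).u t x = B (t, x) := rfl
    rw [this, hB1, hθ]; norm_num
  obtain ⟨e0, e1⟩ := F1 _ hy.le
  have e2 := F2 _ hy
  have hx : (v 0).ux i t x = J.ux i t x := by simp only [hv, hζ, Jet.mul, Jet.comp, e0, e1]; ring
  have hxx : (v 0).uxx i k t x = J.uxx i k t x := by
    simp only [hv, hζ, Jet.mul, Jet.comp, e0, e1, e2]; ring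
  rw [← hx, ← hxx]
  exact hv1 i k t x

end TVP

namespace TVP

variable {d : ℕ}

/-! ### Compact boxes exhausting the orthant -/

/-- The box `[b⁻¹, b]^d`. -/
def box (d : ℕ) (b : ℝ) : Set (Fin d → ℝ) := {x | ∀ i, b⁻¹ ≤ x i ∧ x i ≤ b}

/-- The nearest point retraction onto the box. -/
def boxClamp (b : ℝ) (x : Fin d → ℝ) : Fin d → ℝ := fun i => max b⁻¹ (min b (x i))

lemma box_eq (b : ℝ) : box d b = Set.pi univ fun _ => Icc b⁻¹ b := by
  ext x; simp only [box, Set.mem_pi, Set.mem_univ, true_imp_iff, Set.mem_Icc]; rfl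

lemma isCompact_box (b : ℝ) : IsCompact (box d b) := by
  rw [box_eq]; exact isCompact_univ_pi fun _ => isCompact_Icc

lemma interior_box (b : ℝ) : interior (box d b) = {x | ∀ i, b⁻¹ < x i ∧ x i < b} := by
  rw [box_eq, interior_pi_set (Set.toFinite _)]
  ext x; simp [Set.mem_pi, interior_Icc]

lemma box_subset_posOrth {b : ℝ} (hb : 0 < b) : box d b ⊆ posOrth d :=
  fun _ hx i => (inv_pos.2 hb).trans_le (hx i).1

lemma box_mono {b c : ℝ} (hb : 0 < b) (hbc : b ≤ c) : box d b ⊆ box d c :=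
  fun _ hx i => ⟨(inv_anti₀ hb hbc).trans (hx i).1, (hx i).2.trans hbc⟩

lemma box_subset_interior {b c : ℝ} (hb : 0 < b) (hbc : b < c) :
    box d b ⊆ interior (box d c) := by
  rw [interior_box]
  exact fun _ hx i => ⟨(inv_strictAnti₀ hb hbc).trans_le (hx i).1, (hx i).2.trans_lt hbc⟩

lemma exists_mem_box {x : Fin d → ℝ} (hx : x ∈ posOrth d) : ∃ b, 1 ≤ b ∧ x ∈ box d b := by
  refine ⟨1 + ∑ i, (x i + (x i)⁻¹), ?_, fun i => ?_⟩
  · have := Finset.sum_nonneg (s := Finset.univ) fun i _ =>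
      (add_pos (hx i) (inv_pos.2 (hx i))).le
    linarith
  · have h1 := Finset.single_le_sum (s := Finset.univ) (f := fun i => x i + (x i)⁻¹)
      (fun i _ => (add_pos (hx i) (inv_pos.2 (hx i))).le) (Finset.mem_univ i)
    have h2 := inv_pos.2 (hx i)
    have h3 := hx i
    refine ⟨inv_le_of_inv_le₀ h3 (by linarith), by linarith⟩

lemma boxClamp_mem {b : ℝ} (hb : 1 ≤ b) (x : Fin d → ℝ) : boxClamp b x ∈ box d b :=
  fun _ => ⟨le_max_left _ _, max_le ((inv_le_one_of_one_le₀ hb).trans hb) (min_le_left _ _)⟩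

lemma boxClamp_of_mem {b : ℝ} {x : Fin d → ℝ} (hx : x ∈ box d b) : boxClamp b x = x := by
  funext i
  rw [boxClamp, min_eq_right (hx i).2, max_eq_right (hx i).1]

lemma continuous_boxClamp (b : ℝ) : Continuous (boxClamp b : (Fin d → ℝ) → _) := by
  unfold boxClamp; fun_prop

lemma abs_clamp_sub_le (a b x y : ℝ) : |max a (min b x) - max a (min b y)| ≤ |x - y| := by
  rw [max_comm a, max_comm a, min_comm b, min_comm b]
  refine (abs_max_sub_max_le_abs _ _ _).trans ?_
  simpa using abs_min_sub_min_le_max x b y b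

lemma dist_boxClamp_le (b : ℝ) (x y : Fin d → ℝ) : dist (boxClamp b x) (boxClamp b y) ≤ dist x y :=
  (dist_pi_le_iff dist_nonneg).2 fun i => by
    rw [Real.dist_eq]
    exact (abs_clamp_sub_le _ _ _ _).trans (by rw [← Real.dist_eq]; exact dist_le_pi_dist x y i)

lemma exists_of_mem_frontier_box {b : ℝ} {x : Fin d → ℝ} (hx : x ∈ box d b)
    (hi : x ∉ interior (box d b)) : ∃ i, x i = b⁻¹ ∨ x i = b := by
  rw [interior_box] at hi
  by_contra! h
  exact hi fun i => ⟨lt_of_le_of_ne (hx i).1 (h i).1.symm, lt_of_le_of_ne (hx i).2 (h i).2⟩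

/-! ### Local Hölder continuity on compact sets -/

lemma _root_.LocallyHolderOn.holder_of_compact {E : Type*} [MetricSpace E] {f : E → ℝ} {s K : Set E}
    (hf : LocallyHolderOn f s) (hK : IsCompact K) (hKs : K ⊆ s) (hc : ContinuousOn f K) :
    ∃ α₀ C : ℝ, 0 < α₀ ∧ 0 ≤ C ∧ ∀ α, 0 < α → α ≤ α₀ → α ≤ 1 → ∀ q ∈ K, ∀ q' ∈ K,
      |f q - f q'| ≤ C * dist q q' ^ α := by
  obtain ⟨M, hM⟩ := hK.exists_bound_of_continuousOn hc
  have main : ∃ α₀ C : ℝ, 0 < α₀ ∧ 0 ≤ C ∧ ∀ α, 0 < α → α ≤ α₀ → α ≤ 1 → ∀ r ∈ K ×ˢ K,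
      |f r.1 - f r.2| ≤ C * (min (dist r.1 r.2) 1) ^ α := by
    refine (hK.prod hK).induction_on (p := fun V => ∃ α₀ C : ℝ, 0 < α₀ ∧ 0 ≤ C ∧
      ∀ α, 0 < α → α ≤ α₀ → α ≤ 1 → ∀ r ∈ V, |f r.1 - f r.2| ≤ C * (min (dist r.1 r.2) 1) ^ α)
      ⟨1, 0, one_pos, le_rfl, by simp⟩ ?_ ?_ ?_
    · rintro V W hVW ⟨α₀, C, h1, h2, h⟩
      exact ⟨α₀, C, h1, h2, fun α hα hα0 hα1 r hr => h α hα hα0 hα1 r (hVW hr)⟩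
    · rintro V W ⟨α₀, C, h1, h2, h⟩ ⟨β₀, D, k1, k2, k⟩
      refine ⟨min α₀ β₀, max C D, lt_min h1 k1, le_max_of_le_left h2, fun α hα hα0 hα1 r hr => ?_⟩
      have hp : 0 ≤ (min (dist r.1 r.2) 1) ^ α :=
        Real.rpow_nonneg (le_min dist_nonneg zero_le_one) _
      rcases hr with hr | hr
      · exact (h α hα (hα0.trans (min_le_left _ _)) hα1 r hr).trans
          (mul_le_mul_of_nonneg_right (le_max_left _ _) hp)
      · exact (k α hα (hα0.trans (min_le_right _ _)) hα1 r hr).trans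
          (mul_le_mul_of_nonneg_right (le_max_right _ _) hp)
    · rintro ⟨q, q'⟩ ⟨hq, hq'⟩
      have hM0 : 0 ≤ M := (norm_nonneg _).trans (hM q hq)
      rcases eq_or_ne q q' with rfl | hne
      · obtain ⟨U, hU, β, C, hβ, hβ1, hC, h⟩ := hf q (hKs hq)
        have hU' : U ∈ 𝓝[K] q := nhdsWithin_mono q hKs hU
        refine ⟨(U ×ˢ U) ∩ {r | dist r.1 r.2 < 1}, ?_, β, C, hβ, hC, fun α hα hα0 hα1 r hr => ?_⟩
        · refine inter_mem ?_ (mem_nhdsWithin_of_mem_nhds ?_)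
          · rw [nhdsWithin_prod_eq]; exact prod_mem_prod hU' hU'
          · exact (isOpen_lt (by fun_prop) continuous_const).mem_nhds (by simp)
        · have h1 : dist r.1 r.2 < 1 := hr.2
          rw [min_eq_left h1.le]
          refine (h _ hr.1.1 _ hr.1.2).trans (mul_le_mul_of_nonneg_left ?_ hC)
          exact Real.rpow_le_rpow_of_exponent_ge_of_imp dist_nonneg h1.le hα0
            (fun _ h => absurd h hβ.ne')
      · have hd : 0 < dist q q' := dist_pos.2 hne
        set c := min (dist q q' / 2) 1 with hcdef
        have hc0 : 0 < c := lt_min (by linarith) one_pos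
        refine ⟨(K ×ˢ K) ∩ {r | dist q q' / 2 < dist r.1 r.2}, ?_, 1, 2 * M / c, one_pos,
          by positivity, fun α hα hα0 hα1 r hr => ?_⟩
        · refine inter_mem self_mem_nhdsWithin (mem_nhdsWithin_of_mem_nhds ?_)
          exact (isOpen_lt continuous_const (by fun_prop)).mem_nhds (half_lt_self hd)
        · have h2 : c ≤ min (dist r.1 r.2) 1 := min_le_min_right _ (le_of_lt hr.2)
          have h3 : c ≤ (min (dist r.1 r.2) 1) ^ α := h2.trans (by
            have := Real.rpow_le_rpow_of_exponent_ge (hc0.trans_le h2) (min_le_right _ _) hα1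
            rwa [Real.rpow_one] at this)
          have h4 := hM _ hr.1.1
          have h5 := hM _ hr.1.2
          rw [Real.norm_eq_abs] at h4 h5
          calc |f r.1 - f r.2| ≤ 2 * M := (abs_sub _ _).trans (by linarith)
            _ = 2 * M / c * c := by field_simp
            _ ≤ _ := mul_le_mul_of_nonneg_left h3 (by positivity)
  obtain ⟨α₀, C, h1, h2, h⟩ := main
  refine ⟨α₀, C, h1, h2, fun α hα hα0 hα1 q hq q' hq' => ?_⟩
  refine (h α hα hα0 hα1 (q, q') ⟨hq, hq'⟩).trans (mul_le_mul_of_nonneg_left ?_ h2)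
  exact Real.rpow_le_rpow (le_min dist_nonneg zero_le_one) (min_le_left _ _) hα.le

/-! ### Coefficients on the orthant and their cutoffs -/

/-- Standing assumptions on the coefficients `Aᵢⱼ(t, x)` (in reversed time). -/
structure Coef (Cb : ℝ) (A : Fin d → Fin d → ℝ → (Fin d → ℝ) → ℝ) : Prop where
  nonneg : 0 ≤ Cb
  cont : ∀ i j, ContinuousOn (fun p : ℝ × (Fin d → ℝ) => A i j p.1 p.2) (Set.Ici 0 ×ˢ posOrth d)
  hol : ∀ i j, LocallyHolderOn (fun p : ℝ × (Fin d → ℝ) => A i j p.1 p.2) (Set.Ioi 0 ×ˢ posOrth d)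
  pd : ∀ t, 0 ≤ t → ∀ x ∈ posOrth d, (Matrix.of fun i j => A i j t x).PosDef
  bdd : ∀ t, 0 ≤ t → ∀ x ∈ posOrth d, ∀ i j, |A i j t x| ≤ Cb * (x i * x j)

variable {A : Fin d → Fin d → ℝ → (Fin d → ℝ) → ℝ} {Cb : ℝ}

lemma Coef.bdd_box (hA : Coef Cb A) {b t : ℝ} (hb : 1 ≤ b) (ht : 0 ≤ t) {x : Fin d → ℝ}
    (hx : x ∈ box d b) (i j : Fin d) : |A i j t x| ≤ Cb * b ^ 2 := by
  have hp := box_subset_posOrth (by linarith) hx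
  refine (hA.bdd t ht x hp i j).trans (mul_le_mul_of_nonneg_left ?_ hA.nonneg)
  nlinarith [(hx i).2, (hx j).2, hp i, hp j]

theorem Coef.exists_cutoff (hA : Coef Cb A) {b S δ : ℝ} (hb : 1 ≤ b) (hδ : 0 < δ) (hδS : δ ≤ S) :
    ∃ (α H : ℝ) (A' : Fin d → Fin d → ℝ → (Fin d → ℝ) → ℝ), 0 < α ∧ α ≤ 1 / 2 ∧
      (∀ i j, Hol α H (A' i j)) ∧ (∀ t x, (Matrix.of fun i j => A' i j t x).PosDef) ∧
      LocSolv α A' ∧ (∀ t ∈ Icc δ S, ∀ x ∈ box d b, ∀ i j, A' i j t x = A i j t x) ∧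
      ∀ i j t x, |A' i j t x| ≤ 1 + Cb * b ^ 2 := by
  set K : Set (ℝ × (Fin d → ℝ)) := Icc δ S ×ˢ box d b with hKdef
  have hK : IsCompact K := isCompact_Icc.prod (isCompact_box b)
  have hKs : K ⊆ Set.Ioi 0 ×ˢ posOrth d := Set.prod_mono (fun t ht => hδ.trans_le ht.1)
    (box_subset_posOrth (by linarith))
  have hKc : ∀ i j, ContinuousOn (fun p : ℝ × (Fin d → ℝ) => A i j p.1 p.2) K := fun i j =>
    (hA.cont i j).mono (hKs.trans (Set.prod_mono Set.Ioi_subset_Ici_self Subset.rfl))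
  choose α₀ C hα₀ hC hol using fun i j => (hA.hol i j).holder_of_compact hK hKs (hKc i j)
  obtain ⟨α, hα, hα2, hαα⟩ : ∃ α : ℝ, 0 < α ∧ α ≤ 1 / 2 ∧ ∀ i j, α ≤ α₀ i j := by
    have h1 : ∀ᶠ α : ℝ in 𝓝[>] 0, α ≤ 1 / 2 ∧ ∀ i j, α ≤ α₀ i j := by
      refine eventually_nhdsWithin_of_eventually_nhds (Filter.Eventually.and ?_ ?_)
      · exact (eventually_le_nhds (by norm_num))
      · exact eventually_all.2 fun i => eventually_all.2 fun j => eventually_le_nhds (hα₀ i j)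
    obtain ⟨α, h1, h2⟩ := (h1.and self_mem_nhdsWithin).exists
    exact ⟨α, h2, h1⟩
  have hα1 : α ≤ 1 := by linarith
  set cl : ℝ → (Fin d → ℝ) → ℝ × (Fin d → ℝ) := fun t x => (max δ (min S t), boxClamp b x) with hcl
  have hclK : ∀ t x, cl t x ∈ K := fun t x =>
    ⟨⟨le_max_left _ _, max_le hδS (min_le_left _ _)⟩, boxClamp_mem hb x⟩
  have hclc : Continuous fun p : ℝ × (Fin d → ℝ) => cl p.1 p.2 := by
    have := continuous_boxClamp (d := d) b
    simp only [hcl]; fun_prop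
  set χ : ℝ → (Fin d → ℝ) → ℝ := fun t x => max 0 (1 - Metric.infDist (t, x) K) with hχ
  have hχ0 : ∀ t x, 0 ≤ χ t x := fun t x => le_max_left _ _
  have hχ1 : ∀ t x, χ t x ≤ 1 := fun t x =>
    max_le zero_le_one (by linarith [Metric.infDist_nonneg (x := (t, x)) (s := K)])
  have hχH : Hol α (2 * 1 + |1|) χ := by
    refine Hol.of_lip hα hα1 ?_ (fun t x => abs_le.2 ⟨by linarith [hχ0 t x], hχ1 t x⟩)
      fun t x y => ?_
    · have := Metric.continuous_infDist_pt K
      simp only [hχ]; fun_prop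
    · have h1 := (Metric.lipschitz_infDist_pt K).dist_le_mul (t, x) (t, y)
      simp only [hχ]
      rw [max_comm 0, max_comm 0]
      refine (abs_max_sub_max_le_abs _ _ _).trans ?_
      rw [Real.dist_eq, abs_sub_comm] at h1
      have h2 : dist ((t, x) : ℝ × (Fin d → ℝ)) (t, y) = ‖x - y‖ := by
        simp [dist_eq_norm]
      rw [h2] at h1
      rw [show 1 - Metric.infDist (t, x) K - (1 - Metric.infDist (t, y) K)
        = Metric.infDist (t, y) K - Metric.infDist (t, x) K by ring]
      simpa using h1
  have hAH : ∀ i j, ∃ H, Hol α H (fun t x => A i j (cl t x).1 (cl t x).2) := by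
    intro i j
    refine ⟨max (Cb * b ^ 2) (C i j), ?_, fun t x => ?_, fun t x y => ?_⟩
    · exact (hKc i j).comp_continuous hclc fun p => hclK _ _
    · exact (hA.bdd_box hb (hδ.le.trans (hclK t x).1.1) (hclK t x).2 i j).trans (le_max_left _ _)
    · refine (hol i j α hα (hαα i j) hα1 _ (hclK t x) _ (hclK t y)).trans ?_
      refine mul_le_mul (le_max_right _ _) (Real.rpow_le_rpow dist_nonneg ?_ hα.le)
        (Real.rpow_nonneg dist_nonneg _) ((hC i j).trans (le_max_right _ _))
      rw [Prod.dist_eq, ← dist_eq_norm]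
      simpa [hcl] using dist_boxClamp_le b x y
  choose H' hAH using hAH
  set A' : Fin d → Fin d → ℝ → (Fin d → ℝ) → ℝ := fun i j t x =>
    kr i j + χ t x * (A i j (cl t x).1 (cl t x).2 - kr i j) with hA'
  have hA'H : ∀ i j, ∃ H, Hol α H (A' i j) := fun i j =>
    ⟨_, (Hol.const (kr i j)).add (hχH.mul ((hAH i j).sub (Hol.const (kr i j))))⟩
  choose H'' hA'H using hA'H
  have hA'H : ∀ i j, Hol α (∑ i, ∑ j, H'' i j) (A' i j) := fun i j => (hA'H i j).mono
    ((Finset.single_le_sum (f := fun j => H'' i j) (fun j _ => (hA'H i j).nonneg)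
      (Finset.mem_univ j)).trans (Finset.single_le_sum (f := fun i => ∑ j, H'' i j)
        (fun i _ => Finset.sum_nonneg fun j _ => (hA'H i j).nonneg) (Finset.mem_univ i)))
  have hpd : ∀ t x, (Matrix.of fun i j => A' i j t x).PosDef := by
    intro t x
    have h1 := hA.pd (cl t x).1 (hδ.le.trans (hclK t x).1.1) (cl t x).2
      (box_subset_posOrth (by linarith) (hclK t x).2)
    have e : (Matrix.of fun i j => A' i j t x) = (1 - χ t x) • (1 : Matrix (Fin d) (Fin d) ℝ)
        + χ t x • (Matrix.of fun i j => A i j (cl t x).1 (cl t x).2) := by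
      ext i j
      simp only [hA', Matrix.of_apply, Matrix.add_apply, Matrix.smul_apply, Matrix.one_apply, kr,
        smul_eq_mul]
      ring
    rw [e]
    rcases (hχ0 t x).eq_or_lt with h0 | h0
    · rw [← h0]; simpa using Matrix.PosDef.one
    · exact Matrix.PosDef.posSemidef_add
        (Matrix.PosDef.one.posSemidef.smul (by linarith [hχ1 t x])) (h1.smul h0)
  refine ⟨α, _, A', hα, hα2, hA'H, hpd, locSolv_of_compact hα hα2 hA'H hpd
    (hK.cthickening (r := 1)) fun t x hx i j => ?_, fun t ht x hx i j => ?_, fun i j t x => ?_⟩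
  · have h1 : χ t x = 0 := by
      simp only [hχ]
      refine max_eq_left ?_
      by_contra! h
      apply hx
      have hne : K.Nonempty := ⟨_, hclK 0 0⟩
      obtain ⟨y, hy, hyd⟩ := hK.exists_infDist_eq_dist hne (t, x)
      exact Metric.mem_cthickening_of_dist_le _ y _ _ hy (by linarith)
    simp [hA', h1]
  · have h1 : χ t x = 1 := by
      simp only [hχ]
      rw [Metric.infDist_zero_of_mem (show (t, x) ∈ K from ⟨ht, hx⟩)]; simp
    simp only [hA', h1, hcl, boxClamp_of_mem hx, min_eq_right ht.2, max_eq_right ht.1]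
    ring
  · have h1 := hA.bdd_box hb (hδ.le.trans (hclK t x).1.1) (hclK t x).2 i j
    have h2 : |(kr i j : ℝ)| ≤ 1 := by unfold kr; split_ifs <;> simp
    have e : A' i j t x = (1 - χ t x) * kr i j + χ t x * A i j (cl t x).1 (cl t x).2 := by
      simp only [hA']; ring
    rw [e]
    refine (abs_add_le _ _).trans ?_
    rw [abs_mul, abs_mul, abs_of_nonneg (hχ0 t x), abs_of_nonneg (by linarith [hχ1 t x])]
    have := hχ0 t x
    have := hχ1 t x
    have h3 : 0 ≤ Cb * b ^ 2 := (abs_nonneg _).trans h1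
    have h4 := mul_le_mul_of_nonneg_left h1 (hχ0 t x)
    have h5 := mul_le_mul_of_nonneg_left h2 (show 0 ≤ 1 - χ t x by linarith)
    nlinarith

end TVP

namespace TVP

variable {d : ℕ}

/-! ### Approximate solutions with smooth initial data -/

lemma Hol.of_time {α M : ℝ} {k : ℝ → ℝ} (hk : Continuous k) (hM : ∀ t, |k t| ≤ M) :
    Hol (d := d) α M (fun t _ => k t) :=
  ⟨by fun_prop, fun t _ => hM t, fun t x y => by
    have : 0 ≤ M := (abs_nonneg _).trans (hM t)
    simp; positivity⟩

/-- A function of space alone, as a jet. -/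
lemma exists_spaceJet {φ : (Fin d → ℝ) → ℝ} (hφ : ContDiff ℝ 3 φ) (hc : HasCompactSupport φ) :
    ∃ Φ : Jet d, (∀ t x, Φ.u t x = φ x) ∧ (∀ t x, Φ.ut t x = 0) ∧
      (∃ B, 0 ≤ B ∧ ∀ i j t x, |Φ.uxx i j t x| ≤ B) ∧
      ∀ α, 0 < α → α ≤ 1 → ∃ Z, JB α Z Z Φ := by
  let b : ContDiffBump (0 : ℝ) := ⟨1, 2, one_pos, one_lt_two⟩
  set F : ℝ × (Fin d → ℝ) → ℝ := fun p => b p.1 * φ p.2 with hF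
  have hFc : ContDiff ℝ 3 F := (b.contDiff.comp contDiff_fst).mul (hφ.comp contDiff_snd)
  have hFs : HasCompactSupport F := by
    refine HasCompactSupport.intro (b.hasCompactSupport.isCompact.prod hc.isCompact) fun p hp => ?_
    rw [Set.mem_prod, not_and_or] at hp
    rcases hp with hp | hp
    · simp only [hF]; rw [image_eq_zero_of_notMem_tsupport hp, zero_mul]
    · simp only [hF]; rw [image_eq_zero_of_notMem_tsupport hp, mul_zero]
  have hb0 : b 0 = 1 := b.one_of_mem_closedBall (by simp [b])
  set K := smoothJet F with hK
  set Φ : Jet d := ⟨fun _ x => K.u 0 x, fun _ _ => 0, fun i _ x => K.ux i 0 x,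
    fun i j _ x => K.uxx i j 0 x⟩ with hΦ
  have hfreeze : ∀ {α M : ℝ} {g : ℝ → (Fin d → ℝ) → ℝ}, Hol α M g → Hol α M (fun _ x => g 0 x) :=
    fun h => ⟨h.cont.comp (continuous_const.prodMk continuous_snd), fun _ x => h.bdd 0 x,
      fun _ x y => h.hol 0 x y⟩
  have hJB : ∀ α, 0 < α → α ≤ 1 → ∃ Z, JB α Z Z Φ := by
    intro α hα hα1
    obtain ⟨Z, hZ⟩ := exists_JB_smoothJet hα hα1 hFc hFs
    exact ⟨Z, fun t x => hasDerivAt_const t _, fun t x => hZ.dx 0 x, fun i t x => hZ.dxx i 0 x,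
      hfreeze hZ.hu, fun i => hfreeze (hZ.hux i), fun i j => hfreeze (hZ.huxx i j),
      Hol.zero.mono hZ.hu.nonneg⟩
  obtain ⟨Z, hZ⟩ := hJB 1 one_pos le_rfl
  exact ⟨Φ, fun t x => by simp [hΦ, hK, smoothJet, hF, hb0], fun t x => rfl,
    ⟨Z, hZ.hu.nonneg, fun i j => (hZ.huxx i j).bdd⟩, hJB⟩

/-- A function of time alone which is `exp (l t)` on a given interval, as a jet. -/
lemma exists_expJet (α l S : ℝ) (hS : 0 < S) :
    ∃ (E : Jet d) (Z : ℝ), JB α Z Z E ∧ (∀ i t x, E.ux i t x = 0) ∧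
      (∀ i j t x, E.uxx i j t x = 0) ∧
      ∀ t, 0 ≤ t → t ≤ S → ∀ x, E.u t x = Real.exp (l * t) ∧ E.ut t x = l * Real.exp (l * t) := by
  let b : ContDiffBump (0 : ℝ) := ⟨S + 1, S + 2, by linarith, by linarith⟩
  set e : ℝ → ℝ := fun t => b t * Real.exp (l * t) with he
  have hec : ContDiff ℝ 1 e := b.contDiff.mul (by fun_prop)
  have hes : HasCompactSupport e := b.hasCompactSupport.mul_right
  obtain ⟨M, hM⟩ := hes.exists_bound_of_continuous hec.continuous
  have hdc : Continuous (deriv e) := hec.continuous_deriv le_rfl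
  obtain ⟨M', hM'⟩ := hes.deriv.exists_bound_of_continuous hdc
  refine ⟨⟨fun t _ => e t, fun t _ => deriv e t, fun _ _ _ => 0, fun _ _ _ _ => 0⟩, max M M',
    ⟨fun t x => (hec.differentiable one_ne_zero t).hasDerivAt, fun t x => ?_, fun i t x => ?_,
      Hol.of_time hec.continuous fun t => (hM t).trans (le_max_left _ _),
      fun i => Hol.zero.mono (((norm_nonneg _).trans (hM 0)).trans (le_max_left _ _)),
      fun i j => Hol.zero.mono (((norm_nonneg _).trans (hM 0)).trans (le_max_left _ _)),
      Hol.of_time hdc fun t => (hM' t).trans (le_max_right _ _)⟩, fun _ _ _ => rfl,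
    fun _ _ _ _ => rfl, fun t ht0 htS x => ?_⟩
  · simpa only [grad_zero] using hasFDerivAt_const _ x
  · simpa only [grad_zero] using hasFDerivAt_const _ x
  · have hev : e =ᶠ[𝓝 t] fun t => Real.exp (l * t) := by
      have : Metric.ball (0 : ℝ) (S + 1) ∈ 𝓝 t := Metric.isOpen_ball.mem_nhds (by
        rw [Metric.mem_ball, dist_zero_right, Real.norm_eq_abs, abs_of_nonneg ht0]; linarith)
      filter_upwards [this] with s hs
      simp only [he]
      rw [b.one_of_mem_closedBall (Metric.ball_subset_closedBall hs), one_mul]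
    refine ⟨hev.eq_of_nhds, ?_⟩
    change deriv e t = _
    rw [hev.deriv_eq]
    have : HasDerivAt (fun t => Real.exp (l * t)) (Real.exp (l * t) * (l * 1)) t :=
      ((hasDerivAt_id t).const_mul l).exp
    rw [this.deriv]; ring

theorem exists_approximant {α H : ℝ} (hα : 0 < α) (hα1 : α ≤ 1 / 2)
    {A : Fin d → Fin d → ℝ → (Fin d → ℝ) → ℝ} (hA : ∀ i j, Hol α H (A i j))
    (hpd : ∀ t x, (Matrix.of fun i j => A i j t x).PosDef) (hs : LocSolv α A)
    {Φ : Jet d} {Z B M S δ : ℝ} (hΦ : JB α Z Z Φ) (hΦt : ∀ t x, Φ.ut t x = 0)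
    (hB : ∀ t x, |Φ.u t x| ≤ B)
    (hM : ∀ t x, |(1 / 2) * ∑ i, ∑ j, A i j t x * Φ.uxx i j t x| ≤ M)
    (hδ : 0 < δ) (hδS : δ < S) :
    ∃ (U : Jet d) (N : ℝ), JB α N N U ∧ (∀ t ∈ Set.Icc δ S, ∀ x, U.res A 0 t x = 0) ∧
      (∀ t ∈ Set.Icc 0 S, ∀ x, |U.u t x - Φ.u t x| ≤ M * t) ∧
      ∀ t ∈ Set.Icc 0 S, ∀ x, |U.u t x| ≤ B + M * δ := by
  have hM0 : 0 ≤ M := (abs_nonneg _).trans (hM 0 0)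
  have hS : 0 < S := hδ.trans hδS
  have hpsd : ∀ t x, (Matrix.of fun i j => A i j t x).PosSemidef := fun t x => (hpd t x).posSemidef
  obtain ⟨C, l, hC, hl, hsol⟩ := hs
  have hl0 : 0 < l := by linarith
  set k : ℝ → ℝ := fun t => max 0 (min 1 (t / δ)) * Real.exp (-l * max t 0) with hk
  have hkc : Continuous k := by simp only [hk]; fun_prop
  have hθ : ∀ t, 0 ≤ max 0 (min 1 (t / δ)) ∧ max 0 (min 1 (t / δ)) ≤ 1 := fun t =>
    ⟨le_max_left _ _, max_le zero_le_one (min_le_left _ _)⟩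
  have hkb : ∀ t, |k t| ≤ 1 := fun t => by
    rw [abs_mul, abs_of_nonneg (hθ t).1, abs_of_pos (Real.exp_pos _)]
    refine mul_le_one₀ (hθ t).2 (Real.exp_pos _).le (Real.exp_le_one_iff.2 ?_)
    have : 0 ≤ l * max t 0 := mul_nonneg hl0.le (le_max_right _ _)
    linarith
  set G : ℝ → (Fin d → ℝ) → ℝ := fun t x => (1 / 2) * ∑ i, ∑ j, A i j t x * Φ.uxx i j t x with hG
  have hGH := (Hol.sum_const fun i => Hol.sum_const fun j =>
    (hA i j).mul (hΦ.huxx i j)).const_mul (1 / 2)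
  obtain ⟨w, hw, hwr⟩ := hsol l le_rfl _ _ ((Hol.of_time hkc hkb).mul hGH)
  have hw0 : ∀ t ≤ 0, ∀ x, w.u t x = 0 := by
    have := ancient_unique (t₂ := 0) hl0 (hw.jc (le_max_left _ _) (le_max_right _ _))
      ((JB.const (d := d) (α := α) 0).jc le_rfl le_rfl) hpsd (fun i j t x => (hA i j).bdd t x)
      fun t ht x => by
        rw [hwr, hk]
        have : max 0 (min 1 (t / δ)) = 0 := max_eq_left
          ((min_le_right _ _).trans (div_nonpos_of_nonpos_of_nonneg ht.le hδ.le))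
        simp [this, Jet.res, Jet.const]
    exact this
  obtain ⟨E, ZE, hE, hEx, hExx, hEu⟩ := exists_expJet (d := d) α l S hS
  set U := Φ.add (E.mul w) with hU
  have hUJ := hΦ.add (hE.mul hw)
  have hres : ∀ t ∈ Set.Icc 0 S, ∀ x, U.res A 0 t x = (max 0 (min 1 (t / δ)) - 1) * G t x := by
    intro t ht x
    obtain ⟨h1, h2⟩ := hEu t ht.1 ht.2 x
    have h3 := hwr t x
    simp only [Jet.res] at h3
    have h4 : Real.exp (l * t) * k t = max 0 (min 1 (t / δ)) := by
      simp only [hk]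
      rw [max_eq_left ht.1, mul_left_comm, ← Real.exp_add]
      ring_nf; simp
    have h5 : w.res A 0 t x = k t * G t x - l * w.u t x := by
      simp only [Jet.res, hG]; linarith
    rw [hU, res_add, res_mul, h5, h1]
    simp only [comm, h2, hEx, hExx]
    have h6 : Φ.res A 0 t x = - G t x := by simp only [Jet.res, hΦt, hG]; ring
    rw [h6]
    have : ∀ a : ℝ, a = Real.exp (l * t) * k t → -G t x + (Real.exp (l * t) *
      (k t * G t x - l * w.u t x) + (l * Real.exp (l * t) * w.u t x - 0)) = (a - 1) * G t x := by
      rintro a rfl; ring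
    simpa using this _ h4.symm
  have hres0 : ∀ t ∈ Set.Icc δ S, ∀ x, U.res A 0 t x = 0 := fun t ht x => by
    rw [hres t ⟨hδ.le.trans ht.1, ht.2⟩ x, min_eq_left ((one_le_div hδ).2 ht.1)]
    simp
  have hU0 : ∀ x, U.u 0 x = Φ.u 0 x := fun x => by
    simp [hU, Jet.add, Jet.mul, hw0 0 le_rfl x]
  have hΦ0 : ∀ t x, Φ.u t x = Φ.u 0 x := fun t x =>
    is_const_of_deriv_eq_zero (f := fun s => Φ.u s x)
      (fun s => (hΦ.dt s x).differentiableAt) (fun s => by rw [(hΦ.dt s x).deriv, hΦt]) t 0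
  obtain ⟨N, hN⟩ : ∃ N, JB α N N U :=
    ⟨_, hUJ.mono (le_max_left _ _) (le_max_right _ _)⟩
  -- one-sided bounds on a time interval
  have key : ∀ (σ : ℝ) (V : Jet d) (NV t₁ t₂ R D : ℝ), (σ = 1 ∨ σ = -1) → JB α NV NV V →
      (∀ t ∈ Set.Ioo t₁ t₂, ∀ x, |V.res A 0 t x| ≤ R) → (∀ x, |V.u t₁ x| ≤ D) →
      ∀ t ∈ Set.Icc t₁ t₂, ∀ x, σ * V.u t x ≤ D + R * (t - t₁) := by
    intro σ V NV t₁ t₂ R D hσ hV hVr hV0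
    have habs : ∀ y : ℝ, σ * y ≤ |y| := fun y => by
      rcases hσ with rfl | rfl
      · simpa using le_abs_self y
      · simpa using neg_le_abs y
    rcases lt_or_ge t₂ t₁ with h21 | h21
    · exact fun t ht => absurd (ht.1.trans ht.2) (not_le.2 h21)
    have hD0 : 0 ≤ D := (abs_nonneg _).trans (hV0 0)
    set L : Jet d := ⟨fun t _ => -(D + R * (t - t₁)), fun _ _ => -R, fun _ _ _ => 0,
      fun _ _ _ _ => 0⟩ with hL
    have hLat : ∀ t x, L.At t x := fun t x => ⟨by
        have : HasDerivAt (fun t => -(D + R * (t - t₁))) (-(R * 1)) t :=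
          ((((hasDerivAt_id t).sub_const t₁).const_mul R).const_add D).neg
        simpa [hL] using this,
      Eventually.of_forall fun y => by
        simpa only [hL, grad_zero] using hasFDerivAt_const (-(D + R * (t - t₁))) y,
      fun i => by simpa only [hL, grad_zero] using hasFDerivAt_const (0 : ℝ) x⟩
    have := bounded_max_principle (t₁ := t₁) (t₂ := t₂) (l := 0) (H := H)
      (B := |NV| + D + |R| * (t₂ - t₁))
      le_rfl (A := A) (J := (V.smul σ).add L) ?_ (fun t ht x => ((hV.at t x).smul σ).add (hLat t x))
      (fun t ht x => hpsd t x) ?_ ?_ ?_ ?_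
    · intro t ht x
      have h1 := this t ht x
      simp only [Jet.add, Jet.smul, hL] at h1
      linarith
    · have := hV.hu.cont
      refine Continuous.continuousOn ?_
      simp only [Jet.add, Jet.smul, hL]
      fun_prop
    · exact fun t _ x i => (le_abs_self _).trans ((hA i i).bdd t x)
    · intro t ht x
      have h1 := (habs (V.u t x)).trans ((hV.hu.bdd t x).trans (le_abs_self NV))
      have h2 : |R * (t - t₁)| ≤ |R| * (t₂ - t₁) := by
        rw [abs_mul, abs_of_nonneg (sub_nonneg.2 ht.1)]
        exact mul_le_mul_of_nonneg_left (by linarith [ht.2]) (abs_nonneg _)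
      have h3 := neg_abs_le (R * (t - t₁))
      simp only [Jet.add, Jet.smul, hL]
      linarith
    · intro t ht x
      rw [res_add, res_smul]
      have h1 := (habs (V.res A 0 t x)).trans (hVr t ht x)
      have h2 : L.res A 0 t x = -R := by simp [Jet.res, hL]
      linarith
    · intro x
      have h1 := (habs (V.u t₁ x)).trans (hV0 x)
      simp only [Jet.add, Jet.smul, hL]
      linarith
  have hboth : ∀ (V : Jet d) (NV t₁ t₂ R D : ℝ), JB α NV NV V →
      (∀ t ∈ Set.Ioo t₁ t₂, ∀ x, |V.res A 0 t x| ≤ R) → (∀ x, |V.u t₁ x| ≤ D) →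
      ∀ t ∈ Set.Icc t₁ t₂, ∀ x, |V.u t x| ≤ D + R * (t - t₁) := by
    intro V NV t₁ t₂ R D hV hVr hV0 t ht x
    have h1 := key 1 V NV t₁ t₂ R D (Or.inl rfl) hV hVr hV0 t ht x
    have h2 := key (-1) V NV t₁ t₂ R D (Or.inr rfl) hV hVr hV0 t ht x
    exact abs_le.2 ⟨by linarith, by linarith⟩
  have hdiff : ∀ t ∈ Set.Icc 0 S, ∀ x, |U.u t x - Φ.u t x| ≤ M * t := by
    intro t ht x
    have h1 := hboth _ _ 0 S M 0 ((hN.add (hΦ.smul (-1))).mono (le_max_left _ _) (le_max_right _ _))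
      (fun t ht x => ?_) (fun x => ?_) t ht x
    · simp only [Jet.add, Jet.smul] at h1
      convert h1 using 1
      · congr 1; ring
      · ring
    · rw [res_add, res_smul, hres t (Ioo_subset_Icc_self ht)]
      have h6 : Φ.res A 0 t x = - G t x := by simp only [Jet.res, hΦt, hG]; ring
      rw [h6, show (max 0 (min 1 (t / δ)) - 1) * G t x + -1 * -G t x
        = max 0 (min 1 (t / δ)) * G t x by ring, abs_mul, abs_of_nonneg (hθ t).1]
      exact (mul_le_mul (hθ t).2 (hM t x) (abs_nonneg _) zero_le_one).trans (by simp)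
    · simp [Jet.add, Jet.smul, hU0]
  have hsmall : ∀ t ∈ Set.Icc 0 δ, ∀ x, |U.u t x| ≤ B + M * δ := fun t ht x => by
    have h1 := hdiff t ⟨ht.1, ht.2.trans hδS.le⟩ x
    have h2 := hB t x
    have h3 := mul_le_mul_of_nonneg_left ht.2 hM0
    have h4 := abs_add_le (U.u t x - Φ.u t x) (Φ.u t x)
    rw [sub_add_cancel] at h4
    linarith
  refine ⟨U, N, hN, hres0, hdiff, fun t ht x => ?_⟩
  rcases le_total t δ with h | h
  · exact hsmall t ⟨ht.1, h⟩ x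
  · simpa using hboth U N δ S 0 (B + M * δ) hN
      (fun t ht x => by rw [hres0 t (Ioo_subset_Icc_self ht), abs_zero])
      (hsmall δ ⟨hδ.le, le_rfl⟩) t ⟨h, ht.2⟩ x

end TVP

namespace TVP

variable {d : ℕ}

/-! ### Smooth approximation of the data -/

lemma exists_smooth_approx {f : (Fin d → ℝ) → ℝ} {b B ε : ℝ} (hb : 1 ≤ b) (hε : 0 < ε)
    (hf : ContinuousOn f (box d b)) (hB : ∀ x ∈ box d b, |f x| ≤ B) :
    ∃ φ : (Fin d → ℝ) → ℝ, ContDiff ℝ 3 φ ∧ HasCompactSupport φ ∧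
      (∀ x ∈ box d b, |φ x - f x| ≤ ε) ∧ ∀ x, |φ x| ≤ B + ε := by
  have hu : UniformContinuous (fun x => f (boxClamp b x)) := by
    have h1 := (isCompact_box b).uniformContinuousOn_of_continuous hf
    rw [Metric.uniformContinuousOn_iff] at h1
    rw [Metric.uniformContinuous_iff]
    intro e he
    obtain ⟨r, hr, h⟩ := h1 e he
    exact ⟨r, hr, fun {x y} hxy => h _ (boxClamp_mem hb x) _ (boxClamp_mem hb y)
      ((dist_boxClamp_le b x y).trans_lt hxy)⟩
  obtain ⟨g, hg, hgf⟩ := hu.exists_contDiff_dist_le hε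
  let η : ContDiffBump (0 : Fin d → ℝ) := ⟨b, b + 1, by linarith, by linarith⟩
  refine ⟨fun x => η x * g x, η.contDiff.mul (hg.of_le (mod_cast le_top)),
    η.hasCompactSupport.mul_right, fun x hx => ?_, fun x => ?_⟩
  · have h1 : η x = 1 := η.one_of_mem_closedBall (by
      rw [mem_closedBall_zero_iff]
      refine (pi_norm_le_iff_of_nonneg (by linarith)).2 fun i => ?_
      rw [Real.norm_eq_abs, abs_of_pos (box_subset_posOrth (by linarith) hx i)]
      exact (hx i).2)
    have h2 := hgf x
    simp only [boxClamp_of_mem hx, Real.dist_eq] at h2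
    simpa [h1] using h2.le
  · have h1 := hB _ (boxClamp_mem hb x)
    have h2 := hgf x
    rw [Real.dist_eq] at h2
    have h3 := abs_add_le (g x - f (boxClamp b x)) (f (boxClamp b x))
    rw [sub_add_cancel] at h3
    rw [abs_mul, abs_of_nonneg η.nonneg]
    exact (mul_le_of_le_one_left (abs_nonneg _) η.le_one).trans (by linarith)

/-! ### Power barriers -/

/-- The separated barrier `exp (μ t) (1 + ∑ xᵢ ^ m)`. -/
def powJet (d : ℕ) (μ : ℝ) (m : ℤ) : Jet d :=
  sepJet μ (fun z => z ^ m) (fun z => m * z ^ (m - 1)) (fun z => m * ((m - 1 : ℤ) * z ^ (m - 1 - 1)))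

lemma powJet_at (μ : ℝ) (m : ℤ) (t : ℝ) {x : Fin d → ℝ} (hx : x ∈ posOrth d) :
    (powJet d μ m).At t x :=
  sepJet_at (fun i => by
    filter_upwards [lt_mem_nhds (hx i)] with s hs using hasDerivAt_zpow m s (Or.inl hs.ne'))
    fun i => (hasDerivAt_zpow (m - 1) (x i) (Or.inl (hx i).ne')).const_mul _

lemma powJet_u (μ : ℝ) (m : ℤ) (t : ℝ) (x : Fin d → ℝ) :
    (powJet d μ m).u t x = Real.exp (μ * t) * (1 + ∑ i, x i ^ m) := rfl

lemma powJet_pos (μ : ℝ) (m : ℤ) (t : ℝ) {x : Fin d → ℝ} (hx : x ∈ posOrth d) :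
    0 < (powJet d μ m).u t x := by
  have := Finset.sum_nonneg (s := Finset.univ) fun i _ => (zpow_pos (hx i) m).le
  rw [powJet_u]; positivity

lemma powJet_continuousOn (μ : ℝ) (m : ℤ) (I : Set ℝ) :
    ContinuousOn (fun p : ℝ × (Fin d → ℝ) => (powJet d μ m).u p.1 p.2) (I ×ˢ posOrth d) := by
  simp only [powJet_u]
  refine ContinuousOn.mul (by fun_prop) (continuousOn_const.add
    (continuousOn_finsetSum _ fun i _ => ContinuousOn.zpow₀ (by fun_prop) m fun p hp =>
      Or.inl (hp.2 i).ne'))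

lemma powJet_res_nonneg {μ Cb : ℝ} {m : ℤ} {A : Fin d → Fin d → ℝ → (Fin d → ℝ) → ℝ} {t : ℝ}
    {x : Fin d → ℝ} (hx : x ∈ posOrth d) (hA : ∀ i, |A i i t x| ≤ Cb * (x i * x i)) (hμ0 : 0 ≤ μ)
    (hμ : Cb * |(m : ℝ) * (m - 1)| ≤ μ) : 0 ≤ (powJet d μ m).res A 0 t x := by
  rw [powJet, sepJet_res, add_zero]
  refine mul_nonneg (Real.exp_pos _).le ?_
  have : ∀ i, A i i t x * (m * ((m - 1 : ℤ) * x i ^ (m - 1 - 1))) ≤ μ * x i ^ m := fun i => by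
    have hz := zpow_pos (hx i) m
    have e : x i ^ m = x i * x i * x i ^ (m - 1 - 1) := by
      rw [zpow_sub_one₀ (hx i).ne', zpow_sub_one₀ (hx i).ne']
      have := (hx i).ne'
      field_simp
    have hz' := zpow_pos (hx i) (m - 1 - 1)
    calc A i i t x * (m * ((m - 1 : ℤ) * x i ^ (m - 1 - 1)))
        = A i i t x * ((m : ℝ) * (m - 1)) * x i ^ (m - 1 - 1) := by push_cast; ring
      _ ≤ Cb * (x i * x i) * |(m : ℝ) * (m - 1)| * x i ^ (m - 1 - 1) := by
          refine mul_le_mul_of_nonneg_right ((le_abs_self _).trans ?_) hz'.le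
          rw [abs_mul]
          exact mul_le_mul_of_nonneg_right (hA i) (abs_nonneg _)
      _ = Cb * |(m : ℝ) * (m - 1)| * x i ^ m := by rw [e]; ring
      _ ≤ _ := mul_le_mul_of_nonneg_right hμ hz.le
  have h2 := Finset.sum_le_sum (s := Finset.univ) fun i _ => this i
  have h3 := Finset.sum_nonneg (s := Finset.univ) fun i _ => (zpow_pos (hx i) m).le
  rw [← Finset.mul_sum] at h2
  have h4 := mul_nonneg hμ0 h3
  nlinarith

/-- The size of the boundary barrier. -/
def bar (d : ℕ) (μ : ℝ) (κ : ℕ) (t : ℝ) (x : Fin d → ℝ) : ℝ :=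
  (powJet d μ κ).u t x + (powJet d μ (-κ)).u t x

lemma bar_nonneg (μ : ℝ) (κ : ℕ) (t : ℝ) {x : Fin d → ℝ} (hx : x ∈ posOrth d) :
    0 ≤ bar d μ κ t x := add_nonneg (powJet_pos _ _ _ hx).le (powJet_pos _ _ _ hx).le

lemma bar_continuousOn (μ : ℝ) (κ : ℕ) (I : Set ℝ) :
    ContinuousOn (fun p : ℝ × (Fin d → ℝ) => bar d μ κ p.1 p.2) (I ×ˢ posOrth d) :=
  (powJet_continuousOn _ _ _).add (powJet_continuousOn _ _ _)

lemma le_bar {μ b t : ℝ} (κ : ℕ) (hb : 1 ≤ b) (hμ : 0 ≤ μ) (ht : 0 ≤ t) {x : Fin d → ℝ}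
    (hx : x ∈ box d b) (hi : x ∉ interior (box d b)) : b ^ κ ≤ bar d μ κ t x := by
  have hp := box_subset_posOrth (by linarith) hx
  have h1 : 1 ≤ Real.exp (μ * t) := Real.one_le_exp (mul_nonneg hμ ht)
  have key : ∀ m : ℤ, ∀ i, x i ^ m ≤ (powJet d μ m).u t x := fun m i => by
    have h2 := Finset.single_le_sum (s := Finset.univ) (f := fun i => x i ^ m)
      (fun i _ => (zpow_pos (hp i) m).le) (Finset.mem_univ i)
    have h3 := zpow_pos (hp i) m
    rw [powJet_u]
    exact h2.trans ((le_add_of_nonneg_left zero_le_one).trans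
      (le_mul_of_one_le_left (by linarith [h3.le.trans h2]) h1))
  obtain ⟨i, h | h⟩ := exists_of_mem_frontier_box hx hi
  · have := key (-κ) i
    rw [h, inv_zpow', neg_neg, zpow_natCast] at this
    exact this.trans (le_add_of_nonneg_left (powJet_pos _ _ _ hp).le)
  · have := key κ i
    rw [h, zpow_natCast] at this
    exact this.trans (le_add_of_nonneg_right (powJet_pos _ _ _ hp).le)

theorem box_bound {b Cb t₁ t₂ R E C₁ c μ : ℝ} (q κ : ℕ) (hb : 1 ≤ b) (hCb : 0 ≤ Cb) (ht₁ : 0 ≤ t₁)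
    (hR : 0 ≤ R) (hE : 0 ≤ E) (hC₁ : 0 ≤ C₁) (hc : 0 ≤ c)
    (hμ : Cb * ((q + 1) ^ 2 + (κ + 1) ^ 2) ≤ μ)
    {A : Fin d → Fin d → ℝ → (Fin d → ℝ) → ℝ} {J : Jet d}
    (hJc : ContinuousOn (fun p : ℝ × (Fin d → ℝ) => J.u p.1 p.2) (Set.Icc t₁ t₂ ×ˢ box d b))
    (hJ : ∀ t ∈ Set.Ioo t₁ t₂, ∀ x ∈ interior (box d b), J.At t x)
    (hA : ∀ t ∈ Set.Ioo t₁ t₂, ∀ x ∈ interior (box d b), (Matrix.of fun i j => A i j t x).PosSemidef)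
    (hAb : ∀ t ∈ Set.Ioo t₁ t₂, ∀ x ∈ interior (box d b), ∀ i, |A i i t x| ≤ Cb * (x i * x i))
    (hres : ∀ t ∈ Set.Ioo t₁ t₂, ∀ x ∈ interior (box d b), |J.res A 0 t x| ≤ R)
    (h0 : ∀ x ∈ box d b, |J.u t₁ x| ≤ E + C₁ * (1 + ∑ i, x i ^ q) + c * bar d μ κ t₁ x)
    (hlat : ∀ t ∈ Set.Icc t₁ t₂, ∀ x ∈ box d b, x ∉ interior (box d b) → |J.u t x| ≤ c * b ^ κ) :
    ∀ t ∈ Set.Icc t₁ t₂, ∀ x ∈ box d b, |J.u t x| ≤ E + R * (t - t₁)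
      + C₁ * (Real.exp (μ * t) * (1 + ∑ i, x i ^ q)) + c * bar d μ κ t x := by
  have hb0 : 0 < b := by linarith
  have hpos := box_subset_posOrth (d := d) hb0
  have hμ0 : 0 ≤ μ := le_trans (by positivity) hμ
  set L : Jet d := ⟨fun t _ => E + R * (t - t₁), fun _ _ => R, fun _ _ _ => 0,
    fun _ _ _ _ => 0⟩ with hL
  have hLat : ∀ t x, L.At t x := fun t x => ⟨by
      have : HasDerivAt (fun t => E + R * (t - t₁)) (R * 1) t :=
        (((hasDerivAt_id t).sub_const t₁).const_mul R).const_add E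
      simpa [hL] using this,
    Eventually.of_forall fun y => by
      simpa only [hL, grad_zero] using hasFDerivAt_const (E + R * (t - t₁)) y,
    fun i => by simpa only [hL, grad_zero] using hasFDerivAt_const (0 : ℝ) x⟩
  set G : Jet d := (L.add ((powJet d μ q).smul C₁)).add
    (((powJet d μ κ).add (powJet d μ (-κ))).smul c) with hG
  have hGu : ∀ t x, G.u t x = E + R * (t - t₁)
      + C₁ * (Real.exp (μ * t) * (1 + ∑ i, x i ^ q)) + c * bar d μ κ t x := fun t x => by
    simp only [hG, hL, Jet.add, Jet.smul, bar, powJet_u, zpow_natCast]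
  have hGat : ∀ t, ∀ x ∈ posOrth d, G.At t x := fun t x hx =>
    ((hLat t x).add ((powJet_at _ _ _ hx).smul _)).add
      (((powJet_at _ _ _ hx).add (powJet_at _ _ _ hx)).smul _)
  have hGc : ContinuousOn (fun p : ℝ × (Fin d → ℝ) => G.u p.1 p.2)
      (Set.Icc t₁ t₂ ×ˢ box d b) := by
    refine ContinuousOn.mono (s := Set.Icc t₁ t₂ ×ˢ posOrth d) ?_ (Set.prod_mono Subset.rfl hpos)
    exact (ContinuousOn.add (by simp only [hL]; fun_prop)
      (continuousOn_const.mul (powJet_continuousOn _ _ _))).add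
      (continuousOn_const.mul ((powJet_continuousOn _ _ _).add (powJet_continuousOn _ _ _)))
  have hrate : ∀ m : ℤ, |(m : ℝ) * (m - 1)| ≤ (q + 1) ^ 2 + (κ + 1) ^ 2 →
      Cb * |(m : ℝ) * (m - 1)| ≤ μ := fun m hm => (mul_le_mul_of_nonneg_left hm hCb).trans hμ
  have hq0 : (0 : ℝ) ≤ q := q.cast_nonneg
  have hκ0 : (0 : ℝ) ≤ κ := κ.cast_nonneg
  have hGres : ∀ t ∈ Set.Ioo t₁ t₂, ∀ x ∈ interior (box d b), R ≤ G.res A 0 t x := by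
    intro t ht x hx
    have hx' := hpos (interior_subset hx)
    have hA' := hAb t ht x hx
    have h1 := powJet_res_nonneg (m := q) hx' hA' hμ0 (hrate _ (by
      rw [abs_le]; push_cast; constructor <;> nlinarith))
    have h2 := powJet_res_nonneg (m := κ) hx' hA' hμ0 (hrate _ (by
      rw [abs_le]; push_cast; constructor <;> nlinarith))
    have h3 := powJet_res_nonneg (m := -κ) hx' hA' hμ0 (hrate _ (by
      rw [abs_le]; push_cast; constructor <;> nlinarith))
    have h4 : L.res A 0 t x = R := by simp [Jet.res, hL]
    rw [hG, res_add, res_add, res_smul, res_smul, res_add, h4]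
    have := mul_nonneg hC₁ h1
    have := mul_nonneg hc (add_nonneg h2 h3)
    linarith
  have key : ∀ σ : ℝ, (σ = 1 ∨ σ = -1) → ∀ t ∈ Set.Icc t₁ t₂, ∀ x ∈ box d b,
      σ * J.u t x ≤ G.u t x := by
    intro σ hσ
    have habs : ∀ y : ℝ, σ * y ≤ |y| := fun y => by
      rcases hσ with rfl | rfl
      · simpa using le_abs_self y
      · simpa using neg_le_abs y
    refine comparison (isCompact_box b) le_rfl (A := A) (J := J.smul σ) (B := G)
      (continuousOn_const.mul hJc) hGc (fun t ht x hx => (hJ t ht x hx).smul σ)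
      (fun t _ x hx => hGat t x (hpos (interior_subset hx))) hA (fun t ht x hx => ?_)
      (fun x hx => ?_) fun t ht x hx hxi => ?_
    · rw [res_smul]
      exact (habs _).trans ((hres t ht x hx).trans (hGres t ht x hx))
    · refine (habs _).trans ((h0 x hx).trans ?_)
      rw [hGu, sub_self, mul_zero, add_zero]
      have h1 : 1 ≤ Real.exp (μ * t₁) := Real.one_le_exp (mul_nonneg hμ0 ht₁)
      have h2 : 0 ≤ 1 + ∑ i, x i ^ q := by
        have := Finset.sum_nonneg (s := Finset.univ) fun i _ => (pow_pos (hpos hx i) q).le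
        linarith
      have h3 := mul_le_mul_of_nonneg_left (le_mul_of_one_le_left h2 h1) hC₁
      linarith
    · refine (habs _).trans ((hlat t ht x hx hxi).trans ?_)
      rw [hGu]
      have h1 := mul_le_mul_of_nonneg_left (le_bar κ hb hμ0 (ht₁.trans ht.1) hx hxi) hc
      have h2 := mul_nonneg hC₁ (powJet_pos μ q t (hpos hx)).le
      simp only [powJet_u, zpow_natCast] at h2
      have h3 := mul_nonneg hR (sub_nonneg.2 ht.1)
      linarith
  intro t ht x hx
  rw [← hGu]
  have h1 := key 1 (Or.inl rfl) t ht x hx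
  have h2 := key (-1) (Or.inr rfl) t ht x hx
  exact abs_le.2 ⟨by linarith, by linarith⟩

end TVP

namespace TVP

variable {d : ℕ}

lemma res_congr {A A' : Fin d → Fin d → ℝ → (Fin d → ℝ) → ℝ} {l t : ℝ} {x : Fin d → ℝ} (J : Jet d)
    (h : ∀ i j, A i j t x = A' i j t x) : J.res A l t x = J.res A' l t x := by
  simp only [Jet.res, h]

lemma abs_trace_le {Λ B : ℝ} (hΛ : 0 ≤ Λ) {a u : Fin d → Fin d → ℝ} (ha : ∀ i j, |a i j| ≤ Λ)
    (hu : ∀ i j, |u i j| ≤ B) : |(1 / 2) * ∑ i, ∑ j, a i j * u i j| ≤ 1 / 2 * (d * (d * (Λ * B))) := by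
  rw [abs_mul, abs_of_pos (by norm_num : (0 : ℝ) < 1 / 2)]
  refine mul_le_mul_of_nonneg_left ?_ (by norm_num)
  refine (Finset.abs_sum_le_sum_abs _ _).trans ?_
  refine (Finset.sum_le_card_nsmul _ _ _ fun i _ => (Finset.abs_sum_le_sum_abs _ _).trans
    (Finset.sum_le_card_nsmul _ _ _ fun j _ => ?_)).trans (le_of_eq (by
      simp only [Finset.card_univ, Fintype.card_fin, nsmul_eq_mul]; rfl))
  rw [abs_mul]
  exact mul_le_mul (ha i j) (hu i j) (abs_nonneg _) hΛ

lemma one_add_sum_pow_nonneg (q : ℕ) {x : Fin d → ℝ} (hx : x ∈ posOrth d) :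
    1 ≤ 1 + ∑ i, x i ^ q := by
  have := Finset.sum_nonneg (s := Finset.univ) fun i _ => (pow_pos (hx i) q).le
  linarith

lemma one_add_sum_pow_le {b : ℝ} (hb : 0 < b) (q : ℕ) {x : Fin d → ℝ} (hx : x ∈ box d b) :
    1 + ∑ i, x i ^ q ≤ 1 + d * b ^ q := by
  have : ∑ i, x i ^ q ≤ d * b ^ q := by
    refine (Finset.sum_le_card_nsmul _ _ (b ^ q) fun i _ =>
      pow_le_pow_left₀ (box_subset_posOrth hb hx i).le (hx i).2 q).trans (le_of_eq ?_)
    simp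
  linarith

variable {A : Fin d → Fin d → ℝ → (Fin d → ℝ) → ℝ} {Cb : ℝ}

/-- Solutions of at most polynomial growth are controlled by their initial values. -/
theorem growth_comparison (hA : Coef Cb A) {S C C₁ : ℝ} (q r : ℕ) (hC : 0 ≤ C) (hC₁ : 0 ≤ C₁)
    {J : Jet d}
    (hJc : ContinuousOn (fun p : ℝ × (Fin d → ℝ) => J.u p.1 p.2) (Set.Icc 0 S ×ˢ posOrth d))
    (hJ : ∀ t ∈ Set.Ioo 0 S, ∀ x ∈ posOrth d, J.At t x)
    (hres : ∀ t ∈ Set.Ioo 0 S, ∀ x ∈ posOrth d, J.res A 0 t x = 0)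
    (hg : ∀ t ∈ Set.Icc 0 S, ∀ x ∈ posOrth d, |J.u t x| ≤ C * (1 + ∑ i, x i ^ r))
    (h0 : ∀ x ∈ posOrth d, |J.u 0 x| ≤ C₁ * (1 + ∑ i, x i ^ q)) :
    ∀ t ∈ Set.Icc 0 S, ∀ x ∈ posOrth d, |J.u t x| ≤
      C₁ * (Real.exp (Cb * ((q + 1) ^ 2 + ((r + 1 : ℕ) + 1) ^ 2) * t) * (1 + ∑ i, x i ^ q)) := by
  intro t ht x hx
  set μ := Cb * ((q + 1) ^ 2 + ((r + 1 : ℕ) + 1) ^ 2 : ℝ) with hμ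
  have main : ∀ᶠ b : ℝ in atTop, |J.u t x| ≤
      C₁ * (Real.exp (μ * t) * (1 + ∑ i, x i ^ q)) + C * (1 + d) * b⁻¹ * bar d μ (r + 1) t x := by
    obtain ⟨b₀, hb₀, hxb⟩ := exists_mem_box hx
    filter_upwards [eventually_ge_atTop b₀] with b hb
    have hb1 : 1 ≤ b := hb₀.trans hb
    have hb0 : 0 < b := by linarith
    have hpos := box_subset_posOrth (d := d) hb0
    have hintg := (interior_subset (s := box d b)).trans hpos
    have := box_bound (t₁ := 0) (t₂ := S) (R := 0) (E := 0) (c := C * (1 + d) * b⁻¹) q (r + 1) hb1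
      hA.nonneg le_rfl le_rfl le_rfl hC₁ (by positivity) hμ.ge (A := A) (J := J)
      (hJc.mono (Set.prod_mono Subset.rfl hpos)) (fun t ht x hx => hJ t ht x (hintg hx))
      (fun t ht x hx => (hA.pd t ht.1.le x (hintg hx)).posSemidef)
      (fun t ht x hx i => hA.bdd t ht.1.le x (hintg hx) i i)
      (fun t ht x hx => by rw [hres t ht x (hintg hx), abs_zero])
      (fun x hx => (h0 x (hpos hx)).trans (by
        have := bar_nonneg μ (r + 1) 0 (hpos hx)
        rw [zero_add]
        refine le_add_of_nonneg_right (by positivity)))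
      (fun t ht x hx _ => (hg t ht x (hpos hx)).trans ?_) t ht x (box_mono (by linarith) hb hxb)
    · simpa using this
    · have h1 := one_add_sum_pow_le hb0 r hx
      have h2 : 1 ≤ b ^ r := one_le_pow₀ hb1
      rw [pow_succ, show C * (1 + d) * b⁻¹ * (b ^ r * b) = C * ((1 + d) * b ^ r) by field_simp]
      refine mul_le_mul_of_nonneg_left (h1.trans ?_) hC
      nlinarith
  have hlim : Tendsto (fun b : ℝ => C₁ * (Real.exp (μ * t) * (1 + ∑ i, x i ^ q))
      + C * (1 + d) * b⁻¹ * bar d μ (r + 1) t x) atTop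
      (𝓝 (C₁ * (Real.exp (μ * t) * (1 + ∑ i, x i ^ q))
        + C * (1 + d) * 0 * bar d μ (r + 1) t x)) :=
    ((tendsto_inv_atTop_zero.const_mul _).mul_const _).const_add _
  simpa using ge_of_tendsto hlim main

/-! ### The approximating sequence -/

lemma exists_times {S : ℝ} (hS : 0 < S) {M : ℕ → ℝ} (hM0 : ∀ n, 0 ≤ M n) :
    ∃ δ : ℕ → ℝ, (∀ n, 0 < δ n) ∧ (∀ n, δ n < S) ∧ Antitone δ ∧ Tendsto δ atTop (𝓝 0) ∧
      ∀ n, M n * δ n ≤ (1 / 2) ^ n := by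
  have hε : ∀ n : ℕ, (0 : ℝ) < (1 / 2) ^ n := fun n => by positivity
  have hε1 : ∀ n : ℕ, (1 / 2 : ℝ) ^ n ≤ 1 := fun n => pow_le_one₀ (by norm_num) (by norm_num)
  have hSum0 : ∀ n, 0 ≤ ∑ k ∈ Finset.range (n + 1), M k := fun n =>
    Finset.sum_nonneg fun k _ => hM0 k
  have hSumM : ∀ n, M n ≤ ∑ k ∈ Finset.range (n + 1), M k := fun n =>
    Finset.single_le_sum (fun k _ => hM0 k) (Finset.self_mem_range_succ n)
  have hmin : 0 < min S 1 := lt_min hS one_pos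
  have hfrac : ∀ n, min S 1 / (2 * (1 + ∑ k ∈ Finset.range (n + 1), M k)) ≤ min S 1 / 2 := fun n =>
    div_le_div_of_nonneg_left hmin.le (by norm_num) (by linarith [hSum0 n])
  refine ⟨fun n => (1 / 2) ^ n * (min S 1 / (2 * (1 + ∑ k ∈ Finset.range (n + 1), M k))),
    fun n => ?_, fun n => ?_, antitone_nat_of_succ_le fun n => ?_, ?_, fun n => ?_⟩
  · have := hSum0 n
    positivity
  · have h1 := mul_le_mul (hε1 n) (hfrac n) (by have := hSum0 n; positivity) zero_le_one
    have := min_le_left S 1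
    show (1 / 2) ^ n * (min S 1 / (2 * (1 + ∑ k ∈ Finset.range (n + 1), M k))) < S
    linarith
  · have h0 := hSum0 n
    have h1 := hM0 (n + 1)
    refine mul_le_mul (pow_le_pow_of_le_one (by norm_num) (by norm_num) n.le_succ)
      (div_le_div_of_nonneg_left hmin.le (by positivity) ?_)
      (by have := hSum0 (n + 1); positivity) (hε n).le
    rw [Finset.sum_range_succ _ (n + 1)]
    linarith
  · refine squeeze_zero (fun n => ?_) (fun n => ?_)
      (tendsto_pow_atTop_nhds_zero_of_lt_one (r := (1 / 2 : ℝ)) (by norm_num) (by norm_num))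
    · have := hSum0 n
      positivity
    · refine mul_le_of_le_one_right (hε n).le ((hfrac n).trans ?_)
      linarith [min_le_right S 1]
  · have h0 := hSum0 n
    have h1 : M n * (min S 1 / (2 * (1 + ∑ k ∈ Finset.range (n + 1), M k))) ≤ 1 := by
      rw [← mul_div_assoc, div_le_one (by positivity)]
      have := mul_le_mul (hSumM n) (min_le_right S 1) hmin.le h0
      linarith
    calc M n * ((1 / 2) ^ n * (min S 1 / (2 * (1 + ∑ k ∈ Finset.range (n + 1), M k))))
        = (1 / 2) ^ n * (M n * (min S 1 / (2 * (1 + ∑ k ∈ Finset.range (n + 1), M k)))) := by ring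
      _ ≤ (1 / 2) ^ n * 1 := mul_le_mul_of_nonneg_left h1 (hε n).le
      _ = _ := mul_one _

/-- Regularised initial data. -/
lemma exists_smooth_data {C₀ : ℝ} (q : ℕ) (hC₀ : 0 ≤ C₀)
    {f : (Fin d → ℝ) → ℝ} (hf : ContinuousOn f (posOrth d))
    (hfb : ∀ x ∈ posOrth d, |f x| ≤ C₀ * (1 + ∑ i, x i ^ q)) (n : ℕ) :
    ∃ (Φ : Jet d) (B₂ : ℝ), (∀ s t, Φ.u s = Φ.u t) ∧ (∀ t x, Φ.ut t x = 0) ∧ 0 ≤ B₂ ∧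
      (∀ i j t x, |Φ.uxx i j t x| ≤ B₂) ∧
      (∀ α : ℝ, 0 < α → α ≤ 1 → ∃ Z, JB α Z Z Φ) ∧
      (∀ x ∈ box d ((n : ℝ) + 1), |Φ.u 0 x - f x| ≤ (1 / 2) ^ n) ∧
      ∀ t x, |Φ.u t x| ≤ C₀ * (1 + d * ((n : ℝ) + 1) ^ q) + (1 / 2) ^ n := by
  have hb0 : (0 : ℝ) < n + 1 := by positivity
  have hb1 : (1 : ℝ) ≤ n + 1 := by linarith [n.cast_nonneg (α := ℝ)]
  obtain ⟨φ, hφs, hφc, hφf, hφb⟩ := exists_smooth_approx (d := d) hb1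
    (show (0 : ℝ) < (1 / 2) ^ n by positivity) (hf.mono (box_subset_posOrth hb0)) fun x hx =>
      (hfb x (box_subset_posOrth hb0 hx)).trans
        (mul_le_mul_of_nonneg_left (one_add_sum_pow_le hb0 q hx) hC₀)
  obtain ⟨Φ, hΦu, hΦt, ⟨B₂, hB₂, hΦB⟩, hΦJ⟩ := exists_spaceJet hφs hφc
  exact ⟨Φ, B₂, fun s t => by ext x; rw [hΦu, hΦu], hΦt, hB₂, hΦB, hΦJ,
    fun x hx => by rw [hΦu]; exact hφf x hx, fun t x => by rw [hΦu]; exact hφb x⟩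

/-- Approximate solutions, the quality of which is controlled for short times. -/
lemma exists_raw_sequence (hA : Coef Cb A) {S C₀ : ℝ} (hS : 0 < S) (q : ℕ) (hC₀ : 0 ≤ C₀)
    {f : (Fin d → ℝ) → ℝ} (hf : ContinuousOn f (posOrth d))
    (hfb : ∀ x ∈ posOrth d, |f x| ≤ C₀ * (1 + ∑ i, x i ^ q)) :
    ∃ (Φ U : ℕ → Jet d) (δ M : ℕ → ℝ), (∀ n, 0 < δ n) ∧ (∀ n, δ n < S) ∧ Antitone δ ∧
      Tendsto δ atTop (𝓝 0) ∧ (∀ n, 0 ≤ M n) ∧ (∀ n, M n * δ n ≤ (1 / 2) ^ n) ∧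
      (∀ n s t, (Φ n).u s = (Φ n).u t) ∧ (∀ n, ∃ N, JC N (Φ n)) ∧ (∀ n, ∃ α N, JB α N N (U n)) ∧
      (∀ n : ℕ, ∀ x ∈ box d ((n : ℝ) + 1), |(Φ n).u 0 x - f x| ≤ (1 / 2) ^ n) ∧
      (∀ (n : ℕ) t x, |(Φ n).u t x| ≤ C₀ * (1 + d * ((n : ℝ) + 1) ^ q) + (1 / 2) ^ n) ∧
      (∀ n : ℕ, ∀ t ∈ Set.Ici (0 : ℝ), ∀ x ∈ box d ((n : ℝ) + 1), |(Φ n).res A 0 t x| ≤ M n) ∧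
      (∀ n : ℕ, ∀ t ∈ Set.Icc (δ n) S, ∀ x ∈ box d ((n : ℝ) + 1), (U n).res A 0 t x = 0) ∧
      (∀ n, ∀ t ∈ Set.Icc 0 S, ∀ x, |(U n).u t x - (Φ n).u t x| ≤ M n * t) ∧
      (∀ n : ℕ, ∀ t ∈ Set.Icc 0 S, ∀ x,
        |(U n).u t x| ≤ C₀ * (1 + d * ((n : ℝ) + 1) ^ q) + (1 / 2) ^ n + M n * δ n) := by
  have hb1 : ∀ n : ℕ, (1 : ℝ) ≤ n + 1 := fun n => by linarith [n.cast_nonneg (α := ℝ)]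
  choose Φ B₂ hΦu hΦt hB₂ hΦB hΦJ hΦf hΦb using exists_smooth_data q hC₀ hf hfb
  have hCb := hA.nonneg
  obtain ⟨Λ, hΛ⟩ : ∃ Λ : ℕ → ℝ, ∀ n, Λ n = 1 + Cb * ((n : ℝ) + 1) ^ 2 := ⟨_, fun _ => rfl⟩
  have hΛ0 : ∀ n, 0 ≤ Λ n := fun n => by rw [hΛ]; positivity
  obtain ⟨M, hM⟩ : ∃ M : ℕ → ℝ, ∀ n, M n = 1 / 2 * (d * (d * (Λ n * B₂ n))) := ⟨_, fun _ => rfl⟩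
  have hM0 : ∀ n, 0 ≤ M n := fun n => by
    have := hB₂ n; have := hΛ0 n; rw [hM]; positivity
  obtain ⟨δ, hδ0, hδS, hδa, hδl, hMδ⟩ := exists_times hS hM0
  have hex : ∀ n, ∃ U : Jet d, (∃ α N, JB α N N U) ∧
      (∀ t ∈ Set.Icc (δ n) S, ∀ x ∈ box d ((n : ℝ) + 1), U.res A 0 t x = 0) ∧
      (∀ t ∈ Set.Icc 0 S, ∀ x, |U.u t x - (Φ n).u t x| ≤ M n * t) ∧
      (∀ t ∈ Set.Icc 0 S, ∀ x,
        |U.u t x| ≤ C₀ * (1 + d * ((n : ℝ) + 1) ^ q) + (1 / 2) ^ n + M n * δ n) := by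
    intro n
    obtain ⟨α, H, A', hα, hα2, hA'H, hA'pd, hA's, hA'A, hA'b⟩ :=
      hA.exists_cutoff (hb1 n) (hδ0 n) (hδS n).le
    obtain ⟨Z, hZ⟩ := hΦJ n α hα (hα2.trans (by norm_num))
    obtain ⟨U, N, hUJ, hUres, hUΦ, hUB⟩ := exists_approximant hα hα2 hA'H hA'pd hA's hZ (hΦt n)
      (hΦb n) (M := M n) (fun t x => by
        rw [hM]
        exact abs_trace_le (hΛ0 n) (fun i j => (hA'b i j t x).trans (hΛ n).ge)
          fun i j => hΦB n i j t x) (hδ0 n) (hδS n)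
    exact ⟨U, ⟨α, N, hUJ⟩, fun t ht x hx => by
      rw [← res_congr U (hA'A t ht x hx)]
      exact hUres t ht x, hUΦ, hUB⟩
  choose U hU hUres hUΦ hUb using hex
  refine ⟨Φ, U, δ, M, hδ0, hδS, hδa, hδl, hM0, hMδ, hΦu, fun n => ?_, hU, hΦf, hΦb, ?_, hUres, hUΦ,
    hUb⟩
  · obtain ⟨Z, hZ⟩ := hΦJ n 1 one_pos le_rfl
    exact ⟨Z, hZ.jc le_rfl le_rfl⟩
  · intro n t ht x hx
    have hx' := box_subset_posOrth (by linarith [hb1 n]) hx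
    have h1 := abs_trace_le (hΛ0 n) (a := fun i j => A i j t x) (fun i j =>
      (hA.bdd_box (hb1 n) ht hx i j).trans ?_) fun i j => hΦB n i j t x
    · rw [Jet.res, hΦt, hM, zero_mul, add_zero, zero_sub, abs_neg]
      exact h1
    · rw [hΛ]; linarith

theorem exists_sequence (hA : Coef Cb A) {S C₀ : ℝ} (hS : 0 < S) (q : ℕ) (hC₀ : 0 ≤ C₀)
    {f : (Fin d → ℝ) → ℝ} (hf : ContinuousOn f (posOrth d))
    (hfb : ∀ x ∈ posOrth d, |f x| ≤ C₀ * (1 + ∑ i, x i ^ q)) :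
    ∃ (U : ℕ → Jet d) (δ : ℕ → ℝ) (K μ : ℝ), (∀ n, 0 < δ n) ∧ (∀ n, δ n < S) ∧ Antitone δ ∧
      Tendsto δ atTop (𝓝 0) ∧ 0 ≤ K ∧ 0 ≤ μ ∧ (∀ n, ∃ α N, JB α N N (U n)) ∧
      (∀ n : ℕ, ∀ t ∈ Set.Icc (δ n) S, ∀ x ∈ box d ((n : ℝ) + 1), (U n).res A 0 t x = 0) ∧
      (∀ n : ℕ, ∀ x ∈ box d ((n : ℝ) + 1), |(U n).u 0 x - f x| ≤ (1 / 2) ^ n) ∧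
      (∀ n : ℕ, ∀ t ∈ Set.Icc 0 S, ∀ x ∈ box d ((n : ℝ) + 1), |(U (n + 1)).u t x - (U n).u t x|
        ≤ 5 * (1 / 2) ^ n + K / ((n : ℝ) + 1) ^ 2 * bar d μ (q + 2) t x) ∧
      (∀ n : ℕ, ∀ t ∈ Set.Icc 0 S, ∀ x ∈ box d ((n : ℝ) + 1), |(U n).u t x|
        ≤ (C₀ + 2) * (Real.exp (μ * t) * (1 + ∑ i, x i ^ q))
          + K / ((n : ℝ) + 1) ^ 2 * bar d μ (q + 2) t x) := by
  have hb1 : ∀ n : ℕ, (1 : ℝ) ≤ n + 1 := fun n => by linarith [n.cast_nonneg (α := ℝ)]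
  have hb0 : ∀ n : ℕ, (0 : ℝ) < n + 1 := fun n => by linarith [hb1 n]
  have hpos : ∀ n : ℕ, box d ((n : ℝ) + 1) ⊆ posOrth d := fun n => box_subset_posOrth (hb0 n)
  have hε : ∀ n : ℕ, (0 : ℝ) < (1 / 2) ^ n := fun n => by positivity
  have hε1 : ∀ n : ℕ, (1 / 2 : ℝ) ^ n ≤ 1 := fun n => pow_le_one₀ (by norm_num) (by norm_num)
  have hCb := hA.nonneg
  obtain ⟨Φ, U, δ, M, hδ0, hδS, hδa, hδl, hM0, hMδ, hΦu, hΦJ, hUJ, hΦf, hΦb, hΦres, hUres, hUΦ,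
    hUB⟩ := exists_raw_sequence hA hS q hC₀ hf hfb
  obtain ⟨κ, hκ⟩ : ∃ κ, κ = q + 2 := ⟨_, rfl⟩
  obtain ⟨μ, hμ⟩ : ∃ μ : ℝ, μ = Cb * ((q + 1) ^ 2 + (κ + 1) ^ 2) := ⟨_, rfl⟩
  have hμ0 : 0 ≤ μ := by rw [hμ]; positivity
  obtain ⟨K, hK⟩ : ∃ K : ℝ, K = 2 * (C₀ * (1 + d * 2 ^ q) + 2) := ⟨_, rfl⟩
  have hK0 : 0 ≤ K := by rw [hK]; positivity
  have hc0 : ∀ n : ℕ, 0 ≤ K / ((n : ℝ) + 1) ^ 2 := fun n => by positivity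
  have hcb : ∀ (n : ℕ) (t : ℝ), ∀ x ∈ box d ((n : ℝ) + 1),
      0 ≤ K / ((n : ℝ) + 1) ^ 2 * bar d μ κ t x := fun n t x hx =>
    mul_nonneg (hc0 n) (bar_nonneg μ κ t (hpos n hx))
  have hcK : ∀ n : ℕ, K / ((n : ℝ) + 1) ^ 2 * ((n : ℝ) + 1) ^ κ = K * ((n : ℝ) + 1) ^ q := fun n => by
    rw [hκ, pow_add]; field_simp
  have hbound : ∀ n m : ℕ, m ≤ n + 1 → C₀ * (1 + d * ((m : ℝ) + 1) ^ q) + 2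
      ≤ K / 2 * ((n : ℝ) + 1) ^ q := by
    intro n m hmn
    have h1 : ((m : ℝ) + 1) ^ q ≤ 2 ^ q * ((n : ℝ) + 1) ^ q := by
      rw [← mul_pow]
      refine pow_le_pow_left₀ (hb0 m).le ?_ q
      have : (m : ℝ) ≤ n + 1 := mod_cast hmn
      linarith [n.cast_nonneg (α := ℝ)]
    have h2 : (1 : ℝ) ≤ ((n : ℝ) + 1) ^ q := one_le_pow₀ (hb1 n)
    have h3 := mul_le_mul_of_nonneg_left h1 (mul_nonneg hC₀ (d.cast_nonneg (α := ℝ)))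
    have h4 := mul_le_mul_of_nonneg_left h2 hC₀
    rw [hK]
    nlinarith
  have hΦb' : ∀ n m : ℕ, m ≤ n + 1 → ∀ t x, |(Φ m).u t x| ≤ K / 2 * ((n : ℝ) + 1) ^ q :=
    fun n m hmn t x => (hΦb m t x).trans (le_trans (by linarith [hε1 m]) (hbound n m hmn))
  have hUb' : ∀ n m : ℕ, m ≤ n + 1 → ∀ t ∈ Set.Icc 0 S, ∀ x,
      |(U m).u t x| ≤ K / 2 * ((n : ℝ) + 1) ^ q := fun n m hmn t ht x =>
    (hUB m t ht x).trans (le_trans (by linarith [hε1 m, hMδ m]) (hbound n m hmn))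
  have hUφ : ∀ n, ∀ t ∈ Set.Icc 0 (δ n), ∀ x, |(U n).u t x - (Φ n).u t x| ≤ (1 / 2) ^ n :=
    fun n t ht x => (hUΦ n t ⟨ht.1, ht.2.trans (hδS n).le⟩ x).trans
      ((mul_le_mul_of_nonneg_left ht.2 (hM0 n)).trans (hMδ n))
  have hboxs : ∀ n : ℕ, box d ((n : ℝ) + 1) ⊆ box d (((n + 1 : ℕ) : ℝ) + 1) := fun n =>
    box_mono (hb0 n) (by push_cast; linarith)
  have hhalf : ∀ n : ℕ, (1 / 2 : ℝ) ^ (n + 1) = (1 / 2) ^ n / 2 := fun n => by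
    rw [pow_succ]; ring
  have hφφ : ∀ n : ℕ, ∀ t, ∀ x ∈ box d ((n : ℝ) + 1),
      |(Φ (n + 1)).u t x - (Φ n).u t x| ≤ 3 / 2 * (1 / 2) ^ n := by
    intro n t x hx
    have h1 := abs_le.1 (hΦf (n + 1) x (hboxs n hx))
    have h2 := abs_le.1 (hΦf n x hx)
    rw [hhalf] at h1
    rw [hΦu (n + 1) t 0, hΦu n t 0]
    exact abs_le.2 ⟨by linarith, by linarith⟩
  have hUJ' : ∀ n, ∃ N, JC N (U n) := fun n => by
    obtain ⟨α, N, h⟩ := hUJ n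
    exact ⟨N, h.jc le_rfl le_rfl⟩
  have cmp : ∀ (n : ℕ) (V : Jet d) (N' t₁ t₂ R E C₁ : ℝ), JC N' V → 0 < t₁ → t₂ ≤ S →
      0 ≤ R → 0 ≤ E → 0 ≤ C₁ →
      (∀ t ∈ Set.Ioo t₁ t₂, ∀ x ∈ box d ((n : ℝ) + 1), |V.res A 0 t x| ≤ R) →
      (∀ x ∈ box d ((n : ℝ) + 1), |V.u t₁ x| ≤ E + C₁ * (1 + ∑ i, x i ^ q)
        + K / ((n : ℝ) + 1) ^ 2 * bar d μ κ t₁ x) →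
      (∀ t ∈ Set.Icc t₁ t₂, ∀ x, |V.u t x| ≤ K * ((n : ℝ) + 1) ^ q) →
      ∀ t ∈ Set.Icc t₁ t₂, ∀ x ∈ box d ((n : ℝ) + 1), |V.u t x| ≤ E + R * (t - t₁)
        + C₁ * (Real.exp (μ * t) * (1 + ∑ i, x i ^ q))
        + K / ((n : ℝ) + 1) ^ 2 * bar d μ κ t x := by
    intro n V N' t₁ t₂ R E C₁ hV ht₁ ht₂ hR hE hC₁ hVres hV0 hVb
    have hintg := (interior_subset (s := box d ((n : ℝ) + 1))).trans (hpos n)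
    exact box_bound q κ (hb1 n) hCb ht₁.le hR hE hC₁ (hc0 n) hμ.ge hV.cu.continuousOn
      (fun t _ x _ => hV.hat t x)
      (fun t ht x hx => (hA.pd t (ht₁.trans ht.1).le x (hintg hx)).posSemidef)
      (fun t ht x hx i => hA.bdd t (ht₁.trans ht.1).le x (hintg hx) i i)
      (fun t ht x hx => hVres t ht x (interior_subset hx)) hV0
      (fun t ht x _ _ => by rw [hcK]; exact hVb t ht x)
  have hδs : ∀ n, δ (n + 1) ≤ δ n := fun n => hδa n.le_succ
  -- the intermediate time interval
  have hmid : ∀ n : ℕ, ∀ t ∈ Set.Icc (δ (n + 1)) (δ n), ∀ x ∈ box d ((n : ℝ) + 1),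
      |(U (n + 1)).u t x - (Φ n).u t x|
        ≤ 3 * (1 / 2) ^ n + K / ((n : ℝ) + 1) ^ 2 * bar d μ κ t x := by
    intro n t ht x hx
    obtain ⟨N₁, h1⟩ := hUJ' (n + 1)
    obtain ⟨N₂, h2⟩ := hΦJ n
    have hu : ∀ t x, ((U (n + 1)).add ((Φ n).smul (-1))).u t x
        = (U (n + 1)).u t x - (Φ n).u t x := fun t x => by
      simp only [Jet.add, Jet.smul]; ring
    have := cmp n ((U (n + 1)).add ((Φ n).smul (-1))) _ (δ (n + 1)) (δ n) (M n) (2 * (1 / 2) ^ n) 0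
      (h1.add (h2.smul (-1))) (hδ0 _) (hδS n).le (hM0 n) (by positivity) le_rfl
      (fun t ht x hx => by
        rw [res_add, res_smul, hUres (n + 1) t ⟨ht.1.le, ht.2.le.trans (hδS n).le⟩ x (hboxs n hx),
          zero_add, neg_one_mul, abs_neg]
        exact hΦres n t ((hδ0 _).trans ht.1).le x hx)
      (fun x hx => by
        rw [hu]
        have e1 := abs_le.1 (hUφ (n + 1) _ (Set.right_mem_Icc.2 (hδ0 _).le) x)
        have e2 := abs_le.1 (hφφ n (δ (n + 1)) x hx)
        have e3 := hcb n (δ (n + 1)) x hx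
        rw [hhalf] at e1
        exact abs_le.2 ⟨by linarith, by linarith⟩)
      (fun t ht x => by
        rw [hu]
        have e1 := hUb' n (n + 1) le_rfl t ⟨(hδ0 _).le.trans ht.1, ht.2.trans (hδS n).le⟩ x
        have e2 := hΦb' n n n.le_succ t x
        exact (abs_sub _ _).trans (by linarith)) t ht x hx
    rw [hu] at this
    have e := mul_le_mul_of_nonneg_left (show t - δ (n + 1) ≤ δ n by linarith [ht.2, hδ0 (n + 1)])
      (hM0 n)
    linarith [hMδ n]
  refine ⟨U, δ, K, μ, hδ0, hδS, hδa, hδl, hK0, hμ0, hUJ, hUres, fun n x hx => ?_,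
    fun n t ht x hx => ?_, fun n t ht x hx => ?_⟩
  · have h1 := hUΦ n 0 (Set.left_mem_Icc.2 hS.le) x
    rw [mul_zero] at h1
    rw [sub_eq_zero.1 (abs_nonpos_iff.1 h1)]
    exact hΦf n x hx
  · rw [← hκ]
    have hlow : ∀ t ∈ Set.Icc 0 (δ n), ∀ x ∈ box d ((n : ℝ) + 1),
        |(U (n + 1)).u t x - (U n).u t x|
          ≤ 4 * (1 / 2) ^ n + K / ((n : ℝ) + 1) ^ 2 * bar d μ κ t x := by
      intro t ht x hx
      have e0 := abs_le.1 (hUφ n t ht x)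
      have e3 := hcb n t x hx
      rcases le_total t (δ (n + 1)) with h | h
      · have e1 := abs_le.1 (hUφ (n + 1) t ⟨ht.1, h⟩ x)
        have e2 := abs_le.1 (hφφ n t x hx)
        rw [hhalf] at e1
        have := hε n
        exact abs_le.2 ⟨by linarith, by linarith⟩
      · have e1 := abs_le.1 (hmid n t ⟨h, ht.2⟩ x hx)
        exact abs_le.2 ⟨by linarith, by linarith⟩
    rcases le_total t (δ n) with h | h
    · exact (hlow t ⟨ht.1, h⟩ x hx).trans (by linarith [hε n])
    · obtain ⟨N₁, h1⟩ := hUJ' (n + 1)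
      obtain ⟨N₂, h2⟩ := hUJ' n
      have hu : ∀ t x, ((U (n + 1)).add ((U n).smul (-1))).u t x
          = (U (n + 1)).u t x - (U n).u t x := fun t x => by
        simp only [Jet.add, Jet.smul]; ring
      have := cmp n ((U (n + 1)).add ((U n).smul (-1))) _ (δ n) S 0 (4 * (1 / 2) ^ n) 0
        (h1.add (h2.smul (-1))) (hδ0 _) le_rfl le_rfl (by positivity) le_rfl
        (fun t ht x hx => by
          rw [res_add, res_smul, hUres (n + 1) t ⟨(hδs n).trans ht.1.le, ht.2.le⟩ x (hboxs n hx),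
            hUres n t ⟨ht.1.le, ht.2.le⟩ x hx]
          simp)
        (fun x hx => by
          rw [hu, zero_mul, add_zero]
          exact hlow _ (Set.right_mem_Icc.2 (hδ0 n).le) x hx)
        (fun t ht x => by
          rw [hu]
          have e1 := hUb' n (n + 1) le_rfl t ⟨(hδ0 _).le.trans ht.1, ht.2⟩ x
          have e2 := hUb' n n n.le_succ t ⟨(hδ0 _).le.trans ht.1, ht.2⟩ x
          exact (abs_sub _ _).trans (by linarith)) t ⟨h, ht.2⟩ x hx
      rw [hu] at this
      have := hε n
      linarith
  · rw [← hκ]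
    have hlow : ∀ t ∈ Set.Icc 0 (δ n), ∀ x ∈ box d ((n : ℝ) + 1), |(U n).u t x|
        ≤ (C₀ + 2) * (1 + ∑ i, x i ^ q) := by
      intro t ht x hx
      have e0 := abs_le.1 (hUφ n t ht x)
      have e1 := abs_le.1 (hΦf n x hx)
      rw [hΦu n 0 t] at e1
      have e2 := abs_le.1 (hfb x (hpos n hx))
      have e3 := one_add_sum_pow_nonneg q (hpos n hx)
      have := hε1 n
      exact abs_le.2 ⟨by linarith, by linarith⟩
    have e4 := hcb n t x hx
    rcases le_total t (δ n) with h | h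
    · refine (hlow t ⟨ht.1, h⟩ x hx).trans (le_add_of_le_of_nonneg ?_ e4)
      have e3 := one_add_sum_pow_nonneg q (hpos n hx)
      exact mul_le_mul_of_nonneg_left (le_mul_of_one_le_left (by linarith)
        (Real.one_le_exp (mul_nonneg hμ0 ht.1))) (by linarith)
    · obtain ⟨N₂, h2⟩ := hUJ' n
      have := cmp n (U n) _ (δ n) S 0 0 (C₀ + 2) h2 (hδ0 _) le_rfl le_rfl le_rfl (by linarith)
        (fun t ht x hx => by rw [hUres n t ⟨ht.1.le, ht.2.le⟩ x hx, abs_zero])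
        (fun x hx => by
          have e3 := hcb n (δ n) x hx
          have := hlow (δ n) (Set.right_mem_Icc.2 (hδ0 n).le) x hx
          linarith)
        (fun t ht x => (hUb' n n n.le_succ t ⟨(hδ0 _).le.trans ht.1, ht.2⟩ x).trans (by
          have : 0 ≤ K * ((n : ℝ) + 1) ^ q := by positivity
          linarith)) t ⟨h, ht.2⟩ x hx
      linarith

end TVP

namespace TVP

variable {d : ℕ}

/-! ### Passage to the limit -/

lemma tendstoUniformlyOn_of_dist_le {E F : Type*} [PseudoMetricSpace F] {g : ℕ → E → F} {G : E → F}
    {s : Set E} {ε : ℕ → ℝ} (hε : Summable ε) (m : ℕ)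
    (h : ∀ n ≥ m, ∀ p ∈ s, dist (g n p) (g (n + 1) p) ≤ ε n)
    (hG : ∀ p ∈ s, Tendsto (fun n => g n p) atTop (𝓝 (G p))) : TendstoUniformlyOn g G atTop s := by
  rw [Metric.tendstoUniformlyOn_iff]
  intro η hη
  have hs : Summable fun n => ε (n + m) := (summable_nat_add_iff m).2 hε
  have h0 : ∀ᶠ n in atTop, ∑' k, ε (k + n) < η :=
    (tendsto_sum_nat_add ε).eventually (gt_mem_nhds hη)
  filter_upwards [h0, eventually_ge_atTop m] with n hn hm p hp
  have h1 := dist_le_tsum_of_dist_le_of_tendsto (f := fun k => g (k + m) p) (fun n => ε (n + m))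
    (fun n => by simpa [add_right_comm] using h (n + m) (by lia) p hp) hs
    ((tendsto_add_atTop_iff_nat m).2 (hG p hp)) (n - m)
  rw [dist_comm]
  simp only [Nat.sub_add_cancel hm] at h1
  refine h1.trans_lt (lt_of_eq_of_lt (tsum_congr fun k => ?_) hn)
  congr 1
  lia

lemma tendsto_limUnder_of_dist_le {F : Type*} [PseudoMetricSpace F] [CompleteSpace F] [Nonempty F]
    {g : ℕ → F} {ε : ℕ → ℝ} (hε : Summable ε) (m : ℕ) (h : ∀ n ≥ m, dist (g n) (g (n + 1)) ≤ ε n) :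
    Tendsto g atTop (𝓝 (limUnder atTop g)) := by
  refine CauchySeq.tendsto_limUnder ?_
  have : CauchySeq fun n => g (n + m) := cauchySeq_of_dist_le_of_summable (fun n => ε (n + m))
    (fun n => by simpa [add_right_comm] using h (n + m) (by lia)) ((summable_nat_add_iff m).2 hε)
  obtain ⟨y, hy⟩ := cauchySeq_tendsto_of_complete this
  exact ((tendsto_add_atTop_iff_nat m).1 hy).cauchySeq

lemma summable_error (K B : ℝ) :
    Summable fun n : ℕ => 5 * (1 / 2 : ℝ) ^ n + K / ((n : ℝ) + 1) ^ 2 * B := by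
  refine ((summable_geometric_of_lt_one (by norm_num) (by norm_num)).mul_left 5).add ?_
  have := (summable_nat_add_iff 1).2 (Real.summable_one_div_nat_pow.2 one_lt_two)
  refine (this.mul_left (K * B)).congr fun n => ?_
  push_cast
  ring

/-- The pointwise limit of a sequence of jets. -/
def Jet.lim (U : ℕ → Jet d) : Jet d where
  u t x := limUnder atTop fun n => (U n).u t x
  ut t x := limUnder atTop fun n => (U n).ut t x
  ux i t x := limUnder atTop fun n => (U n).ux i t x
  uxx i j t x := limUnder atTop fun n => (U n).uxx i j t x

/-- Limits of summable sequences of jets. -/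
lemma Jet.lim_at {U : ℕ → Jet d} (hU : ∀ n, ∃ α N, JB α N N (U n)) {V₁ : Set ℝ}
    {V₂ : Set (Fin d → ℝ)} (h₁ : IsOpen V₁) (h₂ : IsOpen V₂) {ε : ℕ → ℝ} (hε : Summable ε) (m : ℕ)
    (hu : ∀ n ≥ m, ∀ t ∈ V₁, ∀ x ∈ V₂, |(U (n + 1)).u t x - (U n).u t x| ≤ ε n)
    (hut : ∀ n ≥ m, ∀ t ∈ V₁, ∀ x ∈ V₂, |(U (n + 1)).ut t x - (U n).ut t x| ≤ ε n)
    (hux : ∀ n ≥ m, ∀ t ∈ V₁, ∀ x ∈ V₂, ∀ i, |(U (n + 1)).ux i t x - (U n).ux i t x| ≤ ε n)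
    (huxx : ∀ n ≥ m, ∀ t ∈ V₁, ∀ x ∈ V₂, ∀ i j, |(U (n + 1)).uxx i j t x - (U n).uxx i j t x| ≤ ε n)
    {t : ℝ} (ht : t ∈ V₁) {x : Fin d → ℝ} (hx : x ∈ V₂) :
    (Jet.lim U).At t x ∧
    ContinuousAt (fun p : ℝ × (Fin d → ℝ) => (Jet.lim U).ut p.1 p.2) (t, x) ∧
    (∀ i, ContinuousAt (fun p : ℝ × (Fin d → ℝ) => (Jet.lim U).ux i p.1 p.2) (t, x)) ∧
    (∀ i j, ContinuousAt (fun p : ℝ × (Fin d → ℝ) => (Jet.lim U).uxx i j p.1 p.2) (t, x)) ∧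
    ∀ (A : Fin d → Fin d → ℝ → (Fin d → ℝ) → ℝ) (l : ℝ),
      Tendsto (fun n => (U n).res A l t x) atTop (𝓝 ((Jet.lim U).res A l t x)) := by
  have dd : ∀ {a b c : ℝ}, |b - a| ≤ c → dist a b ≤ c := fun {a b c} h => by
    rwa [dist_comm, Real.dist_eq]
  have tu : ∀ t ∈ V₁, ∀ x ∈ V₂, Tendsto (fun n => (U n).u t x) atTop (𝓝 ((Jet.lim U).u t x)) :=
    fun t ht x hx => tendsto_limUnder_of_dist_le hε m fun n hn => dd (hu n hn t ht x hx)
  have tut : ∀ t ∈ V₁, ∀ x ∈ V₂, Tendsto (fun n => (U n).ut t x) atTop (𝓝 ((Jet.lim U).ut t x)) :=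
    fun t ht x hx => tendsto_limUnder_of_dist_le hε m fun n hn => dd (hut n hn t ht x hx)
  have tux : ∀ t ∈ V₁, ∀ x ∈ V₂, ∀ i,
      Tendsto (fun n => (U n).ux i t x) atTop (𝓝 ((Jet.lim U).ux i t x)) :=
    fun t ht x hx i => tendsto_limUnder_of_dist_le hε m fun n hn => dd (hux n hn t ht x hx i)
  have tuxx : ∀ t ∈ V₁, ∀ x ∈ V₂, ∀ i j,
      Tendsto (fun n => (U n).uxx i j t x) atTop (𝓝 ((Jet.lim U).uxx i j t x)) :=
    fun t ht x hx i j => tendsto_limUnder_of_dist_le hε m fun n hn => dd (huxx n hn t ht x hx i j)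
  have hc : ∀ {g : ℕ → ℝ → (Fin d → ℝ) → ℝ} {G : ℝ → (Fin d → ℝ) → ℝ},
      (∀ n, Continuous fun p : ℝ × (Fin d → ℝ) => g n p.1 p.2) →
      (∀ n ≥ m, ∀ t ∈ V₁, ∀ x ∈ V₂, |g (n + 1) t x - g n t x| ≤ ε n) →
      (∀ t ∈ V₁, ∀ x ∈ V₂, Tendsto (fun n => g n t x) atTop (𝓝 (G t x))) →
      ContinuousAt (fun p : ℝ × (Fin d → ℝ) => G p.1 p.2) (t, x) := by
    intro g G h1 h2 h3
    refine ContinuousOn.continuousAt (s := V₁ ×ˢ V₂) (TendstoUniformlyOn.continuousOn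
      (tendstoUniformlyOn_of_dist_le (g := fun n p => g n p.1 p.2) hε m (fun n hn p hp =>
        dd (h2 n hn _ hp.1 _ hp.2)) fun p hp => h3 _ hp.1 _ hp.2)
      (Frequently.of_forall fun n => (h1 n).continuousOn))
      ((h₁.prod h₂).mem_nhds ⟨ht, hx⟩)
  have hgrad : ∀ {c : ℕ → Fin d → ℝ} {C : Fin d → ℝ}, (∀ i, Tendsto (fun n => c n i) atTop (𝓝 (C i))) →
      Tendsto (fun n => grad (c n)) atTop (𝓝 (grad C)) := fun {c C} h =>
    ((gradL d).continuous.tendsto C).comp (tendsto_pi_nhds.2 h)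
  have hgradd : ∀ {c e : Fin d → ℝ} {r : ℝ}, (∀ i, |e i - c i| ≤ r) →
      dist (grad c) (grad e) ≤ d * r := fun {c e r} h => by
    rw [dist_comm, dist_eq_norm, ← gradL_apply, ← gradL_apply, ← map_sub]
    exact norm_grad_le _ h
  choose α N hJ using hU
  refine ⟨⟨?_, ?_, fun i => ?_⟩, hc (fun n => (hJ n).hut.cont) hut tut,
    fun i => hc (fun n => ((hJ n).hux i).cont) (fun n hn t ht x hx => hux n hn t ht x hx i)
      fun t ht x hx => tux t ht x hx i,
    fun i j => hc (fun n => ((hJ n).huxx i j).cont) (fun n hn t ht x hx => huxx n hn t ht x hx i j)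
      fun t ht x hx => tuxx t ht x hx i j, fun A l => ?_⟩
  · exact hasDerivAt_of_tendstoLocallyUniformlyOn (g' := fun s => (Jet.lim U).ut s x) h₁
      (tendstoUniformlyOn_of_dist_le hε m (fun n hn t ht => dd (hut n hn t ht x hx))
        fun t ht => tut t ht x hx).tendstoLocallyUniformlyOn
      (Eventually.of_forall fun n s _ => (hJ n).dt s x) (fun s hs => tu s hs x hx) ht
  · filter_upwards [h₂.mem_nhds hx] with y hy
    exact hasFDerivAt_of_tendstoLocallyUniformlyOn
      (g' := fun y => grad fun i => (Jet.lim U).ux i t y) h₂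
      (tendstoUniformlyOn_of_dist_le (hε.mul_left (d : ℝ)) m
        (fun n hn y hy => hgradd fun i => hux n hn t ht y hy i)
        fun y hy => hgrad fun i => tux t ht y hy i).tendstoLocallyUniformlyOn
      (fun n s _ => (hJ n).dx t s) (fun s hs => tu t ht s hs) hy
  · exact hasFDerivAt_of_tendstoLocallyUniformlyOn
      (g' := fun y => grad fun j => (Jet.lim U).uxx i j t y) h₂
      (tendstoUniformlyOn_of_dist_le (hε.mul_left (d : ℝ)) m
        (fun n hn y hy => hgradd fun j => huxx n hn t ht y hy i j)
        fun y hy => hgrad fun j => tuxx t ht y hy i j).tendstoLocallyUniformlyOn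
      (fun n s _ => (hJ n).dxx i t s) (fun s hs => tux t ht s hs i) hx
  · exact ((tut t ht x hx).add ((tu t ht x hx).const_mul l)).sub
      ((tendsto_finsetSum _ fun i _ => tendsto_finsetSum _ fun j _ =>
        (tuxx t ht x hx i j).const_mul _).const_mul _)

variable {A : Fin d → Fin d → ℝ → (Fin d → ℝ) → ℝ} {Cb : ℝ}

/-- Locally uniform convergence propagates to derivatives by the interior estimates. -/
lemma exists_local_bound (hA : Coef Cb A) {S K μ : ℝ} {q : ℕ} (hK : 0 ≤ K) {U : ℕ → Jet d}
    {δ : ℕ → ℝ} (hδ0 : ∀ n, 0 < δ n) (hδS : ∀ n, δ n < S) (hδa : Antitone δ)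
    (hδl : Tendsto δ atTop (𝓝 0)) (hUJ : ∀ n, ∃ α N, JB α N N (U n))
    (hres : ∀ n : ℕ, ∀ t ∈ Set.Icc (δ n) S, ∀ x ∈ box d ((n : ℝ) + 1), (U n).res A 0 t x = 0)
    (hdiff : ∀ n : ℕ, ∀ t ∈ Set.Icc 0 S, ∀ x ∈ box d ((n : ℝ) + 1),
      |(U (n + 1)).u t x - (U n).u t x| ≤ 5 * (1 / 2) ^ n + K / ((n : ℝ) + 1) ^ 2 * bar d μ q t x)
    {t : ℝ} (ht : t ∈ Set.Ioo 0 S) {x : Fin d → ℝ} (hx : x ∈ posOrth d) :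
    ∃ (V₁ : Set ℝ) (V₂ : Set (Fin d → ℝ)) (ε : ℕ → ℝ) (m : ℕ), IsOpen V₁ ∧ IsOpen V₂ ∧ t ∈ V₁ ∧
      x ∈ V₂ ∧ Summable ε ∧ (∀ n ≥ m, (U n).res A 0 t x = 0) ∧
      ∀ n ≥ m, ∀ t ∈ V₁, ∀ x ∈ V₂, |(U (n + 1)).u t x - (U n).u t x| ≤ ε n ∧
        |(U (n + 1)).ut t x - (U n).ut t x| ≤ ε n ∧
        (∀ i, |(U (n + 1)).ux i t x - (U n).ux i t x| ≤ ε n) ∧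
        ∀ i j, |(U (n + 1)).uxx i j t x - (U n).uxx i j t x| ≤ ε n := by
  obtain ⟨b, hb, hxb⟩ := exists_mem_box hx
  obtain ⟨m, hm⟩ := ((hδl.eventually (gt_mem_nhds ht.1)).and
    ((tendsto_natCast_atTop_atTop (R := ℝ)).eventually_ge_atTop b)).exists
  have hb1 : ∀ n : ℕ, (1 : ℝ) ≤ n + 1 := fun n => by linarith [n.cast_nonneg (α := ℝ)]
  have hb0 : ∀ n : ℕ, (0 : ℝ) < n + 1 := fun n => by linarith [hb1 n]
  have hboxm : ∀ n ≥ m, box d ((m : ℝ) + 1) ⊆ box d ((n : ℝ) + 1) := fun n hn =>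
    box_mono (hb0 m) (by have : (m : ℝ) ≤ n := mod_cast hn; linarith)
  have hxi : x ∈ interior (box d ((m : ℝ) + 1)) :=
    box_subset_interior (by linarith) (by linarith [hm.2]) hxb
  obtain ⟨α, H, A', hα, hα2, hA'H, hA'pd, hA's, hA'A, -⟩ :=
    hA.exists_cutoff (hb1 m) (hδ0 m) (hδS m).le
  obtain ⟨r, hr, hball⟩ := Metric.isOpen_iff.1 (isOpen_Ioo.prod isOpen_interior) (t, x)
    (show (t, x) ∈ Set.Ioo (δ m) S ×ˢ interior (box d ((m : ℝ) + 1)) from ⟨⟨hm.1, ht.2⟩, hxi⟩)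
  have hb' : ∀ q ∈ Metric.ball (t, x) r, q.1 ∈ Set.Icc (δ m) S ∧ q.2 ∈ box d ((m : ℝ) + 1) :=
    fun q hq => ⟨Ioo_subset_Icc_self (hball hq).1, interior_subset (hball hq).2⟩
  obtain ⟨C, hC⟩ := interior_estimate hα hα2 hA'H (fun t x => (hA'pd t x).posSemidef) hA's (t, x) hr
  obtain ⟨B, hB⟩ := (isCompact_Icc.prod (isCompact_box (d := d) ((m : ℝ) + 1))).exists_bound_of_continuousOn
    ((bar_continuousOn μ q (Set.Icc 0 S)).mono (Set.prod_mono Subset.rfl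
      (box_subset_posOrth (d := d) (hb0 m))))
  obtain ⟨e, he⟩ : ∃ e : ℕ → ℝ, ∀ n, e n = 5 * (1 / 2 : ℝ) ^ n + K / ((n : ℝ) + 1) ^ 2 * |B| :=
    ⟨_, fun _ => rfl⟩
  have he0 : ∀ n, 0 ≤ e n := fun n => by rw [he]; positivity
  have hes : Summable e := (summable_error K |B|).congr fun n => (he n).symm
  have hu : ∀ n ≥ m, ∀ q ∈ Metric.ball (t, x) r, |(U (n + 1)).u q.1 q.2 - (U n).u q.1 q.2| ≤ e n := by
    intro n hn p hp
    have hp1 : p.1 ∈ Set.Icc 0 S := ⟨(hδ0 m).le.trans (hb' p hp).1.1, (hb' p hp).1.2⟩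
    refine (hdiff n p.1 hp1 p.2 (hboxm n hn (hb' p hp).2)).trans ?_
    rw [he]
    gcongr
    exact (le_abs_self _).trans ((hB p ⟨hp1, (hb' p hp).2⟩).trans (le_abs_self B))
  have hres' : ∀ n ≥ m, ∀ q ∈ Metric.ball (t, x) r, (U n).res A 0 q.1 q.2 = 0 := fun n hn p hp =>
    hres n p.1 ⟨(hδa hn).trans (hb' p hp).1.1, (hb' p hp).1.2⟩ p.2 (hboxm n hn (hb' p hp).2)
  have hJC : ∀ n, ∃ N, JC N (U n) := fun n => by
    obtain ⟨α, N, h⟩ := hUJ n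
    exact ⟨N, h.jc le_rfl le_rfl⟩
  have hder : ∀ n ≥ m, ∀ q ∈ Metric.closedBall (t, x) (r / 2), ∀ i j,
      |(U (n + 1)).ux i q.1 q.2 - (U n).ux i q.1 q.2| ≤ C * e n ∧
      |(U (n + 1)).uxx i j q.1 q.2 - (U n).uxx i j q.1 q.2| ≤ C * e n := by
    intro n hn q hq i j
    obtain ⟨N₁, h1⟩ := hJC (n + 1)
    obtain ⟨N₂, h2⟩ := hJC n
    have := hC ((U (n + 1)).add ((U n).smul (-1))) _ (e n) (h1.add (h2.smul (-1))) (he0 n)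
      (fun q hq => by
        rw [res_congr (A' := A) _ (hA'A q.1 (hb' q hq).1 q.2 (hb' q hq).2), res_add, res_smul,
          hres' n hn q hq, hres' (n + 1) (by lia) q hq]
        simp)
      (fun q hq => by
        simpa only [Jet.add, Jet.smul, neg_one_mul, ← sub_eq_add_neg] using hu n hn q hq) q hq i j
    simpa only [Jet.add, Jet.smul, neg_one_mul, ← sub_eq_add_neg] using this
  obtain ⟨Λ, hΛ⟩ : ∃ Λ, Λ = Cb * ((m : ℝ) + 1) ^ 2 := ⟨_, rfl⟩
  have hΛ0 : 0 ≤ Λ := by rw [hΛ]; have := hA.nonneg; positivity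
  obtain ⟨D, hD⟩ : ∃ D, D = 1 + |C| + 1 / 2 * (d * (d * (Λ * |C|))) := ⟨_, rfl⟩
  have hnn : 0 ≤ 1 / 2 * (d * (d * (Λ * |C|))) := by positivity
  have hr2 : ∀ s ∈ Metric.ball t (r / 2), ∀ y ∈ Metric.ball x (r / 2),
      (s, y) ∈ Metric.closedBall (t, x) (r / 2) := fun s hs y hy => by
    rw [Metric.mem_closedBall, Prod.dist_eq]
    exact max_le (Metric.mem_ball.1 hs).le (Metric.mem_ball.1 hy).le
  have hcb := Metric.closedBall_subset_ball (x := (t, x)) (half_lt_self hr)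
  refine ⟨Metric.ball t (r / 2), Metric.ball x (r / 2), fun n => D * e n, m, Metric.isOpen_ball,
    Metric.isOpen_ball, Metric.mem_ball_self (by linarith), Metric.mem_ball_self (by linarith),
    hes.mul_left D, fun n hn => hres' n hn (t, x) (Metric.mem_ball_self hr),
    fun n hn s hs y hy => ?_⟩
  have hmem := hr2 s hs y hy
  have hCD : C * e n ≤ D * e n := mul_le_mul_of_nonneg_right
    (by rw [hD]; linarith [le_abs_self C]) (he0 n)
  refine ⟨(hu n hn _ (hcb hmem)).trans (le_mul_of_one_le_left (he0 n) (by
    rw [hD]; linarith [abs_nonneg C])), ?_, fun i => ((hder n hn _ hmem i i).1).trans hCD,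
    fun i j => ((hder n hn _ hmem i j).2).trans hCD⟩
  have e1 := hres' n hn _ (hcb hmem)
  have e2 := hres' (n + 1) (by lia) _ (hcb hmem)
  simp only [Jet.res, zero_mul, add_zero, sub_eq_zero] at e1 e2
  rw [e1, e2, ← mul_sub, ← Finset.sum_sub_distrib]
  simp only [← Finset.sum_sub_distrib, ← mul_sub]
  have hb'' := hb' _ (hcb hmem)
  refine (abs_trace_le (B := C * e n) hΛ0 (fun i j => hΛ ▸ hA.bdd_box (hb1 m)
    ((hδ0 m).le.trans hb''.1.1) hb''.2 i j) fun i j => (hder n hn _ hmem i j).2).trans ?_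
  have : 1 / 2 * (d * (d * (Λ * (C * e n)))) ≤ 1 / 2 * (d * (d * (Λ * |C|))) * e n := by
    have := mul_le_mul_of_nonneg_right (le_abs_self C) (he0 n)
    calc 1 / 2 * (d * (d * (Λ * (C * e n)))) ≤ 1 / 2 * (d * (d * (Λ * (|C| * e n)))) := by gcongr
      _ = _ := by ring
  refine this.trans (mul_le_mul_of_nonneg_right ?_ (he0 n))
  rw [hD]
  linarith [abs_nonneg C]

/-- A classical solution of the initial value problem on `[0,S]`. -/
structure Sol (A : Fin d → Fin d → ℝ → (Fin d → ℝ) → ℝ) (S : ℝ) (f : (Fin d → ℝ) → ℝ)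
    (J : Jet d) : Prop where
  at_ : ∀ t ∈ Set.Ioo 0 S, ∀ x ∈ posOrth d, J.At t x
  res : ∀ t ∈ Set.Ioo 0 S, ∀ x ∈ posOrth d, J.res A 0 t x = 0
  cont : ContinuousOn (fun p : ℝ × (Fin d → ℝ) => J.u p.1 p.2) (Set.Icc 0 S ×ˢ posOrth d)
  cut : ∀ t ∈ Set.Ioo 0 S, ∀ x ∈ posOrth d,
    ContinuousAt (fun p : ℝ × (Fin d → ℝ) => J.ut p.1 p.2) (t, x)
  cux : ∀ i, ∀ t ∈ Set.Ioo 0 S, ∀ x ∈ posOrth d,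
    ContinuousAt (fun p : ℝ × (Fin d → ℝ) => J.ux i p.1 p.2) (t, x)
  cuxx : ∀ i j, ∀ t ∈ Set.Ioo 0 S, ∀ x ∈ posOrth d,
    ContinuousAt (fun p : ℝ × (Fin d → ℝ) => J.uxx i j p.1 p.2) (t, x)
  initial : ∀ x ∈ posOrth d, J.u 0 x = f x

theorem exists_sol (hA : Coef Cb A) {S C₀ : ℝ} (hS : 0 < S) (q : ℕ) (hC₀ : 0 ≤ C₀)
    {f : (Fin d → ℝ) → ℝ} (hf : ContinuousOn f (posOrth d))
    (hfb : ∀ x ∈ posOrth d, |f x| ≤ C₀ * (1 + ∑ i, x i ^ q)) :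
    ∃ J, Sol A S f J ∧ ∃ C, 0 ≤ C ∧ ∀ t ∈ Set.Icc 0 S, ∀ x ∈ posOrth d,
      |J.u t x| ≤ C * (1 + ∑ i, x i ^ q) := by
  obtain ⟨U, δ, K, μ, hδ0, hδS, hδa, hδl, hK, hμ, hUJ, hres, hinit, hdiff, hgr⟩ :=
    exists_sequence hA hS q hC₀ hf hfb
  have hb0 : ∀ n : ℕ, (0 : ℝ) < n + 1 := fun n => by positivity
  have hbox : ∀ x ∈ posOrth d, ∃ m : ℕ, x ∈ interior (box d ((m : ℝ) + 1)) := fun x hx => by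
    obtain ⟨b, hb, hxb⟩ := exists_mem_box hx
    obtain ⟨m, hm⟩ := exists_nat_ge b
    exact ⟨m, box_subset_interior (by linarith) (by linarith) hxb⟩
  have hboxm : ∀ {n m : ℕ}, m ≤ n → box d ((m : ℝ) + 1) ⊆ box d ((n : ℝ) + 1) := fun {n m} hn =>
    box_mono (hb0 m) (by have : (m : ℝ) ≤ n := mod_cast hn; linarith)
  have hdist : ∀ m : ℕ, ∃ ε : ℕ → ℝ, Summable ε ∧ ∀ n ≥ m, ∀ t ∈ Set.Icc 0 S,
      ∀ x ∈ box d ((m : ℝ) + 1), dist ((U n).u t x) ((U (n + 1)).u t x) ≤ ε n := by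
    intro m
    obtain ⟨B, hB⟩ := (isCompact_Icc.prod (isCompact_box (d := d)
      ((m : ℝ) + 1))).exists_bound_of_continuousOn
      ((bar_continuousOn μ (q + 2) (Set.Icc 0 S)).mono (Set.prod_mono Subset.rfl
        (box_subset_posOrth (d := d) (hb0 m))))
    refine ⟨_, summable_error K B, fun n hn t ht x hx => ?_⟩
    rw [dist_comm, Real.dist_eq]
    refine (hdiff n t ht x (hboxm hn hx)).trans ?_
    gcongr
    exact (le_abs_self _).trans (hB (t, x) ⟨ht, hx⟩)
  have htend : ∀ t ∈ Set.Icc 0 S, ∀ x ∈ posOrth d,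
      Tendsto (fun n => (U n).u t x) atTop (𝓝 ((Jet.lim U).u t x)) := by
    intro t ht x hx
    obtain ⟨m, hm⟩ := hbox x hx
    obtain ⟨ε, hε, h⟩ := hdist m
    exact tendsto_limUnder_of_dist_le hε m fun n hn => h n hn t ht x (interior_subset hm)
  have hev : ∀ x ∈ posOrth d, ∀ᶠ n : ℕ in atTop, x ∈ box d ((n : ℝ) + 1) := by
    intro x hx
    obtain ⟨m, hm⟩ := hbox x hx
    filter_upwards [eventually_ge_atTop m] with n hn
    exact hboxm hn (interior_subset hm)
  have hloc : ∀ t ∈ Set.Ioo 0 S, ∀ x ∈ posOrth d, (Jet.lim U).At t x ∧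
      ContinuousAt (fun p : ℝ × (Fin d → ℝ) => (Jet.lim U).ut p.1 p.2) (t, x) ∧
      (∀ i, ContinuousAt (fun p : ℝ × (Fin d → ℝ) => (Jet.lim U).ux i p.1 p.2) (t, x)) ∧
      (∀ i j, ContinuousAt (fun p : ℝ × (Fin d → ℝ) => (Jet.lim U).uxx i j p.1 p.2) (t, x)) ∧
      (Jet.lim U).res A 0 t x = 0 := by
    intro t ht x hx
    obtain ⟨V₁, V₂, ε, m, h₁, h₂, htV, hxV, hε, hr, h⟩ :=
      exists_local_bound hA hK hδ0 hδS hδa hδl hUJ hres hdiff ht hx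
    obtain ⟨g1, g2, g3, g4, g5⟩ := Jet.lim_at hUJ h₁ h₂ hε m
      (fun n hn t ht x hx => (h n hn t ht x hx).1) (fun n hn t ht x hx => (h n hn t ht x hx).2.1)
      (fun n hn t ht x hx => (h n hn t ht x hx).2.2.1)
      (fun n hn t ht x hx => (h n hn t ht x hx).2.2.2) htV hxV
    refine ⟨g1, g2, g3, g4, tendsto_nhds_unique (g5 A 0) (tendsto_const_nhds.congr' ?_)⟩
    filter_upwards [eventually_ge_atTop m] with n hn
    exact (hr n hn).symm
  refine ⟨Jet.lim U, ⟨fun t ht x hx => (hloc t ht x hx).1, fun t ht x hx => (hloc t ht x hx).2.2.2.2,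
    fun p hp => ?_, fun t ht x hx => (hloc t ht x hx).2.1,
    fun i t ht x hx => (hloc t ht x hx).2.2.1 i, fun i j t ht x hx => (hloc t ht x hx).2.2.2.1 i j,
    fun x hx => ?_⟩, (C₀ + 2) * Real.exp (μ * S), by positivity, fun t ht x hx => ?_⟩
  · obtain ⟨m, hm⟩ := hbox p.2 hp.2
    obtain ⟨ε, hε, h⟩ := hdist m
    have hsub := box_subset_posOrth (d := d) (hb0 m)
    have hcont := (tendstoUniformlyOn_of_dist_le (g := fun n (p : ℝ × (Fin d → ℝ)) => (U n).u p.1 p.2)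
      (G := fun p => (Jet.lim U).u p.1 p.2) (s := Set.Icc 0 S ×ˢ box d ((m : ℝ) + 1)) hε m
      (fun n hn p hp => h n hn p.1 hp.1 p.2 hp.2)
      fun p hp => htend p.1 hp.1 p.2 (hsub hp.2)).continuousOn
      (Frequently.of_forall fun n => by
        obtain ⟨α, N, hJ⟩ := hUJ n
        exact hJ.hu.cont.continuousOn)
    refine (hcont p ⟨hp.1, interior_subset hm⟩).mono_of_mem_nhdsWithin ?_
    obtain ⟨p1, p2⟩ := p
    rw [nhdsWithin_prod_eq]
    exact prod_mem_prod self_mem_nhdsWithin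
      (mem_nhdsWithin_of_mem_nhds (mem_interior_iff_mem_nhds.1 hm))
  · refine tendsto_nhds_unique (htend 0 (Set.left_mem_Icc.2 hS.le) x hx) ?_
    rw [tendsto_iff_dist_tendsto_zero]
    refine squeeze_zero' (Eventually.of_forall fun _ => dist_nonneg) ?_
      (tendsto_pow_atTop_nhds_zero_of_lt_one (r := (1 / 2 : ℝ)) (by norm_num) (by norm_num))
    filter_upwards [hev x hx] with n hn
    exact hinit n x hn
  · have hlim : Tendsto (fun n : ℕ => (C₀ + 2) * (Real.exp (μ * t) * (1 + ∑ i, x i ^ q))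
        + K / ((n : ℝ) + 1) ^ 2 * bar d μ (q + 2) t x) atTop
        (𝓝 ((C₀ + 2) * (Real.exp (μ * t) * (1 + ∑ i, x i ^ q)) + 0 * bar d μ (q + 2) t x)) := by
      refine ((tendsto_const_nhds.div_atTop ?_).mul_const _).const_add _
      exact (tendsto_pow_atTop two_ne_zero).comp
        (tendsto_atTop_add_const_right _ 1 tendsto_natCast_atTop_atTop)
    have h1 := le_of_tendsto_of_tendsto (htend t ht x hx).abs hlim (by
      filter_upwards [hev x hx] with n hn
      exact hgr n t ht x hn)
    refine h1.trans ?_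
    rw [zero_mul, add_zero, mul_assoc]
    have := one_add_sum_pow_nonneg q hx
    have hh : μ * t ≤ μ * S := mul_le_mul_of_nonneg_left ht.2 hμ
    gcongr

end TVP

namespace TVP

variable {d : ℕ}

/-! ### Polynomial weights -/

lemma isOpen_posOrth (d : ℕ) : IsOpen (posOrth d) := by
  have : posOrth d = ⋂ i, {x | 0 < x i} := by ext; simp [posOrth]
  rw [this]
  exact isOpen_iInter_of_finite fun i => isOpen_lt continuous_const (continuous_apply i)

/-- The polynomial weight of degree `q`. -/
def wt (q : ℕ) (x : Fin d → ℝ) : ℝ := 1 + ∑ i, x i ^ q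

lemma one_le_wt (q : ℕ) {x : Fin d → ℝ} (hx : x ∈ posOrth d) : 1 ≤ wt q x :=
  one_add_sum_pow_nonneg q hx

lemma wt_le_norm (q : ℕ) {x : Fin d → ℝ} (hx : x ∈ posOrth d) :
    wt q x ≤ (1 + d) * (1 + ‖x‖) ^ q := by
  have h1 : ∀ i ∈ (Finset.univ : Finset (Fin d)), x i ^ q ≤ (1 + ‖x‖) ^ q := fun i _ =>
    pow_le_pow_left₀ (hx i).le (by linarith [(le_abs_self _).trans (norm_le_pi_norm x i)]) q
  have h2 := Finset.sum_le_card_nsmul _ _ _ h1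
  simp only [Finset.card_univ, Fintype.card_fin, nsmul_eq_mul] at h2
  have h3 : (1 : ℝ) ≤ (1 + ‖x‖) ^ q := one_le_pow₀ (by linarith [norm_nonneg x])
  unfold wt
  linarith

lemma norm_pow_le_wt (q : ℕ) {x : Fin d → ℝ} (hx : x ∈ posOrth d) : ‖x‖ ^ q ≤ wt q x := by
  rcases isEmpty_or_nonempty (Fin d) with h | h
  · have : x = 0 := Subsingleton.elim _ _
    rw [this, norm_zero]
    refine (zero_pow_le_one q).trans ?_
    rw [← this]; exact one_le_wt q hx
  · obtain ⟨i, hi⟩ := Finite.exists_max x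
    have h1 : ‖x‖ ≤ x i := (pi_norm_le_iff_of_nonneg (hx i).le).2 fun j => by
      rw [Real.norm_eq_abs, abs_of_pos (hx j)]; exact hi j
    have h2 : x i ^ q ≤ ∑ j, x j ^ q :=
      Finset.single_le_sum (f := fun j => x j ^ q) (fun j _ => (pow_pos (hx j) q).le)
        (Finset.mem_univ i)
    have := pow_le_pow_left₀ (norm_nonneg x) h1 q
    unfold wt; linarith

lemma one_add_norm_pow_le_wt (q : ℕ) {x : Fin d → ℝ} (hx : x ∈ posOrth d) :
    (1 + ‖x‖) ^ q ≤ 2 ^ (q + 1) * wt q x := by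
  have h1 := norm_pow_le_wt q hx
  have h2 := one_le_wt q hx
  have h3 : (1 + ‖x‖) ^ q ≤ 2 ^ q * (1 ^ q + ‖x‖ ^ q) := by
    refine (add_pow_le zero_le_one (norm_nonneg x) q).trans ?_
    have : (2 : ℝ) ^ (q - 1) ≤ 2 ^ q := pow_le_pow_right₀ one_le_two (Nat.sub_le _ _)
    gcongr
  refine h3.trans ?_
  rw [one_pow, pow_succ, mul_assoc]
  gcongr
  linarith

lemma pow_mul_wt_le (q r : ℕ) {x : Fin d → ℝ} (hx : x ∈ posOrth d) :
    (1 + ‖x‖) ^ r * wt q x ≤ (1 + d) * 2 ^ (r + q + 1) * wt (r + q) x := by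
  calc (1 + ‖x‖) ^ r * wt q x ≤ (1 + ‖x‖) ^ r * ((1 + d) * (1 + ‖x‖) ^ q) := by
        gcongr; exact wt_le_norm q hx
    _ = (1 + d) * (1 + ‖x‖) ^ (r + q) := by rw [pow_add]; ring
    _ ≤ _ := by rw [mul_assoc]; gcongr; exact one_add_norm_pow_le_wt _ hx

lemma wt_mono {q r : ℕ} (h : q ≤ r) {x : Fin d → ℝ} (hx : x ∈ posOrth d) :
    wt q x ≤ (1 + d) * 2 ^ (r + 1) * wt r x := by
  refine (wt_le_norm q hx).trans ?_
  rw [mul_assoc]; gcongr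
  refine le_trans ?_ (one_add_norm_pow_le_wt r hx)
  exact pow_le_pow_right₀ (by linarith [norm_nonneg x]) h

lemma wt_le_rpow (q : ℕ) {x : Fin d → ℝ} (hx : x ∈ posOrth d) :
    wt q x ≤ (1 + d) * 2 ^ (q + 1) * (1 + ‖x‖ ^ ((q + 1 : ℕ) : ℝ)) := by
  rw [Real.rpow_natCast]
  refine (wt_le_norm q hx).trans ?_
  rw [mul_assoc]; gcongr
  calc (1 + ‖x‖) ^ q ≤ (1 + ‖x‖) ^ (q + 1) :=
        pow_le_pow_right₀ (by linarith [norm_nonneg x]) (Nat.le_succ q)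
    _ ≤ 2 ^ (q + 1 - 1) * (1 ^ (q + 1) + ‖x‖ ^ (q + 1)) :=
        add_pow_le zero_le_one (norm_nonneg x) _
    _ ≤ _ := by
        rw [one_pow]; gcongr
        · norm_num
        · omega

lemma rpow_le_wt {q : ℝ} (hq : 0 ≤ q) {r : ℕ} (hr : q ≤ r) {x : Fin d → ℝ} (hx : x ∈ posOrth d) :
    1 + ‖x‖ ^ q ≤ 2 ^ (r + 2) * wt r x := by
  have h0 := norm_nonneg x
  have h1 : ‖x‖ ^ q ≤ (1 + ‖x‖) ^ r := by
    rw [← Real.rpow_natCast (1 + ‖x‖)]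
    exact (Real.rpow_le_rpow h0 (le_add_of_nonneg_left zero_le_one) hq).trans
      (Real.rpow_le_rpow_of_exponent_le (le_add_of_nonneg_right h0) hr)
  have h2 : 1 ≤ (1 + ‖x‖) ^ r := one_le_pow₀ (by linarith)
  have h3 := one_add_norm_pow_le_wt r hx
  rw [pow_succ]; linarith

/-! ### The coefficient field of one step of the scheme -/

lemma coef_step {T Cb : ℝ} {a : ℝ → (Fin d → ℝ) → Fin d → Fin d → ℝ} (hCb : 0 ≤ Cb)
    (ha_cont : ∀ i j, ContinuousOn (fun p : ℝ × (Fin d → ℝ) => a p.1 p.2 i j)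
      (Set.Icc 0 T ×ˢ posOrth d))
    (ha_symm : ∀ t ∈ Set.Icc (0 : ℝ) T, ∀ x ∈ posOrth d, ∀ i j, a t x i j = a t x j i)
    (ha_pd : ∀ t ∈ Set.Icc (0 : ℝ) T, ∀ x ∈ posOrth d, ∀ y : Fin d → ℝ, y ≠ 0 →
      0 < ∑ i, ∑ j, a t x i j * y i * y j)
    (ha_bdd : ∀ t ∈ Set.Icc (0 : ℝ) T, ∀ x ∈ posOrth d, ∀ i j, |a t x i j| ≤ Cb)
    (ha_holder : ∀ i j, LocallyHolderOn (fun p : ℝ × (Fin d → ℝ) => a p.1 p.2 i j)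
      (Set.Ico 0 T ×ˢ posOrth d)) {t₁ : ℝ} (h0 : 0 < t₁) (h1 : t₁ ≤ T) :
    Coef Cb fun i j s (x : Fin d → ℝ) => a (max (t₁ - s) 0) x i j * x i * x j := by
  have hm : ∀ s : ℝ, 0 ≤ s → max (t₁ - s) 0 ∈ Set.Icc 0 T := fun s hs =>
    ⟨le_max_right _ _, max_le (by linarith) (by linarith)⟩
  have hc : Continuous fun p : ℝ × (Fin d → ℝ) => (max (t₁ - p.1) 0, p.2) := by fun_prop
  refine ⟨hCb, fun i j => ?_, fun i j => ?_, fun t ht x hx => ?_, fun t ht x hx i j => ?_⟩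
  · refine (((ha_cont i j).comp hc.continuousOn fun p hp => ⟨hm p.1 hp.1, hp.2⟩).mul ?_).mul ?_ <;>
      fun_prop
  · rintro p hp
    have hp' : ((max (t₁ - p.1) 0, p.2) : ℝ × (Fin d → ℝ)) ∈ Set.Ico 0 T ×ˢ posOrth d := by
      refine ⟨⟨le_max_right _ _, max_lt ?_ (by linarith)⟩, hp.2⟩
      have : 0 < p.1 := hp.1
      linarith
    obtain ⟨U, hU, α, C, hα, hα1, hC, hUC⟩ := ha_holder i j _ hp'
    have hmaps : Set.MapsTo (fun p : ℝ × (Fin d → ℝ) => (max (t₁ - p.1) 0, p.2))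
        (Set.Ioi 0 ×ˢ posOrth d) (Set.Ico 0 T ×ˢ posOrth d) := fun q hq => by
      have : 0 < q.1 := hq.1
      exact ⟨⟨le_max_right _ _, max_lt (by linarith) (by linarith)⟩, hq.2⟩
    have hU' := (hc.continuousOn.continuousWithinAt (s := Set.Ioi 0 ×ˢ posOrth d) (x := p)
      hp).tendsto_nhdsWithin hmaps hU
    obtain ⟨R, hR⟩ : ∃ R, R = ‖p‖ + 1 := ⟨_, rfl⟩
    have hR0 : 0 ≤ R := by rw [hR]; positivity
    refine ⟨_, inter_mem (inter_mem hU' self_mem_nhdsWithin)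
      (mem_nhdsWithin_of_mem_nhds (Metric.ball_mem_nhds p (show (0 : ℝ) < 1 / 2 by norm_num))),
      α, C * R * R + Cb * R + Cb * R, hα, hα1, by positivity, ?_⟩
    rintro q ⟨⟨hqU, hqp⟩, hqb⟩ q' ⟨⟨hqU', hqp'⟩, hqb'⟩
    have hco : ∀ z ∈ Metric.ball p (1 / 2), ∀ k, |z.2 k| ≤ R := by
      intro z hz k
      have h1 : ‖z‖ ≤ ‖p‖ + 1 := by
        have := norm_le_norm_add_norm_sub' z p
        rw [← dist_eq_norm] at this
        linarith [Metric.mem_ball.1 hz]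
      rw [hR]
      exact (norm_le_pi_norm z.2 k).trans ((norm_snd_le z).trans h1)
    have hd1 : dist q q' ≤ 1 := by
      have := dist_triangle_right q q' p
      linarith [Metric.mem_ball.1 hqb, Metric.mem_ball.1 hqb']
    have hdα : dist q q' ≤ dist q q' ^ α := by
      conv_lhs => rw [← Real.rpow_one (dist q q')]
      exact Real.rpow_le_rpow_of_exponent_ge' dist_nonneg hd1 hα.le hα1
    have hk : ∀ k, |q.2 k - q'.2 k| ≤ dist q q' ^ α := fun k => by
      refine le_trans ?_ hdα
      rw [← Real.dist_eq]
      exact (dist_le_pi_dist q.2 q'.2 k).trans (le_max_right _ _)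
    have hca : dist ((max (t₁ - q.1) 0, q.2) : ℝ × (Fin d → ℝ)) (max (t₁ - q'.1) 0, q'.2) ≤
        dist q q' := by
      rw [Prod.dist_eq, Prod.dist_eq]
      refine max_le_max ?_ le_rfl
      rw [Real.dist_eq, Real.dist_eq]
      refine (abs_max_sub_max_le_abs _ _ _).trans (le_of_eq ?_)
      rw [← abs_neg]; congr 1; ring
    have hA : |a (max (t₁ - q.1) 0) q.2 i j - a (max (t₁ - q'.1) 0) q'.2 i j| ≤
        C * dist q q' ^ α :=
      (hUC _ hqU _ hqU').trans (by gcongr)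
    have hb := ha_bdd _ (hm q'.1 (le_of_lt hqp'.1)) _ hqp'.2 i j
    have e1 := hco q hqb
    have e2 := hco q' hqb'
    have hD : 0 ≤ dist q q' ^ α := by positivity
    calc _ = |(a (max (t₁ - q.1) 0) q.2 i j - a (max (t₁ - q'.1) 0) q'.2 i j) * q.2 i * q.2 j
          + a (max (t₁ - q'.1) 0) q'.2 i j * (q.2 i - q'.2 i) * q.2 j
          + a (max (t₁ - q'.1) 0) q'.2 i j * q'.2 i * (q.2 j - q'.2 j)| := by congr 1; ring
      _ ≤ C * dist q q' ^ α * R * R + Cb * dist q q' ^ α * R + Cb * R * dist q q' ^ α := by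
          refine (abs_add_three _ _ _).trans ?_
          simp only [abs_mul]
          gcongr
          exacts [e1 i, e1 j, hk i, e1 j, e2 i, hk j]
      _ = _ := by ring
  · refine Matrix.PosDef.of_dotProduct_mulVec_pos ?_ fun {y} hy => ?_
    · ext i j
      simp only [Matrix.conjTranspose_apply, Matrix.of_apply, star_trivial]
      rw [ha_symm _ (hm t ht) x hx j i]; ring
    · have := ha_pd _ (hm t ht) x hx (fun i => y i * x i) fun h => hy <| by
        funext i
        have := congrFun h i
        simpa [(hx i).ne'] using this
      simp only [dotProduct, Matrix.mulVec, Matrix.of_apply, Pi.star_apply, star_trivial,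
        Finset.mul_sum]
      refine this.trans_eq (Finset.sum_congr rfl fun i _ => Finset.sum_congr rfl fun j _ => ?_)
      ring
  · rw [mul_assoc, abs_mul, abs_of_pos (mul_pos (hx i) (hx j))]
    exact mul_le_mul_of_nonneg_right (ha_bdd _ (hm t ht) x hx i j)
      (mul_pos (hx i) (hx j)).le

end TVP

namespace TVP

variable {d : ℕ} {A : Fin d → Fin d → ℝ → (Fin d → ℝ) → ℝ} {Cb : ℝ}

/-! ### The solution operator -/

/-- The solution `J` grows at most polynomially of degree `q`, uniformly on `[0, S]`. -/
def Grows (S : ℝ) (q : ℕ) (J : Jet d) : Prop :=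
  ∃ C, 0 ≤ C ∧ ∀ t ∈ Set.Icc 0 S, ∀ x ∈ posOrth d, |J.u t x| ≤ C * wt q x

lemma Grows.mono {S : ℝ} {q r : ℕ} (hqr : q ≤ r) {J : Jet d} (h : Grows S q J) : Grows S r J := by
  obtain ⟨C, hC, h⟩ := h
  refine ⟨C * ((1 + d) * 2 ^ (r + 1)), by positivity, fun t ht x hx => (h t ht x hx).trans ?_⟩
  rw [mul_assoc]
  exact mul_le_mul_of_nonneg_left (wt_mono hqr hx) hC

/-- The growth factor of the solution operator on the weight of degree `q`. -/
def growthFactor (Cb S : ℝ) (q : ℕ) : ℝ :=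
  Real.exp (Cb * ((q + 1) ^ 2 + ((q + 1 : ℕ) + 1) ^ 2) * S)

lemma growthFactor_pos (Cb S : ℝ) (q : ℕ) : 0 < growthFactor Cb S q := Real.exp_pos _

lemma exp_le_growthFactor (hCb : 0 ≤ Cb) {S t : ℝ} (ht : t ≤ S) (q : ℕ) :
    Real.exp (Cb * ((q + 1) ^ 2 + ((q + 1 : ℕ) + 1) ^ 2) * t) ≤ growthFactor Cb S q := by
  unfold growthFactor
  gcongr

lemma Sol.growth_le (hA : Coef Cb A) {S : ℝ} {q : ℕ} {f : (Fin d → ℝ) → ℝ} {J : Jet d}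
    (hJ : Sol A S f J) (hg : Grows S q J) {C₁ : ℝ} (hC₁ : 0 ≤ C₁)
    (hf : ∀ x ∈ posOrth d, |f x| ≤ C₁ * wt q x) :
    ∀ t ∈ Set.Icc 0 S, ∀ x ∈ posOrth d, |J.u t x| ≤ C₁ * growthFactor Cb S q * wt q x := by
  obtain ⟨C, hC, hg⟩ := hg
  intro t ht x hx
  have := growth_comparison hA q q hC hC₁ hJ.cont hJ.at_ hJ.res hg
    (fun x hx => by rw [hJ.initial x hx]; exact hf x hx) t ht x hx
  refine this.trans ?_
  rw [mul_assoc C₁]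
  have h1 := one_le_wt q hx
  have h2 := exp_le_growthFactor hA.nonneg ht.2 q
  change C₁ * (_ * wt q x) ≤ _
  gcongr

lemma Sol.sub_growth {S : ℝ} {q r : ℕ} {f g : (Fin d → ℝ) → ℝ} {J K : Jet d}
    (hJ : Sol A S f J) (hK : Sol A S g K) (hgJ : Grows S q J) (hgK : Grows S r K) :
    ∃ D : Jet d, Sol A S (fun x => f x - g x) D ∧ Grows S (max q r) D ∧
      ∀ t x, D.u t x = J.u t x - K.u t x := by
  obtain ⟨C, hC, h1⟩ := hgJ.mono (le_max_left q r)
  obtain ⟨C', hC', h2⟩ := hgK.mono (le_max_right q r)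
  have hu : ∀ t x, (J.add (K.smul (-1))).u t x = J.u t x - K.u t x := fun t x => by
    simp only [Jet.add, Jet.smul]; ring
  refine ⟨J.add (K.smul (-1)), ⟨fun t ht x hx => (hJ.at_ t ht x hx).add
    ((hK.at_ t ht x hx).smul (-1)), fun t ht x hx => ?_, ?_,
    fun t ht x hx => (hJ.cut t ht x hx).add ((hK.cut t ht x hx).const_mul (-1)),
    fun i t ht x hx => (hJ.cux i t ht x hx).add ((hK.cux i t ht x hx).const_mul (-1)),
    fun i j t ht x hx => (hJ.cuxx i j t ht x hx).add ((hK.cuxx i j t ht x hx).const_mul (-1)),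
    fun x hx => ?_⟩, ⟨C + C', by positivity, fun t ht x hx => ?_⟩, hu⟩
  · rw [res_add, res_smul, hJ.res t ht x hx, hK.res t ht x hx]; ring
  · simp only [hu]; exact hJ.cont.sub hK.cont
  · rw [hu, hJ.initial x hx, hK.initial x hx]
  · rw [hu, add_mul]
    exact (abs_sub _ _).trans (add_le_add (h1 t ht x hx) (h2 t ht x hx))

lemma Sol.unique (hA : Coef Cb A) {S : ℝ} {q r : ℕ} {f : (Fin d → ℝ) → ℝ} {J K : Jet d}
    (hJ : Sol A S f J) (hK : Sol A S f K) (hgJ : Grows S q J) (hgK : Grows S r K) :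
    ∀ t ∈ Set.Icc 0 S, ∀ x ∈ posOrth d, J.u t x = K.u t x := by
  obtain ⟨D, h1, h2, h3⟩ := hJ.sub_growth hK hgJ hgK
  intro t ht x hx
  have := h1.growth_le hA h2 le_rfl (fun x hx => by simp) t ht x hx
  rw [h3, zero_mul, zero_mul] at this
  exact sub_eq_zero.1 (abs_eq_zero.1 (le_antisymm this (abs_nonneg _)))

open Classical in
/-- A solution of polynomial growth of the initial value problem with data `f`, if one exists. -/
def sol (A : Fin d → Fin d → ℝ → (Fin d → ℝ) → ℝ) (S : ℝ) (f : (Fin d → ℝ) → ℝ) : Jet d :=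
  if h : ∃ J, Sol A S f J ∧ ∃ q, Grows S q J then h.choose
  else ⟨fun _ _ => 0, fun _ _ => 0, fun _ _ _ => 0, fun _ _ _ _ => 0⟩

lemma sol_spec (hA : Coef Cb A) {S C₀ : ℝ} (hS : 0 < S) (q : ℕ) (hC₀ : 0 ≤ C₀)
    {f : (Fin d → ℝ) → ℝ} (hf : ContinuousOn f (posOrth d))
    (hfb : ∀ x ∈ posOrth d, |f x| ≤ C₀ * wt q x) :
    Sol A S f (sol A S f) ∧ Grows S q (sol A S f) := by
  obtain ⟨J, hJ, C, hC, hg⟩ := exists_sol hA hS q hC₀ hf hfb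
  have hex : ∃ J, Sol A S f J ∧ ∃ q, Grows S q J := ⟨J, hJ, q, C, hC, hg⟩
  obtain ⟨h1, r, h2⟩ := hex.choose_spec
  rw [sol, dif_pos hex]
  refine ⟨h1, C, hC, fun t ht x hx => ?_⟩
  rw [h1.unique hA hJ h2 ⟨C, hC, hg⟩ t ht x hx]
  exact hg t ht x hx

lemma sol_le (hA : Coef Cb A) {S C₀ : ℝ} (hS : 0 < S) (q : ℕ) (hC₀ : 0 ≤ C₀)
    {f : (Fin d → ℝ) → ℝ} (hf : ContinuousOn f (posOrth d))
    (hfb : ∀ x ∈ posOrth d, |f x| ≤ C₀ * wt q x) :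
    ∀ t ∈ Set.Icc 0 S, ∀ x ∈ posOrth d,
      |(sol A S f).u t x| ≤ C₀ * growthFactor Cb S q * wt q x := by
  obtain ⟨h1, h2⟩ := sol_spec hA hS q hC₀ hf hfb
  exact h1.growth_le hA h2 hC₀ hfb

lemma sol_sub_le (hA : Coef Cb A) {S C C' C₁ : ℝ} (hS : 0 < S) (q : ℕ) (hC : 0 ≤ C)
    (hC' : 0 ≤ C') (hC₁ : 0 ≤ C₁)
    {f g : (Fin d → ℝ) → ℝ} (hf : ContinuousOn f (posOrth d)) (hg : ContinuousOn g (posOrth d))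
    (hfb : ∀ x ∈ posOrth d, |f x| ≤ C * wt q x) (hgb : ∀ x ∈ posOrth d, |g x| ≤ C' * wt q x)
    (hfg : ∀ x ∈ posOrth d, |f x - g x| ≤ C₁ * wt q x) :
    ∀ t ∈ Set.Icc 0 S, ∀ x ∈ posOrth d,
      |(sol A S f).u t x - (sol A S g).u t x| ≤ C₁ * growthFactor Cb S q * wt q x := by
  obtain ⟨h1, h2⟩ := sol_spec hA hS q hC hf hfb
  obtain ⟨h3, h4⟩ := sol_spec hA hS q hC' hg hgb
  obtain ⟨D, e1, e2, e3⟩ := h1.sub_growth h3 h2 h4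
  rw [max_self] at e2
  intro t ht x hx
  rw [← e3]
  exact e1.growth_le hA e2 hC₁ hfg t ht x hx

end TVP

namespace TVP

variable {d : ℕ} {A : Fin d → Fin d → ℝ → (Fin d → ℝ) → ℝ} {Cb : ℝ}

/-! ### Reversing time -/

lemma Jet.At.pd1_eq {J : Jet d} {t : ℝ} {x : Fin d → ℝ} (h : J.At t x) (i : Fin d) :
    pd1 (J.u t) i x = J.ux i t x := by
  rw [pd1, h.dx.self_of_nhds.fderiv, grad_single]

lemma Jet.At.hasFDerivAt_pd1 {J : Jet d} {t : ℝ} {x : Fin d → ℝ} (h : J.At t x) (i : Fin d) :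
    HasFDerivAt (pd1 (J.u t) i) (grad fun j => J.uxx i j t x) x := by
  refine (h.dxx i).congr_of_eventuallyEq ?_
  filter_upwards [h.dx] with y hy
  rw [pd1, hy.fderiv, grad_single]

lemma Jet.At.pd2_eq {J : Jet d} {t : ℝ} {x : Fin d → ℝ} (h : J.At t x) (i j : Fin d) :
    pd2 (J.u t) i j x = J.uxx j i t x := by
  rw [pd2, (h.hasFDerivAt_pd1 j).fderiv, grad_single]

lemma continuousAt_grad {E : Type*} [TopologicalSpace E] {c : Fin d → E → ℝ} {p : E}
    (h : ∀ i, ContinuousAt (c i) p) : ContinuousAt (fun p => grad fun i => c i p) p := by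
  unfold grad
  fun_prop

lemma Sol.differentiableAt {S : ℝ} {f : (Fin d → ℝ) → ℝ} {J : Jet d} (hJ : Sol A S f J) {t : ℝ}
    (ht : t ∈ Set.Ioo 0 S) {x : Fin d → ℝ} (hx : x ∈ posOrth d) :
    DifferentiableAt ℝ (fun p : ℝ × (Fin d → ℝ) => J.u p.1 p.2) (t, x) := by
  have hnhds : ∀ᶠ p : ℝ × (Fin d → ℝ) in 𝓝 (t, x), p ∈ Set.Ioo 0 S ×ˢ posOrth d :=
    (isOpen_Ioo.prod (isOpen_posOrth d)).mem_nhds ⟨ht, hx⟩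
  refine (hasStrictFDerivAt_uncurry_coprod (𝕜 := ℝ) (f := J.u)
    (f₁ := fun t x => ContinuousLinearMap.toSpanSingleton ℝ (J.ut t x))
    (f₂ := fun t x => grad fun i => J.ux i t x) ?_ ?_ ?_ ?_).hasFDerivAt.differentiableAt
  · filter_upwards [hnhds] with p hp
    exact (hJ.at_ p.1 hp.1 p.2 hp.2).dt.hasFDerivAt
  · filter_upwards [hnhds] with p hp
    exact (hJ.at_ p.1 hp.1 p.2 hp.2).dx.self_of_nhds
  · exact ((ContinuousLinearMap.toSpanSingletonCLE (𝕜 := ℝ) (E := ℝ)).continuous.continuousAt.comp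
      (hJ.cut t ht x hx) : _)
  · exact continuousAt_grad fun i => hJ.cux i t ht x hx

/-- `v` is a solution of polynomial growth of the terminal value problem on `[t₀, t₁]` with
terminal data `f`. -/
def SolvesTVP (a : ℝ → (Fin d → ℝ) → Fin d → Fin d → ℝ) (t₀ t₁ : ℝ) (f : (Fin d → ℝ) → ℝ)
    (v : ℝ → (Fin d → ℝ) → ℝ) : Prop :=
  ContinuousOn (fun pr : ℝ × (Fin d → ℝ) => v pr.1 pr.2) (Set.Icc t₀ t₁ ×ˢ posOrth d) ∧
  IsC12 (Set.Ico t₀ t₁) (posOrth d) v ∧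
  (∀ τ ∈ Set.Ico t₀ t₁, ∀ x ∈ posOrth d, tderiv (Set.Icc t₀ t₁) v τ x
    + (1 / 2) * ∑ i, ∑ j, a τ x i j * x i * x j * pd2 (v τ) i j x = 0) ∧
  (∀ x ∈ posOrth d, v t₁ x = f x) ∧
  (∃ C q : ℝ, 0 < C ∧ 0 < q ∧ ∀ τ ∈ Set.Icc t₀ t₁, ∀ x ∈ posOrth d, |v τ x| ≤ C * (1 + ‖x‖ ^ q))

/-- The coefficients of one step of the scheme, after reversing time from `t₁`. -/
def stepCoef (a : ℝ → (Fin d → ℝ) → Fin d → Fin d → ℝ) (t₁ : ℝ) (i j : Fin d) (s : ℝ)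
    (x : Fin d → ℝ) : ℝ :=
  a (max (t₁ - s) 0) x i j * x i * x j

variable {a : ℝ → (Fin d → ℝ) → Fin d → Fin d → ℝ} {t₀ t₁ T : ℝ}

lemma exists_rpow_growth {C : ℝ} (hC : 0 ≤ C) (q : ℕ) :
    ∃ C' r : ℝ, 0 < C' ∧ 0 < r ∧ ∀ x ∈ posOrth d, C * wt q x ≤ C' * (1 + ‖x‖ ^ r) := by
  refine ⟨(C + 1) * ((1 + d) * 2 ^ (q + 1)), ((q + 1 : ℕ) : ℝ), by positivity, by positivity,
    fun x hx => ?_⟩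
  have h1 := wt_le_rpow q hx
  have h2 := one_le_wt q hx
  calc C * wt q x ≤ (C + 1) * wt q x := by gcongr; linarith
    _ ≤ _ := by rw [mul_assoc (C + 1)]; gcongr

lemma Sol.solvesTVP
    (ha_symm : ∀ t ∈ Set.Icc (0 : ℝ) T, ∀ x ∈ posOrth d, ∀ i j, a t x i j = a t x j i)
    (h0 : 0 ≤ t₀) (h1 : t₁ ≤ T) {S : ℝ} (hS : t₁ - t₀ < S) {f : (Fin d → ℝ) → ℝ} {J : Jet d}
    (hJ : Sol (stepCoef a t₁) S f J) {q : ℕ} (hg : Grows S q J) :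
    SolvesTVP a t₀ t₁ f fun τ x => J.u (t₁ - τ) x := by
  have hrev : ∀ τ ∈ Set.Ico t₀ t₁, t₁ - τ ∈ Set.Ioo 0 S := fun τ hτ =>
    ⟨sub_pos.2 hτ.2, by linarith [hτ.1]⟩
  have hrev' : ∀ τ ∈ Set.Icc t₀ t₁, t₁ - τ ∈ Set.Icc 0 S := fun τ hτ =>
    ⟨sub_nonneg.2 hτ.2, by linarith [hτ.1]⟩
  have hc : Continuous fun p : ℝ × (Fin d → ℝ) => (t₁ - p.1, p.2) := by fun_prop
  have hcont : ContinuousOn (fun pr : ℝ × (Fin d → ℝ) => J.u (t₁ - pr.1) pr.2)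
      (Set.Icc t₀ t₁ ×ˢ posOrth d) :=
    hJ.cont.comp hc.continuousOn fun p hp => ⟨hrev' p.1 hp.1, hp.2⟩
  have hdt : ∀ τ ∈ Set.Ico t₀ t₁, ∀ x ∈ posOrth d,
      HasDerivAt (fun τ => J.u (t₁ - τ) x) (-J.ut (t₁ - τ) x) τ := fun τ hτ x hx => by
    simpa using (hJ.at_ _ (hrev τ hτ) x hx).dt.comp_const_sub t₁ τ
  refine ⟨hcont, ⟨hcont.mono (prod_mono Ico_subset_Icc_self le_rfl), ?_, ?_,
    fun p => -J.ut (t₁ - p.1) p.2, fun i p => J.ux i (t₁ - p.1) p.2,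
    fun i j p => J.uxx j i (t₁ - p.1) p.2, ?_, ?_, ?_, ?_⟩, ?_, ?_, ?_⟩
  · intro τ hτ x hx
    have := hJ.differentiableAt (hrev τ (interior_subset hτ)) hx
    exact DifferentiableAt.comp (f := fun p : ℝ × (Fin d → ℝ) => (t₁ - p.1, p.2)) (τ, x) this
      (by fun_prop)
  · intro τ hτ x hx j
    exact ((hJ.at_ _ (hrev τ (interior_subset hτ)) x hx).hasFDerivAt_pd1 j).differentiableAt
  · intro p hp
    exact (ContinuousAt.comp (f := fun p : ℝ × (Fin d → ℝ) => (t₁ - p.1, p.2))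
      (hJ.cut _ (hrev _ hp.1) _ hp.2) hc.continuousAt).neg.continuousWithinAt
  · intro i p hp
    exact (ContinuousAt.comp (f := fun p : ℝ × (Fin d → ℝ) => (t₁ - p.1, p.2))
      (hJ.cux i _ (hrev _ hp.1) _ hp.2) hc.continuousAt).continuousWithinAt
  · intro i j p hp
    exact (ContinuousAt.comp (f := fun p : ℝ × (Fin d → ℝ) => (t₁ - p.1, p.2))
      (hJ.cuxx j i _ (hrev _ hp.1) _ hp.2) hc.continuousAt).continuousWithinAt
  · intro τ hτ x hx
    have hτ := interior_subset hτ
    have hat := hJ.at_ _ (hrev τ hτ) x hx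
    exact ⟨(hdt τ hτ x hx).deriv.symm, fun i => (hat.pd1_eq i).symm,
      fun i j => (hat.pd2_eq i j).symm⟩
  · intro τ hτ x hx
    have hat := hJ.at_ _ (hrev τ hτ) x hx
    have hres := hJ.res _ (hrev τ hτ) x hx
    have hlt : t₀ < t₁ := hτ.1.trans_lt hτ.2
    rw [tderiv, ((hdt τ hτ x hx).hasDerivWithinAt.derivWithin
      (uniqueDiffOn_Icc hlt τ (Ico_subset_Icc_self hτ)))]
    have hsum : ∑ i, ∑ j, a τ x i j * x i * x j * pd2 (J.u (t₁ - τ)) i j x =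
        ∑ i, ∑ j, stepCoef a t₁ i j (t₁ - τ) x * J.uxx i j (t₁ - τ) x := by
      rw [Finset.sum_comm]
      refine Finset.sum_congr rfl fun i _ => Finset.sum_congr rfl fun j _ => ?_
      have h00 : 0 ≤ τ := h0.trans hτ.1
      rw [hat.pd2_eq, stepCoef, sub_sub_cancel, max_eq_left h00,
        ha_symm τ ⟨h00, hτ.2.le.trans h1⟩ x hx j i]
      ring
    rw [hsum]
    simp only [Jet.res] at hres
    linarith
  · intro x hx
    simpa using hJ.initial x hx
  · obtain ⟨C, hC, hg⟩ := hg
    obtain ⟨C', r, h1, h2, h3⟩ := exists_rpow_growth (d := d) hC q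
    exact ⟨C', r, h1, h2, fun τ hτ x hx => (hg _ (hrev' τ hτ) x hx).trans (h3 x hx)⟩

lemma SolvesTVP.exists_sol
    (ha_symm : ∀ t ∈ Set.Icc (0 : ℝ) T, ∀ x ∈ posOrth d, ∀ i j, a t x i j = a t x j i)
    (h0 : 0 ≤ t₀) (h1 : t₁ ≤ T) {f : (Fin d → ℝ) → ℝ} {w : ℝ → (Fin d → ℝ) → ℝ}
    (hw : SolvesTVP a t₀ t₁ f w) :
    ∃ (K : Jet d) (q : ℕ), (∀ t ∈ Set.Ioo 0 (t₁ - t₀), ∀ x ∈ posOrth d, K.At t x) ∧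
      (∀ t ∈ Set.Ioo 0 (t₁ - t₀), ∀ x ∈ posOrth d, K.res (stepCoef a t₁) 0 t x = 0) ∧
      ContinuousOn (fun p : ℝ × (Fin d → ℝ) => K.u p.1 p.2) (Set.Icc 0 (t₁ - t₀) ×ˢ posOrth d) ∧
      (∀ x ∈ posOrth d, K.u 0 x = f x) ∧ Grows (t₁ - t₀) q K ∧ ∀ τ x, K.u (t₁ - τ) x = w τ x := by
  obtain ⟨hc, hI, hp, hf, C, q, hC, hq, hg⟩ := hw
  have hrev : ∀ t ∈ Set.Ioo 0 (t₁ - t₀), t₁ - t ∈ Set.Ioo t₀ t₁ := fun τ hτ =>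
    ⟨by linarith [hτ.2], by linarith [hτ.1]⟩
  have hrev' : ∀ t ∈ Set.Icc 0 (t₁ - t₀), t₁ - t ∈ Set.Icc t₀ t₁ := fun τ hτ =>
    ⟨by linarith [hτ.2], by linarith [hτ.1]⟩
  have hdt : ∀ τ ∈ Set.Ioo t₀ t₁, ∀ x ∈ posOrth d,
      HasDerivAt (fun τ => w τ x) (deriv (fun τ => w τ x) τ) τ := fun τ hτ x hx => by
    have := hI.diff τ (by rwa [interior_Ico]) x hx
    exact (DifferentiableAt.comp (f := fun τ : ℝ => (τ, x)) τ this (by fun_prop)).hasDerivAt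
  refine ⟨⟨fun s x => w (t₁ - s) x, fun s x => -deriv (fun τ => w τ x) (t₁ - s),
    fun i s x => pd1 (w (t₁ - s)) i x, fun i j s x => pd2 (w (t₁ - s)) j i x⟩, ⌈q⌉₊,
    fun t ht x hx => ⟨?_, ?_, fun i => ?_⟩, fun t ht x hx => ?_, ?_, fun x hx => ?_,
    ⟨C * 2 ^ (⌈q⌉₊ + 2), by positivity, fun t ht x hx => ?_⟩, fun τ x => ?_⟩
  · exact (hdt _ (hrev t ht) x hx).comp_const_sub t₁ t
  · filter_upwards [(isOpen_posOrth d).mem_nhds hx] with y hy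
    have := hI.diff (t₁ - t) (by rw [interior_Ico]; exact hrev t ht) y hy
    have h2 : DifferentiableAt ℝ (w (t₁ - t)) y :=
      DifferentiableAt.comp (f := fun y : Fin d → ℝ => (t₁ - t, y)) y this (by fun_prop)
    have h3 := h2.hasFDerivAt
    rw [← grad_eq (fderiv ℝ (w (t₁ - t)) y)] at h3
    exact h3
  · have h3 := (hI.diff2 (t₁ - t) (by rw [interior_Ico]; exact hrev t ht) x hx i).hasFDerivAt
    rw [← grad_eq (fderiv ℝ (pd1 (w (t₁ - t)) i) x)] at h3
    exact h3
  · have hτ := hrev t ht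
    have := hp _ (Ioo_subset_Ico_self hτ) x hx
    rw [tderiv, derivWithin_of_mem_nhds (Icc_mem_nhds hτ.1 hτ.2)] at this
    have hsum : ∑ i, ∑ j, a (t₁ - t) x i j * x i * x j * pd2 (w (t₁ - t)) i j x =
        ∑ i, ∑ j, stepCoef a t₁ i j t x * pd2 (w (t₁ - t)) j i x := by
      rw [Finset.sum_comm]
      refine Finset.sum_congr rfl fun i _ => Finset.sum_congr rfl fun j _ => ?_
      have h00 : 0 ≤ t₁ - t := h0.trans hτ.1.le
      rw [stepCoef, max_eq_left h00, ha_symm _ ⟨h00, hτ.2.le.trans h1⟩ x hx j i]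
      ring
    rw [hsum] at this
    simp only [Jet.res]
    linarith
  · exact hc.comp (f := fun p : ℝ × (Fin d → ℝ) => (t₁ - p.1, p.2)) (by fun_prop)
      fun p hp => ⟨hrev' p.1 hp.1, hp.2⟩
  · simpa using hf x hx
  · refine (hg _ (hrev' t ht) x hx).trans ?_
    rw [mul_assoc]
    exact mul_le_mul_of_nonneg_left (rpow_le_wt hq.le (Nat.le_ceil q) hx) hC.le
  · simp

lemma SolvesTVP.unique (hA : Coef Cb (stepCoef a t₁))
    (ha_symm : ∀ t ∈ Set.Icc (0 : ℝ) T, ∀ x ∈ posOrth d, ∀ i j, a t x i j = a t x j i)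
    (h0 : 0 ≤ t₀) (h1 : t₁ ≤ T) {f : (Fin d → ℝ) → ℝ} {v w : ℝ → (Fin d → ℝ) → ℝ}
    (hv : SolvesTVP a t₀ t₁ f v) (hw : SolvesTVP a t₀ t₁ f w) :
    ∀ τ ∈ Set.Icc t₀ t₁, ∀ x ∈ posOrth d, w τ x = v τ x := by
  obtain ⟨J, q, j1, j2, j3, j4, j5, j6⟩ := hv.exists_sol ha_symm h0 h1
  obtain ⟨K, r, k1, k2, k3, k4, k5, k6⟩ := hw.exists_sol ha_symm h0 h1
  obtain ⟨C, hC, g1⟩ := j5.mono (le_max_left q r)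
  obtain ⟨C', hC', g2⟩ := k5.mono (le_max_right q r)
  have hu : ∀ t x, (J.add (K.smul (-1))).u t x = J.u t x - K.u t x := fun t x => by
    simp only [Jet.add, Jet.smul]; ring
  intro τ hτ x hx
  have := growth_comparison hA (J := J.add (K.smul (-1))) 0 (max q r) (C := C + C')
    (add_nonneg hC hC') le_rfl (by simp only [hu]; exact j3.sub k3)
    (fun t ht x hx => (j1 t ht x hx).add ((k1 t ht x hx).smul (-1)))
    (fun t ht x hx => by rw [res_add, res_smul, j2 t ht x hx, k2 t ht x hx]; ring)
    (fun t ht x hx => by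
      rw [hu, add_mul]
      exact (abs_sub _ _).trans (add_le_add (g1 t ht x hx) (g2 t ht x hx)))
    (fun x hx => by rw [hu, j4 x hx, k4 x hx]; simp)
    (t₁ - τ) ⟨by linarith [hτ.2], by linarith [hτ.1]⟩ x hx
  rw [hu, j6, k6, zero_mul] at this
  exact (sub_eq_zero.1 (abs_eq_zero.1 (le_antisymm this (abs_nonneg _)))).symm

end TVP

namespace TVP

variable {d : ℕ}

/-! ### Regularity of the terminal conditions in their parameters -/

/-- The size of the first `N + 1` points of a sequence. -/
def psize (N : ℕ) (xs : ℕ → Fin d → ℝ) : ℝ := 1 + ∑ i ∈ Finset.range (N + 1), ‖xs i‖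

/-- The distance between the first `N + 1` points of two sequences. -/
def pdist (N : ℕ) (xs ys : ℕ → Fin d → ℝ) : ℝ := ∑ i ∈ Finset.range (N + 1), ‖xs i - ys i‖

lemma one_le_psize (N : ℕ) (xs : ℕ → Fin d → ℝ) : 1 ≤ psize N xs := by
  have := Finset.sum_nonneg (s := Finset.range (N + 1)) fun i _ => norm_nonneg (xs i)
  unfold psize; linarith

lemma pdist_nonneg (N : ℕ) (xs ys : ℕ → Fin d → ℝ) : 0 ≤ pdist N xs ys :=
  Finset.sum_nonneg fun _ _ => norm_nonneg _

lemma pdist_le (N : ℕ) (xs ys : ℕ → Fin d → ℝ) : pdist N xs ys ≤ psize N xs + psize N ys := by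
  have := Finset.sum_le_sum (s := Finset.range (N + 1)) fun i _ => norm_sub_le (xs i) (ys i)
  rw [Finset.sum_add_distrib] at this
  unfold pdist psize; linarith

lemma sum_ite_le (N k : ℕ) {c : ℝ} (hc : 0 ≤ c) :
    ∑ i ∈ Finset.range (N + 1), (if i = k then c else 0) ≤ c := by
  rw [Finset.sum_ite_eq']
  split_ifs <;> simp [hc]

lemma psize_update_le (N k : ℕ) (xs : ℕ → Fin d → ℝ) (x : Fin d → ℝ) :
    psize N (Function.update xs k x) ≤ psize N xs * (1 + ‖x‖) := by
  have h1 : ∀ i ∈ Finset.range (N + 1), ‖Function.update xs k x i‖ ≤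
      ‖xs i‖ + if i = k then ‖x‖ else 0 := fun i _ => by
    by_cases h : i = k
    · subst h; simp
    · simp [h]
  have h2 := Finset.sum_le_sum h1
  rw [Finset.sum_add_distrib] at h2
  have h3 := sum_ite_le N k (norm_nonneg x)
  have h4 : ‖x‖ ≤ psize N xs * ‖x‖ := le_mul_of_one_le_left (norm_nonneg x) (one_le_psize N xs)
  rw [mul_add, mul_one]
  unfold psize at *; linarith

lemma pdist_update_le (N k : ℕ) (xs ys : ℕ → Fin d → ℝ) (x : Fin d → ℝ) :
    pdist N (Function.update xs k x) (Function.update ys k x) ≤ pdist N xs ys := by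
  refine Finset.sum_le_sum fun i _ => ?_
  by_cases h : i = k
  · subst h; simp
  · simp [h]

lemma pdist_update_update_le (N k : ℕ) (xs : ℕ → Fin d → ℝ) (x y : Fin d → ℝ) :
    pdist N (Function.update xs k x) (Function.update xs k y) ≤ ‖x - y‖ := by
  refine le_trans (Finset.sum_le_sum fun i _ => ?_) (sum_ite_le N k (norm_nonneg (x - y)))
  by_cases h : i = k
  · subst h; simp
  · simp [h]

lemma update_pos {xs : ℕ → Fin d → ℝ} (hxs : ∀ i, xs i ∈ posOrth d) (k : ℕ) {x : Fin d → ℝ}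
    (hx : x ∈ posOrth d) (i : ℕ) : Function.update xs k x i ∈ posOrth d := by
  by_cases h : i = k
  · subst h; simpa
  · simpa [h] using hxs i

/-- `F` is continuous and of polynomial growth in `x`, and locally Lipschitz in its parameters
with constants of polynomial growth. -/
structure Reg (N : ℕ) (C : ℝ) (r q : ℕ) (F : (ℕ → Fin d → ℝ) → (Fin d → ℝ) → ℝ) : Prop where
  nonneg : 0 ≤ C
  bdd : ∀ xs, (∀ i, xs i ∈ posOrth d) → ∀ x ∈ posOrth d, |F xs x| ≤ C * psize N xs ^ r * wt q x
  lip : ∀ xs ys, (∀ i, xs i ∈ posOrth d) → (∀ i, ys i ∈ posOrth d) → ∀ x ∈ posOrth d,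
    |F xs x - F ys x| ≤ C * (psize N xs + psize N ys) ^ r * pdist N xs ys * wt q x
  cont : ∀ xs, (∀ i, xs i ∈ posOrth d) → ContinuousOn (F xs) (posOrth d)

lemma continuous_wt (q : ℕ) : Continuous (wt q : (Fin d → ℝ) → ℝ) := by
  unfold wt; fun_prop

lemma Reg.diag {N : ℕ} {C : ℝ} {r q : ℕ} {F : (ℕ → Fin d → ℝ) → (Fin d → ℝ) → ℝ}
    (h : Reg N C r q F) (k : ℕ) :
    Reg N (C * ((1 + d) * 2 ^ (r + q + 1))) r (r + q)
      fun xs x => F (Function.update xs k x) x := by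
  have hC := h.nonneg
  refine ⟨by positivity, fun xs hxs x hx => ?_, fun xs ys hxs hys x hx => ?_, fun xs hxs x hx => ?_⟩
  · refine (h.bdd _ (update_pos hxs k hx) x hx).trans ?_
    have h0 := one_le_psize N (Function.update xs k x)
    have h1 := one_le_psize N xs
    have h2 := one_le_wt q hx
    calc C * psize N (Function.update xs k x) ^ r * wt q x
        ≤ C * (psize N xs * (1 + ‖x‖)) ^ r * wt q x := by gcongr; exact psize_update_le N k xs x
      _ = C * psize N xs ^ r * ((1 + ‖x‖) ^ r * wt q x) := by rw [mul_pow]; ring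
      _ ≤ C * psize N xs ^ r * ((1 + d) * 2 ^ (r + q + 1) * wt (r + q) x) := by
          exact mul_le_mul_of_nonneg_left (pow_mul_wt_le q r hx) (by positivity)
      _ = _ := by ring
  · refine (h.lip _ _ (update_pos hxs k hx) (update_pos hys k hx) x hx).trans ?_
    have h0 := one_le_psize N (Function.update xs k x)
    have h0' := one_le_psize N (Function.update ys k x)
    have h1 := one_le_psize N xs
    have h1' := one_le_psize N ys
    have h2 := one_le_wt q hx
    have h3 := pdist_nonneg N xs ys
    calc C * (psize N (Function.update xs k x) + psize N (Function.update ys k x)) ^ r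
          * pdist N (Function.update xs k x) (Function.update ys k x) * wt q x
        ≤ C * ((psize N xs + psize N ys) * (1 + ‖x‖)) ^ r * pdist N xs ys * wt q x := by
          have h4 := pdist_nonneg N (Function.update xs k x) (Function.update ys k x)
          gcongr
          · rw [add_mul]
            exact add_le_add (psize_update_le N k xs x) (psize_update_le N k ys x)
          · exact pdist_update_le N k xs ys x
      _ = C * (psize N xs + psize N ys) ^ r * pdist N xs ys * ((1 + ‖x‖) ^ r * wt q x) := by
          rw [mul_pow]; ring
      _ ≤ C * (psize N xs + psize N ys) ^ r * pdist N xs ys *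
            ((1 + d) * 2 ^ (r + q + 1) * wt (r + q) x) := by
          exact mul_le_mul_of_nonneg_left (pow_mul_wt_le q r hx) (by positivity)
      _ = _ := by ring
  · have hsec := h.cont _ (update_pos hxs k hx) x hx
    have hdiff : Tendsto (fun y => F (Function.update xs k y) y - F (Function.update xs k x) y)
        (𝓝[posOrth d] x) (𝓝 0) := by
      have hb : Tendsto (fun y => C * (psize N xs * (1 + ‖y‖) + psize N (Function.update xs k x)) ^ r
          * ‖y - x‖ * wt q y) (𝓝 x) (𝓝 0) := by
        have : Continuous fun y => C * (psize N xs * (1 + ‖y‖)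
            + psize N (Function.update xs k x)) ^ r * ‖y - x‖ * wt q y := by
          have := continuous_wt (d := d) q
          fun_prop
        simpa using this.tendsto x
      refine squeeze_zero_norm' ?_ (hb.mono_left nhdsWithin_le_nhds)
      filter_upwards [self_mem_nhdsWithin] with y hy
      refine (h.lip _ _ (update_pos hxs k hy) (update_pos hxs k hx) y hy).trans ?_
      have h0 := one_le_psize N (Function.update xs k y)
      have h0' := one_le_psize N (Function.update xs k x)
      have h1 := one_le_psize N xs
      have h2 := one_le_wt q hy
      have h3 := pdist_nonneg N (Function.update xs k y) (Function.update xs k x)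
      gcongr
      · exact psize_update_le N k xs y
      · exact pdist_update_update_le N k xs y x
    have := hdiff.add hsec.tendsto
    simpa [ContinuousWithinAt] using this

lemma Reg.solve {N : ℕ} {C Cb S s : ℝ} {r q : ℕ} {F : (ℕ → Fin d → ℝ) → (Fin d → ℝ) → ℝ}
    {A : Fin d → Fin d → ℝ → (Fin d → ℝ) → ℝ} (hA : Coef Cb A) (hS : 0 < S)
    (hs : s ∈ Set.Icc 0 S) (h : Reg N C r q F) :
    Reg N (C * growthFactor Cb S q) r q fun xs x => (sol A S (F xs)).u s x := by
  have hC := h.nonneg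
  have hE := growthFactor_pos Cb S q
  have hn : ∀ xs : ℕ → Fin d → ℝ, 0 ≤ C * psize N xs ^ r := fun xs => by
    have := one_le_psize N xs
    positivity
  refine ⟨by positivity, fun xs hxs x hx => ?_, fun xs ys hxs hys x hx => ?_, fun xs hxs => ?_⟩
  · refine (sol_le hA hS q (hn xs) (h.cont xs hxs) (h.bdd xs hxs) s hs x hx).trans_eq ?_
    ring
  · have h1 := one_le_psize N xs
    have h2 := one_le_psize N ys
    have h3 := pdist_nonneg N xs ys
    refine (sol_sub_le hA hS q (hn xs) (hn ys) (C₁ := C * (psize N xs + psize N ys) ^ r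
      * pdist N xs ys) (by positivity) (h.cont xs hxs) (h.cont ys hys) (h.bdd xs hxs)
      (h.bdd ys hys) (h.lip xs ys hxs hys) s hs x hx).trans_eq ?_
    ring
  · exact (sol_spec hA hS q (hn xs) (h.cont xs hxs) (h.bdd xs hxs)).1.cont.comp
      (f := fun x => (s, x)) (by fun_prop) fun x hx => ⟨hs, hx⟩

lemma Reg.of_payoff {N : ℕ} {p L : ℝ} (hL : 0 ≤ L)
    {h : (Fin (N + 1) → Fin d → ℝ) → ℝ}
    (hh : ∀ m : ℝ, ∀ x y : Fin (N + 1) → Fin d → ℝ,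
      (∀ i, x i ∈ posOrth d) → (∀ i, y i ∈ posOrth d) →
      (∀ i, ‖x i‖ ≤ m) → (∀ i, ‖y i‖ ≤ m) →
      |h x - h y| ≤ (1 + m ^ p) * L * ∑ i, ‖x i - y i‖) :
    ∃ C r, Reg N C r 0 fun xs _ => h fun i : Fin (N + 1) => xs i := by
  obtain ⟨P, hP⟩ : ∃ P, P = ⌈p⌉₊ := ⟨_, rfl⟩
  have hle : ∀ xs : ℕ → Fin d → ℝ, ∀ i : Fin (N + 1), ‖xs i‖ ≤ psize N xs := fun xs i => by
    have := Finset.single_le_sum (s := Finset.range (N + 1)) (f := fun i => ‖xs i‖)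
      (fun i _ => norm_nonneg _) (Finset.mem_range.2 i.2)
    unfold psize; linarith
  have key : ∀ xs ys : ℕ → Fin d → ℝ, (∀ i, xs i ∈ posOrth d) → (∀ i, ys i ∈ posOrth d) →
      |h (fun i : Fin (N + 1) => xs i) - h fun i : Fin (N + 1) => ys i| ≤
        2 * L * (psize N xs + psize N ys) ^ P * pdist N xs ys := by
    intro xs ys hxs hys
    have h1 := one_le_psize N xs
    have h2 := one_le_psize N ys
    have h3 := pdist_nonneg N xs ys
    refine (hh (psize N xs + psize N ys) _ _ (fun i => hxs i) (fun i => hys i)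
      (fun i => (hle xs i).trans (by linarith)) fun i => (hle ys i).trans (by linarith)).trans ?_
    have h4 : (psize N xs + psize N ys) ^ p ≤ (psize N xs + psize N ys) ^ P := by
      rw [← Real.rpow_natCast _ P]
      exact Real.rpow_le_rpow_of_exponent_le (by linarith) (hP ▸ Nat.le_ceil p)
    have h5 : 1 ≤ (psize N xs + psize N ys) ^ P := one_le_pow₀ (by linarith)
    have h6 : ∑ i : Fin (N + 1), ‖xs i - ys i‖ = pdist N xs ys :=
      (Finset.sum_range fun i => ‖xs i - ys i‖).symm
    rw [h6]
    have h7 : (1 + (psize N xs + psize N ys) ^ p) * L ≤ 2 * L * (psize N xs + psize N ys) ^ P := by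
      nlinarith
    exact mul_le_mul_of_nonneg_right h7 h3
  obtain ⟨e, he⟩ : ∃ e : ℕ → Fin d → ℝ, e = fun _ _ => 1 := ⟨_, rfl⟩
  have hepos : ∀ i, e i ∈ posOrth d := fun i j => by rw [he]; exact one_pos
  obtain ⟨M, hM⟩ : ∃ M, M = |h fun i : Fin (N + 1) => e i| := ⟨_, rfl⟩
  have hM0 : 0 ≤ M := hM ▸ abs_nonneg _
  have hE := one_le_psize N e
  refine ⟨2 * L * (1 + psize N e) ^ (P + 1) + M, P + 1, by positivity, fun xs hxs x hx => ?_,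
    fun xs ys hxs hys x hx => ?_, fun xs hxs => continuousOn_const⟩
  · have h1 := one_le_psize N xs
    have h2 := key xs e hxs hepos
    have h3 := pdist_le N xs e
    have h4 : psize N xs + psize N e ≤ (1 + psize N e) * psize N xs := by nlinarith
    have h5 : |h fun i : Fin (N + 1) => xs i| ≤
        |h (fun i : Fin (N + 1) => xs i) - h fun i : Fin (N + 1) => e i| + M := by
      rw [hM]
      have := abs_sub_abs_le_abs_sub (h fun i : Fin (N + 1) => xs i) (h fun i : Fin (N + 1) => e i)
      linarith
    have h6 : 1 ≤ psize N xs ^ (P + 1) := one_le_pow₀ h1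
    calc |h fun i : Fin (N + 1) => xs i|
        ≤ 2 * L * (psize N xs + psize N e) ^ P * (psize N xs + psize N e) + M := by
          refine h5.trans ?_
          gcongr
          refine h2.trans ?_
          gcongr
      _ = 2 * L * (psize N xs + psize N e) ^ (P + 1) + M := by rw [pow_succ]; ring
      _ ≤ 2 * L * ((1 + psize N e) * psize N xs) ^ (P + 1) + M * psize N xs ^ (P + 1) := by
          gcongr
          exact le_mul_of_one_le_right hM0 h6
      _ = (2 * L * (1 + psize N e) ^ (P + 1) + M) * psize N xs ^ (P + 1) := by rw [mul_pow]; ring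
      _ ≤ _ := le_mul_of_one_le_right (by positivity) (one_le_wt 0 hx)
  · have h1 := one_le_psize N xs
    have h2 := one_le_psize N ys
    have h3 := pdist_nonneg N xs ys
    have h4 : 2 * L ≤ 2 * L * (1 + psize N e) ^ (P + 1) + M := by
      have : 2 * L ≤ 2 * L * (1 + psize N e) ^ (P + 1) :=
        le_mul_of_one_le_right (by positivity) (one_le_pow₀ (by linarith))
      linarith
    refine (key xs ys hxs hys).trans ?_
    refine le_trans ?_ (le_mul_of_one_le_right (by positivity) (one_le_wt 0 hx))
    gcongr
    · linarith
    · exact Nat.le_succ P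

/-! ### The recursive scheme -/

/-- The recursive scheme, indexed by the number of steps before maturity. -/
def scheme (a : ℝ → (Fin d → ℝ) → Fin d → Fin d → ℝ) (t : ℕ → ℝ) (N : ℕ)
    (h : (Fin (N + 1) → Fin d → ℝ) → ℝ) :
    ℕ → ℝ → (ℕ → Fin d → ℝ) → (Fin d → ℝ) → ℝ
  | 0, _, xs, _ => h fun i : Fin (N + 1) => xs i
  | j + 1, τ, xs, x =>
    (sol (stepCoef a (t (N - (j + 1) + 1))) (t (N - (j + 1) + 1) - t (N - (j + 1)) + 1) fun y =>
      scheme a t N h j (t (N - (j + 1) + 1)) (Function.update xs (N - (j + 1) + 1) y) y).u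
      (t (N - (j + 1) + 1) - τ) x

lemma scheme_of_lt (a : ℝ → (Fin d → ℝ) → Fin d → Fin d → ℝ) (t : ℕ → ℝ) {N : ℕ}
    (h : (Fin (N + 1) → Fin d → ℝ) → ℝ) {k : ℕ} (hk : k < N) (τ : ℝ) (xs : ℕ → Fin d → ℝ)
    (x : Fin d → ℝ) :
    scheme a t N h (N - k) τ xs x =
      (sol (stepCoef a (t (k + 1))) (t (k + 1) - t k + 1) fun y =>
        scheme a t N h (N - (k + 1)) (t (k + 1)) (Function.update xs (k + 1) y) y).u
        (t (k + 1) - τ) x := by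
  obtain ⟨j, hj⟩ : ∃ j, N - k = j + 1 := ⟨N - k - 1, by omega⟩
  have h1 : N - (k + 1) = j := by omega
  have h2 : N - (j + 1) = k := by omega
  rw [hj, scheme, h1, h2]

lemma exists_reg_scheme {Cb : ℝ} {a : ℝ → (Fin d → ℝ) → Fin d → Fin d → ℝ} {t : ℕ → ℝ} {N : ℕ}
    (hA : ∀ k < N, Coef Cb (stepCoef a (t (k + 1)))) (htm : ∀ k < N, t k < t (k + 1))
    {h : (Fin (N + 1) → Fin d → ℝ) → ℝ}
    (hh : ∃ C r, Reg N C r 0 fun xs (_ : Fin d → ℝ) => h fun i : Fin (N + 1) => xs i) :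
    ∀ j k, k + j = N → ∃ C r q, Reg N C r q (scheme a t N h (N - k) (t k)) := by
  intro j
  induction j with
  | zero =>
    rintro k hk
    obtain ⟨C, r, hh⟩ := hh
    obtain rfl : k = N := by omega
    refine ⟨C, r, 0, ?_⟩
    rw [Nat.sub_self]
    exact hh
  | succ j ih =>
    intro k hk
    have hkN : k < N := by omega
    obtain ⟨C, r, q, hr⟩ := ih (k + 1) (by omega)
    have hlt := htm k hkN
    have := (hr.diag (k + 1)).solve (hA k hkN) (S := t (k + 1) - t k + 1) (s := t (k + 1) - t k)
      (by linarith) ⟨by linarith, by linarith⟩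
    have he : scheme a t N h (N - k) (t k) = _ :=
      funext fun xs => funext fun x => scheme_of_lt a t h hkN (t k) xs x
    rw [he]
    exact ⟨_, _, _, this⟩

end TVP

/-- Theorem 2.6 for (TVP⁺): the recursive scheme of terminal-value problems on `ℝ₊^d`
associated with an exotic payoff `h` is well-defined. -/
theorem stmt7 (T : ℝ) (hT : 0 < T) (d N : ℕ) (hN : 0 < N)
    (a : ℝ → (Fin d → ℝ) → Fin d → Fin d → ℝ)
    (ha_cont : ∀ i j, ContinuousOn (fun p : ℝ × (Fin d → ℝ) => a p.1 p.2 i j)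
      (Set.Icc 0 T ×ˢ posOrth d))
    (ha_symm : ∀ t ∈ Set.Icc (0 : ℝ) T, ∀ x ∈ posOrth d, ∀ i j, a t x i j = a t x j i)
    (ha_pd : ∀ t ∈ Set.Icc (0 : ℝ) T, ∀ x ∈ posOrth d, ∀ y : Fin d → ℝ, y ≠ 0 →
      0 < ∑ i, ∑ j, a t x i j * y i * y j)
    (ha_bdd : ∃ Cb : ℝ, ∀ t ∈ Set.Icc (0 : ℝ) T, ∀ x ∈ posOrth d, ∀ i j, |a t x i j| ≤ Cb)
    (ha_holder : ∀ i j, LocallyHolderOn (fun p : ℝ × (Fin d → ℝ) => a p.1 p.2 i j)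
      (Set.Ico 0 T ×ˢ posOrth d))
    (t : ℕ → ℝ) (ht0 : t 0 = 0) (htN : t N = T) (htm : ∀ k < N, t k < t (k + 1))
    (h : (Fin (N + 1) → Fin d → ℝ) → ℝ)
    (p L : ℝ) (hp : 0 ≤ p) (hL : 0 ≤ L)
    (hh : ∀ m : ℝ, ∀ x y : Fin (N + 1) → Fin d → ℝ,
      (∀ i, x i ∈ posOrth d) → (∀ i, y i ∈ posOrth d) →
      (∀ i, ‖x i‖ ≤ m) → (∀ i, ‖y i‖ ≤ m) →
      |h x - h y| ≤ (1 + m ^ p) * L * ∑ i, ‖x i - y i‖) :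
    ∃ v : ℕ → ℝ → (ℕ → Fin d → ℝ) → (Fin d → ℝ) → ℝ,
      (∀ τ : ℝ, ∀ xs : ℕ → Fin d → ℝ, ∀ x : Fin d → ℝ,
        v N τ xs x = h fun i : Fin (N + 1) => xs i) ∧
      ∀ k < N, ∀ xs : ℕ → Fin d → ℝ, (∀ i, xs i ∈ posOrth d) →
        -- the terminal condition `f_{k+1}` is continuous with polynomial growth
        (ContinuousOn (fun x : Fin d → ℝ =>
            v (k + 1) (t (k + 1)) (Function.update xs (k + 1) x) x) (posOrth d) ∧
          ∃ C q : ℝ, 0 < C ∧ 0 < q ∧ ∀ x ∈ posOrth d,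
            |v (k + 1) (t (k + 1)) (Function.update xs (k + 1) x) x| ≤ C * (1 + ‖x‖ ^ q)) ∧
        -- `v_k` solves the corresponding terminal-value problem ...
        (ContinuousOn (fun pr : ℝ × (Fin d → ℝ) => v k pr.1 xs pr.2)
            (Set.Icc (t k) (t (k + 1)) ×ˢ posOrth d) ∧
          IsC12 (Set.Ico (t k) (t (k + 1))) (posOrth d) (fun τ x => v k τ xs x) ∧
          (∀ τ ∈ Set.Ico (t k) (t (k + 1)), ∀ x ∈ posOrth d,
            tderiv (Set.Icc (t k) (t (k + 1))) (fun σ y => v k σ xs y) τ x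
              + (1 / 2) * ∑ i, ∑ j, a τ x i j * x i * x j
                  * pd2 (fun y => v k τ xs y) i j x = 0) ∧
          (∀ x ∈ posOrth d,
            v k (t (k + 1)) xs x = v (k + 1) (t (k + 1)) (Function.update xs (k + 1) x) x) ∧
          (∃ C q : ℝ, 0 < C ∧ 0 < q ∧ ∀ τ ∈ Set.Icc (t k) (t (k + 1)), ∀ x ∈ posOrth d,
            |v k τ xs x| ≤ C * (1 + ‖x‖ ^ q))) ∧
        -- ... and is the unique such solution with polynomial growth uniformly in `t`
        (∀ w : ℝ → (Fin d → ℝ) → ℝ,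
          (ContinuousOn (fun pr : ℝ × (Fin d → ℝ) => w pr.1 pr.2)
              (Set.Icc (t k) (t (k + 1)) ×ˢ posOrth d) ∧
            IsC12 (Set.Ico (t k) (t (k + 1))) (posOrth d) w ∧
            (∀ τ ∈ Set.Ico (t k) (t (k + 1)), ∀ x ∈ posOrth d,
              tderiv (Set.Icc (t k) (t (k + 1))) w τ x
                + (1 / 2) * ∑ i, ∑ j, a τ x i j * x i * x j * pd2 (w τ) i j x = 0) ∧
            (∀ x ∈ posOrth d,
              w (t (k + 1)) x = v (k + 1) (t (k + 1)) (Function.update xs (k + 1) x) x) ∧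
            (∃ C q : ℝ, 0 < C ∧ 0 < q ∧ ∀ τ ∈ Set.Icc (t k) (t (k + 1)), ∀ x ∈ posOrth d,
              |w τ x| ≤ C * (1 + ‖x‖ ^ q))) →
          ∀ τ ∈ Set.Icc (t k) (t (k + 1)), ∀ x ∈ posOrth d, w τ x = v k τ xs x) := by
  obtain ⟨Cb, hCb⟩ := ha_bdd
  have htle : ∀ j k, k + j = N → t k ≤ T := by
    intro j
    induction j with
    | zero => rintro k rfl; exact htN.le
    | succ j ih => exact fun k hk => (htm k (by omega)).le.trans (ih (k + 1) (by omega))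
  have htpos : ∀ k ≤ N, 0 ≤ t k := by
    intro k
    induction k with
    | zero => exact fun _ => ht0.ge
    | succ k ih => exact fun hk => (ih (by omega)).trans (htm k (by omega)).le
  have hA : ∀ k < N, TVP.Coef (max Cb 0) (TVP.stepCoef a (t (k + 1))) := fun k hk =>
    TVP.coef_step (le_max_right _ _) ha_cont ha_symm ha_pd
      (fun t ht x hx i j => (hCb t ht x hx i j).trans (le_max_left _ _)) ha_holder
      ((htpos k hk.le).trans_lt (htm k hk)) (htle (N - (k + 1)) (k + 1) (by omega))
  have hreg := TVP.exists_reg_scheme hA htm (TVP.Reg.of_payoff hL hh)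
  refine ⟨fun k => TVP.scheme a t N h (N - k), fun τ xs x => ?_, fun k hk xs hxs => ?_⟩
  · simp only [Nat.sub_self, TVP.scheme]
  · obtain ⟨C, r, q, hr⟩ := hreg (N - (k + 1)) (k + 1) (by omega)
    have hr := hr.diag (k + 1)
    have hC : 0 ≤ C * ((1 + d) * 2 ^ (r + q + 1)) * TVP.psize N xs ^ r := by
      have := hr.nonneg
      have := TVP.one_le_psize N xs
      positivity
    have hlt := htm k hk
    have hT₁ := htle (N - (k + 1)) (k + 1) (by omega)
    obtain ⟨hs, hg⟩ := TVP.sol_spec (hA k hk) (S := t (k + 1) - t k + 1) (by linarith) (r + q) hC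
      (hr.cont xs hxs) (hr.bdd xs hxs)
    have hv : TVP.SolvesTVP a (t k) (t (k + 1))
        (fun x => TVP.scheme a t N h (N - (k + 1)) (t (k + 1)) (Function.update xs (k + 1) x) x)
        fun τ x => TVP.scheme a t N h (N - k) τ xs x := by
      simp only [TVP.scheme_of_lt a t h hk]
      exact hs.solvesTVP ha_symm (htpos k hk.le) hT₁ (by linarith) hg
    obtain ⟨C', r', h1, h2, h3⟩ := TVP.exists_rpow_growth (d := d) hC (r + q)
    exact ⟨⟨hr.cont xs hxs, C', r', h1, h2, fun x hx => (hr.bdd xs hxs x hx).trans (h3 x hx)⟩,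
      hv, fun w hw => hv.unique (hA k hk) ha_symm (htpos k hk.le) hT₁ hw⟩
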